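/- Let k ≥ 2 be an integer and θ > log₂ 3 a real number. Suppose that for every ε > 0 there exists n₀ such that every T_k-free partially directed k-graph H on n ≥ n₀ vertices satisfies e_u(H) + θ·e_d(H) ≤ (1+ε)·C(n,k). Then for every ε > 0 there exists n₁ such that for all n ≥ n₁, both the number of k-SAT functions on n Boolean variables and the number of minimal k-SAT formulae on n labeled Boolean variables lie between (1−ε)·2^{n + C(n,k)} and (1+ε)·2^{n + C(n,k)}. -/

import Mathlib

section Defs

variable {V W : Type*}

/-- A clause is a finite set of literals; a literal is a variable paired with a polarity
(`true` = positive, `false` = negative). -/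
abbrev SatClause (V : Type*) := Finset (V × Bool)

/-- A formula is a finite set of clauses. -/
abbrev SatFormula (V : Type*) := Finset (SatClause V)

/-- The set of variables used by a clause. -/
def clauseVars [DecidableEq V] (C : SatClause V) : Finset V := C.image Prod.fst

/-- A valid `k`-SAT clause: `k` literals on `k` distinct variables. -/
def IsKClause [DecidableEq V] (k : ℕ) (C : SatClause V) : Prop :=
  C.card = k ∧ (clauseVars C).card = k

/-- A valid `k`-SAT formula. -/
def IsKFormula [DecidableEq V] (k : ℕ) (G : SatFormula V) : Prop :=
  ∀ C ∈ G, IsKClause k C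

/-- An assignment satisfies a clause if it makes all of its literals true. -/
def SatisfiesClause (a : V → Bool) (C : SatClause V) : Prop := ∀ l ∈ C, a l.1 = l.2

/-- A formula is minimal if every clause has a witness assignment satisfying it and no other
clause. -/
def MinimalFormula (G : SatFormula V) : Prop :=
  ∀ C ∈ G, ∃ w : V → Bool, SatisfiesClause w C ∧ ∀ C' ∈ G, SatisfiesClause w C' → C' = C

/-- A formula is simple if no two distinct clauses use the same set of variables. -/
def SimpleFormula [DecidableEq V] (G : SatFormula V) : Prop :=
  ∀ C ∈ G, ∀ C' ∈ G, clauseVars C = clauseVars C' → C = C'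

/-- A formula is unate if every variable occurs with only one polarity. -/
def UnateFormula (G : SatFormula V) : Prop :=
  ∀ x : V, ¬ ((∃ C ∈ G, (x, true) ∈ C) ∧ (∃ C ∈ G, (x, false) ∈ C))

/-- The set of variables used by a formula. -/
def formulaVars [DecidableEq V] (G : SatFormula V) : Finset V := G.biUnion clauseVars

/-- `f` is a `k`-SAT function: it is computed by some `k`-SAT formula (value `1` iff some
clause has all its literals satisfied). -/
def IsKSatFunction (k n : ℕ) (f : (Fin n → Bool) → Bool) : Prop :=
  ∃ G : SatFormula (Fin n), IsKFormula k G ∧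
    ∀ a : Fin n → Bool, f a = true ↔ ∃ C ∈ G, SatisfiesClause a C

/-- Relabel the variables of a formula along `φ`. -/
def mapFormula [DecidableEq V] [DecidableEq W] (φ : W → V) (F : SatFormula W) : SatFormula V :=
  F.image (fun C => C.image (fun l => (φ l.1, l.2)))

/-- `G'` is a copy of `F`: it is obtained from `F` by an injective relabeling of variables. -/
def IsCopyOf [DecidableEq V] [DecidableEq W] (F : SatFormula W) (G' : SatFormula V) : Prop :=
  ∃ φ : W → V, Set.InjOn φ ↑(formulaVars F) ∧ G' = mapFormula φ F

/-- The number of copies of `F` in `G`, i.e. of subformulae of `G` isomorphic to `F`. -/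
noncomputable def copyCount [DecidableEq V] [DecidableEq W] (F : SatFormula W)
    (G : SatFormula V) : ℕ :=
  Set.ncard {G' : SatFormula V | G' ⊆ G ∧ IsCopyOf F G'}

/-- The `b`-blowup of a clause: replace each literal by the literal of the same polarity on
one of the `b` duplicates of its variable, in all possible ways. -/
def clauseBlowup [DecidableEq V] (b : ℕ) (C : SatClause V) :
    Finset (SatClause (V × Fin b)) :=
  (C.pi (fun _ => (Finset.univ : Finset (Fin b)))).image
    (fun g => C.attach.image (fun l => ((l.1.1, g l.1 l.2), l.1.2)))

/-- The `b`-blowup of a formula. -/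
def formulaBlowup [DecidableEq V] (b : ℕ) (G : SatFormula V) : SatFormula (V × Fin b) :=
  G.biUnion (clauseBlowup b)

/-- The weight of a formula on `n` variables:
`wt(G) = Σ_i log₂(i+1)·α_i(G)` where `α_i(G)·C(n,k)` counts the `k`-sets of variables
supporting exactly `i` clauses. -/
noncomputable def formulaWt (k n : ℕ) (G : SatFormula (Fin n)) : ℝ :=
  (∑ S ∈ (Finset.univ : Finset (Fin n)).powersetCard k,
    Real.logb 2 (((G.filter (fun C => clauseVars C = S)).card : ℝ) + 1)) / (n.choose k)

/-- A partially directed graph: a set of undirected edges together with a set of directed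
(pointed) edges. -/
structure PDG (V : Type*) where
  undir : Finset (Finset V)
  dir : Finset (Finset V × V)

/-- `H` is a valid `k`-PDG: all edges have `k` vertices, each directed edge is pointed at one
of its vertices, and each `k`-set carries at most one edge (undirected or directed). -/
def PDG.IsValid (k : ℕ) (H : PDG V) : Prop :=
  (∀ e ∈ H.undir, e.card = k) ∧
  (∀ p ∈ H.dir, p.1.card = k ∧ p.2 ∈ p.1) ∧
  (∀ p ∈ H.dir, p.1 ∉ H.undir) ∧
  (∀ p ∈ H.dir, ∀ q ∈ H.dir, p.1 = q.1 → p = q)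

/-- `F` is a subgraph of `H`: a copy of `F` can be obtained from `H` by deleting vertices,
deleting edges, and/or forgetting directions of edges. -/
def PDG.IsSubgraph [DecidableEq V] (F : PDG W) (H : PDG V) : Prop :=
  ∃ φ : W → V, Function.Injective φ ∧
    (∀ e ∈ F.undir, e.image φ ∈ H.undir ∨ ∃ v, (e.image φ, v) ∈ H.dir) ∧
    (∀ p ∈ F.dir, (p.1.image φ, φ p.2) ∈ H.dir)

/-- The image of a PDG under a relabeling of vertices. -/
def PDG.map [DecidableEq V] (φ : W → V) (F : PDG W) : PDG V :=
  ⟨F.undir.image (Finset.image φ), F.dir.image (fun p => (p.1.image φ, φ p.2))⟩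

/-- The PDG `T_k` on vertex set `{0, …, k}` (0-indexed): undirected edges everything-but-`k`
and everything-but-`k-2`, and the edge everything-but-`k-1` directed toward `k`. -/
def TkPDG (k : ℕ) : PDG (Fin (k + 1)) where
  undir := { Finset.univ.erase ⟨k, Nat.lt_succ_self k⟩,
             Finset.univ.erase ⟨k - 2, by omega⟩ }
  dir := { (Finset.univ.erase ⟨k - 1, by omega⟩, ⟨k, Nat.lt_succ_self k⟩) }

/-- A semisimple formula: every `k`-set of variables supports at most one clause, or exactly
two clauses whose polarities differ on exactly one variable. -/
def SemisimpleFormula [DecidableEq V] (G : SatFormula V) : Prop :=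
  ∀ C₁ ∈ G, ∀ C₂ ∈ G, C₁ ≠ C₂ → clauseVars C₁ = clauseVars C₂ →
    (((C₁ \ C₂).image Prod.fst).card = 1 ∧
      ∀ C₃ ∈ G, clauseVars C₃ = clauseVars C₁ → C₃ = C₁ ∨ C₃ = C₂)

/-- The type of a (semisimple) formula: an undirected edge on each variable set supporting
exactly one clause, and for each variable set supporting two clauses a directed edge pointed
at the variable where the two clauses differ. -/
def formulaType [DecidableEq V] (G : SatFormula V) : PDG V where
  undir := (G.filter (fun C => ∀ C' ∈ G, clauseVars C' = clauseVars C → C' = C)).image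
    clauseVars
  dir := ((G ×ˢ G).filter (fun p => p.1 ≠ p.2 ∧ clauseVars p.1 = clauseVars p.2)).biUnion
    (fun p => ((p.1 \ p.2).image Prod.fst).image (fun v => (clauseVars p.1, v)))

end Defs

section Proof

open Finset Filter

/-! ### Elementary counting -/

section Counting

open scoped Classical in
/-- Sets of small relative size are few. -/
theorem exists_card_small_subsets_le (h : ℝ) (hh : 0 < h) :
    ∃ η : ℝ, 0 < η ∧ ∀ {α : Type} (U : Finset α) (M : ℝ), (#U : ℝ) ≤ M →
      (#(U.powerset.filter (fun X => (#X : ℝ) ≤ η * M)) : ℝ) ≤ (2 : ℝ) ^ (h * M) := by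
  have h1 : (1 : ℝ) < 2 ^ (h / 2) := Real.one_lt_rpow (by norm_num) (by positivity)
  obtain ⟨x, hx0, hx1, hxh⟩ : ∃ x : ℝ, 0 < x ∧ x < 1 ∧ 1 + x ≤ 2 ^ (h / 2) :=
    ⟨min (1 / 2) (2 ^ (h / 2) - 1), lt_min (by norm_num) (by linarith),
      (min_le_left _ _).trans_lt (by norm_num),
      by linarith [min_le_right (1 / 2 : ℝ) (2 ^ (h / 2) - 1)]⟩
  have hL : 0 < Real.logb 2 x⁻¹ :=
    Real.logb_pos (by norm_num) ((one_lt_inv₀ hx0).2 hx1)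
  refine ⟨h / 2 / Real.logb 2 x⁻¹, by positivity, fun {α} U M hM => ?_⟩
  set η := h / 2 / Real.logb 2 x⁻¹ with hη
  have hM0 : 0 ≤ M := (Nat.cast_nonneg _).trans hM
  have hxη : x⁻¹ ^ η = 2 ^ (h / 2) := by
    rw [← Real.rpow_logb (b := 2) (x := x⁻¹) (by norm_num) (by norm_num) (by positivity),
      ← Real.rpow_mul (by norm_num), hη]
    congr 1
    rw [← mul_div_assoc, mul_div_cancel_left₀ _ hL.ne']
  have key : ∀ X ∈ U.powerset.filter (fun X => (#X : ℝ) ≤ η * M),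
      (1 : ℝ) ≤ x⁻¹ ^ (η * M) * x ^ #X := by
    intro X hX
    have hX' := (mem_filter.1 hX).2
    have : x⁻¹ ^ ((#X : ℕ) : ℝ) ≤ x⁻¹ ^ (η * M) :=
      Real.rpow_le_rpow_of_exponent_le ((one_le_inv₀ hx0).2 hx1.le) hX'
    rw [Real.rpow_natCast, inv_pow] at this
    calc (1 : ℝ) = (x ^ #X)⁻¹ * x ^ #X := by field_simp
      _ ≤ _ := by gcongr
  calc (#(U.powerset.filter (fun X => (#X : ℝ) ≤ η * M)) : ℝ)
      = ∑ X ∈ U.powerset.filter (fun X => (#X : ℝ) ≤ η * M), (1 : ℝ) := by simp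
    _ ≤ ∑ X ∈ U.powerset.filter (fun X => (#X : ℝ) ≤ η * M), x⁻¹ ^ (η * M) * x ^ #X :=
        sum_le_sum key
    _ ≤ ∑ X ∈ U.powerset, x⁻¹ ^ (η * M) * x ^ #X :=
        sum_le_sum_of_subset_of_nonneg (filter_subset _ _) (fun _ _ _ => by positivity)
    _ = x⁻¹ ^ (η * M) * (x + 1) ^ #U := by
        rw [← mul_sum, ← sum_pow_mul_eq_add_pow]; simp
    _ ≤ (2 ^ (h / 2)) ^ M * (2 ^ (h / 2)) ^ M := by
        rw [Real.rpow_mul (by positivity), hxη]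
        gcongr
        calc (x + 1) ^ #U ≤ ((2 : ℝ) ^ (h / 2)) ^ #U := by gcongr; linarith
          _ = ((2 : ℝ) ^ (h / 2)) ^ ((#U : ℕ) : ℝ) := (Real.rpow_natCast _ _).symm
          _ ≤ _ := Real.rpow_le_rpow_of_exponent_le h1.le hM
    _ = 2 ^ (h * M) := by
        rw [← Real.rpow_mul (by norm_num), ← Real.rpow_add (by norm_num)]
        congr 1
        ring

open scoped Classical in
/-- Counting maps constrained on a set of arguments. -/
theorem card_filter_forall_mem_le {U β : Type*} [Fintype U] [DecidableEq U] [Fintype β]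
    [DecidableEq β] (S : Finset U)
    (B : Finset β) :
    #((univ : Finset (U → β)).filter (fun φ => ∀ u ∈ S, φ u ∈ B)) ≤
      #B ^ #S * Fintype.card β ^ (Fintype.card U - #S) := by
  have : ((univ : Finset (U → β)).filter (fun φ => ∀ u ∈ S, φ u ∈ B)) =
      Fintype.piFinset (fun u => if u ∈ S then B else univ) := by
    ext φ
    simp only [mem_filter, mem_univ, true_and, Fintype.mem_piFinset]
    refine forall_congr' fun u => ?_
    by_cases hu : u ∈ S <;> simp [hu]
  rw [this, Fintype.card_piFinset]
  have h2 : ∀ u, #(if u ∈ S then B else univ) = if u ∈ S then #B else Fintype.card β := by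
    intro u; split_ifs <;> simp
  simp only [h2]
  rw [prod_ite, prod_const, prod_const]
  have e1 : univ.filter (fun u => u ∈ S) = S := by ext; simp
  have e2 : #(univ.filter (fun u => u ∉ S)) = Fintype.card U - #S := by
    rw [filter_not, e1, card_sdiff_of_subset (subset_univ _), card_univ]
  rw [e1, e2]

open scoped Classical in
/-- Non-injective maps are few. -/
theorem card_filter_not_injective_le {U : Type*} [Fintype U] [DecidableEq U] (n : ℕ) :
    #((univ : Finset (U → Fin n)).filter (fun φ => ¬ Function.Injective φ)) ≤
      Fintype.card U ^ 2 * n ^ (Fintype.card U - 1) := by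
  have hsub : (univ : Finset (U → Fin n)).filter (fun φ => ¬ Function.Injective φ) ⊆
      ((univ : Finset (U × U)).filter (fun p => p.1 ≠ p.2)).biUnion
        (fun p => univ.filter (fun φ : U → Fin n => φ p.1 = φ p.2)) := by
    intro φ hφ
    simp only [mem_filter, mem_univ, true_and, Function.Injective, not_forall] at hφ
    obtain ⟨a, b, h1, h2⟩ := hφ
    simp only [mem_biUnion, mem_filter, mem_univ, true_and]
    exact ⟨(a, b), h2, h1⟩
  refine (card_le_card hsub).trans ((card_biUnion_le_card_mul _ _
    (n ^ (Fintype.card U - 1)) ?_).trans ?_)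
  · rintro ⟨a, b⟩ hab
    have hab' : a ≠ b := (mem_filter.1 hab).2
    let r : (U → Fin n) → ({u : U // u ≠ a} → Fin n) := fun φ u => φ u.1
    calc #(univ.filter (fun φ : U → Fin n => φ a = φ b))
        ≤ #(univ : Finset ({u : U // u ≠ a} → Fin n)) := by
          refine card_le_card_of_injOn r (fun _ _ => mem_univ _) ?_
          intro φ hφ ψ hψ he
          have hφ' : φ a = φ b := (mem_filter.1 hφ).2
          have hψ' : ψ a = ψ b := (mem_filter.1 hψ).2
          have hb : φ b = ψ b := congrFun he ⟨b, hab'.symm⟩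
          funext u
          by_cases hu : u = a
          · rw [hu, hφ', hψ', hb]
          · exact congrFun he ⟨u, hu⟩
      _ = n ^ (Fintype.card U - 1) := by simp [Fintype.card_subtype_compl]
  · gcongr
    calc #((univ : Finset (U × U)).filter (fun p => p.1 ≠ p.2)) ≤ #(univ : Finset (U × U)) :=
          card_filter_le _ _
      _ = _ := by simp [sq]

open scoped Classical in
/-- A function of several coordinates that rarely changes under a change of one coordinate
rarely takes different values at two independent points. -/
theorem card_filter_ne_le_sum_update {m : ℕ} {α β : Type*} [Fintype α]
    (f : (Fin m → α) → β) :
    #((univ : Finset ((Fin m → α) × (Fin m → α))).filter (fun p => f p.1 ≠ f p.2)) ≤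
      ∑ i : Fin m, #((univ : Finset ((Fin m → α) × (Fin m → α))).filter
        (fun p => f p.1 ≠ f (Function.update p.1 i (p.2 i)))) := by
  let h : ℕ → (Fin m → α) × (Fin m → α) → (Fin m → α) × (Fin m → α) := fun i p =>
    (fun j => if j.1 < i then p.2 j else p.1 j, fun j => if j.1 < i then p.1 j else p.2 j)
  have hinv : ∀ i, Function.Involutive (h i) := by
    intro i p
    ext j <;> simp only [h] <;> split_ifs <;> rfl
  have hsub : (univ : Finset ((Fin m → α) × (Fin m → α))).filter (fun p => f p.1 ≠ f p.2) ⊆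
      (univ : Finset (Fin m)).biUnion (fun i => ((univ : Finset ((Fin m → α) × (Fin m → α))).filter
        (fun p => f p.1 ≠ f (Function.update p.1 i (p.2 i)))).image (h i)) := by
    rintro p hp
    by_contra hcon
    simp only [mem_biUnion, mem_univ, true_and, mem_image, mem_filter, not_exists, not_and] at hcon
    have step : ∀ i : ℕ, i ≤ m → f (h i p).1 = f p.1 := by
      intro i
      induction i with
      | zero => intro _; simp [h]
      | succ i ih =>
        intro hi
        rw [← ih (by omega)]
        by_contra hne
        refine hcon ⟨i, hi⟩ (h i p) ?_ (hinv i p)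
        intro heq
        apply hne
        rw [heq]
        congr 1
        funext j
        by_cases hj : j = ⟨i, hi⟩
        · subst hj; simp [h]
        · have : j.1 ≠ i := fun hji => hj (Fin.ext hji)
          rw [Function.update_of_ne hj]
          simp only [h]
          by_cases hji : j.1 < i
          · simp [hji, Nat.lt_succ_of_lt hji]
          · have : ¬ j.1 < i + 1 := by omega
            simp [hji, this]
    have := step m le_rfl
    apply (mem_filter.1 hp).2
    rw [← this]
    congr 1
    funext j
    simp [h]
  refine (card_le_card hsub).trans (card_biUnion_le.trans (sum_le_sum fun i _ => card_image_le))

open scoped Classical in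
/-- Blow-up lemma: a dense set of `q`-tuples contains densely many combinatorial
`2 × ⋯ × 2` boxes. -/
theorem exists_dense_boxes (q : ℕ) : ∀ γ : ℝ, 0 < γ → ∃ γ' : ℝ, 0 < γ' ∧
    ∀ {α : Type} [Fintype α] (W : Finset (Fin q → α)),
      γ * (Fintype.card α : ℝ) ^ q ≤ #W →
      γ' * (Fintype.card α : ℝ) ^ (2 * q) ≤
        #((univ : Finset ((Fin q → α) × (Fin q → α))).filter
          (fun p => ∀ b : Fin q → Bool, (fun i => if b i then p.2 i else p.1 i) ∈ W)) := by
  induction q with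
  | zero =>
    intro γ hγ
    refine ⟨1, one_pos, fun {α} _ W hW => ?_⟩
    have hpos : 0 < #W := by
      have : (0 : ℝ) < #W := lt_of_lt_of_le (by positivity) hW
      exact_mod_cast this
    obtain ⟨w, hw⟩ := card_pos.1 hpos
    have : ((univ : Finset ((Fin 0 → α) × (Fin 0 → α))).filter
          (fun p => ∀ b : Fin 0 → Bool, (fun i => if b i then p.2 i else p.1 i) ∈ W)) = univ := by
      refine filter_true_of_mem fun p _ b => ?_
      rwa [Subsingleton.elim (fun i => if b i then p.2 i else p.1 i) w]
    rw [this]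
    simp
  | succ q ih =>
    intro γ hγ
    obtain ⟨γ₁, hγ₁, ih⟩ := ih (γ ^ 2 / 2) (by positivity)
    refine ⟨γ ^ 2 / 2 * γ₁, by positivity, fun {α} _ W hW => ?_⟩
    set N : ℝ := (Fintype.card α : ℝ) with hN
    have hN0 : 0 ≤ N := Nat.cast_nonneg _
    let I : α × α → Finset (Fin q → α) := fun x =>
      univ.filter (fun d => Fin.cons x.1 d ∈ W ∧ Fin.cons x.2 d ∈ W)
    let deg : (Fin q → α) → ℕ := fun d => #(univ.filter (fun x : α => Fin.cons x d ∈ W))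
    have hdegsum : ∑ d, deg d = #W := by
      have : ∑ d : Fin q → α, deg d = #((univ : Finset (α × (Fin q → α))).filter
          (fun y => Fin.cons y.1 y.2 ∈ W)) := by
        rw [card_filter, ← univ_product_univ, sum_product_right]
        refine sum_congr rfl fun d _ => ?_
        simp only [deg, card_filter]
      rw [this]
      refine card_bij' (fun y _ => Fin.cons y.1 y.2) (fun w _ => (w 0, Fin.tail w)) ?_ ?_ ?_ ?_
      · intro y hy; exact (mem_filter.1 hy).2
      · intro w hw; simpa using hw
      · intro y _; simp
      · intro w _; simp
    have hIsum : ∑ x : α × α, #(I x) = ∑ d, deg d ^ 2 := by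
      simp only [I, card_filter]
      rw [sum_comm]
      refine sum_congr rfl fun d _ => ?_
      rw [← card_filter, sq]
      simp only [deg]
      rw [← card_product]
      congr 1
      ext x
      simp
    have hCS : (#W : ℝ) ^ 2 ≤ N ^ q * ∑ x : α × α, (#(I x) : ℝ) := by
      have h1 := sq_sum_le_card_mul_sum_sq (s := (univ : Finset (Fin q → α)))
        (f := fun d => (deg d : ℝ))
      have h2 : (∑ x : α × α, (#(I x) : ℝ)) = ∑ d, (deg d : ℝ) ^ 2 := by exact_mod_cast hIsum
      have h3 : (∑ d, (deg d : ℝ)) = #W := by exact_mod_cast hdegsum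
      rw [h3] at h1
      rw [h2]
      refine h1.trans (le_of_eq ?_)
      simp [hN]
    let X := (univ : Finset (α × α)).filter (fun x => γ ^ 2 / 2 * N ^ q ≤ #(I x))
    have hIle : ∀ x, (#(I x) : ℝ) ≤ N ^ q := by
      intro x
      have : #(I x) ≤ #(univ : Finset (Fin q → α)) := card_le_card (subset_univ _)
      have h' : #(univ : Finset (Fin q → α)) = Fintype.card α ^ q := by simp
      rw [h'] at this
      rw [hN]
      exact_mod_cast this
    have hXle : ∑ x : α × α, (#(I x) : ℝ) ≤ #X * N ^ q + N ^ 2 * (γ ^ 2 / 2 * N ^ q) := by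
      rw [← sum_filter_add_sum_filter_not univ (fun x => γ ^ 2 / 2 * N ^ q ≤ #(I x))]
      refine add_le_add ?_ ?_
      · refine (sum_le_card_nsmul _ _ _ (fun x _ => hIle x)).trans (le_of_eq ?_)
        rw [nsmul_eq_mul]
      · refine (sum_le_card_nsmul _ _ (γ ^ 2 / 2 * N ^ q)
          (fun x hx => (not_le.1 (mem_filter.1 hx).2).le)).trans ?_
        rw [nsmul_eq_mul]
        gcongr
        have : #((univ : Finset (α × α)).filter (fun x => ¬ γ ^ 2 / 2 * N ^ q ≤ #(I x))) ≤
            Fintype.card α ^ 2 := by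
          refine (card_filter_le _ _).trans (le_of_eq ?_)
          simp [sq]
        calc _ ≤ ((Fintype.card α ^ 2 : ℕ) : ℝ) := Nat.cast_le.2 this
          _ = N ^ 2 := by rw [hN]; push_cast; rfl
    have hX : γ ^ 2 / 2 * N ^ 2 ≤ #X := by
      rcases hN0.eq_or_lt with h0 | hNpos
      · rw [← h0]; simp
      have h4 : (γ * N ^ (q + 1)) ^ 2 ≤ N ^ q * (#X * N ^ q + N ^ 2 * (γ ^ 2 / 2 * N ^ q)) :=
        (pow_le_pow_left₀ (by positivity) hW 2).trans (hCS.trans (by gcongr))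
      have h5 : N ^ q * N ^ q * (γ ^ 2 * N ^ 2) ≤
          N ^ q * N ^ q * (#X + N ^ 2 * (γ ^ 2 / 2)) := by
        refine le_trans (le_of_eq ?_) (h4.trans (le_of_eq ?_)) <;> ring
      have h6 := le_of_mul_le_mul_left h5 (by positivity)
      nlinarith
    have hcount : ∑ x ∈ X, #((univ : Finset ((Fin q → α) × (Fin q → α))).filter
          (fun p => ∀ b : Fin q → Bool, (fun i => if b i then p.2 i else p.1 i) ∈ I x)) ≤
        #((univ : Finset ((Fin (q + 1) → α) × (Fin (q + 1) → α))).filter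
          (fun p => ∀ b : Fin (q + 1) → Bool, (fun i => if b i then p.2 i else p.1 i) ∈ W)) := by
      rw [← card_sigma]
      refine card_le_card_of_injOn
        (fun y => (Fin.cons y.1.1 y.2.1, Fin.cons y.1.2 y.2.2)) ?_ ?_
      · rintro ⟨x, p⟩ hy
        simp only [coe_sigma, Set.mem_sigma_iff, mem_coe, mem_filter, mem_univ, true_and] at hy
        simp only [coe_filter, mem_univ, true_and, Set.mem_ofPred_eq]
        intro b
        have hb := (mem_filter.1 (hy.2 (fun i => b i.succ))).2
        have e : (fun i : Fin (q + 1) => if b i then (Fin.cons x.2 p.2 : Fin (q + 1) → α) i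
            else (Fin.cons x.1 p.1 : Fin (q + 1) → α) i) =
            Fin.cons (if b 0 then x.2 else x.1)
              (fun i => if b i.succ then p.2 i else p.1 i) := by
          funext i
          refine Fin.cases ?_ (fun i => ?_) i <;> simp
        rw [e]
        cases b 0
        · simpa using hb.1
        · simpa using hb.2
      · rintro ⟨x, p⟩ _ ⟨x', p'⟩ _ he
        simp only [Prod.mk.injEq, Fin.cons_inj] at he
        obtain ⟨⟨h1, h2⟩, h3, h4⟩ := he
        obtain ⟨x1, x2⟩ := x
        obtain ⟨p1, p2⟩ := p
        simp_all
    calc γ ^ 2 / 2 * γ₁ * N ^ (2 * (q + 1)) = (γ ^ 2 / 2 * N ^ 2) * (γ₁ * N ^ (2 * q)) := by ring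
      _ ≤ #X * (γ₁ * N ^ (2 * q)) := by gcongr
      _ = ∑ x ∈ X, γ₁ * N ^ (2 * q) := by rw [sum_const, nsmul_eq_mul]
      _ ≤ ∑ x ∈ X, (#((univ : Finset ((Fin q → α) × (Fin q → α))).filter
          (fun p => ∀ b : Fin q → Bool, (fun i => if b i then p.2 i else p.1 i) ∈ I x)) : ℝ) :=
          sum_le_sum fun x hx => ih (I x) (mem_filter.1 hx).2
      _ ≤ _ := by exact_mod_cast hcount

/-- A family of sets covered by blocks is determined by the traces on the blocks. -/
theorem card_le_prod_card_traces {α ι : Type*} [DecidableEq α] (𝒬 : Finset (Finset α)) (I : Finset ι)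
    (U : ι → Finset α) (b : ι → ℝ)
    (h : ∀ Q ∈ 𝒬, Q ⊆ I.biUnion U ∧ ∀ i ∈ I, (#(Q ∩ U i) : ℝ) ≤ b i) :
    #𝒬 ≤ ∏ i ∈ I, #((U i).powerset.filter (fun X => (#X : ℝ) ≤ b i)) := by
  classical
  rw [← card_pi]
  refine card_le_card_of_injOn (fun Q i _ => Q ∩ U i) ?_ ?_
  · intro Q hQ
    refine mem_coe.2 (mem_pi.2 fun i hi => mem_filter.2 ?_)
    rw [mem_powerset]
    exact ⟨inter_subset_right, (h Q hQ).2 i hi⟩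
  · intro Q hQ Q' hQ' he
    have aux : ∀ {A B : Finset α}, A ∈ 𝒬 → (∀ i ∈ I, A ∩ U i = B ∩ U i) → A ⊆ B := by
      intro A B hA hAB x hx
      obtain ⟨i, hi, hxi⟩ := mem_biUnion.1 ((h A hA).1 hx)
      have : x ∈ B ∩ U i := hAB i hi ▸ mem_inter.2 ⟨hx, hxi⟩
      exact (mem_inter.1 this).1
    have he' : ∀ i ∈ I, Q ∩ U i = Q' ∩ U i := fun i hi => congrFun (congrFun he i) hi
    exact (aux hQ he').antisymm (aux hQ' fun i hi => (he' i hi).symm)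

end Counting

/-! ### A container lemma for ordered multi-hypergraphs -/

section Containers

open scoped Classical in
/-- The edges of an ordered multi-hypergraph lying inside a vertex set. -/
noncomputable def edgesIn {r : ℕ} {α ι : Type} (E : Finset ι) (e : Fin r → ι → α) (Γ : Finset α) :
    Finset ι := E.filter (fun i => ∀ j, e j i ∈ Γ)

theorem mem_edgesIn {r : ℕ} {α ι : Type} {E : Finset ι} {e : Fin r → ι → α} {Γ : Finset α}
    {i : ι} : i ∈ edgesIn E e Γ ↔ i ∈ E ∧ ∀ j, e j i ∈ Γ := by
  simp [edgesIn]

open scoped Classical in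
/-- `T` is the set of first vertices of a subfamily of edges with bounded degrees in the other
coordinates. -/
def FingerprintGood {r : ℕ} {α ι : Type} (E : Finset ι) (e : Fin (r + 1) → ι → α)
    (cap low : ℝ) (T : Finset α) : Prop :=
  ∃ E' ⊆ E, (∀ i ∈ E', e 0 i ∈ T) ∧
    (∀ (j : Fin r) (x : α), (#(E'.filter (fun i => e j.succ i = x)) : ℝ) ≤ cap) ∧
    ∀ v ∈ T, low ≤ #(E'.filter (fun i => e 0 i = v))

open scoped Classical in
theorem card_le_of_forall_exists_mem {r : ℕ} {α ι : Type} (E : Finset ι) (e : Fin r → ι → α)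
    (M : Finset α) (D : ℝ) (hdeg : ∀ j, ∀ x, (#(E.filter (fun i => e j i = x)) : ℝ) ≤ D)
    (hE : ∀ i ∈ E, ∃ j, e j i ∈ M) : (#E : ℝ) ≤ r * (#M * D) := by
  have hsub : E ⊆ (univ : Finset (Fin r)).biUnion
      (fun j => M.biUnion (fun x => E.filter (fun i => e j i = x))) := by
    intro i hi
    obtain ⟨j, hj⟩ := hE i hi
    simp only [mem_biUnion, mem_univ, true_and, mem_filter]
    exact ⟨j, e j i, hj, hi, rfl⟩
  calc (#E : ℝ) ≤ ((∑ j : Fin r, ∑ x ∈ M, #(E.filter (fun i => e j i = x)) : ℕ) : ℝ) := by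
        exact_mod_cast (card_le_card hsub).trans (card_biUnion_le.trans
          (sum_le_sum fun j _ => card_biUnion_le))
    _ ≤ ∑ j : Fin r, ∑ x ∈ M, D := by
        push_cast
        exact sum_le_sum fun j _ => sum_le_sum fun x _ => hdeg j x
    _ = r * (#M * D) := by simp [sum_const, nsmul_eq_mul]

open scoped Classical in
/-- The containers of the sets whose fingerprint cannot be enlarged. -/
theorem stuck_container {r : ℕ} {α ι : Type} (E : Finset ι) (e : Fin (r + 1) → ι → α)
    (Γ T : Finset α) (N Δ a β p δ : ℝ) (ha : 0 < a) (hβ : β = (2 * r ^ 2 + 1) / a)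
    (hp : 0 < p) (hpa : p ≤ a) (hδ : δ ≤ β * p / 2) (hΔ : 0 < Δ)
    (hN : (#Γ : ℝ) ≤ N) (hT : (#T : ℝ) ≤ p * N)
    (hdeg : ∀ j x, (#(E.filter (fun i => e j i = x)) : ℝ) ≤ Δ)
    (hcodeg : ∀ j l, j ≠ l → ∀ x y, (#(E.filter (fun i => e j i = x ∧ e l i = y)) : ℝ) ≤ δ * Δ)
    (hgood : FingerprintGood (edgesIn E e Γ) e (β * p * Δ) (a * Δ) T) :
    ∃ Γ' ⊆ Γ ∪ T, (#(edgesIn E e Γ') : ℝ) ≤ 3 * a * Δ * N ∧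
      ∀ I ⊆ Γ, (∀ v ∈ I, v ∉ T →
        ¬ FingerprintGood (edgesIn E e Γ) e (β * p * Δ) (a * Δ) (insert v T)) → I ⊆ Γ' := by
  obtain ⟨E', hE', h0, hcap, hlow⟩ := hgood
  have hEE : edgesIn E e Γ ⊆ E := filter_subset _ _
  have hβ0 : 0 < β := by rw [hβ]; positivity
  have hN0 : 0 ≤ N := (Nat.cast_nonneg _).trans hN
  let M := Γ.filter (fun x => ∃ j : Fin r, (β * p - δ) * Δ <
    #(E'.filter (fun i => e j.succ i = x)))
  let free : α → Finset ι := fun v => (edgesIn E e Γ).filter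
    (fun i => e 0 i = v ∧ ∀ j : Fin r, e j.succ i ∉ M)
  let L := Γ.filter (fun v => (#(free v) : ℝ) < a * Δ)
  have hE'card : (#E' : ℝ) ≤ p * N * Δ := by
    have := card_le_of_forall_exists_mem (r := 1) E' (fun _ => e 0) T Δ
      (fun _ x => (Nat.cast_le.2 (card_le_card (filter_subset_filter _ (hE'.trans hEE)))).trans
        (hdeg 0 x)) (fun i hi => ⟨0, h0 i hi⟩)
    calc (#E' : ℝ) ≤ #T * Δ := by simpa using this
      _ ≤ _ := by gcongr
  have hMcard : (r : ℝ) * #M ≤ a * N := by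
    have h1 : (#M : ℝ) * (β * p / 2 * Δ) ≤ r * (p * N * Δ) := by
      calc (#M : ℝ) * (β * p / 2 * Δ) = ∑ x ∈ M, β * p / 2 * Δ := by
            rw [sum_const, nsmul_eq_mul]
        _ ≤ ∑ x ∈ M, ∑ j : Fin r, (#(E'.filter (fun i => e j.succ i = x)) : ℝ) := by
            refine sum_le_sum fun x hx => ?_
            obtain ⟨j, hj⟩ := (mem_filter.1 hx).2
            have hle : β * p / 2 * Δ ≤ (β * p - δ) * Δ := by gcongr; linarith
            exact (hle.trans hj.le).trans (single_le_sum
              (f := fun j : Fin r => (#(E'.filter (fun i => e j.succ i = x)) : ℝ))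
              (fun _ _ => Nat.cast_nonneg _) (mem_univ j))
        _ = ∑ j : Fin r, ∑ x ∈ M, (#(E'.filter (fun i => e j.succ i = x)) : ℝ) := sum_comm
        _ ≤ ∑ j : Fin r, (#E' : ℝ) := by
            refine sum_le_sum fun j _ => ?_
            have h := (sum_card_fiberwise_eq_card_filter E' M (fun i => e j.succ i)).le.trans
              (card_filter_le _ _)
            exact_mod_cast h
        _ ≤ ∑ j : Fin r, p * N * Δ := sum_le_sum fun _ _ => hE'card
        _ = _ := by simp
    have h2 : (#M : ℝ) * β ≤ 2 * r * N := by
      have h3 : (p * Δ / 2) * ((#M : ℝ) * β) ≤ (p * Δ / 2) * (2 * r * N) := by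
        refine le_trans (le_of_eq ?_) (h1.trans (le_of_eq ?_)) <;> ring
      exact le_of_mul_le_mul_left h3 (by positivity)
    have h4 : (#M : ℝ) * (2 * r ^ 2 + 1) ≤ a * (2 * r * N) := by
      rw [hβ] at h2
      have h5 := mul_le_mul_of_nonneg_left h2 ha.le
      calc (#M : ℝ) * (2 * r ^ 2 + 1) = a * (#M * ((2 * r ^ 2 + 1) / a)) := by field_simp
        _ ≤ _ := h5
    rcases Nat.eq_zero_or_pos r with hr | hr
    · rw [hr]; simp; positivity
    · have hr' : (0 : ℝ) < r := by exact_mod_cast hr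
      have h6 : (2 * r) * ((r : ℝ) * #M) ≤ (2 * r) * (a * N) := by
        have : (0 : ℝ) ≤ #M := Nat.cast_nonneg _
        nlinarith
      exact le_of_mul_le_mul_left h6 (by positivity)
  refine ⟨T ∪ L, union_subset subset_union_right
    ((filter_subset _ _).trans subset_union_left), ?_, ?_⟩
  · by_cases hTΓ : T ⊆ Γ
    swap
    · -- vertices of a good set have edges inside `Γ`
      exfalso
      apply hTΓ
      intro v hv
      have hpos : 0 < #(E'.filter (fun i => e 0 i = v)) := by
        have : (0 : ℝ) < #(E'.filter (fun i => e 0 i = v)) :=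
          lt_of_lt_of_le (by positivity) (hlow v hv)
        exact_mod_cast this
      obtain ⟨i, hi⟩ := card_pos.1 hpos
      obtain ⟨hi1, hi2⟩ := mem_filter.1 hi
      rw [← hi2]
      exact (mem_filter.1 (hE' hi1)).2 0
    have hsplit : edgesIn E e (T ∪ L) ⊆ E.filter (fun i => e 0 i ∈ T) ∪
        (E.filter (fun i => ∃ j : Fin r, e j.succ i ∈ M) ∪ L.biUnion free) := by
      intro i hi
      obtain ⟨hiE, hi⟩ := mem_filter.1 hi
      rw [mem_union, mem_union, mem_filter, mem_filter, mem_biUnion]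
      by_cases h1 : e 0 i ∈ T
      · exact Or.inl ⟨hiE, h1⟩
      by_cases h2 : ∃ j : Fin r, e j.succ i ∈ M
      · exact Or.inr (Or.inl ⟨hiE, h2⟩)
      refine Or.inr (Or.inr ⟨e 0 i, (mem_union.1 (hi 0)).resolve_left h1, ?_⟩)
      refine mem_filter.2 ⟨mem_filter.2 ⟨hiE, fun j => ?_⟩, rfl, fun j hj => h2 ⟨j, hj⟩⟩
      rcases mem_union.1 (hi j) with h | h
      · exact hTΓ h
      · exact (mem_filter.1 h).1
    have b1 : (#(E.filter (fun i => e 0 i ∈ T)) : ℝ) ≤ a * N * Δ := by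
      have := card_le_of_forall_exists_mem (r := 1) (E.filter (fun i => e 0 i ∈ T))
        (fun _ => e 0) T Δ
        (fun _ x => (Nat.cast_le.2 (card_le_card (filter_subset_filter _
          (filter_subset _ _)))).trans (hdeg 0 x)) (fun i hi => ⟨0, (mem_filter.1 hi).2⟩)
      calc _ ≤ (#T : ℝ) * Δ := by simpa using this
        _ ≤ (p * N) * Δ := by gcongr
        _ ≤ _ := by gcongr
    have b2 : (#(E.filter (fun i => ∃ j : Fin r, e j.succ i ∈ M)) : ℝ) ≤ a * N * Δ := by
      have := card_le_of_forall_exists_mem (E.filter (fun i => ∃ j : Fin r, e j.succ i ∈ M))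
        (fun j => e j.succ) M Δ
        (fun j x => (Nat.cast_le.2 (card_le_card (filter_subset_filter _
          (filter_subset _ _)))).trans (hdeg j.succ x)) (fun i hi => (mem_filter.1 hi).2)
      calc _ ≤ (r : ℝ) * (#M * Δ) := this
        _ = (r * #M) * Δ := by ring
        _ ≤ _ := by gcongr
    have b3 : (#(L.biUnion free) : ℝ) ≤ a * N * Δ := by
      calc (#(L.biUnion free) : ℝ) ≤ ∑ v ∈ L, (#(free v) : ℝ) := by
            exact_mod_cast card_biUnion_le
        _ ≤ ∑ v ∈ L, a * Δ := sum_le_sum fun v hv => (mem_filter.1 hv).2.le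
        _ = #L * (a * Δ) := by rw [sum_const, nsmul_eq_mul]
        _ ≤ N * (a * Δ) := by
            gcongr
            exact (Nat.cast_le.2 (card_le_card (filter_subset _ _))).trans hN
        _ = _ := by ring
    have hsplit' := (card_le_card hsplit).trans ((card_union_le _ _).trans
      (Nat.add_le_add_left (card_union_le _ _) _))
    calc (#(edgesIn E e (T ∪ L)) : ℝ) ≤ #(E.filter (fun i => e 0 i ∈ T)) +
          (#(E.filter (fun i => ∃ j : Fin r, e j.succ i ∈ M)) + #(L.biUnion free)) := by
          exact_mod_cast hsplit'
      _ ≤ a * N * Δ + (a * N * Δ + a * N * Δ) := add_le_add b1 (add_le_add b2 b3)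
      _ = _ := by ring
  · intro I hIΓ hI v hv
    rw [mem_union]
    by_cases hvT : v ∈ T
    · exact Or.inl hvT
    refine Or.inr (mem_filter.2 ⟨hIΓ hv, ?_⟩)
    by_contra hcon
    rw [not_lt] at hcon
    refine hI v hv hvT ⟨E' ∪ free v, union_subset hE' (filter_subset _ _), ?_, ?_, ?_⟩
    · intro i hi
      rcases mem_union.1 hi with h | h
      · exact mem_insert_of_mem (h0 i h)
      · rw [(mem_filter.1 h).2.1]; exact mem_insert_self _ _
    · intro j x
      rw [filter_union]
      by_cases hx : x ∈ M
      · have : (free v).filter (fun i => e j.succ i = x) = ∅ := by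
          refine filter_eq_empty_iff.2 fun i hi hix => ?_
          exact (mem_filter.1 hi).2.2 j (hix ▸ hx)
        rw [this, union_empty]
        exact hcap j x
      · by_cases hxΓ : x ∈ Γ
        · have h1 : (#(E'.filter (fun i => e j.succ i = x)) : ℝ) ≤ (β * p - δ) * Δ := by
            by_contra hlt
            exact hx (mem_filter.2 ⟨hxΓ, j, not_le.1 hlt⟩)
          have h2 : (#((free v).filter (fun i => e j.succ i = x)) : ℝ) ≤ δ * Δ := by
            refine le_trans (Nat.cast_le.2 (card_le_card ?_))
              (hcodeg 0 j.succ (Fin.succ_ne_zero j).symm v x)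
            intro i hi
            obtain ⟨hi1, hi2⟩ := mem_filter.1 hi
            exact mem_filter.2 ⟨hEE (mem_filter.1 hi1).1, (mem_filter.1 hi1).2.1, hi2⟩
          calc _ ≤ (#(E'.filter (fun i => e j.succ i = x)) : ℝ) +
                #((free v).filter (fun i => e j.succ i = x)) := by
                exact_mod_cast card_union_le _ _
            _ ≤ (β * p - δ) * Δ + δ * Δ := add_le_add h1 h2
            _ = _ := by ring
        · have : E'.filter (fun i => e j.succ i = x) ∪
              (free v).filter (fun i => e j.succ i = x) = ∅ := by
            rw [← filter_union]
            refine filter_eq_empty_iff.2 fun i hi hix => hxΓ ?_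
            rw [← hix]
            rcases mem_union.1 hi with h | h
            · exact (mem_filter.1 (hE' h)).2 _
            · exact (mem_filter.1 (mem_filter.1 h).1).2 _
          rw [this]
          simp only [card_empty, Nat.cast_zero]
          positivity
    · intro w hw
      by_cases hwT : w ∈ T
      · exact (hlow w hwT).trans (Nat.cast_le.2 (card_le_card
          (filter_subset_filter _ subset_union_left)))
      · have hwv : w = v := (mem_insert.1 hw).resolve_right hwT
        subst hwv
        refine hcon.trans (Nat.cast_le.2 (card_le_card ?_))
        intro i hi
        exact mem_filter.2 ⟨mem_union_right _ hi, (mem_filter.1 hi).2.1⟩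

/-- The container property for ordered `r`-uniform multi-hypergraphs. -/
def ContainerProperty (r : ℕ) : Prop :=
  ∀ ε : ℝ, 0 < ε → ∃ δ : ℝ, 0 < δ ∧ ∃ N₀ : ℝ, ∀ {α ι : Type} (V₀ : Finset α) (E : Finset ι)
    (e : Fin r → ι → α) (N Δ : ℝ), (#V₀ : ℝ) ≤ N → N₀ ≤ N → 0 < Δ →
    (∀ j x, (Set.ncard {i | i ∈ E ∧ e j i = x} : ℝ) ≤ Δ) →
    (∀ j l, j ≠ l → ∀ x y, (Set.ncard {i | i ∈ E ∧ e j i = x ∧ e l i = y} : ℝ) ≤ δ * Δ) →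
    ∃ 𝒞 : Finset (Finset α), (#𝒞 : ℝ) ≤ 2 ^ (ε * N) ∧
      ∀ I ⊆ V₀, (∀ i ∈ E, ∃ j, e j i ∉ I) →
        ∃ Γ ∈ 𝒞, I ⊆ Γ ∧ Γ ⊆ V₀ ∧ (#(edgesIn E e Γ) : ℝ) ≤ ε * Δ * N

theorem ncard_setOf_mem_and {ι : Type} (E : Finset ι) (P : ι → Prop) [DecidablePred P] :
    Set.ncard {i | i ∈ E ∧ P i} = #(E.filter P) := by
  rw [← Set.ncard_coe_finset, coe_filter]

open scoped Classical in
theorem exists_maximal_fingerprint {α : Type} (good : Finset α → Prop) (I : Finset α) (B : ℝ)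
    (hB : 0 ≤ B) (h0 : good ∅) :
    ∃ T ⊆ I, (#T : ℝ) ≤ B ∧ good T ∧
      ((#T : ℝ) + 1 ≤ B → ∀ v ∈ I, v ∉ T → ¬ good (insert v T)) := by
  let 𝒯 := I.powerset.filter (fun T => (#T : ℝ) ≤ B ∧ good T)
  have hne : 𝒯.Nonempty := ⟨∅, by simp [𝒯, h0, hB]⟩
  obtain ⟨T, hT, hmax⟩ := exists_max_image 𝒯 card hne
  obtain ⟨h1, h2, h3⟩ := mem_filter.1 hT
  rw [mem_powerset] at h1
  refine ⟨T, h1, h2, h3, fun hlt v hv hvT hg => ?_⟩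
  have hins : insert v T ∈ 𝒯 := by
    refine mem_filter.2 ⟨mem_powerset.2 (insert_subset hv h1), ?_, hg⟩
    rw [card_insert_of_notMem hvT]
    push_cast
    exact hlt
  have := hmax _ hins
  rw [card_insert_of_notMem hvT] at this
  omega

open scoped Classical in
/-- One round of the container algorithm. -/
theorem container_step {r : ℕ} (IH : ContainerProperty r) (ε : ℝ) (hε : 0 < ε) :
    ∃ κ : ℝ, 0 < κ ∧ ∀ ε₂ : ℝ, 0 < ε₂ → ∃ δ : ℝ, 0 < δ ∧ ∃ N₀ : ℝ, ∀ {α ι : Type}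
    (E : Finset ι) (e : Fin (r + 1) → ι → α) (N Δ : ℝ), N₀ ≤ N → 0 < Δ →
    (∀ j x, (#(E.filter (fun i => e j i = x)) : ℝ) ≤ Δ) →
    (∀ j l, j ≠ l → ∀ x y, (#(E.filter (fun i => e j i = x ∧ e l i = y)) : ℝ) ≤ δ * Δ) →
    ∀ Γ : Finset α, (#Γ : ℝ) ≤ N → ∃ 𝒞 : Finset (Finset α), (#𝒞 : ℝ) ≤ 2 ^ (ε₂ * N) ∧
      ∀ I ⊆ Γ, (∀ i ∈ E, ∃ j, e j i ∉ I) →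
        ∃ Γ' ∈ 𝒞, I ⊆ Γ' ∧ Γ' ⊆ Γ ∧
          ((#(edgesIn E e Γ') : ℝ) ≤ ε * Δ * N ∨ (#Γ' : ℝ) ≤ #Γ - κ * N) := by
  obtain ⟨a, ha⟩ : ∃ a, a = ε / 3 := ⟨_, rfl⟩
  have ha0 : 0 < a := by rw [ha]; positivity
  obtain ⟨β, hβ⟩ : ∃ β : ℝ, β = (2 * r ^ 2 + 1) / a := ⟨_, rfl⟩
  have hβ0 : 0 < β := by rw [hβ]; positivity
  refine ⟨a / (4 * (r + 1) * β), by positivity, fun ε₂ hε₂ => ?_⟩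
  obtain ⟨η, hη0, hη⟩ := exists_card_small_subsets_le (ε₂ / 4) (by positivity)
  obtain ⟨p, hp0, hpη, hpa⟩ : ∃ p, 0 < p ∧ p ≤ η ∧ p ≤ a :=
    ⟨min η a, lt_min hη0 ha0, min_le_left _ _, min_le_right _ _⟩
  obtain ⟨ε', hε'0, hε'1, hε'2⟩ : ∃ ε', 0 < ε' ∧ ε' ≤ ε₂ / 4 ∧ ε' ≤ a / (4 * β) :=
    ⟨min (ε₂ / 4) (a / (4 * β)), by positivity, min_le_left _ _, min_le_right _ _⟩
  obtain ⟨δ', hδ'0, N₁, hIH⟩ := IH ε' hε'0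
  refine ⟨min (δ' * (β * p)) (β * p / 2), by positivity,
    max N₁ (max (2 / p) (max (2 / ε₂) 0)), ?_⟩
  intro α ι E e N Δ hN hΔ hdeg hcodeg Γ hΓ
  obtain ⟨hN1, hN2⟩ := max_le_iff.1 hN
  obtain ⟨hN2, hN3⟩ := max_le_iff.1 hN2
  obtain ⟨hN3, hN0⟩ := max_le_iff.1 hN3
  have hpN : 2 ≤ p * N := by rw [div_le_iff₀ hp0] at hN2; linarith
  have hεN : 2 ≤ ε₂ * N := by rw [div_le_iff₀ hε₂] at hN3; linarith
  let good := FingerprintGood (edgesIn E e Γ) e (β * p * Δ) (a * Δ)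
  have hEE : edgesIn E e Γ ⊆ E := filter_subset _ _
  have hgood0 : good ∅ := ⟨∅, by simp, by simp, by intro j x; simp; positivity, by simp⟩
  have claim : ∀ T : Finset α, ∃ 𝒞 : Finset (Finset α), (#𝒞 : ℝ) ≤ 2 ^ (ε₂ / 4 * N) ∧
      (T ⊆ Γ → (#T : ℝ) ≤ p * N → ∀ I ⊆ Γ, (∀ i ∈ E, ∃ j, e j i ∉ I) → T ⊆ I → good T →
      ((#T : ℝ) + 1 ≤ p * N → ∀ v ∈ I, v ∉ T → ¬ good (insert v T)) →
      ∃ Γ' ∈ 𝒞, I ⊆ Γ' ∧ Γ' ⊆ Γ ∧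
          ((#(edgesIn E e Γ') : ℝ) ≤ ε * Δ * N ∨
            (#Γ' : ℝ) ≤ #Γ - a / (4 * (r + 1) * β) * N)) := by
    intro T
    by_cases hT : T ⊆ Γ ∧ (#T : ℝ) ≤ p * N ∧ good T
    swap
    · refine ⟨∅, by simp; positivity, ?_⟩
      intro h1 h2 I _ _ _ h3
      exact absurd ⟨h1, h2, h3⟩ hT
    obtain ⟨hTΓ, hTN, hgood⟩ := hT
    by_cases hstuck : (#T : ℝ) + 1 ≤ p * N
    · obtain ⟨Γ', hΓ'1, hΓ'2, hΓ'3⟩ := stuck_container E e Γ T N Δ a β p _ ha0 hβ hp0 hpa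
        (min_le_right _ _) hΔ hΓ hTN hdeg hcodeg hgood
      refine ⟨{Γ'}, ?_, ?_⟩
      · rw [card_singleton, Nat.cast_one]
        exact Real.one_le_rpow (by norm_num) (by positivity)
      · intro _ _ I hI _ _ _ hmax
        refine ⟨Γ', mem_singleton_self _, hΓ'3 I hI (hmax hstuck), ?_, Or.inl ?_⟩
        · rwa [union_eq_left.2 hTΓ] at hΓ'1
        · refine hΓ'2.trans (le_of_eq ?_)
          rw [ha]; ring
    · obtain ⟨E', hE', h0, hcap, hlow⟩ := hgood
      have hE'card : p * a * Δ * N / 2 ≤ #E' := by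
        have h1 : (#T : ℝ) * (a * Δ) ≤ #E' := by
          calc (#T : ℝ) * (a * Δ) = ∑ v ∈ T, a * Δ := by rw [sum_const, nsmul_eq_mul]
            _ ≤ ∑ v ∈ T, (#(E'.filter (fun i => e 0 i = v)) : ℝ) := sum_le_sum hlow
            _ ≤ _ := by
              have h := (sum_card_fiberwise_eq_card_filter E' T (fun i => e 0 i)).le.trans
                (card_filter_le _ _)
              exact_mod_cast h
        have h2 : p * N / 2 ≤ #T := by linarith
        calc p * a * Δ * N / 2 = (p * N / 2) * (a * Δ) := by ring
          _ ≤ #T * (a * Δ) := by gcongr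
          _ ≤ _ := h1
      obtain ⟨𝒞, h𝒞1, h𝒞2⟩ := hIH Γ E' (fun j => e j.succ) N (β * p * Δ) hΓ hN1 (by positivity)
        (fun j x => by rw [ncard_setOf_mem_and]; exact hcap j x)
        (fun j l hjl x y => by
          rw [ncard_setOf_mem_and]
          refine le_trans (Nat.cast_le.2 (card_le_card (filter_subset_filter _
            (hE'.trans hEE)))) ((hcodeg j.succ l.succ (by simpa using hjl) x y).trans ?_)
          calc min (δ' * (β * p)) (β * p / 2) * Δ ≤ δ' * (β * p) * Δ := by
                gcongr; exact min_le_left _ _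
            _ = _ := by ring)
      refine ⟨𝒞, h𝒞1.trans (Real.rpow_le_rpow_of_exponent_le (by norm_num) (by gcongr)), ?_⟩
      intro _ _ I hI hind hTI _ _
      obtain ⟨Γ', hΓ'1, hΓ'2, hΓ'3, hΓ'4⟩ := h𝒞2 I hI (fun i hi => by
        obtain ⟨j, hj⟩ := hind i (hEE (hE' hi))
        refine Fin.cases (fun hj => absurd (hTI (h0 i hi)) hj) (fun j hj => ⟨j, hj⟩) j hj)
      refine ⟨Γ', hΓ'1, hΓ'2, hΓ'3, Or.inr ?_⟩
      have h3 := card_le_of_forall_exists_mem (E' \ edgesIn E' (fun j => e j.succ) Γ')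
        (fun j => e j.succ) (Γ \ Γ') (β * p * Δ)
        (fun j x => (Nat.cast_le.2 (card_le_card (filter_subset_filter _
          sdiff_subset))).trans (hcap j x)) (by
          intro i hi
          obtain ⟨hi1, hi2⟩ := mem_sdiff.1 hi
          by_contra hcon
          refine hi2 (mem_filter.2 ⟨hi1, fun j => ?_⟩)
          by_contra hj
          exact hcon ⟨j, mem_sdiff.2 ⟨(mem_filter.1 (hE' hi1)).2 _, hj⟩⟩)
      have h4 : (#(E' \ edgesIn E' (fun j => e j.succ) Γ') : ℝ) =
          #E' - #(edgesIn E' (fun j => e j.succ) Γ') := by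
        have hs : edgesIn E' (fun j => e j.succ) Γ' ⊆ E' := filter_subset _ _
        rw [card_sdiff_of_subset hs, Nat.cast_sub (card_le_card hs)]
      have h5 : (#(Γ \ Γ') : ℝ) = #Γ - #Γ' := by
        rw [card_sdiff_of_subset hΓ'3, Nat.cast_sub (card_le_card hΓ'3)]
      have h6 : ε' * (β * p * Δ) * N ≤ p * a * Δ * N / 4 := by
        calc ε' * (β * p * Δ) * N ≤ a / (4 * β) * (β * p * Δ) * N := by gcongr
          _ = _ := by field_simp
      have h7 : p * a * Δ * N / 4 ≤ r * (#(Γ \ Γ') * (β * p * Δ)) := by linarith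
      have h8 : (r : ℝ) * (#(Γ \ Γ') * (β * p * Δ)) ≤ (r + 1) * (#(Γ \ Γ') * (β * p * Δ)) := by
        gcongr; linarith
      have h9 : a / (4 * (r + 1) * β) * N ≤ #(Γ \ Γ') := by
        rw [div_mul_eq_mul_div, div_le_iff₀ (by positivity)]
        have : (p * Δ) * (a * N) ≤ (p * Δ) * (#(Γ \ Γ') * (4 * (r + 1) * β)) := by
          nlinarith
        exact le_of_mul_le_mul_left this (by positivity)
      linarith
  choose F hF1 hF2 using claim
  refine ⟨(Γ.powerset.filter (fun T => (#T : ℝ) ≤ p * N)).biUnion F, ?_, ?_⟩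
  · have hcount : (#(Γ.powerset.filter (fun T => (#T : ℝ) ≤ p * N)) : ℝ) ≤
        2 ^ (ε₂ / 4 * N) := by
      refine le_trans (Nat.cast_le.2 (card_le_card ?_)) (hη Γ N hΓ)
      refine monotone_filter_right _ fun T _ hT => ?_
      exact le_trans hT (by gcongr)
    calc (#((Γ.powerset.filter (fun T => (#T : ℝ) ≤ p * N)).biUnion F) : ℝ)
        ≤ ∑ T ∈ Γ.powerset.filter (fun T => (#T : ℝ) ≤ p * N), (#(F T) : ℝ) := by
          exact_mod_cast card_biUnion_le
      _ ≤ ∑ T ∈ Γ.powerset.filter (fun T => (#T : ℝ) ≤ p * N), (2 : ℝ) ^ (ε₂ / 4 * N) :=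
          sum_le_sum fun T _ => hF1 T
      _ ≤ 2 ^ (ε₂ / 4 * N) * 2 ^ (ε₂ / 4 * N) := by
          rw [sum_const, nsmul_eq_mul]
          gcongr
      _ ≤ 2 ^ (ε₂ * N) := by
          rw [← Real.rpow_add (by norm_num)]
          exact Real.rpow_le_rpow_of_exponent_le (by norm_num) (by linarith)
  · intro I hI hind
    obtain ⟨T, hT1, hT2, hT3, hT4⟩ := exists_maximal_fingerprint good I (p * N) (by linarith) hgood0
    obtain ⟨Γ', h1, h2⟩ := hF2 T (hT1.trans hI) hT2 I hI hind hT1 hT3 hT4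
    exact ⟨Γ', mem_biUnion.2 ⟨T, mem_filter.2 ⟨mem_powerset.2 (hT1.trans hI), hT2⟩, h1⟩, h2⟩

open scoped Classical in
theorem containerProperty (r : ℕ) : ContainerProperty r := by
  induction r with
  | zero =>
    intro ε hε
    refine ⟨1, one_pos, 0, fun {α ι} V₀ E e N Δ hN hN0 hΔ _ _ => ⟨{V₀}, ?_, ?_⟩⟩
    · rw [card_singleton, Nat.cast_one]
      exact Real.one_le_rpow (by norm_num) (by positivity)
    · intro I hI hind
      refine ⟨V₀, mem_singleton_self _, hI, subset_rfl, ?_⟩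
      have : E = ∅ := by
        refine eq_empty_of_forall_notMem fun i hi => ?_
        obtain ⟨j, _⟩ := hind i hi
        exact j.elim0
      simp only [edgesIn, this, filter_empty, card_empty, Nat.cast_zero]
      positivity
  | succ r IH =>
    intro ε hε
    obtain ⟨κ, hκ, hstep⟩ := container_step IH ε hε
    obtain ⟨ℓ₀, hℓ₀⟩ := exists_nat_ge (1 / κ)
    rw [div_le_iff₀ hκ] at hℓ₀
    obtain ⟨δ, hδ, N₀, hstep⟩ := hstep (ε / (ℓ₀ + 1)) (by positivity)
    refine ⟨δ, hδ, max N₀ 0, fun {α ι} V₀ E e N Δ hN hN0 hΔ hdeg hcodeg => ?_⟩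
    obtain ⟨hN1, hN2⟩ := max_le_iff.1 hN0
    simp only [ncard_setOf_mem_and] at hdeg hcodeg
    have hstep := hstep E e N Δ hN1 hΔ hdeg hcodeg
    have hone : (1 : ℝ) ≤ 2 ^ (ε / (ℓ₀ + 1) * N) :=
      Real.one_le_rpow (by norm_num) (by positivity)
    have main : ∀ ℓ : ℕ, ∀ Γ : Finset α, Γ ⊆ V₀ → (#Γ : ℝ) ≤ ℓ * (κ * N) →
        ∃ 𝒞 : Finset (Finset α), (#𝒞 : ℝ) ≤ (2 ^ (ε / (ℓ₀ + 1) * N)) ^ ℓ ∧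
          ∀ I ⊆ Γ, (∀ i ∈ E, ∃ j, e j i ∉ I) →
            ∃ Γ' ∈ 𝒞, I ⊆ Γ' ∧ Γ' ⊆ V₀ ∧ (#(edgesIn E e Γ') : ℝ) ≤ ε * Δ * N := by
      intro ℓ
      induction ℓ with
      | zero =>
        intro Γ hΓ hcard
        refine ⟨{Γ}, by simp, fun I hI _ => ⟨Γ, mem_singleton_self _, hI, hΓ, ?_⟩⟩
        have hΓ0 : Γ = ∅ := by
          rw [← card_eq_zero]
          have : (#Γ : ℝ) ≤ 0 := by simpa using hcard
          exact_mod_cast le_antisymm this (Nat.cast_nonneg _)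
        have : edgesIn E e Γ = ∅ :=
          filter_eq_empty_iff.2 fun i _ h => by simpa [hΓ0] using h 0
        rw [this, card_empty, Nat.cast_zero]
        positivity
      | succ ℓ ihℓ =>
        intro Γ hΓ hcard
        by_cases hedge : (#(edgesIn E e Γ) : ℝ) ≤ ε * Δ * N
        · refine ⟨{Γ}, ?_, fun I hI _ => ⟨Γ, mem_singleton_self _, hI, hΓ, hedge⟩⟩
          rw [card_singleton, Nat.cast_one]
          exact one_le_pow₀ hone
        obtain ⟨𝒞, h𝒞1, h𝒞2⟩ := hstep Γ ((Nat.cast_le.2 (card_le_card hΓ)).trans hN)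
        have : ∀ Γ' : Finset α, ∃ 𝒟 : Finset (Finset α),
            (#𝒟 : ℝ) ≤ (2 ^ (ε / (ℓ₀ + 1) * N)) ^ ℓ ∧ (Γ' ⊆ Γ →
            ((#(edgesIn E e Γ') : ℝ) ≤ ε * Δ * N ∨ (#Γ' : ℝ) ≤ #Γ - κ * N) →
            ∀ I ⊆ Γ', (∀ i ∈ E, ∃ j, e j i ∉ I) →
              ∃ Γ'' ∈ 𝒟, I ⊆ Γ'' ∧ Γ'' ⊆ V₀ ∧ (#(edgesIn E e Γ'') : ℝ) ≤ ε * Δ * N) := by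
          intro Γ'
          by_cases h1 : Γ' ⊆ Γ ∧ (#Γ' : ℝ) ≤ #Γ - κ * N
          · obtain ⟨𝒟, h𝒟1, h𝒟2⟩ := ihℓ Γ' (h1.1.trans hΓ) (by
              have := h1.2
              push_cast at hcard
              linarith)
            exact ⟨𝒟, h𝒟1, fun _ _ => h𝒟2⟩
          · refine ⟨{Γ'}, ?_, ?_⟩
            · rw [card_singleton, Nat.cast_one]
              exact one_le_pow₀ hone
            · intro h2 h3 I hI _
              exact ⟨Γ', mem_singleton_self _, hI, h2.trans hΓ,
                h3.resolve_right fun h => h1 ⟨h2, h⟩⟩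
        choose D hD1 hD2 using this
        refine ⟨𝒞.biUnion D, ?_, ?_⟩
        · calc (#(𝒞.biUnion D) : ℝ) ≤ ∑ Γ' ∈ 𝒞, (#(D Γ') : ℝ) := by
                exact_mod_cast card_biUnion_le
            _ ≤ ∑ Γ' ∈ 𝒞, ((2 : ℝ) ^ (ε / (ℓ₀ + 1) * N)) ^ ℓ := sum_le_sum fun Γ' _ => hD1 Γ'
            _ ≤ 2 ^ (ε / (ℓ₀ + 1) * N) * (2 ^ (ε / (ℓ₀ + 1) * N)) ^ ℓ := by
                rw [sum_const, nsmul_eq_mul]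
                gcongr
            _ = _ := by rw [pow_succ']
        · intro I hI hind
          obtain ⟨Γ', h1, h2, h3, h4⟩ := h𝒞2 I hI hind
          obtain ⟨Γ'', h5, h6⟩ := hD2 Γ' h3 h4 I h2 hind
          exact ⟨Γ'', mem_biUnion.2 ⟨Γ', h1, h5⟩, h6⟩
    obtain ⟨𝒞, h𝒞1, h𝒞2⟩ := main ℓ₀ V₀ subset_rfl (hN.trans (by nlinarith))
    refine ⟨𝒞, h𝒞1.trans ?_, fun I hI hind => h𝒞2 I hI hind⟩
    rw [← Real.rpow_natCast, ← Real.rpow_mul (by norm_num)]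
    refine Real.rpow_le_rpow_of_exponent_le (by norm_num) ?_
    calc ε / (ℓ₀ + 1) * N * ℓ₀ = ε * N * (ℓ₀ / (ℓ₀ + 1)) := by ring
      _ ≤ ε * N * 1 := by
          gcongr
          rw [div_le_one (by positivity)]
          linarith
      _ = _ := by ring

end Containers

/-! ### Clauses, relabelings and non-minimal patterns -/

section Clauses

/-- The clause on the variable set `S` with polarities `z`. -/
def litClause {V : Type*} [DecidableEq V] (z : V → Bool) (S : Finset V) : SatClause V :=
  S.image (fun x => (x, z x))

/-- Relabel the variables of a clause. -/
def mapClause {V W : Type*} [DecidableEq V] (φ : W → V) (C : SatClause W) : SatClause V :=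
  C.image (fun l => (φ l.1, l.2))

variable {V W : Type*} [DecidableEq V]

theorem mem_litClause {z : V → Bool} {S : Finset V} {l : V × Bool} :
    l ∈ litClause z S ↔ l.1 ∈ S ∧ z l.1 = l.2 := by
  obtain ⟨x, b⟩ := l
  simp only [litClause, mem_image, Prod.mk.injEq]
  constructor
  · rintro ⟨y, hy, rfl, rfl⟩
    exact ⟨hy, rfl⟩
  · rintro ⟨h1, h2⟩
    exact ⟨x, h1, rfl, h2⟩

@[simp] theorem clauseVars_litClause (z : V → Bool) (S : Finset V) :
    clauseVars (litClause z S) = S := by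
  simp [clauseVars, litClause, image_image, Function.comp_def]

@[simp] theorem card_litClause (z : V → Bool) (S : Finset V) : #(litClause z S) = #S :=
  card_image_of_injective _ fun _ _ h => (Prod.mk.inj h).1

theorem isKClause_litClause {k : ℕ} {z : V → Bool} {S : Finset V} :
    IsKClause k (litClause z S) ↔ #S = k := by
  simp [IsKClause]

theorem litClause_congr {z z' : V → Bool} {S : Finset V} (h : ∀ x ∈ S, z x = z' x) :
    litClause z S = litClause z' S :=
  image_congr fun x hx => by simp [h x hx]

theorem litClause_inj {z z' : V → Bool} {S S' : Finset V} (h : litClause z S = litClause z' S') :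
    S = S' ∧ ∀ x ∈ S, z x = z' x := by
  have hS : S = S' := by rw [← clauseVars_litClause z S, h, clauseVars_litClause]
  refine ⟨hS, fun x hx => ?_⟩
  have : (x, z x) ∈ litClause z' S' := h ▸ mem_litClause.2 ⟨hx, rfl⟩
  exact (mem_litClause.1 this).2.symm

theorem IsKClause.exists_litClause {k : ℕ} {C : SatClause V} (h : IsKClause k C) :
    ∃ z : V → Bool, C = litClause z (clauseVars C) := by
  have hinj : Set.InjOn Prod.fst (C : Set (V × Bool)) :=
    card_image_iff.1 (h.2.trans h.1.symm)
  refine ⟨fun x => decide ((x, true) ∈ C), ?_⟩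
  ext ⟨x, b⟩
  rw [mem_litClause]
  simp only [clauseVars, mem_image]
  constructor
  · intro hx
    refine ⟨⟨_, hx, rfl⟩, ?_⟩
    cases b
    · simp only [decide_eq_false_iff_not]
      intro hx'
      have := hinj hx hx' rfl
      simp at this
    · simpa using hx
  · rintro ⟨⟨⟨y, c⟩, hy, rfl⟩, hb⟩
    simp only at hb ⊢
    cases b
    · simp only [decide_eq_false_iff_not] at hb
      cases c
      · exact hy
      · exact absurd hy hb
    · simpa using hb

theorem mapClause_litClause [DecidableEq W] (φ : W → V) (z : V → Bool) (S : Finset W) :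
    mapClause φ (litClause (z ∘ φ) S) = litClause z (S.image φ) := by
  simp [mapClause, litClause, image_image, Function.comp_def]

theorem clauseVars_mapClause [DecidableEq W] (φ : W → V) (C : SatClause W) :
    clauseVars (mapClause φ C) = (clauseVars C).image φ := by
  simp [clauseVars, mapClause, image_image, Function.comp_def]

theorem satisfiesClause_mapClause (φ : W → V) (C : SatClause W) (w : V → Bool) :
    SatisfiesClause w (mapClause φ C) ↔ SatisfiesClause (w ∘ φ) C :=
  forall_mem_image

theorem mapFormula_subset_iff [DecidableEq W] {φ : W → V} {F : SatFormula W} {G : SatFormula V} :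
    mapFormula φ F ⊆ G ↔ ∀ C ∈ F, mapClause φ C ∈ G :=
  image_subset_iff

theorem mapClause_injective {φ : W → V} (hφ : Function.Injective φ) :
    Function.Injective (mapClause φ) :=
  image_injective fun a b h => by
    obtain ⟨h1, h2⟩ := Prod.mk.inj h
    exact Prod.ext (hφ h1) h2

theorem MinimalFormula.of_mapFormula_subset [DecidableEq W] {φ : W → V} (hφ : Function.Injective φ)
    {F : SatFormula W} {G : SatFormula V} (hG : MinimalFormula G) (h : mapFormula φ F ⊆ G) :
    MinimalFormula F := by
  rw [mapFormula_subset_iff] at h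
  intro C hC
  obtain ⟨w, hw1, hw2⟩ := hG _ (h C hC)
  refine ⟨w ∘ φ, (satisfiesClause_mapClause φ C w).1 hw1, fun C' hC' hs => ?_⟩
  exact mapClause_injective hφ (hw2 _ (h C' hC') ((satisfiesClause_mapClause φ C' w).2 hs))

end Clauses

section Patterns

/-- The clause of the 2-blowup of a clause selecting the copy `b i` of each variable `i`. -/
def selClause {k : ℕ} (p b : Fin (k + 1) → Bool) (S : Finset (Fin (k + 1))) :
    SatClause (Fin (k + 1) × Bool) :=
  S.image (fun i => ((i, b i), p i))

variable {k : ℕ}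

theorem mapClause_selClause (p b : Fin (k + 1) → Bool) (S : Finset (Fin (k + 1))) :
    mapClause Prod.fst (selClause p b S) = litClause p S := by
  simp [mapClause, selClause, litClause, image_image, Function.comp_def]

theorem clauseVars_selClause (p b : Fin (k + 1) → Bool) (S : Finset (Fin (k + 1))) :
    clauseVars (selClause p b S) = S.image (fun i => (i, b i)) := by
  simp [clauseVars, selClause, image_image, Function.comp_def]

theorem mem_clauseVars_selClause {p b : Fin (k + 1) → Bool} {S : Finset (Fin (k + 1))}
    {i : Fin (k + 1)} {c : Bool} :
    (i, c) ∈ clauseVars (selClause p b S) ↔ i ∈ S ∧ b i = c := by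
  rw [clauseVars_selClause]
  exact mem_litClause (z := b) (S := S) (l := (i, c))

theorem isKClause_selClause (p b : Fin (k + 1) → Bool) (S : Finset (Fin (k + 1))) :
    IsKClause k (selClause p b S) ↔ #S = k := by
  have h1 : #(selClause p b S) = #S :=
    card_image_of_injective _ fun _ _ h => (Prod.mk.inj (Prod.mk.inj h).1).1
  have h2 : #(clauseVars (selClause p b S)) = #S := by
    rw [clauseVars_selClause]
    exact card_image_of_injective _ fun _ _ h => (Prod.mk.inj h).1
  simp [IsKClause, h1, h2]

theorem satisfiesClause_selClause {w : Fin (k + 1) × Bool → Bool} {p b : Fin (k + 1) → Bool}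
    {S : Finset (Fin (k + 1))} :
    SatisfiesClause w (selClause p b S) ↔ ∀ i ∈ S, w (i, b i) = p i := by
  simp [SatisfiesClause, selClause]

/-- A clause together with its single-vertex flips in the 2-blowup. -/
def flipFormula (p : Fin (k + 1) → Bool) (S : Finset (Fin (k + 1))) :
    SatFormula (Fin (k + 1) × Bool) :=
  insert (selClause p (fun _ => false) S)
    (S.image (fun i => selClause p (fun j => decide (j = i)) S))

theorem exists_eq_of_mem_flipFormula {p : Fin (k + 1) → Bool} {S : Finset (Fin (k + 1))}
    {C : SatClause (Fin (k + 1) × Bool)} (hC : C ∈ flipFormula p S) :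
    ∃ b, C = selClause p b S ∧ ∀ i ∈ S, ∀ j ∈ S, b i = true → b j = true → i = j := by
  rw [flipFormula, mem_insert, mem_image] at hC
  rcases hC with rfl | ⟨i, _, rfl⟩
  · exact ⟨_, rfl, by simp⟩
  · refine ⟨_, rfl, fun x _ y _ hx hy => ?_⟩
    simp only [decide_eq_true_eq] at hx hy
    rw [hx, hy]

theorem simpleFormula_flipFormula (p : Fin (k + 1) → Bool) (S : Finset (Fin (k + 1))) :
    SimpleFormula (flipFormula p S) := by
  intro C hC C' hC' h
  obtain ⟨b, rfl, _⟩ := exists_eq_of_mem_flipFormula hC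
  obtain ⟨b', rfl, _⟩ := exists_eq_of_mem_flipFormula hC'
  refine image_congr fun i hi => ?_
  have : (i, b i) ∈ clauseVars (selClause p b' S) := h ▸ mem_clauseVars_selClause.2 ⟨hi, rfl⟩
  simp [(mem_clauseVars_selClause.1 this).2]

/-- If a clause with all its flips is in a minimal formula, every value is forced on one of the
two copies of each variable of the clause. -/
theorem exists_forced_witness {F : SatFormula (Fin (k + 1) × Bool)} (hF : MinimalFormula F)
    (p : Fin (k + 1) → Bool) (S : Finset (Fin (k + 1))) (hsub : flipFormula p S ⊆ F) :
    ∃ w, (∀ i ∈ S, ∀ v : Bool, w (i, decide (p i ≠ v)) = v) ∧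
      ∀ C' ∈ F, SatisfiesClause w C' → C' = selClause p (fun _ => false) S := by
  obtain ⟨w, hw1, hw2⟩ := hF _ (hsub (mem_insert_self _ _))
  refine ⟨w, fun i hi v => ?_, hw2⟩
  rw [satisfiesClause_selClause] at hw1
  have h0 := hw1 i hi
  have h1 : w (i, true) ≠ p i := by
    intro h1
    have := hw2 (selClause p (fun j => decide (j = i)) S)
      (hsub (mem_insert_of_mem (mem_image_of_mem _ hi))) (by
        rw [satisfiesClause_selClause]
        intro j hj
        by_cases hji : j = i
        · subst hji; simpa using h1
        · simpa [hji] using hw1 j hj)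
    have hmem : (i, true) ∈ clauseVars (selClause p (fun j => decide (j = i)) S) :=
      mem_clauseVars_selClause.2 ⟨hi, by simp⟩
    rw [this, mem_clauseVars_selClause] at hmem
    simp at hmem
  by_cases hv : p i = v
  · simp [hv, h0]
  · simp only [hv, ne_eq, not_false_eq_true, decide_true]
    cases hp : p i <;> cases v <;> simp_all

/-- A finite set of clauses whose 2-blowup contains a given kind of non-minimal formula. -/
def NonminimalPattern (k : ℕ) (P : SatFormula (Fin (k + 1))) : Prop :=
  IsKFormula k P ∧ ∃ F : SatFormula (Fin (k + 1) × Bool),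
    IsKFormula k F ∧ ¬ MinimalFormula F ∧ mapFormula Prod.fst F ⊆ P

/-- A pattern whose 2-blowup contains a simple non-minimal formula. -/
def SimpleNonminimalPattern (k : ℕ) (P : SatFormula (Fin (k + 1))) : Prop :=
  IsKFormula k P ∧ ∃ F : SatFormula (Fin (k + 1) × Bool),
    IsKFormula k F ∧ SimpleFormula F ∧ ¬ MinimalFormula F ∧ mapFormula Prod.fst F ⊆ P

theorem isKFormula_flipFormula {p : Fin (k + 1) → Bool} {S : Finset (Fin (k + 1))}
    (hS : #S = k) : IsKFormula k (flipFormula p S) := by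
  intro C hC
  obtain ⟨b, rfl, _⟩ := exists_eq_of_mem_flipFormula hC
  rwa [isKClause_selClause]

theorem mapClause_mem_of_mem_flipFormula {p : Fin (k + 1) → Bool} {S : Finset (Fin (k + 1))}
    {C : SatClause (Fin (k + 1) × Bool)} (hC : C ∈ flipFormula p S) :
    mapClause Prod.fst C = litClause p S := by
  obtain ⟨b, rfl, _⟩ := exists_eq_of_mem_flipFormula hC
  exact mapClause_selClause _ _ _

theorem not_minimal_flipFormula_insert (p q : Fin (k + 1) → Bool) (S : Finset (Fin (k + 1)))
    {x : Fin (k + 1)} (hx : x ∈ S) (hpq : p x ≠ q x) :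
    ¬ MinimalFormula (insert (selClause q (fun i => decide (p i ≠ q i)) S) (flipFormula p S)) := by
  intro hmin
  obtain ⟨w, hw1, hw2⟩ := exists_forced_witness hmin p S (subset_insert _ _)
  have := hw2 _ (mem_insert_self _ _)
    (satisfiesClause_selClause.2 fun i hi => hw1 i hi (q i))
  have hmem : (x, true) ∈ clauseVars (selClause q (fun i => decide (p i ≠ q i)) S) :=
    mem_clauseVars_selClause.2 ⟨hx, by simpa using hpq⟩
  rw [this, mem_clauseVars_selClause] at hmem
  simp at hmem

theorem nonminimalPattern_pair (p q : Fin (k + 1) → Bool) (S : Finset (Fin (k + 1)))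
    (hS : #S = k) {x : Fin (k + 1)} (hx : x ∈ S) (hpq : p x ≠ q x) :
    NonminimalPattern k {litClause p S, litClause q S} := by
  refine ⟨?_, _, ?_, not_minimal_flipFormula_insert p q S hx hpq, ?_⟩
  · intro C hC
    simp only [mem_insert, mem_singleton] at hC
    rcases hC with rfl | rfl <;> rwa [isKClause_litClause]
  · intro C hC
    rcases mem_insert.1 hC with rfl | hC
    · rwa [isKClause_selClause]
    · exact isKFormula_flipFormula hS C hC
  · rw [mapFormula_subset_iff]
    intro C hC
    rcases mem_insert.1 hC with rfl | hC
    · rw [mapClause_selClause]; simp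
    · rw [mapClause_mem_of_mem_flipFormula hC]; simp

theorem SimpleFormula.insert {V : Type*} [DecidableEq V] {F : SatFormula V} {C : SatClause V}
    (hF : SimpleFormula F) (h : ∀ C' ∈ F, clauseVars C' ≠ clauseVars C) :
    SimpleFormula (insert C F) := by
  intro C₁ h₁ C₂ h₂ he
  rcases mem_insert.1 h₁ with e₁ | m₁ <;> rcases mem_insert.1 h₂ with e₂ | m₂
  · rw [e₁, e₂]
  · exact absurd (e₁ ▸ he.symm) (h _ m₂)
  · exact absurd (e₂ ▸ he) (h _ m₁)
  · exact hF _ m₁ _ m₂ he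

theorem simpleNonminimalPattern_pair (p q : Fin (k + 1) → Bool) (S : Finset (Fin (k + 1)))
    (hS : #S = k) {x y : Fin (k + 1)} (hx : x ∈ S) (hy : y ∈ S) (hxy : x ≠ y)
    (hpqx : p x ≠ q x) (hpqy : p y ≠ q y) :
    SimpleNonminimalPattern k {litClause p S, litClause q S} := by
  refine ⟨(nonminimalPattern_pair p q S hS hx hpqx).1, _, ?_, ?_,
    not_minimal_flipFormula_insert p q S hx hpqx, ?_⟩
  · intro C hC
    rcases mem_insert.1 hC with rfl | hC
    · rwa [isKClause_selClause]
    · exact isKFormula_flipFormula hS C hC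
  · refine (simpleFormula_flipFormula p S).insert fun C hC he => ?_
    obtain ⟨b, rfl, hb⟩ := exists_eq_of_mem_flipFormula hC
    have aux : ∀ i ∈ S, p i ≠ q i → b i = true := by
      intro i hi hpq
      have : (i, true) ∈ clauseVars (selClause p b S) := by
        rw [he]
        exact mem_clauseVars_selClause.2 ⟨hi, by simpa using hpq⟩
      exact (mem_clauseVars_selClause.1 this).2
    exact hxy (hb x hx y hy (aux x hx hpqx) (aux y hy hpqy))
  · rw [mapFormula_subset_iff]
    intro C hC
    rcases mem_insert.1 hC with rfl | hC
    · rw [mapClause_selClause]; simp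
    · rw [mapClause_mem_of_mem_flipFormula hC]; simp

theorem simpleNonminimalPattern_triple (p₁ p₂ p₃ : Fin (k + 1) → Bool) {x₁ x₂ x₃ : Fin (k + 1)}
    (h₁₂ : x₁ ≠ x₂) (h₁₃ : x₁ ≠ x₃) (h₂₃ : x₂ ≠ x₃) (hp : p₂ x₁ ≠ p₃ x₁) :
    SimpleNonminimalPattern k {litClause p₁ (univ.erase x₁), litClause p₂ (univ.erase x₂),
      litClause p₃ (univ.erase x₃)} := by
  have hcard : ∀ x : Fin (k + 1), #(univ.erase x) = k := by
    intro x; rw [card_erase_of_mem (mem_univ _)]; simp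
  let b : (Fin (k + 1) → Bool) → Fin (k + 1) → Bool :=
    fun q i => if i = x₁ then false else decide (p₁ i ≠ q i)
  have hvars : ∀ q x, x₁ ≠ x → (x₁, false) ∈ clauseVars (selClause q (b q) (univ.erase x)) :=
    fun q x hx => mem_clauseVars_selClause.2 ⟨mem_erase.2 ⟨hx, mem_univ _⟩, by simp [b]⟩
  have hflip : ∀ C ∈ flipFormula p₁ (univ.erase x₁), (x₁, false) ∉ clauseVars C := by
    intro C hC
    obtain ⟨b, rfl, _⟩ := exists_eq_of_mem_flipFormula hC
    rw [mem_clauseVars_selClause]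
    simp
  refine ⟨?_, insert (selClause p₂ (b p₂) (univ.erase x₂))
    (insert (selClause p₃ (b p₃) (univ.erase x₃)) (flipFormula p₁ (univ.erase x₁))),
    ?_, ?_, ?_, ?_⟩
  · intro C hC
    simp only [mem_insert, mem_singleton] at hC
    rcases hC with rfl | rfl | rfl <;> rw [isKClause_litClause] <;> exact hcard _
  · intro C hC
    rcases mem_insert.1 hC with rfl | hC
    · rw [isKClause_selClause]; exact hcard _
    rcases mem_insert.1 hC with rfl | hC
    · rw [isKClause_selClause]; exact hcard _
    · exact isKFormula_flipFormula (hcard _) C hC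
  · refine ((simpleFormula_flipFormula p₁ _).insert fun C hC he => ?_).insert fun C hC he => ?_
    · exact hflip C hC (he ▸ hvars p₃ x₃ h₁₃)
    · rcases mem_insert.1 hC with rfl | hC
      · have : (x₂, b p₃ x₂) ∈ clauseVars (selClause p₂ (b p₂) (univ.erase x₂)) := by
          rw [← he]
          exact mem_clauseVars_selClause.2 ⟨mem_erase.2 ⟨h₂₃, mem_univ _⟩, rfl⟩
        rw [mem_clauseVars_selClause] at this
        simp at this
      · exact hflip C hC (he ▸ hvars p₂ x₂ h₁₂)
  · intro hmin
    obtain ⟨w, hw1, hw2⟩ := exists_forced_witness hmin p₁ (univ.erase x₁)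
      ((subset_insert _ _).trans (subset_insert _ _))
    have key : ∀ q x, x₁ ≠ x → selClause q (b q) (univ.erase x) ∈
        insert (selClause p₂ (b p₂) (univ.erase x₂))
        (insert (selClause p₃ (b p₃) (univ.erase x₃)) (flipFormula p₁ (univ.erase x₁))) →
        w (x₁, false) ≠ q x₁ := by
      intro q x hx hmem hw
      have := hw2 _ hmem (satisfiesClause_selClause.2 fun i _ => by
        by_cases hi : i = x₁
        · subst hi; simpa [b] using hw
        · simp only [b, hi, if_false]
          exact hw1 i (mem_erase.2 ⟨hi, mem_univ _⟩) (q i))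
      have hv := hvars q x hx
      rw [this, mem_clauseVars_selClause] at hv
      simp at hv
    have k2 := key p₂ x₂ h₁₂ (mem_insert_self _ _)
    have k3 := key p₃ x₃ h₁₃ (mem_insert_of_mem (mem_insert_self _ _))
    revert k2 k3 hp
    cases w (x₁, false) <;> cases p₂ x₁ <;> cases p₃ x₁ <;> simp
  · rw [mapFormula_subset_iff]
    intro C hC
    rcases mem_insert.1 hC with rfl | hC
    · rw [mapClause_selClause]; simp
    rcases mem_insert.1 hC with rfl | hC
    · rw [mapClause_selClause]; simp
    · rw [mapClause_mem_of_mem_flipFormula hC]; simp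

end Patterns

/-! ### Containers for minimal formulae -/

section FormulaContainers

open scoped Classical in
/-- All `k`-SAT clauses on `n` variables. -/
noncomputable def kClauses (k n : ℕ) : Finset (SatClause (Fin n)) := univ.filter (IsKClause k)

theorem mem_kClauses {k n : ℕ} {C : SatClause (Fin n)} : C ∈ kClauses k n ↔ IsKClause k C := by
  simp [kClauses]

theorem card_kClauses_le (k n : ℕ) : #(kClauses k n) ≤ (2 * n) ^ k := by
  have hsub : kClauses k n ⊆ (univ : Finset (Fin n × Bool)).powersetCard k := fun C hC =>
    mem_powersetCard.2 ⟨subset_univ _, (mem_kClauses.1 hC).1⟩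
  refine (card_le_card hsub).trans ?_
  rw [card_powersetCard]
  refine (Nat.choose_le_pow _ _).trans (le_of_eq ?_)
  simp [mul_comm]

theorem IsKFormula.subset_kClauses {k n : ℕ} {G : SatFormula (Fin n)} (hG : IsKFormula k G) :
    G ⊆ kClauses k n := fun C hC => mem_kClauses.2 (hG C hC)

open scoped Classical in
/-- The injective relabelings placing `F` inside `Γ`. -/
noncomputable def injCopies {U : Type} [Fintype U] [DecidableEq U] {n : ℕ} (F : SatFormula U)
    (Γ : SatFormula (Fin n)) : Finset (U → Fin n) :=
  univ.filter (fun φ => Function.Injective φ ∧ mapFormula φ F ⊆ Γ)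

open scoped Classical in
theorem card_filter_mapClause_le {U : Type} [Fintype U] [DecidableEq U] {k n : ℕ}
    (C : SatClause U) (hC : IsKClause k C) (x : SatClause (Fin n)) :
    #((univ.filter (fun φ : U → Fin n => Function.Injective φ)).filter
      (fun φ => mapClause φ C = x)) ≤ k ^ k * n ^ (Fintype.card U - k) := by
  rcases ((univ.filter (fun φ : U → Fin n => Function.Injective φ)).filter
      (fun φ => mapClause φ C = x)).eq_empty_or_nonempty with h | ⟨φ₀, h₀⟩
  · rw [h]; simp
  have hB : #(clauseVars x) ≤ k := by
    rw [← (mem_filter.1 h₀).2, clauseVars_mapClause]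
    exact card_image_le.trans hC.2.le
  have := card_filter_forall_mem_le (clauseVars C) (clauseVars x)
  rw [hC.2, Fintype.card_fin] at this
  refine le_trans (card_le_card ?_) (this.trans (by gcongr))
  intro φ hφ
  refine mem_filter.2 ⟨mem_univ _, fun u hu => ?_⟩
  rw [← (mem_filter.1 hφ).2, clauseVars_mapClause]
  exact mem_image_of_mem _ hu

open scoped Classical in
theorem card_filter_mapClause_and_le {U : Type} [Fintype U] [DecidableEq U] {k n : ℕ} (hk : 1 ≤ k) (hn : 1 ≤ n)
    (C C' : SatClause U) (hC : IsKClause k C) (hC' : IsKClause k C')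
    (hne : clauseVars C ≠ clauseVars C') (x y : SatClause (Fin n)) :
    #((univ.filter (fun φ : U → Fin n => Function.Injective φ)).filter
      (fun φ => mapClause φ C = x ∧ mapClause φ C' = y)) * n ≤
      (2 * k) ^ Fintype.card U * n ^ (Fintype.card U - k) := by
  rcases ((univ.filter (fun φ : U → Fin n => Function.Injective φ)).filter
      (fun φ => mapClause φ C = x ∧ mapClause φ C' = y)).eq_empty_or_nonempty with h | ⟨φ₀, h₀⟩
  · rw [h]; simp
  have hB : #(clauseVars x ∪ clauseVars y) ≤ 2 * k := by
    refine (card_union_le _ _).trans ?_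
    rw [← (mem_filter.1 h₀).2.1, ← (mem_filter.1 h₀).2.2, clauseVars_mapClause,
      clauseVars_mapClause, two_mul]
    exact add_le_add (card_image_le.trans hC.2.le) (card_image_le.trans hC'.2.le)
  have hS : k + 1 ≤ #(clauseVars C ∪ clauseVars C') := by
    by_contra hlt
    have h1 : clauseVars C = clauseVars C ∪ clauseVars C' :=
      eq_of_subset_of_card_le subset_union_left (by rw [hC.2]; omega)
    have h2 : clauseVars C' = clauseVars C ∪ clauseVars C' :=
      eq_of_subset_of_card_le subset_union_right (by rw [hC'.2]; omega)
    exact hne (h1.trans h2.symm)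
  have hSU : #(clauseVars C ∪ clauseVars C') ≤ Fintype.card U := card_le_univ _
  have := card_filter_forall_mem_le (clauseVars C ∪ clauseVars C') (clauseVars x ∪ clauseVars y)
  rw [Fintype.card_fin] at this
  have hle : #((univ.filter (fun φ : U → Fin n => Function.Injective φ)).filter
      (fun φ => mapClause φ C = x ∧ mapClause φ C' = y)) ≤
      (2 * k) ^ Fintype.card U * n ^ (Fintype.card U - (k + 1)) := by
    refine le_trans (card_le_card ?_) (this.trans ?_)
    · intro φ hφ
      refine mem_filter.2 ⟨mem_univ _, fun u hu => ?_⟩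
      rw [← (mem_filter.1 hφ).2.1, ← (mem_filter.1 hφ).2.2, clauseVars_mapClause,
        clauseVars_mapClause, ← image_union]
      exact mem_image_of_mem _ hu
    · refine Nat.mul_le_mul ?_ (Nat.pow_le_pow_right hn (by omega))
      exact (Nat.pow_le_pow_left hB _).trans (Nat.pow_le_pow_right (by omega) hSU)
  calc _ ≤ (2 * k) ^ Fintype.card U * n ^ (Fintype.card U - (k + 1)) * n := by gcongr
    _ = (2 * k) ^ Fintype.card U * n ^ (Fintype.card U - (k + 1) + 1) := by rw [pow_succ]; ring
    _ = _ := by rw [show Fintype.card U - (k + 1) + 1 = Fintype.card U - k by omega]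

open scoped Classical in
theorem formula_container_single {U : Type} [Fintype U] [DecidableEq U] (k : ℕ) (hk : 1 ≤ k)
    (hkU : k ≤ Fintype.card U)
    (F : SatFormula U) (hF : IsKFormula k F) (hFs : SimpleFormula F) (hFm : ¬ MinimalFormula F)
    (ε : ℝ) (hε : 0 < ε) :
    ∀ᶠ n : ℕ in atTop, ∃ 𝒞 : Finset (SatFormula (Fin n)), (#𝒞 : ℝ) ≤ 2 ^ (ε * (n : ℝ) ^ k) ∧
      ∀ G : SatFormula (Fin n), IsKFormula k G → MinimalFormula G →
        ∃ Γ ∈ 𝒞, G ⊆ Γ ∧ Γ ⊆ kClauses k n ∧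
          (#(injCopies F Γ) : ℝ) ≤ ε * (n : ℝ) ^ Fintype.card U := by
  obtain ⟨u, hu⟩ : ∃ u, u = Fintype.card U := ⟨_, rfl⟩
  rw [← hu] at hkU ⊢
  obtain ⟨K, hK⟩ : ∃ K : ℝ, K = ((2 * k : ℕ) : ℝ) ^ u := ⟨_, rfl⟩
  have hK1 : 1 ≤ K := by
    rw [hK]
    exact one_le_pow₀ (by exact_mod_cast (by omega : 1 ≤ 2 * k))
  obtain ⟨δ, hδ, N₀, hcont⟩ := containerProperty #F (ε / (K * 2 ^ k)) (by positivity)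
  filter_upwards [eventually_ge_atTop 1, eventually_ge_atTop ⌈N₀⌉₊,
    eventually_ge_atTop ⌈1 / δ⌉₊] with n hn hnN hnδ
  have hn0 : (0 : ℝ) < n := by exact_mod_cast hn
  have hn1 : (1 : ℝ) ≤ n := by exact_mod_cast hn
  have hNn : (N₀ : ℝ) ≤ n := Nat.ceil_le.1 hnN
  have hδn : 1 ≤ δ * n := by
    have := Nat.ceil_le.1 hnδ
    rwa [div_le_iff₀' hδ] at this
  let c : Fin #F → SatClause U := fun j => (F.equivFin.symm j).1
  have hcF : ∀ j, c j ∈ F := fun j => (F.equivFin.symm j).2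
  have hcinj : ∀ j l, j ≠ l → clauseVars (c j) ≠ clauseVars (c l) := by
    intro j l hjl he
    have := hFs _ (hcF j) _ (hcF l) he
    exact hjl (F.equivFin.symm.injective (Subtype.ext this))
  have hcsurj : ∀ C ∈ F, ∃ j, c j = C := by
    intro C hC
    exact ⟨F.equivFin ⟨C, hC⟩, by simp [c]⟩
  let E := univ.filter (fun φ : U → Fin n => Function.Injective φ)
  obtain ⟨𝒞, h𝒞1, h𝒞2⟩ := hcont (kClauses k n) E (fun j φ => mapClause φ (c j))
    ((2 * n : ℝ) ^ k) (K * (n : ℝ) ^ (u - k))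
    (by exact_mod_cast card_kClauses_le k n)
    (hNn.trans ((by linarith : (n : ℝ) ≤ 2 * n).trans (le_self_pow₀ (by linarith) (by omega))))
    (by positivity)
    (by
      intro j x
      rw [ncard_setOf_mem_and]
      calc (#(E.filter (fun φ => mapClause φ (c j) = x)) : ℝ) ≤ ((k ^ k * n ^ (u - k) : ℕ) : ℝ) :=
            Nat.cast_le.2 (by
              rw [hu]
              exact card_filter_mapClause_le (c j) (hF _ (hcF j)) x)
        _ ≤ (((2 * k) ^ u * n ^ (u - k) : ℕ) : ℝ) := by
            refine Nat.cast_le.2 (Nat.mul_le_mul_right _ ?_)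
            exact (Nat.pow_le_pow_left (by omega) _).trans (Nat.pow_le_pow_right (by omega) hkU)
        _ = _ := by push_cast [hK]; rfl)
    (by
      intro j l hjl x y
      rw [ncard_setOf_mem_and]
      have h := card_filter_mapClause_and_le hk hn (c j) (c l) (hF _ (hcF j)) (hF _ (hcF l))
        (hcinj j l hjl) x y
      rw [← hu] at h
      have h' : (#(E.filter (fun φ => mapClause φ (c j) = x ∧ mapClause φ (c l) = y)) : ℝ) * n ≤
          K * (n : ℝ) ^ (u - k) := by
        rw [hK]; exact_mod_cast h
      have h2 : K * (n : ℝ) ^ (u - k) * 1 ≤ K * (n : ℝ) ^ (u - k) * (δ * n) := by gcongr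
      refine le_of_mul_le_mul_right ?_ hn0
      linarith)
  refine ⟨𝒞, h𝒞1.trans (Real.rpow_le_rpow_of_exponent_le (by norm_num) (le_of_eq_of_le ?_
    (mul_le_of_le_one_right (b := K⁻¹) (by positivity) (inv_le_one_of_one_le₀ hK1)))), ?_⟩
  · rw [mul_pow]; field_simp
  · intro G hG hGm
    obtain ⟨Γ, hΓ1, hΓ2, hΓ3, hΓ4⟩ := h𝒞2 G hG.subset_kClauses (by
      intro φ hφ
      by_contra hcon
      push Not at hcon
      refine hFm (hGm.of_mapFormula_subset (mem_filter.1 hφ).2 (mapFormula_subset_iff.2 ?_))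
      intro C hC
      obtain ⟨j, rfl⟩ := hcsurj C hC
      exact hcon j)
    refine ⟨Γ, hΓ1, hΓ2, hΓ3, le_trans (Nat.cast_le.2 (card_le_card ?_))
      (hΓ4.trans (le_of_eq ?_))⟩
    · intro φ hφ
      obtain ⟨h1, h2⟩ := (mem_filter.1 hφ).2
      rw [mapFormula_subset_iff] at h2
      exact mem_edgesIn.2 ⟨mem_filter.2 ⟨mem_univ _, h1⟩, fun j => h2 _ (hcF j)⟩
    · rw [mul_pow]
      have : (n : ℝ) ^ u = (n : ℝ) ^ (u - k) * (n : ℝ) ^ k := by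
        rw [← pow_add]; congr 1; omega
      rw [this]
      field_simp

open scoped Classical in
theorem formula_container_family {U : Type} [Fintype U] [DecidableEq U] (k : ℕ) (hk : 1 ≤ k)
    (hkU : k ≤ Fintype.card U) (𝓕 : Finset (SatFormula U)) :
    (∀ F ∈ 𝓕, IsKFormula k F ∧ SimpleFormula F ∧ ¬ MinimalFormula F) → ∀ ε : ℝ, 0 < ε →
    ∀ᶠ n : ℕ in atTop, ∃ 𝒞 : Finset (SatFormula (Fin n)), (#𝒞 : ℝ) ≤ 2 ^ (ε * (n : ℝ) ^ k) ∧
      ∀ G : SatFormula (Fin n), IsKFormula k G → MinimalFormula G →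
        ∃ Γ ∈ 𝒞, G ⊆ Γ ∧ Γ ⊆ kClauses k n ∧
          ∀ F ∈ 𝓕, (#(injCopies F Γ) : ℝ) ≤ ε * (n : ℝ) ^ Fintype.card U := by
  induction 𝓕 using Finset.induction_on with
  | empty =>
    intro _ ε hε
    refine Eventually.of_forall fun n => ⟨{kClauses k n}, ?_, ?_⟩
    · rw [card_singleton, Nat.cast_one]
      exact Real.one_le_rpow (by norm_num) (by positivity)
    · intro G hG _
      exact ⟨_, mem_singleton_self _, hG.subset_kClauses, subset_rfl, by simp⟩
  | insert F 𝓕 _ ih =>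
    intro h ε hε
    obtain ⟨hF1, hF2, hF3⟩ := h F (mem_insert_self _ _)
    filter_upwards [ih (fun F' hF' => h F' (mem_insert_of_mem hF')) (ε / 2) (half_pos hε),
      formula_container_single k hk hkU F hF1 hF2 hF3 (ε / 2) (half_pos hε)] with n h1 h2
    obtain ⟨𝒞₁, h11, h12⟩ := h1
    obtain ⟨𝒞₂, h21, h22⟩ := h2
    refine ⟨(𝒞₁ ×ˢ 𝒞₂).image (fun p => p.1 ∩ p.2), ?_, ?_⟩
    · calc (#((𝒞₁ ×ˢ 𝒞₂).image (fun p => p.1 ∩ p.2)) : ℝ) ≤ (#𝒞₁ : ℝ) * #𝒞₂ := by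
            exact_mod_cast card_image_le.trans (card_product _ _).le
        _ ≤ 2 ^ (ε / 2 * (n : ℝ) ^ k) * 2 ^ (ε / 2 * (n : ℝ) ^ k) := by gcongr
        _ = _ := by
          rw [← Real.rpow_add (by norm_num)]
          congr 1
          ring
    · intro G hG hGm
      obtain ⟨Γ₁, hm1, hG1, hA1, hc1⟩ := h12 G hG hGm
      obtain ⟨Γ₂, hm2, hG2, hA2, hc2⟩ := h22 G hG hGm
      have hmono : ∀ (F : SatFormula U) {Γ Γ' : SatFormula (Fin n)}, Γ ⊆ Γ' →
          ((#(injCopies F Γ') : ℝ) ≤ ε / 2 * (n : ℝ) ^ Fintype.card U) →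
          (#(injCopies F Γ) : ℝ) ≤ ε * (n : ℝ) ^ Fintype.card U := by
        intro F Γ Γ' hsub hc
        have h1 : #(injCopies F Γ) ≤ #(injCopies F Γ') :=
          card_le_card (monotone_filter_right _ fun φ _ hφ => ⟨hφ.1, hφ.2.trans hsub⟩)
        refine (Nat.cast_le.2 h1).trans (hc.trans ?_)
        gcongr
        linarith
      refine ⟨Γ₁ ∩ Γ₂, mem_image.2 ⟨(Γ₁, Γ₂), mem_product.2 ⟨hm1, hm2⟩, rfl⟩,
        subset_inter hG1 hG2, inter_subset_left.trans hA1, fun F' hF' => ?_⟩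
      rcases mem_insert.1 hF' with rfl | hF'
      · exact hmono _ inter_subset_right hc2
      · exact hmono _ inter_subset_left (hc1 F' hF')

/-- The (not necessarily injective) placements of a pattern inside a formula. -/
noncomputable def patternCopies {k n : ℕ} (P : SatFormula (Fin (k + 1))) (Γ : SatFormula (Fin n)) :
    Finset (Fin (k + 1) → Fin n) := univ.filter (fun d => mapFormula d P ⊆ Γ)

theorem card_le_card_injCopies_add {k n : ℕ} {P : SatFormula (Fin (k + 1))}
    {F : SatFormula (Fin (k + 1) × Bool)} {Γ : SatFormula (Fin n)} (hP : IsKFormula k P)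
    (hF : IsKFormula k F) (hFP : mapFormula Prod.fst F ⊆ P)
    (X : Finset ((Fin (k + 1) → Fin n) × (Fin (k + 1) → Fin n)))
    (hX : ∀ p ∈ X, ∀ b : Fin (k + 1) → Bool, (fun i => if b i then p.2 i else p.1 i) ∈
      patternCopies P Γ) :
    #X ≤ #(injCopies F Γ) + (2 * (k + 1)) ^ 2 * n ^ (2 * (k + 1) - 1) := by
  have hninj := card_filter_not_injective_le (U := Fin (k + 1) × Bool) n
  rw [show Fintype.card (Fin (k + 1) × Bool) = 2 * (k + 1) by simp [mul_comm]] at hninj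
  classical
  refine le_trans (card_le_card_of_injOn
    (t := injCopies F Γ ∪ univ.filter (fun φ => ¬ Function.Injective φ))
    (fun p (x : Fin (k + 1) × Bool) => if x.2 then p.2 x.1 else p.1 x.1) ?_ ?_)
    ((card_union_le _ _).trans (Nat.add_le_add_left hninj _))
  · intro p hp
    have hp := hX p hp
    rw [mem_coe, mem_union, mem_filter]
    by_cases hinj : Function.Injective
        (fun x : Fin (k + 1) × Bool => if x.2 then p.2 x.1 else p.1 x.1)
    swap
    · exact Or.inr ⟨mem_univ _, hinj⟩
    refine Or.inl (mem_filter.2 ⟨mem_univ _, hinj, mapFormula_subset_iff.2 fun C hC => ?_⟩)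
    have hCP := mapFormula_subset_iff.1 hFP C hC
    have hfst : Set.InjOn Prod.fst (clauseVars C : Set (Fin (k + 1) × Bool)) := by
      refine card_image_iff.1 ?_
      rw [← clauseVars_mapClause Prod.fst C, (hP _ hCP).2, (hF C hC).2]
    have := mapFormula_subset_iff.1
      (mem_filter.1 (hp (fun i => decide ((i, true) ∈ clauseVars C)))).2 _ hCP
    convert this using 1
    simp only [mapClause, image_image]
    refine image_congr fun l hl => ?_
    have hl' : l.1 ∈ clauseVars C := mem_image_of_mem _ hl
    simp only [Function.comp_def, Prod.mk.injEq, and_true, decide_eq_true_eq]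
    obtain ⟨⟨i, c⟩, s⟩ := l
    simp only at hl' ⊢
    cases c
    · have : (i, true) ∉ clauseVars C := fun h => by
        have := hfst hl' h rfl
        simp at this
      simp [this]
    · simp [hl']
  · intro p _ p' _ he
    have h1 : ∀ i, p.1 i = p'.1 i := fun i => by simpa using congrFun he (i, false)
    have h2 : ∀ i, p.2 i = p'.2 i := fun i => by simpa using congrFun he (i, true)
    exact Prod.ext (funext h1) (funext h2)

open scoped Classical in
theorem exists_dense_boxes_finset (q : ℕ) (γ : ℝ) (hγ : 0 < γ) : ∃ γ' : ℝ, 0 < γ' ∧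
    ∀ {α : Type} [Fintype α] (W : Finset (Fin q → α)), γ * (Fintype.card α : ℝ) ^ q ≤ #W →
      ∃ X : Finset ((Fin q → α) × (Fin q → α)),
        (∀ p ∈ X, ∀ b : Fin q → Bool, (fun i => if b i then p.2 i else p.1 i) ∈ W) ∧
        γ' * (Fintype.card α : ℝ) ^ (2 * q) ≤ #X := by
  obtain ⟨γ', hγ', h⟩ := exists_dense_boxes q γ hγ
  exact ⟨γ', hγ', fun W hW => ⟨_, fun p hp => (mem_filter.1 hp).2, h W hW⟩⟩

/-- Many placements of a pattern yield many copies of each formula in its 2-blowup. -/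
theorem exists_card_injCopies_of_patternCopies (k : ℕ) (γ : ℝ) (hγ : 0 < γ) :
    ∃ ε : ℝ, 0 < ε ∧ ∀ᶠ n : ℕ in atTop, ∀ (P : SatFormula (Fin (k + 1)))
      (F : SatFormula (Fin (k + 1) × Bool)) (Γ : SatFormula (Fin n)), IsKFormula k P →
      IsKFormula k F → mapFormula Prod.fst F ⊆ P → γ * (n : ℝ) ^ (k + 1) ≤ #(patternCopies P Γ) →
      ε * (n : ℝ) ^ (2 * (k + 1)) < #(injCopies F Γ) := by
  obtain ⟨γ', hγ', hbox⟩ := exists_dense_boxes_finset (k + 1) γ hγ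
  obtain ⟨u, hu⟩ : ∃ u, u = 2 * (k + 1) := ⟨_, rfl⟩
  rw [← hu] at hbox ⊢
  refine ⟨γ' / 3, by positivity, ?_⟩
  filter_upwards [eventually_ge_atTop 1, eventually_ge_atTop ⌈3 * (u : ℝ) ^ 2 / γ'⌉₊]
    with n hn hnu P F Γ hP hF hFP hcount
  have hn0 : (0 : ℝ) < n := by exact_mod_cast hn
  have hnu' : 3 * (u : ℝ) ^ 2 ≤ γ' * n := by
    have := Nat.ceil_le.1 hnu
    rwa [div_le_iff₀' hγ'] at this
  obtain ⟨X, hX, hXb⟩ := hbox (patternCopies P Γ) (by rwa [Fintype.card_fin])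
  rw [Fintype.card_fin] at hXb
  have hle := card_le_card_injCopies_add hP hF hFP X hX
  rw [← hu] at hle
  have hle' : γ' * (n : ℝ) ^ u ≤ #(injCopies F Γ) + (u : ℝ) ^ 2 * (n : ℝ) ^ (u - 1) :=
    hXb.trans (by exact_mod_cast hle)
  have hpow : (n : ℝ) ^ u = (n : ℝ) ^ (u - 1) * n := by
    rw [← pow_succ]; congr 1; omega
  have h3 : 3 * ((u : ℝ) ^ 2 * (n : ℝ) ^ (u - 1)) ≤ γ' * (n : ℝ) ^ u := by
    rw [hpow]
    calc 3 * ((u : ℝ) ^ 2 * (n : ℝ) ^ (u - 1)) = (n : ℝ) ^ (u - 1) * (3 * (u : ℝ) ^ 2) := by ring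
      _ ≤ (n : ℝ) ^ (u - 1) * (γ' * n) := by gcongr
      _ = _ := by ring
  have : 0 < γ' * (n : ℝ) ^ u := by positivity
  linarith

open scoped Classical in
/-- Few containers cover all minimal formulae, with few placements of every pattern whose
blowup contains a simple non-minimal formula. -/
theorem formula_containers (k : ℕ) (hk : 1 ≤ k) (γ ε : ℝ) (hγ : 0 < γ) (hε : 0 < ε) :
    ∀ᶠ n : ℕ in atTop, ∃ 𝒞 : Finset (SatFormula (Fin n)), (#𝒞 : ℝ) ≤ 2 ^ (ε * (n : ℝ) ^ k) ∧
      ∀ G : SatFormula (Fin n), IsKFormula k G → MinimalFormula G →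
        ∃ Γ ∈ 𝒞, G ⊆ Γ ∧ Γ ⊆ kClauses k n ∧
          ∀ P, SimpleNonminimalPattern k P →
            (#(patternCopies P Γ) : ℝ) ≤ γ * (n : ℝ) ^ (k + 1) := by
  obtain ⟨ε₁, hε₁, hpat⟩ := exists_card_injCopies_of_patternCopies k γ hγ
  have hcont := formula_container_family (U := Fin (k + 1) × Bool) k hk (by simp; omega)
    (univ.filter (fun F => IsKFormula k F ∧ SimpleFormula F ∧ ¬ MinimalFormula F))
    (fun F hF => (mem_filter.1 hF).2) (min ε ε₁) (by positivity)
  rw [show Fintype.card (Fin (k + 1) × Bool) = 2 * (k + 1) by simp [mul_comm]] at hcont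
  filter_upwards [hcont, hpat] with n h1 h2
  obtain ⟨𝒞, h𝒞1, h𝒞2⟩ := h1
  refine ⟨𝒞, h𝒞1.trans (Real.rpow_le_rpow_of_exponent_le (by norm_num) (by
    gcongr; exact min_le_left _ _)), fun G hG hGm => ?_⟩
  obtain ⟨Γ, hΓ1, hΓ2, hΓ3, hΓ4⟩ := h𝒞2 G hG hGm
  refine ⟨Γ, hΓ1, hΓ2, hΓ3, fun P hP => ?_⟩
  obtain ⟨hPk, F, hF1, hF2, hF3, hF4⟩ := hP
  by_contra hcon
  have := h2 P F Γ hPk hF1 hF4 (not_le.1 hcon).le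
  have h5 := hΓ4 F (mem_filter.2 ⟨mem_univ _, hF1, hF2, hF3⟩)
  have h6 : min ε ε₁ * (n : ℝ) ^ (2 * (k + 1)) ≤
      ε₁ * (n : ℝ) ^ (2 * (k + 1)) := by
    gcongr; exact min_le_right _ _
  linarith

/-- A minimal formula has few placements of every pattern whose blowup contains a non-minimal
formula. -/
theorem card_patternCopies_le_of_minimal (k : ℕ) (γ : ℝ) (hγ : 0 < γ) :
    ∀ᶠ n : ℕ in atTop, ∀ G : SatFormula (Fin n), MinimalFormula G →
      ∀ P, NonminimalPattern k P → (#(patternCopies P G) : ℝ) ≤ γ * (n : ℝ) ^ (k + 1) := by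
  obtain ⟨ε₁, hε₁, hpat⟩ := exists_card_injCopies_of_patternCopies k γ hγ
  filter_upwards [hpat] with n h2 G hG P hP
  obtain ⟨hPk, F, hF1, hF3, hF4⟩ := hP
  by_contra hcon
  have := h2 P F G hPk hF1 hF4 (not_le.1 hcon).le
  have h0 : injCopies F G = ∅ :=
    filter_eq_empty_iff.2 fun φ _ h => hF3 (hG.of_mapFormula_subset h.1 h.2)
  rw [h0, card_empty, Nat.cast_zero] at this
  have : 0 ≤ ε₁ * (n : ℝ) ^ (2 * (k + 1)) := by positivity
  linarith

end FormulaContainers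

/-! ### Counting consequences of sparse patterns -/

section SparsePatterns

/-- A formula with few placements of every pattern whose blowup contains a simple non-minimal
formula. -/
def PatternSparse (k : ℕ) {n : ℕ} (γ : ℝ) (Γ : SatFormula (Fin n)) : Prop :=
  ∀ P, SimpleNonminimalPattern k P → (#(patternCopies P Γ) : ℝ) ≤ γ * (n : ℝ) ^ (k + 1)

variable {k n : ℕ}

theorem mem_patternCopies {P : SatFormula (Fin (k + 1))} {Γ : SatFormula (Fin n)}
    {d : Fin (k + 1) → Fin n} : d ∈ patternCopies P Γ ↔ mapFormula d P ⊆ Γ := by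
  simp [patternCopies]

theorem mem_patternCopies_pair {Γ : SatFormula (Fin n)} {d : Fin (k + 1) → Fin n}
    {z₁ z₂ : Fin n → Bool} {S₁ S₂ : Finset (Fin (k + 1))}
    (h₁ : litClause z₁ (S₁.image d) ∈ Γ) (h₂ : litClause z₂ (S₂.image d) ∈ Γ) :
    d ∈ patternCopies {litClause (z₁ ∘ d) S₁, litClause (z₂ ∘ d) S₂} Γ := by
  rw [mem_patternCopies, mapFormula_subset_iff]
  intro C hC
  simp only [mem_insert, mem_singleton] at hC
  rcases hC with rfl | rfl <;> rw [mapClause_litClause] <;> assumption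

theorem mem_patternCopies_triple {Γ : SatFormula (Fin n)} {d : Fin (k + 1) → Fin n}
    {z₁ z₂ z₃ : Fin n → Bool} {S₁ S₂ S₃ : Finset (Fin (k + 1))}
    (h₁ : litClause z₁ (S₁.image d) ∈ Γ) (h₂ : litClause z₂ (S₂.image d) ∈ Γ)
    (h₃ : litClause z₃ (S₃.image d) ∈ Γ) :
    d ∈ patternCopies {litClause (z₁ ∘ d) S₁, litClause (z₂ ∘ d) S₂, litClause (z₃ ∘ d) S₃} Γ := by
  rw [mem_patternCopies, mapFormula_subset_iff]
  intro C hC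
  simp only [mem_insert, mem_singleton] at hC
  rcases hC with rfl | rfl | rfl <;> rw [mapClause_litClause] <;> assumption

theorem card_le_of_subset_biUnion {ι α : Type*} [DecidableEq α] (I : Finset ι)
    (f : ι → Finset α) (D : Finset α) (M : ℝ) (hD : D ⊆ I.biUnion f)
    (hf : ∀ i ∈ I, (#(f i) : ℝ) ≤ M) : (#D : ℝ) ≤ #I * M := by
  calc (#D : ℝ) ≤ ∑ i ∈ I, (#(f i) : ℝ) := by exact_mod_cast (card_le_card hD).trans card_biUnion_le
    _ ≤ ∑ _i ∈ I, M := sum_le_sum hf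
    _ = _ := by rw [sum_const, nsmul_eq_mul]

open scoped Classical in
theorem card_mul_le_of_pairs (Γ : SatFormula (Fin n)) (M : ℝ) (hM : 0 ≤ M)
    (𝒮 : Finset (Finset (Fin n)))
    (h : ∀ S ∈ 𝒮, #S = k ∧ ∃ z z', litClause z S ∈ Γ ∧ litClause z' S ∈ Γ ∧
      ∀ d : Fin (k + 1) → Fin n, (univ.erase (Fin.last k)).image d = S →
        (#(patternCopies {litClause (z ∘ d) (univ.erase (Fin.last k)),
          litClause (z' ∘ d) (univ.erase (Fin.last k))} Γ) : ℝ) ≤ M) :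
    (#𝒮 : ℝ) * n ≤ 4 ^ (k + 1) * M := by
  have hd : ∀ p : Finset (Fin n) × Fin n, ∃ d : Fin (k + 1) → Fin n, p.1 ∈ 𝒮 →
      (univ.erase (Fin.last k)).image d = p.1 ∧ d (Fin.last k) = p.2 := by
    rintro ⟨S, y⟩
    by_cases hS : S ∈ 𝒮
    · refine ⟨Fin.snoc (S.orderEmbOfFin (h S hS).1) y, fun _ => ⟨?_, by simp⟩⟩
      ext x
      simp only [mem_image, mem_erase, mem_univ, and_true]
      constructor
      · rintro ⟨i, hi, rfl⟩
        obtain ⟨j, rfl⟩ := Fin.exists_castSucc_eq.2 hi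
        simp
      · intro hx
        have : x ∈ Set.range (S.orderEmbOfFin (h S hS).1) := by simpa using hx
        obtain ⟨j, rfl⟩ := this
        exact ⟨j.castSucc, Fin.castSucc_ne_last j, by simp⟩
    · exact ⟨fun _ => y, fun h => absurd h hS⟩
  choose d hd using hd
  let f : (Fin (k + 1) → Bool) × (Fin (k + 1) → Bool) → Finset (Fin (k + 1) → Fin n) := fun p =>
    patternCopies {litClause p.1 (univ.erase (Fin.last k)),
          litClause p.2 (univ.erase (Fin.last k))} Γ
  have h1 : #(𝒮 ×ˢ (univ : Finset (Fin n))) ≤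
      #((univ.filter (fun p => (#(f p) : ℝ) ≤ M)).biUnion f) := by
    refine card_le_card_of_injOn d ?_ ?_
    · rintro ⟨S, y⟩ hp
      have hS : S ∈ 𝒮 := (mem_product.1 hp).1
      obtain ⟨hdS, hdy⟩ := hd (S, y) hS
      obtain ⟨hk, z, z', hz, hz', hc⟩ := h S hS
      rw [mem_coe, mem_biUnion]
      refine ⟨(z ∘ d (S, y), z' ∘ d (S, y)), mem_filter.2 ⟨mem_univ _, hc _ hdS⟩,
        mem_patternCopies_pair ?_ ?_⟩ <;> rwa [hdS]
    · rintro ⟨S, y⟩ hp ⟨S', y'⟩ hp' he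
      obtain ⟨h1, h2⟩ := hd (S, y) (mem_product.1 hp).1
      obtain ⟨h3, h4⟩ := hd (S', y') (mem_product.1 hp').1
      rw [he] at h1 h2
      exact Prod.ext (h1.symm.trans h3) (h2.symm.trans h4)
  rw [card_product, card_univ, Fintype.card_fin] at h1
  calc (#𝒮 : ℝ) * n ≤ #((univ.filter (fun p => (#(f p) : ℝ) ≤ M)).biUnion f) := by
        exact_mod_cast h1
    _ ≤ #(univ.filter (fun p => (#(f p) : ℝ) ≤ M)) * M :=
        card_le_of_subset_biUnion _ f _ M subset_rfl fun p hp => (mem_filter.1 hp).2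
    _ ≤ 4 ^ (k + 1) * M := by
        gcongr
        have : #(univ.filter (fun p => (#(f p) : ℝ) ≤ M)) ≤ 2 ^ (k + 1) * 2 ^ (k + 1) :=
          (card_filter_le _ _).trans (by simp)
        rw [← mul_pow] at this
        exact_mod_cast this

open scoped Classical in
theorem card_triples_le {γ : ℝ} {Γ : SatFormula (Fin n)} (hγ : 0 ≤ γ) (hΓ : PatternSparse k γ Γ)
    {x₁ x₂ x₃ : Fin (k + 1)} (h₁₂ : x₁ ≠ x₂) (h₁₃ : x₁ ≠ x₃) (h₂₃ : x₂ ≠ x₃)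
    (D : Finset (Fin (k + 1) → Fin n))
    (hD : ∀ d ∈ D, ∃ z₁ z₂ z₃ : Fin n → Bool, litClause z₁ ((univ.erase x₁).image d) ∈ Γ ∧
      litClause z₂ ((univ.erase x₂).image d) ∈ Γ ∧ litClause z₃ ((univ.erase x₃).image d) ∈ Γ ∧
      z₂ (d x₁) ≠ z₃ (d x₁)) :
    (#D : ℝ) ≤ 8 ^ (k + 1) * (γ * (n : ℝ) ^ (k + 1)) := by
  let f : (Fin (k + 1) → Bool) × (Fin (k + 1) → Bool) × (Fin (k + 1) → Bool) →
      Finset (Fin (k + 1) → Fin n) := fun p =>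
    patternCopies {litClause p.1 (univ.erase x₁), litClause p.2.1 (univ.erase x₂),
      litClause p.2.2 (univ.erase x₃)} Γ
  have h1 : D ⊆ (univ.filter (fun p : (Fin (k + 1) → Bool) × (Fin (k + 1) → Bool) ×
      (Fin (k + 1) → Bool) => p.2.1 x₁ ≠ p.2.2 x₁)).biUnion f := by
    intro d hd
    obtain ⟨z₁, z₂, z₃, m₁, m₂, m₃, hne⟩ := hD d hd
    rw [mem_biUnion]
    exact ⟨(z₁ ∘ d, z₂ ∘ d, z₃ ∘ d), mem_filter.2 ⟨mem_univ _, hne⟩,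
      mem_patternCopies_triple m₁ m₂ m₃⟩
  refine (card_le_of_subset_biUnion _ f D _ h1 fun p hp => hΓ _
    (simpleNonminimalPattern_triple _ _ _ h₁₂ h₁₃ h₂₃ (mem_filter.1 hp).2)).trans ?_
  gcongr
  have : #(univ.filter (fun p : (Fin (k + 1) → Bool) × (Fin (k + 1) → Bool) ×
      (Fin (k + 1) → Bool) => p.2.1 x₁ ≠ p.2.2 x₁)) ≤ 2 ^ (k + 1) * (2 ^ (k + 1) * 2 ^ (k + 1)) :=
    (card_filter_le _ _).trans (by simp)
  rw [← mul_pow, ← mul_pow] at this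
  exact_mod_cast this

/-- Two clauses of `Γ` on the variable set `S` differ on at least two variables. -/
def BadSet (Γ : SatFormula (Fin n)) (S : Finset (Fin n)) : Prop :=
  ∃ z z' : Fin n → Bool, litClause z S ∈ Γ ∧ litClause z' S ∈ Γ ∧
    ∃ x ∈ S, ∃ y ∈ S, x ≠ y ∧ z x ≠ z' x ∧ z y ≠ z' y

open scoped Classical in
theorem card_badSets_mul_le {γ : ℝ} {Γ : SatFormula (Fin n)} (hγ : 0 ≤ γ)
    (hΓ : PatternSparse k γ Γ) :
    (#((univ.powersetCard k).filter (BadSet Γ)) : ℝ) * n ≤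
      4 ^ (k + 1) * (γ * (n : ℝ) ^ (k + 1)) := by
  refine card_mul_le_of_pairs (k := k) Γ _ (by positivity) _ fun S hS => ?_
  obtain ⟨hS, z, z', hz, hz', x, hx, y, hy, hxy, h1, h2⟩ := mem_filter.1 hS
  refine ⟨(mem_powersetCard.1 hS).2, z, z', hz, hz', fun d hd => hΓ _ ?_⟩
  rw [← hd] at hx hy
  obtain ⟨i, hi, rfl⟩ := mem_image.1 hx
  obtain ⟨j, hj, rfl⟩ := mem_image.1 hy
  refine simpleNonminimalPattern_pair _ _ _ ?_ hi hj (fun h => hxy (by rw [h])) h1 h2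
  rw [card_erase_of_mem (mem_univ _)]
  simp

open scoped Classical in
/-- In a minimal formula few variable sets support two clauses. -/
theorem card_doubleSets_mul_le {γ : ℝ} {G : SatFormula (Fin n)} (hγ : 0 ≤ γ)
    (hG : ∀ P, NonminimalPattern k P → (#(patternCopies P G) : ℝ) ≤ γ * (n : ℝ) ^ (k + 1)) :
    (#((univ.powersetCard k).filter (fun S => ∃ z z' : Fin n → Bool, litClause z S ∈ G ∧
      litClause z' S ∈ G ∧ ∃ x ∈ S, z x ≠ z' x)) : ℝ) * n ≤
      4 ^ (k + 1) * (γ * (n : ℝ) ^ (k + 1)) := by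
  refine card_mul_le_of_pairs (k := k) G _ (by positivity) _ fun S hS => ?_
  obtain ⟨hS, z, z', hz, hz', x, hx, h1⟩ := mem_filter.1 hS
  refine ⟨(mem_powersetCard.1 hS).2, z, z', hz, hz', fun d hd => hG _ ?_⟩
  rw [← hd] at hx
  obtain ⟨i, hi, rfl⟩ := mem_image.1 hx
  refine nonminimalPattern_pair _ _ _ ?_ hi h1
  rw [card_erase_of_mem (mem_univ _)]
  simp

end SparsePatterns

/-! ### Supersaturation for partially directed graphs -/

section Averaging

theorem exists_perm_image_eq {α : Type*} [Fintype α] [DecidableEq α] {S S' : Finset α}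
    (h : #S = #S') : ∃ σ : Equiv.Perm α, S.image σ = S' := by
  refine ⟨(Finset.equivOfCardEq h).extendSubtype, eq_of_subset_of_card_le ?_ ?_⟩
  · intro y hy
    obtain ⟨x, hx, rfl⟩ := mem_image.1 hy
    exact Equiv.extendSubtype_mem _ x hx
  · rw [card_image_of_injective _ (Equiv.injective _), h]

open scoped Classical in
/-- The image of a fixed set under a random injection is uniformly distributed. -/
theorem sum_injective_image {k m n : ℕ} (f : Finset (Fin n) → ℝ) (e : Finset (Fin m))
    (he : #e = k) :
    (n.choose k : ℝ) * ∑ ψ ∈ (univ : Finset (Fin m → Fin n)).filter Function.Injective,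
      f (e.image ψ) = (#((univ : Finset (Fin m → Fin n)).filter Function.Injective) : ℝ) *
      ∑ S ∈ univ.powersetCard k, f S := by
  set I := (univ : Finset (Fin m → Fin n)).filter Function.Injective with hI
  have hmaps : ∀ ψ ∈ I, e.image ψ ∈ (univ : Finset (Fin n)).powersetCard k := fun ψ hψ =>
    mem_powersetCard.2 ⟨subset_univ _, by
      rw [card_image_of_injective _ (mem_filter.1 hψ).2, he]⟩
  let B : Finset (Fin n) → ℕ := fun S => #(I.filter (fun ψ => e.image ψ = S))
  have hB : ∀ S S' : Finset (Fin n), #S = #S' → B S ≤ B S' := by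
    intro S S' h
    obtain ⟨σ, hσ⟩ := exists_perm_image_eq h
    refine card_le_card_of_injOn (fun ψ => σ ∘ ψ) ?_ ?_
    · intro ψ hψ
      obtain ⟨h1, h2⟩ := mem_filter.1 hψ
      refine mem_filter.2 ⟨mem_filter.2 ⟨mem_univ _, σ.injective.comp (mem_filter.1 h1).2⟩, ?_⟩
      rw [← image_image, h2, hσ]
    · intro ψ _ ψ' _ h
      funext x
      exact σ.injective (congrFun h x)
  have h1 : ∑ ψ ∈ I, f (e.image ψ) = ∑ S ∈ univ.powersetCard k, (B S : ℝ) * f S := by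
    rw [← sum_fiberwise_of_maps_to hmaps]
    refine sum_congr rfl fun S _ => ?_
    rw [← nsmul_eq_mul, ← sum_const]
    exact sum_congr rfl fun ψ hψ => by rw [(mem_filter.1 hψ).2]
  have h2 : (#I : ℝ) = ∑ S ∈ (univ : Finset (Fin n)).powersetCard k, (B S : ℝ) := by
    exact_mod_cast card_eq_sum_card_fiberwise hmaps
  rcases ((univ : Finset (Fin n)).powersetCard k).eq_empty_or_nonempty with h0 | ⟨S₀, h₀⟩
  · rw [h1, h0]; simp
  · have hBS : ∀ S ∈ (univ : Finset (Fin n)).powersetCard k, (B S : ℝ) = B S₀ := by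
      intro S hS
      have : #S = #S₀ := (mem_powersetCard.1 hS).2.trans (mem_powersetCard.1 h₀).2.symm
      exact_mod_cast le_antisymm (hB _ _ this) (hB _ _ this.symm)
    rw [h1, h2, sum_congr rfl hBS, sum_congr rfl fun S hS => by rw [hBS S hS], ← mul_sum,
      sum_const, card_powersetCard, card_univ, Fintype.card_fin, nsmul_eq_mul]
    ring

open scoped Classical in
theorem card_filter_comp_mem_le {q m n : ℕ} (φ : Fin q → Fin m) (hφ : Function.Injective φ)
    (D : Finset (Fin q → Fin n)) :
    #((univ : Finset (Fin m → Fin n)).filter (fun ψ => ψ ∘ φ ∈ D)) ≤ #D * n ^ (m - q) := by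
  have hcard : #(univ : Finset ({u : Fin m // u ∉ Set.range φ} → Fin n)) = n ^ (m - q) := by
    rw [card_univ, Fintype.card_fun, Fintype.card_fin]
    congr 1
    rw [Fintype.card_subtype_compl, Fintype.card_fin]
    congr 1
    exact (Set.card_range_of_injective hφ).trans (Fintype.card_fin _)
  rw [← hcard, ← card_product]
  refine card_le_card_of_injOn (fun ψ => (ψ ∘ φ, fun u => ψ u.1)) ?_ ?_
  · intro ψ hψ
    exact mem_product.2 ⟨(mem_filter.1 hψ).2, mem_univ _⟩
  · intro ψ _ ψ' _ h
    obtain ⟨h1, h2⟩ := Prod.mk.inj h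
    funext u
    by_cases hu : u ∈ Set.range φ
    · obtain ⟨i, rfl⟩ := hu
      exact congrFun h1 i
    · exact congrFun h2 ⟨u, hu⟩

end Averaging

section Supersaturation

/-- `d` places `T_k` inside `H`. -/
def PDG.TkAt {k n : ℕ} (H : PDG (Fin n)) (d : Fin (k + 1) → Fin n) : Prop :=
  Function.Injective d ∧
    (∀ e ∈ (TkPDG k).undir, e.image d ∈ H.undir ∨ ∃ v, (e.image d, v) ∈ H.dir) ∧
    (∀ p ∈ (TkPDG k).dir, (p.1.image d, d p.2) ∈ H.dir)

open scoped Classical in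
/-- The pullback of a partially directed graph. -/
noncomputable def PDG.comap {m n : ℕ} (ψ : Fin m → Fin n) (H : PDG (Fin n)) : PDG (Fin m) where
  undir := univ.filter (fun e => e.image ψ ∈ H.undir)
  dir := univ.filter (fun p => (p.1.image ψ, ψ p.2) ∈ H.dir)

open scoped Classical in
/-- The weight of a set of vertices. -/
noncomputable def PDG.weight {n : ℕ} (θ : ℝ) (H : PDG (Fin n)) (S : Finset (Fin n)) : ℝ :=
  (if S ∈ H.undir then 1 else 0) + θ * #(univ.filter (fun v => (S, v) ∈ H.dir))

variable {k m n : ℕ}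

theorem PDG.mem_undir_comap {ψ : Fin m → Fin n} {H : PDG (Fin n)} {e : Finset (Fin m)} :
    e ∈ (H.comap ψ).undir ↔ e.image ψ ∈ H.undir := by
  simp [PDG.comap]

theorem PDG.mem_dir_comap {ψ : Fin m → Fin n} {H : PDG (Fin n)} {p : Finset (Fin m) × Fin m} :
    p ∈ (H.comap ψ).dir ↔ (p.1.image ψ, ψ p.2) ∈ H.dir := by
  simp [PDG.comap]

theorem PDG.IsValid.comap {ψ : Fin m → Fin n} (hψ : Function.Injective ψ) {H : PDG (Fin n)}
    (hH : H.IsValid k) : (H.comap ψ).IsValid k := by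
  obtain ⟨h1, h2, h3, h4⟩ := hH
  simp only [PDG.IsValid, PDG.mem_undir_comap, PDG.mem_dir_comap]
  refine ⟨fun e he => ?_, fun p hp => ?_, fun p hp => h3 _ hp, fun p hp q hq h => ?_⟩
  · rw [← h1 _ he, card_image_of_injective _ hψ]
  · obtain ⟨h5, h6⟩ := h2 _ hp
    refine ⟨by rw [← h5, card_image_of_injective _ hψ], ?_⟩
    obtain ⟨u, hu, he⟩ := mem_image.1 h6
    rwa [← hψ he]
  · have := h4 _ hp _ hq (by rw [h])
    exact Prod.ext h (hψ (Prod.mk.inj this).2)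

theorem PDG.weight_comap {ψ : Fin m → Fin n} (hψ : Function.Injective ψ) {H : PDG (Fin n)}
    (hH : H.IsValid k) (θ : ℝ) (e : Finset (Fin m)) :
    (H.comap ψ).weight θ e = H.weight θ (e.image ψ) := by
  have : #(univ.filter (fun v => (e, v) ∈ (H.comap ψ).dir)) =
      #(univ.filter (fun v => (e.image ψ, v) ∈ H.dir)) := by
    rw [← card_image_of_injective _ hψ]
    congr 1
    ext v
    simp only [mem_image, mem_filter, mem_univ, true_and, PDG.mem_dir_comap]
    constructor
    · rintro ⟨u, hu, rfl⟩
      exact hu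
    · intro hv
      obtain ⟨u, _, rfl⟩ := mem_image.1 (hH.2.1 _ hv).2
      exact ⟨u, hv, rfl⟩
  simp only [PDG.weight, PDG.mem_undir_comap, this]

theorem PDG.IsValid.sum_weight {H : PDG (Fin n)} (hH : H.IsValid k) (θ : ℝ) :
    ∑ S ∈ univ.powersetCard k, H.weight θ S = (#H.undir : ℝ) + θ * #H.dir := by
  classical
  simp only [PDG.weight, sum_add_distrib, ← mul_sum]
  congr 1
  · rw [← sum_filter, sum_const, nsmul_eq_mul, mul_one]
    congr 2
    ext S
    simp only [mem_filter, mem_powersetCard, subset_univ, true_and]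
    exact ⟨fun h => h.2, fun h => ⟨hH.1 _ h, h⟩⟩
  · congr 1
    have hmaps : ∀ p ∈ H.dir, p.1 ∈ (univ : Finset (Fin n)).powersetCard k := fun p hp =>
      mem_powersetCard.2 ⟨subset_univ _, (hH.2.1 p hp).1⟩
    rw [card_eq_sum_card_fiberwise hmaps]
    push_cast
    refine sum_congr rfl fun S _ => ?_
    congr 1
    refine card_bij (fun v _ => (S, v)) ?_ ?_ ?_
    · intro v hv
      exact mem_filter.2 ⟨(mem_filter.1 hv).2, rfl⟩
    · intro v _ v' _ h
      exact (Prod.mk.inj h).2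
    · rintro ⟨S', v⟩ hp
      obtain ⟨h1, h2⟩ := mem_filter.1 hp
      simp only at h2
      subst h2
      exact ⟨v, mem_filter.2 ⟨mem_univ _, h1⟩, rfl⟩

theorem PDG.IsValid.weight_le {H : PDG (Fin n)} (hH : H.IsValid k) {θ : ℝ} (hθ : 1 ≤ θ)
    (S : Finset (Fin n)) : H.weight θ S ≤ θ := by
  classical
  have h1 : #(univ.filter (fun v => (S, v) ∈ H.dir)) ≤ 1 :=
    card_le_one.2 fun v hv v' hv' =>
      (Prod.mk.inj (hH.2.2.2 _ (mem_filter.1 hv).2 _ (mem_filter.1 hv').2 rfl)).2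
  rw [PDG.weight]
  split_ifs with h
  · have : univ.filter (fun v => (S, v) ∈ H.dir) = ∅ :=
      filter_eq_empty_iff.2 fun v _ hv => hH.2.2.1 _ hv h
    rw [this]
    simpa using hθ
  · have h2 : (#(univ.filter (fun v => (S, v) ∈ H.dir)) : ℝ) ≤ 1 := by exact_mod_cast h1
    nlinarith

open scoped Classical in
theorem turan_supersaturation (k : ℕ) (θ : ℝ) (hθ : 1 ≤ θ)
    (hturan : ∀ ε : ℝ, 0 < ε → ∃ n₀ : ℕ, ∀ n ≥ n₀, ∀ H : PDG (Fin n),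
      H.IsValid k → ¬ (TkPDG k).IsSubgraph H →
      (H.undir.card : ℝ) + θ * H.dir.card ≤ (1 + ε) * n.choose k)
    (ε : ℝ) (hε : 0 < ε) : ∃ ρ : ℝ, 0 < ρ ∧ ∀ᶠ n : ℕ in atTop, ∀ H : PDG (Fin n), H.IsValid k →
      (#(univ.filter (fun d : Fin (k + 1) → Fin n => H.TkAt d)) : ℝ) ≤ ρ * (n : ℝ) ^ (k + 1) →
      (#H.undir : ℝ) + θ * #H.dir ≤ (1 + ε) * n.choose k := by
  obtain ⟨n₀, hn₀⟩ := hturan (ε / 2) (half_pos hε)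
  obtain ⟨m, hm1, hm2⟩ : ∃ m, n₀ ≤ m ∧ k + 1 ≤ m := ⟨max n₀ (k + 1), le_max_left _ _, le_max_right _ _⟩
  have hm0 : (0 : ℝ) < m := by exact_mod_cast (by omega : 0 < m)
  have hθ0 : 0 < θ := by linarith
  refine ⟨ε / (4 * θ * (m : ℝ) ^ (k + 1)), by positivity, ?_⟩
  filter_upwards [eventually_ge_atTop (2 * m ^ 2), eventually_ge_atTop 1] with n hn hn1 H hH hD
  have hn0 : (0 : ℝ) < n := by exact_mod_cast hn1
  set I := (univ : Finset (Fin m → Fin n)).filter Function.Injective with hI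
  set D := univ.filter (fun d : Fin (k + 1) → Fin n => H.TkAt d) with hDdef
  set Bd := (univ : Finset (Fin m → Fin n)).filter
    (fun ψ => ∃ φ : Fin (k + 1) → Fin m, Function.Injective φ ∧ ψ ∘ φ ∈ D) with hBd
  obtain ⟨Cm, hCm⟩ : ∃ Cm : ℝ, Cm = ((m.choose k : ℕ) : ℝ) := ⟨_, rfl⟩
  have hCm0 : 0 < Cm := by
    rw [hCm]; exact_mod_cast Nat.choose_pos (by omega)
  have hIcard : (n : ℝ) ^ m ≤ 2 * #I := by
    have h1 := card_filter_not_injective_le (U := Fin m) n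
    rw [Fintype.card_fin] at h1
    have h2 := card_filter_add_card_filter_not (s := (univ : Finset (Fin m → Fin n)))
      (Function.Injective)
    rw [card_univ, Fintype.card_fun, Fintype.card_fin, Fintype.card_fin] at h2
    have h3 : 2 * (m ^ 2 * n ^ (m - 1)) ≤ n ^ m := by
      calc 2 * (m ^ 2 * n ^ (m - 1)) = n ^ (m - 1) * (2 * m ^ 2) := by ring
        _ ≤ n ^ (m - 1) * n := by gcongr
        _ = n ^ m := by rw [← pow_succ]; congr 1; omega
    have h4 : n ^ m ≤ 2 * #I := by rw [hI]; omega
    exact_mod_cast h4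
  have hBdcard : (#Bd : ℝ) ≤ (m : ℝ) ^ (k + 1) * (#D * (n : ℝ) ^ (m - (k + 1))) := by
    have h1 : Bd ⊆ (univ.filter (fun φ : Fin (k + 1) → Fin m => Function.Injective φ)).biUnion
        (fun φ => univ.filter (fun ψ : Fin m → Fin n => ψ ∘ φ ∈ D)) := by
      intro ψ hψ
      obtain ⟨φ, hφ, h⟩ := (mem_filter.1 hψ).2
      exact mem_biUnion.2 ⟨φ, mem_filter.2 ⟨mem_univ _, hφ⟩, mem_filter.2 ⟨mem_univ _, h⟩⟩
    refine (card_le_of_subset_biUnion _ _ _ (#D * (n : ℝ) ^ (m - (k + 1))) h1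
      fun φ hφ => ?_).trans ?_
    · exact_mod_cast card_filter_comp_mem_le φ (mem_filter.1 hφ).2 D
    · gcongr
      have : #(univ.filter (fun φ : Fin (k + 1) → Fin m => Function.Injective φ)) ≤ m ^ (k + 1) :=
        (card_filter_le _ _).trans (by simp)
      exact_mod_cast this
  have hBd2 : θ * #Bd ≤ ε / 2 * #I := by
    have e1 : (n : ℝ) ^ m = (n : ℝ) ^ (k + 1) * (n : ℝ) ^ (m - (k + 1)) := by
      rw [← pow_add]; congr 1; omega
    calc θ * #Bd ≤ θ * ((m : ℝ) ^ (k + 1) * (ε / (4 * θ * (m : ℝ) ^ (k + 1)) * (n : ℝ) ^ (k + 1) *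
          (n : ℝ) ^ (m - (k + 1)))) := by
          gcongr
          exact hBdcard.trans (by gcongr)
      _ = ε / 4 * (n : ℝ) ^ m := by rw [e1]; field_simp
      _ ≤ ε / 4 * (2 * #I) := by gcongr
      _ = _ := by ring
  have hψ : ∀ ψ ∈ I, ∑ e ∈ univ.powersetCard k, H.weight θ (e.image ψ) ≤
      (1 + ε / 2) * Cm + (if ψ ∈ Bd then θ * Cm else 0) := by
    intro ψ hψ
    have hinj : Function.Injective ψ := (mem_filter.1 hψ).2
    split_ifs with hb
    · have : ∑ e ∈ (univ : Finset (Fin m)).powersetCard k, H.weight θ (e.image ψ) ≤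
          ∑ e ∈ (univ : Finset (Fin m)).powersetCard k, θ := sum_le_sum fun e _ => hH.weight_le hθ _
      rw [sum_const, card_powersetCard, card_univ, Fintype.card_fin, nsmul_eq_mul] at this
      nlinarith
    · rw [add_zero, ← sum_congr rfl fun e _ => PDG.weight_comap hinj hH θ e,
        (hH.comap hinj).sum_weight, hCm]
      refine hn₀ m hm1 _ (hH.comap hinj) ?_
      rintro ⟨φ, hφ, h1, h2⟩
      refine hb (mem_filter.2 ⟨mem_univ _, φ, hφ, mem_filter.2 ⟨mem_univ _, hinj.comp hφ, ?_, ?_⟩⟩)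
      · intro e he
        rcases h1 e he with h | ⟨v, h⟩
        · rw [PDG.mem_undir_comap, image_image] at h
          exact Or.inl h
        · rw [PDG.mem_dir_comap] at h
          simp only [image_image] at h
          exact Or.inr ⟨_, h⟩
      · intro p hp
        have h := h2 p hp
        rw [PDG.mem_dir_comap] at h
        simp only [image_image] at h
        exact h
  have hsum : (n.choose k : ℝ) * ∑ ψ ∈ I, ∑ e ∈ univ.powersetCard k, H.weight θ (e.image ψ) =
      Cm * (#I * ((#H.undir : ℝ) + θ * #H.dir)) := by
    rw [sum_comm, mul_sum, ← hH.sum_weight, sum_congr rfl fun e he => sum_injective_image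
      (H.weight θ) e (mem_powersetCard.1 he).2, sum_const, card_powersetCard, card_univ,
      Fintype.card_fin, nsmul_eq_mul, hCm]
  have hsum2 : ∑ ψ ∈ I, ∑ e ∈ univ.powersetCard k, H.weight θ (e.image ψ) ≤
      #I * ((1 + ε) * Cm) := by
    refine (sum_le_sum hψ).trans ?_
    rw [sum_add_distrib, sum_const, nsmul_eq_mul, ← sum_filter, sum_const, nsmul_eq_mul]
    have : (#(I.filter (fun ψ => ψ ∈ Bd)) : ℝ) ≤ #Bd := by
      exact_mod_cast card_le_card fun ψ h => (mem_filter.1 h).2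
    calc _ ≤ (#I : ℝ) * ((1 + ε / 2) * Cm) + #Bd * (θ * Cm) := by gcongr
      _ = (#I : ℝ) * ((1 + ε / 2) * Cm) + θ * #Bd * Cm := by ring
      _ ≤ (#I : ℝ) * ((1 + ε / 2) * Cm) + ε / 2 * #I * Cm := by gcongr
      _ = _ := by ring
  have hI0 : (0 : ℝ) < #I := by
    have : (0 : ℝ) < (n : ℝ) ^ m := by positivity
    linarith
  have hCn : (0 : ℝ) ≤ n.choose k := by positivity
  have hfin := mul_le_mul_of_nonneg_left hsum2 hCn
  rw [hsum] at hfin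
  refine le_of_mul_le_mul_left ?_ (mul_pos hCm0 hI0)
  calc _ = Cm * (#I * ((#H.undir : ℝ) + θ * #H.dir)) := by ring
    _ ≤ _ := hfin
    _ = _ := by ring

end Supersaturation

/-! ### The type of a formula with sparse patterns -/

section TypeGraph

variable {k n : ℕ}

/-- `Γ` has exactly one clause on the variable set `S`. -/
def SingleSet (Γ : SatFormula (Fin n)) (S : Finset (Fin n)) : Prop :=
  ∃ z : Fin n → Bool, litClause z S ∈ Γ ∧ ∀ z', litClause z' S ∈ Γ → ∀ x ∈ S, z' x = z x

/-- Two clauses of `Γ` on the variable set `S` differ at `v`. -/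
def DirAt (Γ : SatFormula (Fin n)) (S : Finset (Fin n)) (v : Fin n) : Prop :=
  v ∈ S ∧ ∃ z z' : Fin n → Bool, litClause z S ∈ Γ ∧ litClause z' S ∈ Γ ∧ z v ≠ z' v

open scoped Classical in
/-- The partially directed graph recording the variable sets with one clause and with two
clauses. -/
noncomputable def typeGraph (k : ℕ) (Γ : SatFormula (Fin n)) : PDG (Fin n) where
  undir := (univ.powersetCard k).filter (SingleSet Γ)
  dir := univ.filter (fun p => #p.1 = k ∧ ¬ BadSet Γ p.1 ∧ DirAt Γ p.1 p.2)

theorem mem_undir_typeGraph {Γ : SatFormula (Fin n)} {S : Finset (Fin n)} :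
    S ∈ (typeGraph k Γ).undir ↔ #S = k ∧ SingleSet Γ S := by
  simp [typeGraph]

theorem mem_dir_typeGraph {Γ : SatFormula (Fin n)} {p : Finset (Fin n) × Fin n} :
    p ∈ (typeGraph k Γ).dir ↔ #p.1 = k ∧ ¬ BadSet Γ p.1 ∧ DirAt Γ p.1 p.2 := by
  simp [typeGraph]

theorem DirAt.eq_of_not_badSet {Γ : SatFormula (Fin n)} {S : Finset (Fin n)} {v v' : Fin n}
    (hS : ¬ BadSet Γ S) (h : DirAt Γ S v) (h' : DirAt Γ S v') : v = v' := by
  by_contra hne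
  obtain ⟨hv, z, z', hz, hz', hd⟩ := h
  obtain ⟨hv', y, y', hy, hy', hd'⟩ := h'
  have key : ∀ {a b : Fin n → Bool}, litClause a S ∈ Γ → litClause b S ∈ Γ →
      a v ≠ b v → a v' = b v' := by
    intro a b ha hb hab
    by_contra hab'
    exact hS ⟨a, b, ha, hb, v, hv, v', hv', hne, hab, hab'⟩
  have hyy : y v = y' v := by
    by_contra h
    exact hd' (key hy hy' h)
  obtain ⟨w, hw, hwy⟩ : ∃ w, litClause w S ∈ Γ ∧ w v ≠ y v := by
    by_cases h : z v = y v
    · exact ⟨z', hz', fun h' => hd (h.trans h'.symm)⟩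
    · exact ⟨z, hz, h⟩
  exact hd' ((key hw hy hwy).symm.trans (key hw hy' (hyy ▸ hwy)))

theorem isValid_typeGraph (k : ℕ) (Γ : SatFormula (Fin n)) : (typeGraph k Γ).IsValid k := by
  refine ⟨fun e he => (mem_undir_typeGraph.1 he).1, fun p hp => ?_, fun p hp hp' => ?_,
    fun p hp q hq h => ?_⟩
  · obtain ⟨h1, _, h3⟩ := mem_dir_typeGraph.1 hp
    exact ⟨h1, h3.1⟩
  · obtain ⟨_, _, hv, z, z', hz, hz', hd⟩ := mem_dir_typeGraph.1 hp
    obtain ⟨_, y, _, hy⟩ := mem_undir_typeGraph.1 hp'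
    exact hd ((hy z hz _ hv).trans (hy z' hz' _ hv).symm)
  · obtain ⟨_, hb, h1⟩ := mem_dir_typeGraph.1 hp
    obtain ⟨_, _, h2⟩ := mem_dir_typeGraph.1 hq
    rw [← h] at h2
    exact Prod.ext h (h1.eq_of_not_badSet hb h2)

theorem exists_litClause_of_mem_typeGraph {Γ : SatFormula (Fin n)} {S : Finset (Fin n)}
    (h : S ∈ (typeGraph k Γ).undir ∨ ∃ v, (S, v) ∈ (typeGraph k Γ).dir) :
    ∃ z : Fin n → Bool, litClause z S ∈ Γ := by
  rcases h with h | ⟨v, h⟩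
  · obtain ⟨_, z, hz, _⟩ := mem_undir_typeGraph.1 h
    exact ⟨z, hz⟩
  · obtain ⟨_, _, _, z, _, hz, _⟩ := mem_dir_typeGraph.1 h
    exact ⟨z, hz⟩

open scoped Classical in
theorem card_tkAt_typeGraph_le (hk : 2 ≤ k) {γ : ℝ} {Γ : SatFormula (Fin n)} (hγ : 0 ≤ γ)
    (hΓ : PatternSparse k γ Γ) :
    (#(univ.filter (fun d : Fin (k + 1) → Fin n => (typeGraph k Γ).TkAt d)) : ℝ) ≤
      8 ^ (k + 1) * (γ * (n : ℝ) ^ (k + 1)) := by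
  refine card_triples_le hγ hΓ (x₁ := ⟨k, Nat.lt_succ_self k⟩) (x₂ := ⟨k - 2, by omega⟩)
    (x₃ := ⟨k - 1, by omega⟩) ?_ ?_ ?_ _ fun d hd => ?_
  · simp only [ne_eq, Fin.mk.injEq]; omega
  · simp only [ne_eq, Fin.mk.injEq]; omega
  · simp only [ne_eq, Fin.mk.injEq]; omega
  · obtain ⟨-, h1, h2⟩ := (mem_filter.1 hd).2
    obtain ⟨z₁, hz₁⟩ := exists_litClause_of_mem_typeGraph
      (h1 (univ.erase ⟨k, Nat.lt_succ_self k⟩) (by simp [TkPDG]))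
    obtain ⟨z₂, hz₂⟩ := exists_litClause_of_mem_typeGraph
      (h1 (univ.erase ⟨k - 2, by omega⟩) (by simp [TkPDG]))
    obtain ⟨_, _, _, z, z', hz, hz', hne⟩ := mem_dir_typeGraph.1
      (h2 (univ.erase ⟨k - 1, by omega⟩, ⟨k, Nat.lt_succ_self k⟩) (by simp [TkPDG]))
    by_cases h : z₂ (d ⟨k, Nat.lt_succ_self k⟩) = z (d ⟨k, Nat.lt_succ_self k⟩)
    · exact ⟨z₁, z₂, z', hz₁, hz₂, hz', fun h' => hne (h.symm.trans h')⟩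
    · exact ⟨z₁, z₂, z, hz₁, hz₂, hz, h⟩

theorem typeGraph_weight_le (k : ℕ) (hk : 2 ≤ k) (θ : ℝ) (hθ : 1 ≤ θ)
    (hturan : ∀ ε : ℝ, 0 < ε → ∃ n₀ : ℕ, ∀ n ≥ n₀, ∀ H : PDG (Fin n),
      H.IsValid k → ¬ (TkPDG k).IsSubgraph H →
      (H.undir.card : ℝ) + θ * H.dir.card ≤ (1 + ε) * n.choose k)
    (ε : ℝ) (hε : 0 < ε) : ∃ γ : ℝ, 0 < γ ∧ ∀ᶠ n : ℕ in atTop, ∀ Γ : SatFormula (Fin n),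
      PatternSparse k γ Γ →
      (#(typeGraph k Γ).undir : ℝ) + θ * #(typeGraph k Γ).dir ≤ (1 + ε) * n.choose k := by
  classical
  obtain ⟨ρ, hρ, h⟩ := turan_supersaturation k θ hθ hturan ε hε
  refine ⟨ρ / 8 ^ (k + 1), by positivity, ?_⟩
  filter_upwards [h] with n hn Γ hΓ
  refine hn _ (isValid_typeGraph k Γ) ?_
  convert card_tkAt_typeGraph_le hk (by positivity) hΓ using 1
  field_simp

end TypeGraph

section SimpleSubformulas

variable {k n : ℕ}

/-- The clauses of `Γ` on the variable set `S`. -/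
def clausesOn (Γ : SatFormula (Fin n)) (S : Finset (Fin n)) : Finset (SatClause (Fin n)) :=
  Γ.filter (fun C => clauseVars C = S)

theorem mem_clausesOn {Γ : SatFormula (Fin n)} (hΓ : IsKFormula k Γ) {S : Finset (Fin n)}
    {C : SatClause (Fin n)} :
    C ∈ clausesOn Γ S ↔ ∃ z, C = litClause z S ∧ litClause z S ∈ Γ := by
  rw [clausesOn, mem_filter]
  constructor
  · rintro ⟨hC, rfl⟩
    obtain ⟨z, hz⟩ := (hΓ C hC).exists_litClause
    exact ⟨z, hz, hz ▸ hC⟩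
  · rintro ⟨z, rfl, hz⟩
    exact ⟨hz, clauseVars_litClause z S⟩

theorem card_clausesOn_le {Γ : SatFormula (Fin n)} (hΓ : IsKFormula k Γ) {S : Finset (Fin n)} :
    #(clausesOn Γ S) ≤ 2 ^ #S := by
  have : clausesOn Γ S ⊆ S.powerset.image (fun T => litClause (fun x => decide (x ∈ T)) S) := by
    intro C hC
    obtain ⟨z, rfl, _⟩ := (mem_clausesOn hΓ).1 hC
    refine mem_image.2 ⟨S.filter (fun x => z x = true), mem_powerset.2 (filter_subset _ _),
      litClause_congr fun x hx => ?_⟩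
    simp [hx]
  exact (card_le_card this).trans (card_image_le.trans (card_powerset S).le)

theorem exists_ne_of_litClause_ne {z z' : Fin n → Bool} {S : Finset (Fin n)}
    (h : litClause z S ≠ litClause z' S) : ∃ x ∈ S, z x ≠ z' x := by
  by_contra! hc
  exact h (litClause_congr hc)

open scoped Classical in
theorem card_clausesOn_add_one_le {Γ : SatFormula (Fin n)} (hΓ : IsKFormula k Γ)
    {S : Finset (Fin n)} (hS : #S = k) :
    (#(clausesOn Γ S) : ℝ) + 1 ≤ (2 : ℝ) ^ ((typeGraph k Γ).weight (Real.logb 2 3) S +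
      if BadSet Γ S then (k + 1 : ℝ) else 0) := by
  have hL : 0 < Real.logb 2 3 := Real.logb_pos (by norm_num) (by norm_num)
  have hw : 0 ≤ (typeGraph k Γ).weight (Real.logb 2 3) S := by
    rw [PDG.weight]
    split_ifs <;> positivity
  split_ifs with hb
  · have h1 : #(clausesOn Γ S) + 1 ≤ 2 ^ (k + 1) := by
      have := card_clausesOn_le hΓ (S := S)
      rw [hS] at this
      have h2 := Nat.one_le_two_pow (n := k)
      rw [pow_succ]; omega
    calc (#(clausesOn Γ S) : ℝ) + 1 ≤ 2 ^ (k + 1) := by exact_mod_cast h1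
      _ = (2 : ℝ) ^ ((k + 1 : ℕ) : ℝ) := (Real.rpow_natCast _ _).symm
      _ ≤ _ := Real.rpow_le_rpow_of_exponent_le (by norm_num) (by push_cast; linarith)
  rw [add_zero]
  rcases (clausesOn Γ S).eq_empty_or_nonempty with h0 | ⟨C, hC⟩
  · rw [h0, card_empty, Nat.cast_zero, zero_add]
    exact Real.one_le_rpow (by norm_num) hw
  obtain ⟨z, rfl, hz⟩ := (mem_clausesOn hΓ).1 hC
  by_cases hall : ∀ C' ∈ clausesOn Γ S, C' = litClause z S
  · have hcard : #(clausesOn Γ S) = 1 := card_eq_one.2 ⟨_, eq_singleton_iff_unique_mem.2 ⟨hC, hall⟩⟩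
    have hmem : S ∈ (typeGraph k Γ).undir := mem_undir_typeGraph.2 ⟨hS, z, hz, fun z' hz' x hx =>
      (litClause_inj (hall _ ((mem_clausesOn hΓ).2 ⟨z', rfl, hz'⟩))).2 x hx⟩
    have h1 : 1 ≤ (typeGraph k Γ).weight (Real.logb 2 3) S := by
      rw [PDG.weight, if_pos hmem]
      have : 0 ≤ Real.logb 2 3 * #(univ.filter (fun v => (S, v) ∈ (typeGraph k Γ).dir)) := by
        positivity
      linarith
    rw [hcard]
    calc ((1 : ℕ) : ℝ) + 1 = (2 : ℝ) ^ (1 : ℝ) := by norm_num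
      _ ≤ _ := Real.rpow_le_rpow_of_exponent_le (by norm_num) h1
  · push Not at hall
    obtain ⟨C', hC', hne⟩ := hall
    obtain ⟨z', rfl, hz'⟩ := (mem_clausesOn hΓ).1 hC'
    obtain ⟨v, hv, hvne⟩ := exists_ne_of_litClause_ne hne
    have hsub : clausesOn Γ S ⊆ {litClause z S, litClause z' S} := by
      intro D hD
      obtain ⟨y, rfl, hy⟩ := (mem_clausesOn hΓ).1 hD
      rw [mem_insert, mem_singleton]
      by_contra! hcon
      obtain ⟨x, hx, hxne⟩ := exists_ne_of_litClause_ne hcon.1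
      obtain ⟨x', hx', hxne'⟩ := exists_ne_of_litClause_ne hcon.2
      have e1 : x = v := DirAt.eq_of_not_badSet hb ⟨hx, y, z, hy, hz, hxne⟩
        ⟨hv, z', z, hz', hz, hvne⟩
      have e2 : x' = v := DirAt.eq_of_not_badSet hb ⟨hx', y, z', hy, hz', hxne'⟩
        ⟨hv, z', z, hz', hz, hvne⟩
      subst e1
      subst e2
      revert hxne hxne' hvne
      cases y x' <;> cases z x' <;> cases z' x' <;> simp
    have h2 : #(clausesOn Γ S) ≤ 2 := (card_le_card hsub).trans card_le_two
    have hmem : (S, v) ∈ (typeGraph k Γ).dir :=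
      mem_dir_typeGraph.2 ⟨hS, hb, hv, z', z, hz', hz, hvne⟩
    have h3 : Real.logb 2 3 ≤ (typeGraph k Γ).weight (Real.logb 2 3) S := by
      have h4 : (1 : ℝ) ≤ #(univ.filter (fun v => (S, v) ∈ (typeGraph k Γ).dir)) := by
        exact_mod_cast card_pos.2 ⟨v, mem_filter.2 ⟨mem_univ _, hmem⟩⟩
      rw [PDG.weight]
      have h5 : (0 : ℝ) ≤ if S ∈ (typeGraph k Γ).undir then 1 else 0 := by split_ifs <;> norm_num
      nlinarith
    calc (#(clausesOn Γ S) : ℝ) + 1 ≤ 2 + 1 := by gcongr; exact_mod_cast h2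
      _ = (2 : ℝ) ^ Real.logb 2 3 := by
        rw [Real.rpow_logb (by norm_num) (by norm_num) (by norm_num)]; norm_num
      _ ≤ _ := Real.rpow_le_rpow_of_exponent_le (by norm_num) h3

open scoped Classical in
theorem card_simple_subformulas_le {Γ : SatFormula (Fin n)} (hΓ : IsKFormula k Γ)
    (𝒬 : Finset (SatFormula (Fin n))) (h𝒬 : ∀ F ∈ 𝒬, F ⊆ Γ ∧ SimpleFormula F) :
    (#𝒬 : ℝ) ≤ (2 : ℝ) ^ ((#(typeGraph k Γ).undir : ℝ) + Real.logb 2 3 * #(typeGraph k Γ).dir +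
      (k + 1) * #((univ.powersetCard k).filter (BadSet Γ))) := by
  have h1 := card_le_prod_card_traces 𝒬 ((univ : Finset (Fin n)).powersetCard k) (clausesOn Γ)
    (fun _ => 1) (by
      intro F hF
      obtain ⟨hsub, hs⟩ := h𝒬 F hF
      refine ⟨fun C hC => mem_biUnion.2 ⟨clauseVars C, mem_powersetCard.2
        ⟨subset_univ _, (hΓ C (hsub hC)).2⟩, mem_filter.2 ⟨hsub hC, rfl⟩⟩, fun S _ => ?_⟩
      have : #(F ∩ clausesOn Γ S) ≤ 1 := card_le_one.2 fun C hC C' hC' => by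
        rw [mem_inter, clausesOn, mem_filter] at hC hC'
        exact hs C hC.1 C' hC'.1 (hC.2.2.trans hC'.2.2.symm)
      exact_mod_cast this)
  have h2 : ∀ S ∈ (univ : Finset (Fin n)).powersetCard k,
      (#((clausesOn Γ S).powerset.filter (fun X => (#X : ℝ) ≤ 1)) : ℝ) ≤
      (2 : ℝ) ^ ((typeGraph k Γ).weight (Real.logb 2 3) S +
        if BadSet Γ S then (k + 1 : ℝ) else 0) := by
    intro S hS
    refine le_trans ?_ (card_clausesOn_add_one_le hΓ (mem_powersetCard.1 hS).2)
    have : (clausesOn Γ S).powerset.filter (fun X => (#X : ℝ) ≤ 1) ⊆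
        insert ∅ ((clausesOn Γ S).image (fun C => {C})) := by
      intro X hX
      obtain ⟨hX1, hX2⟩ := mem_filter.1 hX
      rw [mem_powerset] at hX1
      have hX3 : #X ≤ 1 := by exact_mod_cast hX2
      rcases X.eq_empty_or_nonempty with rfl | ⟨C, hC⟩
      · exact mem_insert_self _ _
      · refine mem_insert_of_mem (mem_image.2 ⟨C, hX1 hC, ?_⟩)
        exact (eq_singleton_iff_unique_mem.2 ⟨hC, fun C' hC' => card_le_one.1 hX3 _ hC' _ hC⟩).symm
    exact_mod_cast (card_le_card this).trans ((card_insert_le _ _).trans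
      (Nat.add_le_add_right card_image_le 1))
  calc (#𝒬 : ℝ) ≤ ∏ S ∈ (univ : Finset (Fin n)).powersetCard k,
        (#((clausesOn Γ S).powerset.filter (fun X => (#X : ℝ) ≤ 1)) : ℝ) := by
        exact_mod_cast h1
    _ ≤ ∏ S ∈ (univ : Finset (Fin n)).powersetCard k,
        (2 : ℝ) ^ ((typeGraph k Γ).weight (Real.logb 2 3) S +
          if BadSet Γ S then (k + 1 : ℝ) else 0) := prod_le_prod (fun _ _ => by positivity) h2
    _ = _ := by
        rw [← Real.rpow_sum_of_pos (by norm_num), sum_add_distrib,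
          (isValid_typeGraph k Γ).sum_weight, ← sum_filter, sum_const, nsmul_eq_mul]
        ring_nf

end SimpleSubformulas

/-! ### Formulas whose type is almost complete are almost unate -/

section NearUnate

variable {k m n : ℕ}

theorem card_filter_image_erase_mem_le (j : Fin (k + 1)) (B : Finset (Finset (Fin n)))
    (hB : ∀ S ∈ B, #S = k) :
    #(univ.filter (fun e : Fin (k + 1) → Fin n => (univ.erase j).image e ∈ B)) ≤
      #B * k ^ k * n := by
  have hD : #(univ.filter (fun d : Fin k → Fin n => univ.image d ∈ B)) ≤ #B * k ^ k := by
    have : univ.filter (fun d : Fin k → Fin n => univ.image d ∈ B) ⊆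
        B.biUnion (fun S => univ.filter (fun d : Fin k → Fin n => ∀ u ∈ univ, d u ∈ S)) := by
      intro d hd
      exact mem_biUnion.2 ⟨_, (mem_filter.1 hd).2, mem_filter.2 ⟨mem_univ _, fun u hu =>
        mem_image_of_mem d hu⟩⟩
    refine (card_le_card this).trans (card_biUnion_le_card_mul _ _ _ fun S hS => ?_)
    have h := card_filter_forall_mem_le (univ : Finset (Fin k)) S
    rw [card_univ, Fintype.card_fin, Fintype.card_fin, hB S hS, Nat.sub_self, pow_zero,
      mul_one] at h
    convert h using 3
  have h := card_filter_comp_mem_le j.succAbove Fin.succAbove_right_injective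
    (univ.filter (fun d : Fin k → Fin n => univ.image d ∈ B))
  rw [Nat.add_sub_cancel_left, pow_one] at h
  refine le_trans (card_le_card ?_) (h.trans (Nat.mul_le_mul_right _ hD))
  intro e he
  refine mem_filter.2 ⟨mem_univ _, mem_filter.2 ⟨mem_univ _, ?_⟩⟩
  rw [← image_image, Fin.image_succAbove_univ, compl_singleton]
  exact (mem_filter.1 he).2

open scoped Classical in
/-- The polarities of the only clause of `Γ` on `S`. -/
noncomputable def setSign (Γ : SatFormula (Fin n)) (S : Finset (Fin n)) : Fin n → Bool :=
  if h : SingleSet Γ S then h.choose else fun _ => true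

theorem litClause_setSign_mem {Γ : SatFormula (Fin n)} {S : Finset (Fin n)}
    (h : SingleSet Γ S) : litClause (setSign Γ S) S ∈ Γ := by
  rw [setSign, dif_pos h]
  exact h.choose_spec.1

theorem eq_setSign {Γ : SatFormula (Fin n)} {S : Finset (Fin n)} (h : SingleSet Γ S)
    {z : Fin n → Bool} (hz : litClause z S ∈ Γ) {x : Fin n} (hx : x ∈ S) :
    z x = setSign Γ S x := by
  rw [setSign, dif_pos h]
  exact h.choose_spec.2 z hz x hx

open scoped Classical in
theorem card_setSign_ne_le {γ : ℝ} {Γ : SatFormula (Fin n)} (hγ : 0 ≤ γ)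
    (hΓ : PatternSparse k γ Γ) {x₁ x₂ x₃ : Fin (k + 1)} (h₁₂ : x₁ ≠ x₂) (h₁₃ : x₁ ≠ x₃)
    (h₂₃ : x₂ ≠ x₃) :
    (#(univ.filter (fun e : Fin (k + 1) → Fin n => setSign Γ ((univ.erase x₂).image e) (e x₁) ≠
      setSign Γ ((univ.erase x₃).image e) (e x₁))) : ℝ) ≤
      (k + 1 : ℕ) ^ 2 * (n : ℝ) ^ k +
        3 * (#((univ.powersetCard k).filter (fun S => ¬ SingleSet Γ S)) * (k : ℝ) ^ k * n) +
        8 ^ (k + 1) * (γ * (n : ℝ) ^ (k + 1)) := by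
  set B := (univ.powersetCard k).filter (fun S => ¬ SingleSet Γ S) with hBdef
  have hB : ∀ S ∈ B, #S = k := fun S hS => (mem_powersetCard.1 (mem_filter.1 hS).1).2
  set A := univ.filter (fun e : Fin (k + 1) → Fin n => setSign Γ ((univ.erase x₂).image e) (e x₁) ≠
      setSign Γ ((univ.erase x₃).image e) (e x₁)) with hA
  set N := univ.filter (fun e : Fin (k + 1) → Fin n => ¬ Function.Injective e) with hN
  let M : Fin (k + 1) → Finset (Fin (k + 1) → Fin n) := fun j =>
    univ.filter (fun e => (univ.erase j).image e ∈ B)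
  let D := A.filter (fun e => Function.Injective e ∧ e ∉ M x₁ ∧ e ∉ M x₂ ∧ e ∉ M x₃)
  have hsub : A ⊆ N ∪ (M x₁ ∪ (M x₂ ∪ (M x₃ ∪ D))) := by
    intro e he
    simp only [mem_union, hN, D, mem_filter, mem_univ, true_and]
    tauto
  have hsingle : ∀ (e : Fin (k + 1) → Fin n) j, Function.Injective e → e ∉ M j →
      SingleSet Γ ((univ.erase j).image e) := by
    intro e j he hj
    by_contra hcon
    refine hj (mem_filter.2 ⟨mem_univ _, mem_filter.2 ⟨mem_powersetCard.2 ⟨subset_univ _, ?_⟩, hcon⟩⟩)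
    rw [card_image_of_injective _ he, card_erase_of_mem (mem_univ _)]
    simp
  have hD : (#D : ℝ) ≤ 8 ^ (k + 1) * (γ * (n : ℝ) ^ (k + 1)) := by
    refine card_triples_le hγ hΓ h₁₂ h₁₃ h₂₃ D fun e he => ?_
    obtain ⟨h1, hinj, h2, h3, h4⟩ := mem_filter.1 he
    exact ⟨_, _, _, litClause_setSign_mem (hsingle e _ hinj h2),
      litClause_setSign_mem (hsingle e _ hinj h3), litClause_setSign_mem (hsingle e _ hinj h4),
      (mem_filter.1 h1).2⟩
  have hM : ∀ j, (#(M j) : ℝ) ≤ #B * (k : ℝ) ^ k * n := fun j => by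
    exact_mod_cast card_filter_image_erase_mem_le j B hB
  have hNc : (#N : ℝ) ≤ (k + 1 : ℕ) ^ 2 * (n : ℝ) ^ k := by
    have := card_filter_not_injective_le (U := Fin (k + 1)) n
    rw [Fintype.card_fin, Nat.add_sub_cancel] at this
    exact_mod_cast this
  have hu : (#A : ℝ) ≤ #N + (#(M x₁) + (#(M x₂) + (#(M x₃) + #D))) := by
    have := (card_le_card hsub).trans ((card_union_le _ _).trans (Nat.add_le_add_left
      ((card_union_le _ _).trans (Nat.add_le_add_left ((card_union_le _ _).trans
      (Nat.add_le_add_left (card_union_le _ _) _)) _)) _))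
    exact_mod_cast this
  linarith [hM x₁, hM x₂, hM x₃]

theorem image_cons_cons_erase_one (x y : Fin n) (d : Fin m → Fin n) :
    (univ.erase (1 : Fin (m + 2))).image (Fin.cons x (Fin.cons y d) : Fin (m + 2) → Fin n) =
      insert x (univ.image d) := by
  ext w
  simp only [mem_image, mem_erase, mem_univ, and_true, mem_insert, true_and]
  constructor
  · rintro ⟨i, hi, rfl⟩
    induction i using Fin.cases with
    | zero => exact Or.inl rfl
    | succ i =>
      induction i using Fin.cases with
      | zero => exact absurd rfl hi
      | succ i => exact Or.inr ⟨i, rfl⟩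
  · rintro (rfl | ⟨i, rfl⟩)
    · exact ⟨0, by simp, rfl⟩
    · exact ⟨i.succ.succ, by simp [Fin.ext_iff], rfl⟩

theorem image_cons_cons_erase_succ_succ (x y : Fin n) (d : Fin m → Fin n) (i : Fin m) :
    (univ.erase i.succ.succ).image (Fin.cons x (Fin.cons y d) : Fin (m + 2) → Fin n) =
      insert x (univ.image (Function.update d i y)) := by
  ext w
  simp only [mem_image, mem_erase, mem_univ, and_true, mem_insert, true_and]
  constructor
  · rintro ⟨j, hj, rfl⟩
    induction j using Fin.cases with
    | zero => exact Or.inl rfl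
    | succ j =>
      induction j using Fin.cases with
      | zero => exact Or.inr ⟨i, by simp⟩
      | succ j =>
        have : j ≠ i := fun h => hj (by rw [h])
        exact Or.inr ⟨j, by simp [this]⟩
  · rintro (rfl | ⟨j, rfl⟩)
    · exact ⟨0, (Fin.succ_ne_zero _).symm, rfl⟩
    · by_cases h : j = i
      · subst h
        exact ⟨1, by simp [Fin.ext_iff], by simp⟩
      · refine ⟨j.succ.succ, fun h' => h (Fin.succ_injective _ (Fin.succ_injective _ h')), ?_⟩
        simp [h]

/-- The polarity of `x` in the clause on `x` and the entries of `d`. -/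
noncomputable def linkSign (Γ : SatFormula (Fin n)) (x : Fin n) (d : Fin m → Fin n) : Bool :=
  setSign Γ (insert x (univ.image d)) x

open scoped Classical in
theorem sum_card_linkSign_ne_le {κ : ℝ} {Γ : SatFormula (Fin n)}
    (h : ∀ i : Fin m, (#(univ.filter (fun e : Fin (m + 2) → Fin n =>
      setSign Γ ((univ.erase 1).image e) (e 0) ≠
        setSign Γ ((univ.erase i.succ.succ).image e) (e 0))) : ℝ) ≤ κ) :
    ∑ x : Fin n, (#(univ.filter (fun p : (Fin m → Fin n) × (Fin m → Fin n) =>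
      linkSign Γ x p.1 ≠ linkSign Γ x p.2)) : ℝ) ≤ m * (κ * (n : ℝ) ^ (m - 1)) := by
  have h1 : ∀ i : Fin m, ∑ x : Fin n, #(univ.filter (fun p : (Fin m → Fin n) × (Fin m → Fin n) =>
      linkSign Γ x p.1 ≠ linkSign Γ x (Function.update p.1 i (p.2 i)))) ≤
      #(univ.filter (fun e : Fin (m + 2) → Fin n => setSign Γ ((univ.erase 1).image e) (e 0) ≠
        setSign Γ ((univ.erase i.succ.succ).image e) (e 0))) * n ^ (m - 1) := by
    intro i
    have hcard : #(univ : Finset ({j : Fin m // j ≠ i} → Fin n)) = n ^ (m - 1) := by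
      simp
    rw [← hcard, ← card_product, ← card_sigma]
    refine card_le_card_of_injOn (fun q => (Fin.cons q.1 (Fin.cons (q.2.2 i) q.2.1),
      fun j => q.2.2 j.1)) ?_ ?_
    · rintro ⟨x, d, d'⟩ hq
      have hq' := (mem_filter.1 (mem_sigma.1 hq).2).2
      refine mem_product.2 ⟨mem_filter.2 ⟨mem_univ _, ?_⟩, mem_univ _⟩
      simp only [linkSign] at hq'
      rw [image_cons_cons_erase_one, image_cons_cons_erase_succ_succ]
      exact hq'
    · rintro ⟨x, d, d'⟩ _ ⟨y, e, e'⟩ _ heq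
      obtain ⟨h2, h3⟩ := Prod.mk.inj heq
      obtain ⟨hx, h4⟩ := Fin.cons_inj.1 h2
      obtain ⟨hi, hd⟩ := Fin.cons_inj.1 h4
      simp only at hx hd hi h3
      have hd' : d' = e' := by
        funext j
        by_cases hj : j = i
        · rw [hj]; exact hi
        · exact congrFun h3 ⟨j, hj⟩
      subst hx hd hd'
      rfl
  calc ∑ x : Fin n, (#(univ.filter (fun p : (Fin m → Fin n) × (Fin m → Fin n) =>
      linkSign Γ x p.1 ≠ linkSign Γ x p.2)) : ℝ)
      ≤ ∑ x : Fin n, ∑ i : Fin m, (#(univ.filter (fun p : (Fin m → Fin n) × (Fin m → Fin n) =>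
      linkSign Γ x p.1 ≠ linkSign Γ x (Function.update p.1 i (p.2 i)))) : ℝ) :=
        sum_le_sum fun x _ => by exact_mod_cast card_filter_ne_le_sum_update (linkSign Γ x)
    _ = ∑ i : Fin m, ∑ x : Fin n, (#(univ.filter (fun p : (Fin m → Fin n) × (Fin m → Fin n) =>
      linkSign Γ x p.1 ≠ linkSign Γ x (Function.update p.1 i (p.2 i)))) : ℝ) := sum_comm
    _ ≤ ∑ _i : Fin m, κ * (n : ℝ) ^ (m - 1) := by
        refine sum_le_sum fun i _ => ?_
        refine le_trans (by exact_mod_cast h1 i) (mul_le_mul_of_nonneg_right (h i) (by positivity))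
    _ = _ := by rw [sum_const, card_univ, Fintype.card_fin, nsmul_eq_mul]

open scoped Classical in
theorem exists_sum_card_linkSign_ne_le {M : ℝ} (hn : 0 < n) {Γ : SatFormula (Fin n)}
    (h : ∑ x : Fin n, (#(univ.filter (fun p : (Fin m → Fin n) × (Fin m → Fin n) =>
      linkSign Γ x p.1 ≠ linkSign Γ x p.2)) : ℝ) ≤ (n : ℝ) ^ m * M) :
    ∃ z : Fin n → Bool, (#(univ.filter (fun p : Fin n × (Fin m → Fin n) =>
      linkSign Γ p.1 p.2 ≠ z p.1)) : ℝ) ≤ M := by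
  have : Nonempty (Fin n) := ⟨⟨0, hn⟩⟩
  have hsum : ∑ d' : Fin m → Fin n, (#(univ.filter (fun p : Fin n × (Fin m → Fin n) =>
      linkSign Γ p.1 p.2 ≠ linkSign Γ p.1 d')) : ℝ) ≤ ∑ _d' : Fin m → Fin n, M := by
    rw [sum_const, card_univ, Fintype.card_fun, Fintype.card_fin, Fintype.card_fin, nsmul_eq_mul]
    push_cast
    refine le_trans (le_of_eq ?_) h
    norm_cast
    rw [← card_sigma, ← card_sigma]
    refine card_bij' (fun q _ => ⟨q.2.1, q.2.2, q.1⟩) (fun q _ => ⟨q.2.2, q.1, q.2.1⟩)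
      ?_ ?_ ?_ ?_
    · intro q hq
      simpa using hq
    · intro q hq
      simpa using hq
    · intro q _; rfl
    · intro q _; rfl
  obtain ⟨d', _, hd'⟩ := exists_le_of_sum_le univ_nonempty hsum
  exact ⟨fun x => linkSign Γ x d', hd'⟩

open scoped Classical in
theorem card_inconsistent_le {k : ℕ} (hk : k = m + 1) {Γ : SatFormula (Fin n)}
    (hΓ : IsKFormula k Γ) (z : Fin n → Bool) :
    #(Γ.filter (fun C => ∃ l ∈ C, l.2 ≠ z l.1)) ≤
      2 ^ k * #((univ.powersetCard k).filter (fun S => ¬ SingleSet Γ S)) +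
      #(univ.filter (fun p : Fin n × (Fin m → Fin n) => linkSign Γ p.1 p.2 ≠ z p.1)) := by
  have hsub : Γ.filter (fun C => ∃ l ∈ C, l.2 ≠ z l.1) ⊆
      ((univ.powersetCard k).filter (fun S => ¬ SingleSet Γ S)).biUnion (clausesOn Γ) ∪
      (univ.filter (fun p : Fin n × (Fin m → Fin n) => linkSign Γ p.1 p.2 ≠ z p.1)).image
        (fun p => litClause (setSign Γ (insert p.1 (univ.image p.2))) (insert p.1 (univ.image p.2))) := by
    intro C hC
    obtain ⟨hC, ⟨x, b⟩, hl, hne⟩ := mem_filter.1 hC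
    obtain ⟨S, hS⟩ : ∃ S, S = clauseVars C := ⟨_, rfl⟩
    have hSk : #S = k := hS ▸ (hΓ C hC).2
    obtain ⟨y, hy⟩ := (hΓ C hC).exists_litClause
    rw [← hS] at hy
    subst hy
    obtain ⟨hx, hxb⟩ := mem_litClause.1 hl
    simp only at hx hxb hne
    by_cases hs : SingleSet Γ S
    · refine mem_union_right _ (mem_image.2 ?_)
      have hcard : #(S.erase x) = m := by rw [card_erase_of_mem hx, hSk, hk, Nat.add_sub_cancel]
      have him : insert x (univ.image ((S.erase x).orderEmbOfFin hcard)) = S := by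
        rw [show univ.image ((S.erase x).orderEmbOfFin hcard) = S.erase x by
          ext w
          simp, insert_erase hx]
      refine ⟨(x, (S.erase x).orderEmbOfFin hcard), mem_filter.2 ⟨mem_univ _, ?_⟩, ?_⟩
      · simp only [linkSign]
        rw [him, ← eq_setSign hs hC hx, hxb]
        exact hne
      · simp only
        rw [him]
        exact (litClause_congr fun w hw => eq_setSign hs hC hw).symm
    · refine mem_union_left _ (mem_biUnion.2 ⟨S, mem_filter.2 ⟨mem_powersetCard.2
        ⟨subset_univ _, hSk⟩, hs⟩, mem_filter.2 ⟨hC, hS.symm⟩⟩)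
  refine (card_le_card hsub).trans ((card_union_le _ _).trans (add_le_add ?_ card_image_le))
  rw [mul_comm]
  refine card_biUnion_le_card_mul _ _ _ fun S hS => ?_
  have := card_clausesOn_le hΓ (S := S)
  rwa [(mem_powersetCard.1 (mem_filter.1 hS).1).2] at this

open scoped Classical in
theorem exists_polarity (k : ℕ) (hk : 2 ≤ k) (ζ : ℝ) (hζ : 0 < ζ) : ∃ ξ : ℝ, 0 < ξ ∧
    ∀ᶠ n : ℕ in atTop, ∀ Γ : SatFormula (Fin n), IsKFormula k Γ → PatternSparse k ξ Γ →
      (#((univ.powersetCard k).filter (fun S => ¬ SingleSet Γ S)) : ℝ) ≤ ξ * (n : ℝ) ^ k →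
      ∃ z : Fin n → Bool, (#(Γ.filter (fun C => ∃ l ∈ C, l.2 ≠ z l.1)) : ℝ) ≤ ζ * (n : ℝ) ^ k := by
  obtain ⟨m, rfl⟩ : ∃ m, k = m + 1 := ⟨k - 1, by omega⟩
  obtain ⟨K, hK⟩ : ∃ K : ℝ, K = 1 + 3 * ((m + 1 : ℕ) : ℝ) ^ (m + 1) + 8 ^ (m + 2) := ⟨_, rfl⟩
  have hK0 : 0 < K := by rw [hK]; positivity
  obtain ⟨ξ, hξ⟩ : ∃ ξ : ℝ, ξ = ζ / (2 ^ (m + 1) + m * K) := ⟨_, rfl⟩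
  have hξ0 : 0 < ξ := by rw [hξ]; positivity
  refine ⟨ξ, hξ0, ?_⟩
  filter_upwards [eventually_ge_atTop 1, eventually_ge_atTop ⌈((m + 2 : ℕ) : ℝ) ^ 2 / ξ⌉₊]
    with n hn1 hn2 Γ hΓ hsparse hB
  have hn2' : ((m + 2 : ℕ) : ℝ) ^ 2 ≤ ξ * n := by
    have := Nat.ceil_le.1 hn2
    rwa [div_le_iff₀' hξ0] at this
  have h1 : ∀ i : Fin m, (#(univ.filter (fun e : Fin (m + 2) → Fin n =>
      setSign Γ ((univ.erase 1).image e) (e 0) ≠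
        setSign Γ ((univ.erase i.succ.succ).image e) (e 0))) : ℝ) ≤ ξ * K * (n : ℝ) ^ (m + 2) := by
    intro i
    refine (card_setSign_ne_le hξ0.le hsparse (by simp) (Fin.succ_ne_zero _).symm
      (by simp [Fin.ext_iff])).trans ?_
    calc _ ≤ ξ * n * (n : ℝ) ^ (m + 1) +
          3 * (ξ * (n : ℝ) ^ (m + 1) * ((m + 1 : ℕ) : ℝ) ^ (m + 1) * n) +
          8 ^ (m + 1 + 1) * (ξ * (n : ℝ) ^ (m + 1 + 1)) := by gcongr
      _ = _ := by rw [hK]; ring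
  have h2 := sum_card_linkSign_ne_le h1
  have hm : m = (m - 1) + 1 := by omega
  have h3 := exists_sum_card_linkSign_ne_le (M := m * (ξ * K * (n : ℝ) ^ (m + 1))) hn1
    (h2.trans (le_of_eq (by
      rw [show (n : ℝ) ^ m = (n : ℝ) ^ (m - 1) * n by rw [← pow_succ, ← hm]]; ring)))
  obtain ⟨z, hz⟩ := h3
  refine ⟨z, ?_⟩
  have h4 : (#(Γ.filter (fun C => ∃ l ∈ C, l.2 ≠ z l.1)) : ℝ) ≤
      2 ^ (m + 1) * #((univ.powersetCard (m + 1)).filter (fun S => ¬ SingleSet Γ S)) +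
      #(univ.filter (fun p : Fin n × (Fin m → Fin n) => linkSign Γ p.1 p.2 ≠ z p.1)) := by
    exact_mod_cast card_inconsistent_le rfl hΓ z
  calc _ ≤ 2 ^ (m + 1) * (ξ * (n : ℝ) ^ (m + 1)) + m * (ξ * K * (n : ℝ) ^ (m + 1)) := by
        refine h4.trans (add_le_add ?_ hz)
        gcongr
    _ = ξ * (2 ^ (m + 1) + m * K) * (n : ℝ) ^ (m + 1) := by ring
    _ = _ := by
        rw [hξ, div_mul_cancel₀ _ (by positivity)]

end NearUnate

/-! ### Minimal formulas far from unate are rare -/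

section Stability

variable {k n : ℕ}

theorem PatternSparse.mono {γ γ' : ℝ} {Γ : SatFormula (Fin n)} (h : PatternSparse k γ Γ)
    (hγ : γ ≤ γ') : PatternSparse k γ' Γ :=
  fun P hP => (h P hP).trans (mul_le_mul_of_nonneg_right hγ (by positivity))

open scoped Classical in
theorem exists_simple_subformula {G : SatFormula (Fin n)} (hG : IsKFormula k G) :
    ∃ F ⊆ G, SimpleFormula F ∧ #(G \ F) ≤ #((univ.powersetCard k).filter
      (fun S => ∃ z z' : Fin n → Bool, litClause z S ∈ G ∧ litClause z' S ∈ G ∧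
        ∃ x ∈ S, z x ≠ z' x)) * 2 ^ k := by
  have hc : ∀ S, ∃ C : SatClause (Fin n), (clausesOn G S).Nonempty → C ∈ clausesOn G S := fun S => by
    by_cases h : (clausesOn G S).Nonempty
    · exact ⟨h.choose, fun _ => h.choose_spec⟩
    · exact ⟨∅, fun h' => absurd h' h⟩
  choose c hc using hc
  refine ⟨G.filter (fun C => C = c (clauseVars C)), filter_subset _ _, ?_, ?_⟩
  · intro C hC C' hC' h
    rw [(mem_filter.1 hC).2, (mem_filter.1 hC').2, h]
  · have hsub : G \ G.filter (fun C => C = c (clauseVars C)) ⊆ ((univ.powersetCard k).filter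
      (fun S => ∃ z z' : Fin n → Bool, litClause z S ∈ G ∧ litClause z' S ∈ G ∧
        ∃ x ∈ S, z x ≠ z' x)).biUnion (clausesOn G) := by
      intro C hC
      obtain ⟨hCG, hne⟩ := mem_sdiff.1 hC
      have hne' : C ≠ c (clauseVars C) := fun h => hne (mem_filter.2 ⟨hCG, h⟩)
      have hCon : C ∈ clausesOn G (clauseVars C) := mem_filter.2 ⟨hCG, rfl⟩
      obtain ⟨z, hz, hzG⟩ := (mem_clausesOn hG).1 hCon
      obtain ⟨z', hz', hzG'⟩ := (mem_clausesOn hG).1 (hc _ ⟨C, hCon⟩)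
      refine mem_biUnion.2 ⟨clauseVars C, mem_filter.2 ⟨mem_powersetCard.2 ⟨subset_univ _,
        (hG C hCG).2⟩, z, z', hzG, hzG', ?_⟩, hCon⟩
      refine exists_ne_of_litClause_ne fun h => hne' ?_
      rw [hz', ← h]
      exact hz
    refine (card_le_card hsub).trans (card_biUnion_le_card_mul _ _ _ fun S hS => ?_)
    have := card_clausesOn_le hG (S := S)
    rwa [(mem_powersetCard.1 (mem_filter.1 hS).1).2] at this

open scoped Classical in
theorem card_far_le (k : ℕ) (hk : 2 ≤ k) (θ : ℝ) (hθ : Real.logb 2 3 < θ)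
    (hturan : ∀ ε : ℝ, 0 < ε → ∃ n₀ : ℕ, ∀ n ≥ n₀, ∀ H : PDG (Fin n),
      H.IsValid k → ¬ (TkPDG k).IsSubgraph H →
      (H.undir.card : ℝ) + θ * H.dir.card ≤ (1 + ε) * n.choose k)
    (ζ : ℝ) (hζ : 0 < ζ) : ∃ c : ℝ, 0 < c ∧ ∀ᶠ n : ℕ in atTop,
      ∀ 𝒜 : Finset (SatFormula (Fin n)), (∀ G ∈ 𝒜, IsKFormula k G ∧ MinimalFormula G ∧
        ∀ z : Fin n → Bool, ζ * (n : ℝ) ^ k < #(G.filter (fun C => ∃ l ∈ C, l.2 ≠ z l.1))) →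
      (#𝒜 : ℝ) ≤ 2 ^ ((n.choose k : ℝ) - c * (n : ℝ) ^ k) := by
  obtain ⟨L, hL⟩ : ∃ L, L = Real.logb 2 3 := ⟨_, rfl⟩
  rw [← hL] at hθ
  have hL1 : 1 ≤ L := by
    rw [hL, Real.le_logb_iff_rpow_le (by norm_num) (by norm_num)]; norm_num
  have hθ0 : 0 < θ := by linarith
  obtain ⟨r, hr⟩ : ∃ r, r = L / θ := ⟨_, rfl⟩
  have hr0 : 0 ≤ r := by rw [hr]; positivity
  have hr1 : r < 1 := by rw [hr, div_lt_one hθ0]; exact hθ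
  have hrθ : r * θ = L := by rw [hr, div_mul_cancel₀ _ hθ0.ne']
  obtain ⟨ξ, hξ, hpol⟩ := exists_polarity k hk ζ hζ
  obtain ⟨c, hc⟩ : ∃ c, c = (1 - r) * ξ / 2 := ⟨_, rfl⟩
  have hc0 : 0 < c := by
    rw [hc]; have : 0 < 1 - r := by linarith
    positivity
  obtain ⟨γ₀, hγ₀, htype⟩ := typeGraph_weight_le k hk θ (by linarith) hturan c hc0
  obtain ⟨η, hη, hsmall⟩ := exists_card_small_subsets_le (c / (8 * 2 ^ k)) (by positivity)
  obtain ⟨γ, hγ⟩ : ∃ γ, γ = min (min γ₀ ξ) (c / (8 * (k + 1) * 4 ^ (k + 1))) := ⟨_, rfl⟩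
  have hγ0 : 0 < γ := by rw [hγ]; positivity
  have hγ1 : γ ≤ γ₀ := by rw [hγ]; exact (min_le_left _ _).trans (min_le_left _ _)
  have hγ2 : γ ≤ ξ := by rw [hγ]; exact (min_le_left _ _).trans (min_le_right _ _)
  have hγ3 : (k + 1) * (4 ^ (k + 1) * γ) ≤ c / 8 := by
    have : γ ≤ c / (8 * (k + 1) * 4 ^ (k + 1)) := by rw [hγ]; exact min_le_right _ _
    rw [le_div_iff₀ (by positivity)] at this
    linarith
  refine ⟨c / 2, by positivity, ?_⟩
  filter_upwards [hpol, htype, formula_containers k (by omega) γ (c / 8) hγ0 (by positivity),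
    card_patternCopies_le_of_minimal k (η / 4 ^ (k + 1)) (by positivity), eventually_ge_atTop 1]
    with n hpol htype hcont hmin hn 𝒜 h𝒜
  have hn0 : (0 : ℝ) < n := by exact_mod_cast hn
  obtain ⟨𝒞, h𝒞, hcov⟩ := hcont
  obtain ⟨c', hc'⟩ : ∃ c', c' = (n.choose k : ℝ) := ⟨_, rfl⟩
  have hc'n : c' ≤ (n : ℝ) ^ k := by
    rw [hc']; exact_mod_cast Nat.choose_le_pow _ _
  rw [← hc']
  set 𝒳 := (kClauses k n).powerset.filter (fun X => (#X : ℝ) ≤ η * (2 * n) ^ k) with h𝒳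
  let 𝒬 : SatFormula (Fin n) → Finset (SatFormula (Fin n)) := fun Γ =>
    Γ.powerset.filter SimpleFormula
  let 𝒞' := 𝒞.filter (fun Γ => IsKFormula k Γ ∧ PatternSparse k γ Γ ∧
    ξ * (n : ℝ) ^ k < #((univ.powersetCard k).filter (fun S => ¬ SingleSet Γ S)))
  have hsub : 𝒜 ⊆ 𝒞'.biUnion (fun Γ => (𝒬 Γ ×ˢ 𝒳).image (fun p => p.1 ∪ p.2)) := by
    intro G hG
    obtain ⟨hGk, hGm, hGf⟩ := h𝒜 G hG
    obtain ⟨Γ, hΓ, hGΓ, hΓk, hΓs⟩ := hcov G hGk hGm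
    have hΓk' : IsKFormula k Γ := fun C hC => mem_kClauses.1 (hΓk hC)
    have hΓs' : PatternSparse k γ Γ := hΓs
    refine mem_biUnion.2 ⟨Γ, mem_filter.2 ⟨hΓ, hΓk', hΓs', ?_⟩, ?_⟩
    · by_contra hcon
      obtain ⟨z, hz⟩ := hpol Γ hΓk' (hΓs'.mono hγ2) (not_lt.1 hcon)
      have h1 := hGf z
      have h2 : (#(G.filter (fun C => ∃ l ∈ C, l.2 ≠ z l.1)) : ℝ) ≤
          #(Γ.filter (fun C => ∃ l ∈ C, l.2 ≠ z l.1)) := by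
        exact_mod_cast card_le_card (filter_subset_filter _ hGΓ)
      linarith
    · obtain ⟨F, hFG, hFs, hFc⟩ := exists_simple_subformula hGk
      refine mem_image.2 ⟨(F, G \ F), mem_product.2 ⟨mem_filter.2 ⟨mem_powerset.2 (hFG.trans hGΓ),
        hFs⟩, mem_filter.2 ⟨mem_powerset.2 (sdiff_subset.trans (hGΓ.trans hΓk)), ?_⟩⟩,
        union_sdiff_of_subset hFG⟩
      have h1 := card_doubleSets_mul_le (by positivity) (hmin G hGm)
      have h2 := (Nat.cast_le (α := ℝ)).2 hFc
      push_cast at h2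
      refine h2.trans ?_
      rw [pow_succ (n : ℝ), ← mul_assoc, ← mul_assoc] at h1
      have h3 := le_of_mul_le_mul_right h1 hn0
      calc _ ≤ 4 ^ (k + 1) * (η / 4 ^ (k + 1)) * (n : ℝ) ^ k * 2 ^ k := by gcongr
        _ = _ := by rw [mul_pow]; field_simp
  have hX : (#𝒳 : ℝ) ≤ 2 ^ (c / 8 * (n : ℝ) ^ k) := by
    refine (hsmall (kClauses k n) ((2 * n) ^ k) (by exact_mod_cast card_kClauses_le k n)).trans ?_
    refine Real.rpow_le_rpow_of_exponent_le (by norm_num) (le_of_eq ?_)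
    rw [mul_pow]; field_simp
  have hfib : ∀ Γ ∈ 𝒞', (#((𝒬 Γ ×ˢ 𝒳).image (fun p => p.1 ∪ p.2)) : ℝ) ≤
      2 ^ (c' - c * (n : ℝ) ^ k + c / 8 * (n : ℝ) ^ k) * 2 ^ (c / 8 * (n : ℝ) ^ k) := by
    intro Γ hΓ
    obtain ⟨_, hΓk, hΓs, hΓξ⟩ := mem_filter.1 hΓ
    have h1 : (#((𝒬 Γ ×ˢ 𝒳).image (fun p => p.1 ∪ p.2)) : ℝ) ≤ #(𝒬 Γ) * #𝒳 := by
      have : #((𝒬 Γ ×ˢ 𝒳).image (fun p => p.1 ∪ p.2)) ≤ #(𝒬 Γ) * #𝒳 := by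
        rw [← card_product]; exact card_image_le
      exact_mod_cast this
    refine h1.trans (mul_le_mul ?_ hX (by positivity) (by positivity))
    refine (card_simple_subformulas_le hΓk (𝒬 Γ) fun F hF => ⟨mem_powerset.1 (mem_filter.1 hF).1,
      (mem_filter.1 hF).2⟩).trans (Real.rpow_le_rpow_of_exponent_le (by norm_num) ?_)
    rw [← hL]
    have hbad := card_badSets_mul_le hγ0.le hΓs
    rw [pow_succ (n : ℝ), ← mul_assoc, ← mul_assoc] at hbad
    have hbad' := le_of_mul_le_mul_right hbad hn0
    have hbad2 : ((k : ℝ) + 1) * #((univ.powersetCard k).filter (BadSet Γ)) ≤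
        c / 8 * (n : ℝ) ^ k := by
      calc _ ≤ ((k : ℝ) + 1) * (4 ^ (k + 1) * γ * (n : ℝ) ^ k) := by gcongr
        _ = (k + 1) * (4 ^ (k + 1) * γ) * (n : ℝ) ^ k := by ring
        _ ≤ _ := by gcongr
    have hw := htype Γ (hΓs.mono hγ1)
    rw [← hc'] at hw
    have hu : (#(typeGraph k Γ).undir : ℝ) ≤ c' - ξ * (n : ℝ) ^ k := by
      have h2 := card_filter_add_card_filter_not (s := (univ : Finset (Fin n)).powersetCard k)
        (SingleSet Γ)
      rw [card_powersetCard, card_univ, Fintype.card_fin] at h2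
      have h3 : (#(typeGraph k Γ).undir : ℝ) +
          #((univ.powersetCard k).filter (fun S => ¬ SingleSet Γ S)) = c' := by
        rw [hc']; exact_mod_cast h2
      linarith
    have hr' : 0 ≤ 1 - r := by linarith
    have hcomb : (#(typeGraph k Γ).undir : ℝ) + L * #(typeGraph k Γ).dir ≤
        c' - c * (n : ℝ) ^ k := by
      calc (#(typeGraph k Γ).undir : ℝ) + L * #(typeGraph k Γ).dir
          = r * (#(typeGraph k Γ).undir + θ * #(typeGraph k Γ).dir) +
            (1 - r) * #(typeGraph k Γ).undir := by rw [← hrθ]; ring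
        _ ≤ r * ((1 + c) * c') + (1 - r) * (c' - ξ * (n : ℝ) ^ k) := by gcongr
        _ = c' + r * (c * c') - 2 * c * (n : ℝ) ^ k := by rw [hc]; ring
        _ ≤ c' + 1 * (c * (n : ℝ) ^ k) - 2 * c * (n : ℝ) ^ k := by
            have : 0 ≤ c' := by rw [hc']; positivity
            gcongr
        _ = _ := by ring
    linarith
  calc (#𝒜 : ℝ) ≤ #𝒞' * (2 ^ (c' - c * (n : ℝ) ^ k + c / 8 * (n : ℝ) ^ k) *
        2 ^ (c / 8 * (n : ℝ) ^ k)) := card_le_of_subset_biUnion _ _ _ _ hsub hfib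
    _ ≤ 2 ^ (c / 8 * (n : ℝ) ^ k) * (2 ^ (c' - c * (n : ℝ) ^ k + c / 8 * (n : ℝ) ^ k) *
        2 ^ (c / 8 * (n : ℝ) ^ k)) := by
        gcongr
        refine le_trans ?_ h𝒞
        exact_mod_cast card_filter_le _ _
    _ = 2 ^ (c / 8 * (n : ℝ) ^ k + ((c' - c * (n : ℝ) ^ k + c / 8 * (n : ℝ) ^ k) +
        c / 8 * (n : ℝ) ^ k)) := by
        rw [← Real.rpow_add (by norm_num), ← Real.rpow_add (by norm_num)]
    _ ≤ _ := by
        refine Real.rpow_le_rpow_of_exponent_le (by norm_num) ?_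
        have : 0 ≤ c * (n : ℝ) ^ k := by positivity
        nlinarith

end Stability

/-! ### Signed pairs: formulas close to monotone -/

section SignedPairs

variable {k n : ℕ}

/-- A minimal formula in signed form: `P` collects the positive clauses, and `Q` the remaining
clauses, each given by the sets of its positive and of its negative variables. A witness is
represented by the set of its true variables. -/
structure IsMinPair (k : ℕ) {n : ℕ} (P : Finset (Finset (Fin n)))
    (Q : Finset (Finset (Fin n) × Finset (Fin n))) : Prop where
  card_pos : ∀ S ∈ P, #S = k
  disjoint : ∀ c ∈ Q, Disjoint c.1 c.2
  nonempty : ∀ c ∈ Q, c.2.Nonempty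
  card_add : ∀ c ∈ Q, #c.1 + #c.2 = k
  witness_pos : ∀ S ∈ P, ∃ W : Finset (Fin n), S ⊆ W ∧ (∀ S' ∈ P, S' ⊆ W → S' = S) ∧
    ∀ c ∈ Q, c.1 ⊆ W → ¬ Disjoint c.2 W
  witness_neg : ∀ c ∈ Q, ∃ W : Finset (Fin n), c.1 ⊆ W ∧ Disjoint c.2 W ∧ (∀ S ∈ P, ¬ S ⊆ W) ∧
    ∀ c' ∈ Q, c'.1 ⊆ W → Disjoint c'.2 W → c' = c

/-- Every set of at least `η n` vertices contains a member of `P`. -/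
def DenseFam (η : ℝ) {n : ℕ} (P : Finset (Finset (Fin n))) : Prop :=
  ∀ X : Finset (Fin n), η * n ≤ #X → ∃ S ∈ P, S ⊆ X

theorem DenseFam.mono {η η' : ℝ} {P : Finset (Finset (Fin n))} (h : DenseFam η P) (hη : η ≤ η') :
    DenseFam η' P :=
  fun X hX => h X ((mul_le_mul_of_nonneg_right hη (Nat.cast_nonneg _)).trans hX)

/-- The unions of two distinct sets, one from each family, having exactly `k` elements. -/
noncomputable def unionSets (k : ℕ) {n : ℕ} (L M : Finset (Finset (Fin n))) :
    Finset (Finset (Fin n)) :=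
  (univ.powersetCard k).filter (fun E => ∃ D ∈ L, ∃ D' ∈ M, D ≠ D' ∧ D ∪ D' = E)

/-- If `unionSets L M` is dense then a positive proportion of `P` lies in it. -/
def JoinFam (k : ℕ) (γ ε : ℝ) {n : ℕ} (P : Finset (Finset (Fin n))) : Prop :=
  ∀ L ⊆ univ.powersetCard (k - 1), ∀ M ⊆ univ.powersetCard (k - 1),
    γ * (n : ℝ) ^ k ≤ #(unionSets k L M) → ε * (n : ℝ) ^ k ≤ #(P ∩ unionSets k L M)

theorem card_filter_superset_le (A : Finset (Fin n)) (j : ℕ) :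
    #((univ.powersetCard j).filter (fun Y => A ⊆ Y)) ≤ n ^ (j - #A) := by
  calc _ ≤ #((univ : Finset (Fin n)).powersetCard (j - #A)) := by
        refine card_le_card_of_injOn (fun Y => Y \ A) (fun Y hY => ?_) (fun Y hY Y' hY' h => ?_)
        · obtain ⟨h1, h2⟩ := mem_filter.1 hY
          rw [mem_coe, mem_powersetCard]
          exact ⟨subset_univ _, by rw [card_sdiff_of_subset h2, (mem_powersetCard.1 h1).2]⟩
        · rw [← sdiff_union_of_subset (mem_filter.1 hY).2,
            ← sdiff_union_of_subset (mem_filter.1 hY').2]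
          exact congrArg (· ∪ A) h
    _ ≤ n ^ (j - #A) := by
        rw [card_powersetCard, card_univ, Fintype.card_fin]
        exact Nat.choose_le_pow _ _

/-- The negative parts containing `A` of the clauses with a given positive part are few. -/
theorem IsMinPair.card_negParts_le {P : Finset (Finset (Fin n))}
    {Q : Finset (Finset (Fin n) × Finset (Fin n))} (h : IsMinPair k P Q) {η : ℝ} (hη : 0 ≤ η)
    (hP : DenseFam η P) (R A : Finset (Fin n)) {j : ℕ} (hj : #A < j) (𝒴 : Finset (Finset (Fin n)))
    (h𝒴 : ∀ Y ∈ 𝒴, (R, Y) ∈ Q ∧ #Y = j ∧ A ⊆ Y) : (#𝒴 : ℝ) ≤ 1 + η * (n : ℝ) ^ (j - #A) := by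
  classical
  rcases 𝒴.eq_empty_or_nonempty with rfl | ⟨Y₀, hY₀⟩
  · simp only [card_empty, Nat.cast_zero]; positivity
  obtain ⟨hY₀Q, -, hAY₀⟩ := h𝒴 Y₀ hY₀
  obtain ⟨W, hRW, hYW, hPW, huniq⟩ := h.witness_neg _ hY₀Q
  have hW : (#W : ℝ) ≤ η * n := by
    by_contra hcon
    obtain ⟨S, hS, hSW⟩ := hP W (not_le.1 hcon).le
    exact hPW S hS hSW
  have hsub : 𝒴.erase Y₀ ⊆ W.biUnion (fun w => (univ.powersetCard j).filter
      (fun Y => w ∉ A ∧ insert w A ⊆ Y)) := by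
    intro Y hY
    obtain ⟨hne, hY⟩ := mem_erase.1 hY
    obtain ⟨hYQ, hYj, hAY⟩ := h𝒴 Y hY
    have hnd : ¬ Disjoint Y W := fun hd => hne (congrArg Prod.snd (huniq _ hYQ hRW hd))
    obtain ⟨w, hwY, hwW⟩ := not_disjoint_iff.1 hnd
    exact mem_biUnion.2 ⟨w, hwW, mem_filter.2 ⟨mem_powersetCard.2 ⟨subset_univ _, hYj⟩,
      fun hwA => disjoint_left.1 hYW (hAY₀ hwA) hwW, insert_subset hwY hAY⟩⟩
  have h1 := card_le_of_subset_biUnion W _ _ ((n : ℝ) ^ (j - #A - 1)) hsub fun w hw => by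
    by_cases hwA : w ∈ A
    · simp [hwA]
    · have := card_filter_superset_le (insert w A) j
      rw [card_insert_of_notMem hwA, ← Nat.sub_sub] at this
      simp only [hwA, not_false_eq_true, true_and]
      exact_mod_cast this
  have h2 : (#𝒴 : ℝ) = #(𝒴.erase Y₀) + 1 := by
    rw [← card_erase_add_one hY₀]; push_cast; ring
  have h3 : (n : ℝ) ^ (j - #A) = n * (n : ℝ) ^ (j - #A - 1) := by
    rw [← pow_succ', Nat.sub_add_cancel (by omega)]
  rw [h2, h3, ← mul_assoc, add_comm]
  gcongr
  exact h1.trans (by gcongr)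

theorem IsMinPair.false_of_exchange {P : Finset (Finset (Fin n))}
    {Q : Finset (Finset (Fin n) × Finset (Fin n))} (h : IsMinPair k P Q)
    {c : Finset (Fin n) × Finset (Fin n)} (hc : c ∈ Q) {E : Finset (Fin n)} (hE : E ∈ P)
    (hRE : c.1 ⊆ E) (hYE : Disjoint c.2 E) (e : Fin n → Fin n)
    (he : ∀ y ∈ c.2, insert y (E.erase (e y)) ∈ P) : False := by
  obtain ⟨W, hEW, huniq, hQ⟩ := h.witness_pos E hE
  obtain ⟨y, hy, hyW⟩ := not_disjoint_iff.1 (hQ c hc (hRE.trans hEW))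
  have := huniq _ (he y hy) (insert_subset hyW ((erase_subset _ _).trans hEW))
  exact disjoint_left.1 hYE hy (this ▸ mem_insert_self _ _)

end SignedPairs

/-! ### Atypical positive parts -/

section AtypicalPositive

variable {k n : ℕ}

theorem card_le_of_forall_not_subset {α : Type*} [DecidableEq α] {m : ℕ} (𝓜 : Finset (Finset α)) :
    ∀ (𝒰 : Finset α) (𝒜 : Finset (Finset α)), (𝓜 : Set (Finset α)).PairwiseDisjoint id →
      (∀ T ∈ 𝓜, T ⊆ 𝒰 ∧ #T ≤ m) → (∀ P ∈ 𝒜, P ⊆ 𝒰 ∧ ∀ T ∈ 𝓜, ¬ T ⊆ P) →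
      (#𝒜 : ℝ) ≤ 2 ^ #𝒰 * (1 - 1 / 2 ^ m) ^ #𝓜 := by
  induction 𝓜 using Finset.induction_on with
  | empty =>
    intro 𝒰 𝒜 _ _ h𝒜
    have : #𝒜 ≤ 2 ^ #𝒰 := by
      rw [← card_powerset]
      exact card_le_card fun P hP => mem_powerset.2 (h𝒜 P hP).1
    simpa using (by exact_mod_cast this : (#𝒜 : ℝ) ≤ 2 ^ #𝒰)
  | insert T 𝓜 hT ih =>
    intro 𝒰 𝒜 hdisj h𝓜 h𝒜
    obtain ⟨hT𝒰, hTm⟩ := h𝓜 T (mem_insert_self _ _)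
    have h1 : #𝒜 ≤ #(T.powerset.erase T) * #(𝒜.image (fun P => P \ T)) := by
      rw [← card_product]
      refine card_le_card_of_injOn (fun P => (P ∩ T, P \ T)) (fun P hP => ?_)
        (fun P hP P' hP' h => ?_)
      · refine mem_coe.2 (mem_product.2 ⟨mem_erase.2 ⟨fun h => ?_, mem_powerset.2
          inter_subset_right⟩, mem_image_of_mem _ hP⟩)
        exact (h𝒜 P hP).2 T (mem_insert_self _ _) (inter_eq_right.1 h)
      · have h1 := congrArg Prod.fst h
        have h2 := congrArg Prod.snd h
        simp only at h1 h2
        rw [← sdiff_union_inter P T, ← sdiff_union_inter P' T, h1, h2]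
    have h2 := ih (𝒰 \ T) (𝒜.image (fun P => P \ T))
      (hdisj.subset (by simp)) (fun T' hT' => ⟨?_, (h𝓜 T' (mem_insert_of_mem hT')).2⟩)
      (fun P' hP' => ?_)
    · have h3 : (#(T.powerset.erase T) : ℝ) ≤ 2 ^ #T * (1 - 1 / 2 ^ m) := by
        rw [card_erase_of_mem (mem_powerset_self T), card_powerset,
          Nat.cast_sub (Nat.one_le_two_pow), mul_sub, mul_one]
        push_cast
        have : (2 : ℝ) ^ #T ≤ 2 ^ m := pow_le_pow_right₀ (by norm_num) hTm
        rw [mul_one_div]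
        have := (div_le_one (by positivity : (0 : ℝ) < 2 ^ m)).2 this
        linarith
      have h4 : (2 : ℝ) ^ #𝒰 = 2 ^ #T * 2 ^ #(𝒰 \ T) := by
        rw [← pow_add, card_sdiff_of_subset hT𝒰, Nat.add_sub_of_le (card_le_card hT𝒰)]
      rw [card_insert_of_notMem hT, pow_succ, h4]
      calc (#𝒜 : ℝ) ≤ #(T.powerset.erase T) * #(𝒜.image (fun P => P \ T)) := by exact_mod_cast h1
        _ ≤ (2 ^ #T * (1 - 1 / 2 ^ m)) * (2 ^ #(𝒰 \ T) * (1 - 1 / 2 ^ m) ^ #𝓜) := by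
          refine mul_le_mul h3 h2 (by positivity) ((Nat.cast_nonneg _).trans h3)
        _ = _ := by ring
    · refine subset_sdiff.2 ⟨(h𝓜 T' (mem_insert_of_mem hT')).1, ?_⟩
      exact hdisj (mem_insert_of_mem hT') (mem_insert_self _ _) (fun h => hT (h ▸ hT'))
    · obtain ⟨P, hP, rfl⟩ := mem_image.1 hP'
      refine ⟨sdiff_subset_sdiff (h𝒜 P hP).1 subset_rfl, fun T' hT' hsub => ?_⟩
      exact (h𝒜 P hP).2 T' (mem_insert_of_mem hT') (hsub.trans sdiff_subset)

theorem card_le_of_card_inter_le {α : Type*} [DecidableEq α] {𝒰 𝓔 : Finset α} (h𝓔 : 𝓔 ⊆ 𝒰) (s : ℝ)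
    (𝒜 : Finset (Finset α)) (h𝒜 : ∀ P ∈ 𝒜, P ⊆ 𝒰 ∧ (#(P ∩ 𝓔) : ℝ) ≤ s) :
    #𝒜 ≤ 2 ^ (#𝒰 - #𝓔) * #(𝓔.powerset.filter (fun X => (#X : ℝ) ≤ s)) := by
  rw [← card_sdiff_of_subset h𝓔, ← card_powerset, ← card_product]
  refine card_le_card_of_injOn (fun P => (P \ 𝓔, P ∩ 𝓔)) (fun P hP => ?_)
    (fun P hP P' hP' h => ?_)
  · exact mem_coe.2 (mem_product.2 ⟨mem_powerset.2 (sdiff_subset_sdiff (h𝒜 P hP).1 subset_rfl),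
      mem_filter.2 ⟨mem_powerset.2 inter_subset_right, (h𝒜 P hP).2⟩⟩)
  · have h1 := congrArg Prod.fst h
    have h2 := congrArg Prod.snd h
    simp only at h1 h2
    rw [← sdiff_union_inter P 𝓔, ← sdiff_union_inter P' 𝓔, h1, h2]

end AtypicalPositive

section AtypicalCount

variable {k n : ℕ}

theorem eventually_pow_le_mul_pow {a b : ℕ} (hab : a < b) {δ : ℝ} (hδ : 0 < δ) :
    ∀ᶠ n : ℕ in atTop, (n : ℝ) ^ a ≤ δ * (n : ℝ) ^ b := by
  filter_upwards [eventually_ge_atTop 1, tendsto_natCast_atTop_atTop.eventually_ge_atTop (1 / δ)]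
    with n hn1 hn
  have hn1' : (1 : ℝ) ≤ n := by exact_mod_cast hn1
  have h1 : 1 ≤ δ * n := by rwa [div_le_iff₀' hδ] at hn
  calc (n : ℝ) ^ a = 1 * (n : ℝ) ^ a := (one_mul _).symm
    _ ≤ δ * n * (n : ℝ) ^ a := by gcongr
    _ = δ * (n : ℝ) ^ (a + 1) := by ring
    _ ≤ δ * (n : ℝ) ^ b := by gcongr; exact hab

/-- The pairs of disjoint sets having `k` elements in total. -/
noncomputable def signedClauses (k n : ℕ) : Finset (Finset (Fin n) × Finset (Fin n)) :=
  (univ.powersetCard k).biUnion (fun S => S.powerset.image (fun R => (R, S \ R)))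

theorem mem_signedClauses {c : Finset (Fin n) × Finset (Fin n)} (h : Disjoint c.1 c.2)
    (hk : #c.1 + #c.2 = k) : c ∈ signedClauses k n := by
  refine mem_biUnion.2 ⟨c.1 ∪ c.2, mem_powersetCard.2 ⟨subset_univ _, ?_⟩,
    mem_image.2 ⟨c.1, mem_powerset.2 subset_union_left, ?_⟩⟩
  · rw [card_union_of_disjoint h, hk]
  · rw [union_sdiff_cancel_left h]

theorem card_signedClauses_le (k n : ℕ) : #(signedClauses k n) ≤ 2 ^ k * n ^ k := by
  calc _ ≤ #((univ : Finset (Fin n)).powersetCard k) * 2 ^ k :=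
        card_biUnion_le_card_mul _ _ _ fun S hS => card_image_le.trans
          (by rw [card_powerset, (mem_powersetCard.1 hS).2])
    _ ≤ _ := by
        rw [mul_comm, card_powersetCard, card_univ, Fintype.card_fin]
        gcongr
        exact Nat.choose_le_pow _ _

theorem exists_le_choose_ceil (k : ℕ) {η : ℝ} (hη : 0 < η) :
    ∃ c : ℝ, 0 < c ∧ ∀ᶠ n : ℕ in atTop, c * (n : ℝ) ^ k ≤ (⌈η * n⌉₊).choose k := by
  refine ⟨(η / 2) ^ k / k.factorial, by positivity, ?_⟩
  filter_upwards [tendsto_natCast_atTop_atTop.eventually_ge_atTop (2 * k / η)] with n hn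
  rw [div_le_iff₀ hη] at hn
  have h1 := Nat.le_ceil (η * n)
  have h2 : k ≤ ⌈η * n⌉₊ := by
    have : (k : ℝ) ≤ ⌈η * n⌉₊ := by nlinarith [(Nat.cast_nonneg k : (0 : ℝ) ≤ k)]
    exact_mod_cast this
  have h3 : η / 2 * n ≤ ((⌈η * n⌉₊ + 1 - k : ℕ) : ℝ) := by
    rw [Nat.cast_sub (by omega)]; push_cast; nlinarith
  have h4 : (((⌈η * n⌉₊ + 1 - k : ℕ) : ℝ)) ^ k ≤ k.factorial * (⌈η * n⌉₊).choose k := by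
    have := Nat.pow_sub_le_descFactorial ⌈η * n⌉₊ k
    rw [Nat.descFactorial_eq_factorial_mul_choose] at this
    exact_mod_cast this
  rw [div_mul_eq_mul_div, div_le_iff₀ (by positivity), ← mul_pow, mul_comm _ (k.factorial : ℝ)]
  exact (pow_le_pow_left₀ (by positivity) h3 k).trans h4

theorem card_not_denseFam_le {η : ℝ} (𝒜 : Finset (Finset (Finset (Fin n))))
    (h𝒜 : ∀ P ∈ 𝒜, P ⊆ univ.powersetCard k ∧ ¬ DenseFam η P) :
    (#𝒜 : ℝ) ≤ 2 ^ ((n : ℝ) + (n.choose k - (⌈η * n⌉₊).choose k)) := by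
  classical
  have hsub : 𝒜 ⊆ (univ.filter (fun X : Finset (Fin n) => η * n ≤ #X)).biUnion
      (fun X => 𝒜.filter (fun P => ∀ S ∈ P, ¬ S ⊆ X)) := by
    intro P hP
    obtain ⟨-, h⟩ := h𝒜 P hP
    simp only [DenseFam] at h
    push Not at h
    obtain ⟨X, hX, hXP⟩ := h
    exact mem_biUnion.2 ⟨X, mem_filter.2 ⟨mem_univ _, hX⟩, mem_filter.2 ⟨hP, hXP⟩⟩
  have h1 := card_le_of_subset_biUnion _ _ _
    (2 ^ ((n.choose k : ℝ) - (⌈η * n⌉₊).choose k)) hsub fun X hX => by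
    have hX' : ⌈η * n⌉₊ ≤ #X := Nat.ceil_le.2 (mem_filter.1 hX).2
    have hXn : (#X).choose k ≤ n.choose k :=
      Nat.choose_le_choose _ (by simpa using card_le_univ X)
    have h := card_le_of_card_inter_le (powersetCard_mono (n := k) (subset_univ X)) 0
      (𝒜.filter (fun P => ∀ S ∈ P, ¬ S ⊆ X)) fun P hP => by
        obtain ⟨hP, hPX⟩ := mem_filter.1 hP
        refine ⟨(h𝒜 P hP).1, ?_⟩
        have : P ∩ powersetCard k X = ∅ := eq_empty_of_forall_notMem fun S hS =>
          hPX S (mem_inter.1 hS).1 (mem_powersetCard.1 (mem_inter.1 hS).2).1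
        simp [this]
    have h2 : #((powersetCard k X).powerset.filter (fun Z => (#Z : ℝ) ≤ 0)) ≤ 1 :=
      card_le_one.2 fun a ha b hb => by
        have ha := (mem_filter.1 ha).2
        have hb := (mem_filter.1 hb).2
        norm_cast at ha hb
        rw [card_eq_zero.1 (Nat.le_zero.1 ha), card_eq_zero.1 (Nat.le_zero.1 hb)]
    have h3 := h.trans (Nat.mul_le_mul_left _ h2)
    rw [mul_one, card_powersetCard, card_powersetCard, card_univ, Fintype.card_fin] at h3
    calc _ ≤ ((2 ^ (n.choose k - (#X).choose k) : ℕ) : ℝ) := by exact_mod_cast h3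
      _ = 2 ^ ((n.choose k : ℝ) - (#X).choose k) := by
        rw [← Nat.cast_sub hXn, Real.rpow_natCast]; norm_num
      _ ≤ _ := by
        refine Real.rpow_le_rpow_of_exponent_le (by norm_num) ?_
        gcongr
  rw [Real.rpow_add (by norm_num), Real.rpow_natCast]
  refine h1.trans (mul_le_mul_of_nonneg_right ?_ (by positivity))
  have : #(univ.filter (fun X : Finset (Fin n) => η * n ≤ #X)) ≤ 2 ^ n :=
    (card_filter_le _ _).trans (by simp)
  exact_mod_cast this

theorem unionSets_subset (L M : Finset (Finset (Fin n))) : unionSets k L M ⊆ univ.powersetCard k :=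
  filter_subset _ _

theorem exists_card_not_joinFam_le (k : ℕ) {γ : ℝ} (hγ : 0 < γ) : ∃ ε : ℝ, 0 < ε ∧
    ∀ (n : ℕ) (𝒜 : Finset (Finset (Finset (Fin n)))),
      (∀ P ∈ 𝒜, P ⊆ univ.powersetCard k ∧ ¬ JoinFam k γ ε P) →
      (#𝒜 : ℝ) ≤ 2 ^ (2 * (n : ℝ) ^ (k - 1) + (n.choose k - γ / 2 * (n : ℝ) ^ k)) := by
  classical
  obtain ⟨ε, hε, hsmall⟩ := exists_card_small_subsets_le (γ / 2) (by positivity)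
  refine ⟨ε, hε, fun n 𝒜 h𝒜 => ?_⟩
  set I := ((univ : Finset (Fin n)).powersetCard (k - 1)).powerset with hI
  have hsub : 𝒜 ⊆ ((I ×ˢ I).filter (fun p => γ * (n : ℝ) ^ k ≤ #(unionSets k p.1 p.2))).biUnion
      (fun p => 𝒜.filter (fun P => (#(P ∩ unionSets k p.1 p.2) : ℝ) ≤ ε * (n : ℝ) ^ k)) := by
    intro P hP
    obtain ⟨-, h⟩ := h𝒜 P hP
    simp only [JoinFam] at h
    push Not at h
    obtain ⟨L, hL, M, hM, h1, h2⟩ := h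
    exact mem_biUnion.2 ⟨(L, M), mem_filter.2 ⟨mem_product.2 ⟨mem_powerset.2 hL,
      mem_powerset.2 hM⟩, h1⟩, mem_filter.2 ⟨hP, h2.le⟩⟩
  have hck : (#((univ : Finset (Fin n)).powersetCard k)) = n.choose k := by simp
  have hch : (n.choose k : ℝ) ≤ (n : ℝ) ^ k := by exact_mod_cast Nat.choose_le_pow _ _
  have h1 := card_le_of_subset_biUnion _ _ _
    (2 ^ ((n.choose k : ℝ) - γ / 2 * (n : ℝ) ^ k)) hsub fun p hp => by
    have hp' := (mem_filter.1 hp).2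
    have hle := card_le_card (unionSets_subset (k := k) p.1 p.2)
    have h := card_le_of_card_inter_le (unionSets_subset (k := k) p.1 p.2) (ε * (n : ℝ) ^ k)
      (𝒜.filter (fun P => (#(P ∩ unionSets k p.1 p.2) : ℝ) ≤ ε * (n : ℝ) ^ k)) fun P hP => by
        obtain ⟨hP, hPX⟩ := mem_filter.1 hP
        exact ⟨(h𝒜 P hP).1, hPX⟩
    have h2 := hsmall (unionSets k p.1 p.2) ((n : ℝ) ^ k)
      (le_trans (by exact_mod_cast hle) (hck ▸ hch))
    calc _ ≤ ((2 ^ (#((univ : Finset (Fin n)).powersetCard k) - #(unionSets k p.1 p.2)) : ℕ) : ℝ) *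
          #((unionSets k p.1 p.2).powerset.filter (fun X => (#X : ℝ) ≤ ε * (n : ℝ) ^ k)) := by
          exact_mod_cast h
      _ ≤ 2 ^ ((n.choose k : ℝ) - γ * (n : ℝ) ^ k) * 2 ^ (γ / 2 * (n : ℝ) ^ k) := by
        refine mul_le_mul ?_ h2 (by positivity) (by positivity)
        push_cast
        rw [← Real.rpow_natCast, Nat.cast_sub hle, hck]
        refine Real.rpow_le_rpow_of_exponent_le (by norm_num) ?_
        linarith
      _ = _ := by
        rw [← Real.rpow_add (by norm_num)]; congr 1; ring
  rw [Real.rpow_add (by norm_num)]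
  refine h1.trans (mul_le_mul_of_nonneg_right ?_ (by positivity))
  have h2 : #((I ×ˢ I).filter (fun p => γ * (n : ℝ) ^ k ≤ #(unionSets k p.1 p.2))) ≤
      2 ^ (2 * n ^ (k - 1)) := by
    refine (card_filter_le _ _).trans ?_
    rw [card_product, hI, card_powerset, ← pow_add, card_powersetCard, card_univ, Fintype.card_fin,
      ← two_mul]
    exact Nat.pow_le_pow_right (by norm_num) (Nat.mul_le_mul_left _ (Nat.choose_le_pow _ _))
  calc _ ≤ ((2 ^ (2 * n ^ (k - 1)) : ℕ) : ℝ) := by exact_mod_cast h2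
    _ = (2 : ℝ) ^ ((2 * n ^ (k - 1) : ℕ) : ℝ) := by rw [Real.rpow_natCast]; push_cast; rfl
    _ = _ := by push_cast; rfl

theorem exists_card_atypical_le (k : ℕ) (hk : 2 ≤ k) {η γ : ℝ} (hη : 0 < η) (hγ : 0 < γ) :
    ∃ ε : ℝ, 0 < ε ∧ ∃ ζ : ℝ, 0 < ζ ∧ ∃ c : ℝ, 0 < c ∧ ∀ᶠ n : ℕ in atTop,
      ∀ 𝒜 : Finset (Finset (Finset (Fin n)) × Finset (Finset (Fin n) × Finset (Fin n))),
        (∀ x ∈ 𝒜, x.1 ⊆ univ.powersetCard k ∧ x.2 ⊆ signedClauses k n ∧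
          (#x.2 : ℝ) ≤ ζ * (n : ℝ) ^ k ∧ ¬ (DenseFam η x.1 ∧ JoinFam k γ ε x.1)) →
        (#𝒜 : ℝ) ≤ 2 ^ ((n.choose k : ℝ) - c * (n : ℝ) ^ k) := by
  classical
  obtain ⟨ε, hε, hJ⟩ := exists_card_not_joinFam_le k hγ
  obtain ⟨c₁, hc₁, hD⟩ := exists_le_choose_ceil k hη
  obtain ⟨e, he, he1, he2⟩ : ∃ e : ℝ, 0 < e ∧ e ≤ c₁ / 2 ∧ e ≤ γ / 4 :=
    ⟨min (c₁ / 2) (γ / 4), by positivity, min_le_left _ _, min_le_right _ _⟩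
  obtain ⟨ζ, hζ, hsmall⟩ := exists_card_small_subsets_le (e / 4 / 2 ^ k) (by positivity)
  refine ⟨ε, hε, ζ, hζ, e / 2, by positivity, ?_⟩
  filter_upwards [hD, eventually_pow_le_mul_pow (a := 1) (b := k) (by omega) (half_pos hc₁),
    eventually_pow_le_mul_pow (a := k - 1) (b := k) (by omega) (δ := γ / 8) (by positivity),
    eventually_pow_le_mul_pow (a := 0) (b := k) (by omega) (δ := e / 4) (by positivity)]
    with n hD h1 h2 h3 𝒜 h𝒜
  rw [pow_one] at h1
  rw [pow_zero] at h3
  have hA1 := card_not_denseFam_le (k := k) ((𝒜.image Prod.fst).filter (fun P => ¬ DenseFam η P))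
    fun P hP => by
      obtain ⟨hP, hPd⟩ := mem_filter.1 hP
      obtain ⟨x, hx, rfl⟩ := mem_image.1 hP
      exact ⟨(h𝒜 x hx).1, hPd⟩
  have hA2 := hJ n ((𝒜.image Prod.fst).filter (fun P => ¬ JoinFam k γ ε P))
    fun P hP => by
      obtain ⟨hP, hPd⟩ := mem_filter.1 hP
      obtain ⟨x, hx, rfl⟩ := mem_image.1 hP
      exact ⟨(h𝒜 x hx).1, hPd⟩
  have hA3 := hsmall (signedClauses k n) (2 ^ k * (n : ℝ) ^ k) (by
    exact_mod_cast card_signedClauses_le k n)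
  have hcard : #𝒜 ≤ (#((𝒜.image Prod.fst).filter (fun P => ¬ DenseFam η P)) +
      #((𝒜.image Prod.fst).filter (fun P => ¬ JoinFam k γ ε P))) *
      #((signedClauses k n).powerset.filter (fun X => (#X : ℝ) ≤ ζ * (2 ^ k * (n : ℝ) ^ k))) := by
    refine le_trans ?_ (Nat.mul_le_mul_right _ (card_union_le _ _))
    rw [← card_product]
    refine card_le_card fun x hx => mem_product.2 ⟨?_, mem_filter.2 ⟨mem_powerset.2 (h𝒜 x hx).2.1,
      (h𝒜 x hx).2.2.1.trans ?_⟩⟩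
    · obtain ⟨-, -, -, h⟩ := h𝒜 x hx
      rw [mem_union, mem_filter, mem_filter]
      by_cases hd : DenseFam η x.1
      · exact Or.inr ⟨mem_image_of_mem _ hx, fun hj => h ⟨hd, hj⟩⟩
      · exact Or.inl ⟨mem_image_of_mem _ hx, hd⟩
    · have : (1 : ℝ) ≤ 2 ^ k := one_le_pow₀ (by norm_num)
      gcongr
      exact le_mul_of_one_le_left (by positivity) this
  have hpos : 0 ≤ (n : ℝ) ^ k := by positivity
  calc (#𝒜 : ℝ) ≤ (#((𝒜.image Prod.fst).filter (fun P => ¬ DenseFam η P)) +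
      #((𝒜.image Prod.fst).filter (fun P => ¬ JoinFam k γ ε P))) *
      #((signedClauses k n).powerset.filter (fun X => (#X : ℝ) ≤ ζ * (2 ^ k * (n : ℝ) ^ k))) := by
        exact_mod_cast hcard
    _ ≤ (2 ^ ((n.choose k : ℝ) - e * (n : ℝ) ^ k) + 2 ^ ((n.choose k : ℝ) - e * (n : ℝ) ^ k)) *
        2 ^ (e / 4 * (n : ℝ) ^ k) := by
      gcongr
      · refine hA1.trans (Real.rpow_le_rpow_of_exponent_le (by norm_num) ?_)
        nlinarith
      · refine hA2.trans (Real.rpow_le_rpow_of_exponent_le (by norm_num) ?_)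
        nlinarith
      · refine hA3.trans (Real.rpow_le_rpow_of_exponent_le (by norm_num) (le_of_eq ?_))
        field_simp
    _ = 2 ^ (1 + ((n.choose k : ℝ) - e * (n : ℝ) ^ k) + e / 4 * (n : ℝ) ^ k) := by
      rw [← two_mul, Real.rpow_add (by norm_num), Real.rpow_add (by norm_num), Real.rpow_one]
    _ ≤ _ := by
      refine Real.rpow_le_rpow_of_exponent_le (by norm_num) ?_
      linarith

end AtypicalCount

/-! ### Exchange edges and rich sets -/

section RichSets

variable {k n : ℕ}

/-- The family `T` meets every exchange edge of `Q`. -/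
def HitsExchanges (k : ℕ) {n : ℕ} (Q : Finset (Finset (Fin n) × Finset (Fin n)))
    (T : Finset (Finset (Fin n))) : Prop :=
  ∀ c ∈ Q, ∀ E : Finset (Fin n), #E = k → c.1 ⊆ E → Disjoint c.2 E → ∀ e : Fin n → Fin n,
    (∀ y ∈ c.2, e y ∈ E) → E ∈ T ∨ ∃ y ∈ c.2, insert y (E.erase (e y)) ∈ T

theorem exists_maximal_disjoint {α : Type*} [DecidableEq α] (𝒦 : Finset (Finset α))
    (h𝒦 : ∀ T ∈ 𝒦, T.Nonempty) : ∃ 𝓜 ⊆ 𝒦, (𝓜 : Set (Finset α)).PairwiseDisjoint id ∧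
      ∀ T ∈ 𝒦, ∃ x ∈ T, x ∈ 𝓜.biUnion id := by
  classical
  obtain ⟨𝓜, h𝓜, hmax⟩ := exists_max_image
    (𝒦.powerset.filter (fun 𝓜 : Finset (Finset α) => (𝓜 : Set (Finset α)).PairwiseDisjoint id)) card
    ⟨∅, mem_filter.2 ⟨empty_mem_powerset _, by simp⟩⟩
  obtain ⟨hsub, hdisj⟩ := mem_filter.1 h𝓜
  rw [mem_powerset] at hsub
  refine ⟨𝓜, hsub, hdisj, fun T hT => ?_⟩
  by_contra! hcon
  have hT𝓜 : ∀ T' ∈ 𝓜, Disjoint T T' := fun T' hT' => disjoint_left.2 fun x hx hx' =>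
    hcon x hx (mem_biUnion.2 ⟨T', hT', hx'⟩)
  have hnot : T ∉ 𝓜 := fun h => (h𝒦 T hT).ne_empty (disjoint_self.1 (hT𝓜 T h))
  have := hmax (insert T 𝓜) (mem_filter.2 ⟨mem_powerset.2 (insert_subset hT hsub), by
    rw [coe_insert]
    exact hdisj.insert fun T' hT' _ => hT𝓜 T' hT'⟩)
  rw [card_insert_of_notMem hnot] at this
  omega

/-- The sets that can never all be positive clauses once `Q` is given contain a large disjoint
family whose union meets every exchange edge. -/
theorem exists_exchange_matching (k : ℕ) {n : ℕ} (Q : Finset (Finset (Fin n) × Finset (Fin n)))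
    (hQ : Q ⊆ signedClauses k n) :
    ∃ 𝓜 : Finset (Finset (Finset (Fin n))), (𝓜 : Set (Finset (Finset (Fin n)))).PairwiseDisjoint id ∧
      (∀ T ∈ 𝓜, T ⊆ univ.powersetCard k ∧ #T ≤ k + 1) ∧
      (∀ P, IsMinPair k P Q → ∀ T ∈ 𝓜, ¬ T ⊆ P) ∧ HitsExchanges k Q (𝓜.biUnion id) := by
  classical
  let f : Finset (Fin n) → Finset (Fin n) → (Fin n → Fin n) → Finset (Finset (Fin n)) :=
    fun Y E e => insert E (Y.image (fun y => insert y (E.erase (e y))))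
  let 𝒦 : Finset (Finset (Finset (Fin n))) := univ.filter (fun T => ∃ c ∈ Q, ∃ E : Finset (Fin n),
    #E = k ∧ c.1 ⊆ E ∧ Disjoint c.2 E ∧ ∃ e : Fin n → Fin n, (∀ y ∈ c.2, e y ∈ E) ∧ T = f c.2 E e)
  obtain ⟨𝓜, hsub, hdisj, hmax⟩ := exists_maximal_disjoint 𝒦 fun T hT => by
    obtain ⟨-, c, -, E, -, -, -, e, -, rfl⟩ := mem_filter.1 hT
    exact ⟨E, mem_insert_self _ _⟩
  refine ⟨𝓜, hdisj, fun T hT => ?_, fun P hP T hT hTP => ?_, fun c hc E hE hcE hdE e he => ?_⟩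
  · obtain ⟨-, c, hc, E, hE, -, hd, e, he, rfl⟩ := mem_filter.1 (hsub hT)
    refine ⟨insert_subset (mem_powersetCard.2 ⟨subset_univ _, hE⟩) fun S hS => ?_, ?_⟩
    · obtain ⟨y, hy, rfl⟩ := mem_image.1 hS
      refine mem_powersetCard.2 ⟨subset_univ _, ?_⟩
      rw [card_insert_of_notMem (fun h => disjoint_left.1 hd hy (mem_of_mem_erase h)),
        card_erase_add_one (he y hy), hE]
    · refine (card_insert_le _ _).trans (Nat.succ_le_succ (card_image_le.trans ?_))
      obtain ⟨S, hS, hcS⟩ := mem_biUnion.1 (hQ hc)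
      obtain ⟨R, -, rfl⟩ := mem_image.1 hcS
      exact (card_le_card sdiff_subset).trans (mem_powersetCard.1 hS).2.le
  · obtain ⟨-, c, hc, E, -, hcE, hd, e, -, rfl⟩ := mem_filter.1 (hsub hT)
    exact hP.false_of_exchange hc (hTP (mem_insert_self _ _)) hcE hd e fun y hy =>
      hTP (mem_insert_of_mem (mem_image_of_mem _ hy))
  · obtain ⟨x, hx, hxM⟩ := hmax (f c.2 E e)
      (mem_filter.2 ⟨mem_univ _, c, hc, E, hE, hcE, hdE, e, he, rfl⟩)
    rcases mem_insert.1 hx with rfl | hx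
    · exact Or.inl hxM
    · obtain ⟨y, hy, rfl⟩ := mem_image.1 hx
      exact Or.inr ⟨y, hy, hxM⟩

/-- The sets of fewer than `k` vertices contained in many members of `T`. -/
noncomputable def richSets (k : ℕ) (c : ℝ) {n : ℕ} (T : Finset (Finset (Fin n))) :
    Finset (Finset (Fin n)) :=
  univ.filter (fun S => #S < k ∧ c * (n : ℝ) ^ (k - #S) ≤ #(T.filter (fun E => S ⊆ E)))

theorem sum_richSets_le {c : ℝ} {T : Finset (Finset (Fin n))} (hT : ∀ E ∈ T, #E = k) :
    c * ∑ S ∈ richSets k c T, (n : ℝ) ^ (k - #S) ≤ 2 ^ k * #T := by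
  rw [mul_sum]
  calc _ ≤ ∑ S ∈ richSets k c T, (#(T.filter (fun E => S ⊆ E)) : ℝ) :=
        sum_le_sum fun S hS => (mem_filter.1 hS).2.2
    _ = ((∑ S ∈ richSets k c T, #(T.bipartiteAbove (fun S E => S ⊆ E) S) : ℕ) : ℝ) := by
        push_cast; rfl
    _ = ∑ E ∈ T, (#((richSets k c T).bipartiteBelow (fun S E => S ⊆ E) E) : ℝ) := by
        rw [sum_card_bipartiteAbove_eq_sum_card_bipartiteBelow]; push_cast; rfl
    _ ≤ ∑ E ∈ T, (2 : ℝ) ^ k := by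
        refine sum_le_sum fun E hE => ?_
        have : #((richSets k c T).bipartiteBelow (fun S E => S ⊆ E) E) ≤ 2 ^ k := by
          rw [← hT E hE, ← card_powerset]
          exact card_le_card fun S hS => mem_powerset.2 (mem_filter.1 hS).2
        exact_mod_cast this
    _ = _ := by rw [sum_const, nsmul_eq_mul, mul_comm]

theorem exists_popular_exchange {Q : Finset (Finset (Fin n) × Finset (Fin n))}
    {T : Finset (Finset (Fin n))} (hT : HitsExchanges k Q T) {R Y : Finset (Fin n)}
    (hc : (R, Y) ∈ Q) (hRY : Disjoint R Y) (hY : Y.Nonempty) (hk : #R + #Y = k)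
    (g : Finset (Fin n) → Fin n)
    (hg : ∀ X ∈ (univ \ (R ∪ Y)).powersetCard #Y, g X ∈ R ∪ X) :
    ((n - k).choose #Y : ℝ) / (2 * k) ≤ #(T.filter (fun E => R ⊆ E)) ∨
      ∃ y ∈ Y, ((n - k).choose #Y : ℝ) / (2 * k) ≤
        #(((univ \ (R ∪ Y)).powersetCard #Y).filter
          (fun X => insert y ((R ∪ X).erase (g X)) ∈ T)) := by
  classical
  set 𝒳 := (univ \ (R ∪ Y)).powersetCard #Y with h𝒳
  have hcard : #𝒳 = (n - k).choose #Y := by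
    rw [h𝒳, card_powersetCard, card_sdiff_of_subset (subset_univ _), card_union_of_disjoint hRY, hk,
      card_univ, Fintype.card_fin]
  have hk0 : (1 : ℝ) ≤ k := by
    have := hY.card_pos
    exact_mod_cast (by omega : 1 ≤ k)
  have hX : ∀ X ∈ 𝒳, Disjoint R X ∧ Disjoint Y X ∧ #X = #Y := by
    intro X hX
    obtain ⟨h1, h2⟩ := mem_powersetCard.1 hX
    have h3 : Disjoint X (R ∪ Y) := (subset_sdiff.1 h1).2
    exact ⟨(disjoint_union_right.1 h3).1.symm, (disjoint_union_right.1 h3).2.symm, h2⟩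
  by_contra! hcon
  obtain ⟨h1, h2⟩ := hcon
  have hsub : 𝒳 ⊆ 𝒳.filter (fun X => R ∪ X ∈ T) ∪
      Y.biUnion (fun y => 𝒳.filter (fun X => insert y ((R ∪ X).erase (g X)) ∈ T)) := by
    intro X hXX
    obtain ⟨hRX, hYX, hXc⟩ := hX X hXX
    rcases hT _ hc (R ∪ X) (by rw [card_union_of_disjoint hRX, hXc, hk]) subset_union_left
      (disjoint_union_right.2 ⟨hRY.symm, hYX⟩) (fun _ => g X) (fun _ _ => hg X hXX) with h | h
    · exact mem_union_left _ (mem_filter.2 ⟨hXX, h⟩)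
    · obtain ⟨y, hy, h⟩ := h
      exact mem_union_right _ (mem_biUnion.2 ⟨y, hy, mem_filter.2 ⟨hXX, h⟩⟩)
  have h3 : #(𝒳.filter (fun X => R ∪ X ∈ T)) ≤ #(T.filter (fun E => R ⊆ E)) := by
    refine card_le_card_of_injOn (fun X => R ∪ X) (fun X hXX => ?_) (fun X hXX X' hXX' h => ?_)
    · exact mem_coe.2 (mem_filter.2 ⟨(mem_filter.1 hXX).2, subset_union_left⟩)
    · have e1 := union_sdiff_cancel_left (hX X (mem_filter.1 hXX).1).1
      have e2 := union_sdiff_cancel_left (hX X' (mem_filter.1 hXX').1).1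
      rw [← e1, ← e2]
      exact congrArg (· \ R) h
  have h4 := card_le_of_subset_biUnion Y _ _ (((n - k).choose #Y : ℝ) / (2 * k)) subset_rfl
    fun y hy => (h2 y hy).le
  have h5 := (card_le_card hsub).trans (card_union_le _ _)
  have h6 : (#𝒳 : ℝ) ≤ #(𝒳.filter (fun X => R ∪ X ∈ T)) + #(Y.biUnion
      (fun y => 𝒳.filter (fun X => insert y ((R ∪ X).erase (g X)) ∈ T))) := by exact_mod_cast h5
  have h7 : (#(𝒳.filter (fun X => R ∪ X ∈ T)) : ℝ) ≤ #(T.filter (fun E => R ⊆ E)) := by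
    exact_mod_cast h3
  rw [hcard] at h6
  have h8 : (#Y : ℝ) ≤ k := by exact_mod_cast (by omega : #Y ≤ k)
  have h9 : (0 : ℝ) ≤ ((n - k).choose #Y : ℝ) / (2 * k) := by positivity
  have h10 : ((n - k).choose #Y : ℝ) = 2 * k * (((n - k).choose #Y : ℝ) / (2 * k)) := by field_simp
  nlinarith

theorem recover_of_exchange {R X : Finset (Fin n)} {x y : Fin n} (hRX : Disjoint R X)
    (hx : x ∈ R ∪ X) (hy : y ∉ R ∪ X) :
    insert x ((insert y ((R ∪ X).erase x)).erase y) \ R = X := by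
  rw [erase_insert (fun h => hy (mem_of_mem_erase h)), insert_erase hx,
    union_sdiff_cancel_left hRX]

theorem exists_choose_lower (k : ℕ) (hk : 1 ≤ k) : ∃ c : ℝ, 0 < c ∧ ∀ᶠ n : ℕ in atTop, ∀ j ≤ k,
    c * (n : ℝ) ^ j ≤ ((n - k).choose j : ℝ) / (2 * k) := by
  refine ⟨1 / (2 ^ k * k.factorial * (2 * k)), by positivity, ?_⟩
  filter_upwards [eventually_ge_atTop (4 * k)] with n hn j hj
  have h1 : ((n : ℝ) / 2) ^ j ≤ j.factorial * (n - k).choose j := by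
    have h2 := Nat.pow_sub_le_descFactorial (n - k) j
    rw [Nat.descFactorial_eq_factorial_mul_choose] at h2
    have h3 : (n : ℝ) / 2 ≤ ((n - k + 1 - j : ℕ) : ℝ) := by
      have : (n : ℝ) ≤ ((2 * (n - k + 1 - j) : ℕ) : ℝ) := by exact_mod_cast (by omega)
      push_cast at this
      linarith
    refine (pow_le_pow_left₀ (by positivity) h3 j).trans ?_
    exact_mod_cast h2
  have h2 : (j.factorial : ℝ) ≤ k.factorial := by exact_mod_cast Nat.factorial_le hj
  have h3 : (2 : ℝ) ^ j ≤ 2 ^ k := pow_le_pow_right₀ (by norm_num) hj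
  have hk' : (0 : ℝ) < k := by exact_mod_cast hk
  rw [div_pow, div_le_iff₀ (by positivity)] at h1
  rw [div_mul_eq_mul_div, one_mul, div_le_div_iff₀ (by positivity) (by positivity)]
  calc (n : ℝ) ^ j * (2 * k) ≤ (k.factorial * (n - k).choose j * 2 ^ k) * (2 * k) := by
        gcongr
        exact h1.trans (by gcongr)
    _ = _ := by ring

theorem exists_rich (k : ℕ) (hk : 1 ≤ k) : ∃ c : ℝ, 0 < c ∧ ∀ᶠ n : ℕ in atTop,
    ∀ (Q : Finset (Finset (Fin n) × Finset (Fin n))) (T : Finset (Finset (Fin n))),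
      HitsExchanges k Q T → ∀ R Y : Finset (Fin n), (R, Y) ∈ Q → Disjoint R Y → Y.Nonempty →
        #R + #Y = k →
        (∃ S ∈ richSets k c T, ∃ A ⊆ S, #A ≤ 1 ∧ S \ A = R ∧ A ⊆ Y ∧ #Y = k - #S + #A) ∨
          ∃ v, Y = {v} ∧ ∀ d ∈ R, insert v (R.erase d) ∈ richSets k c T := by
  obtain ⟨c, hc, hev⟩ := exists_choose_lower k hk
  refine ⟨c, hc, ?_⟩
  filter_upwards [hev, eventually_gt_atTop 0] with n hn hn0 Q T hT R Y hRYQ hRY hY hRYk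
  have hn0' : (0 : ℝ) < n := by exact_mod_cast hn0
  have hYk := hn #Y (by omega)
  have hYpos := hY.card_pos
  have hX : ∀ X ∈ (univ \ (R ∪ Y)).powersetCard #Y, Disjoint R X ∧ Disjoint Y X ∧ #X = #Y := by
    intro X hX
    obtain ⟨h1, h2⟩ := mem_powersetCard.1 hX
    have h3 : Disjoint X (R ∪ Y) := (subset_sdiff.1 h1).2
    exact ⟨(disjoint_union_right.1 h3).1.symm, (disjoint_union_right.1 h3).2.symm, h2⟩
  by_cases hR : R ∈ richSets k c T
  · exact Or.inl ⟨R, hR, ∅, empty_subset _, by simp, by simp, empty_subset _, by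
      rw [card_empty]; omega⟩
  have hRc : ¬ ((n - k).choose #Y : ℝ) / (2 * k) ≤ #(T.filter (fun E => R ⊆ E)) := fun h =>
    hR (mem_filter.2 ⟨mem_univ _, by omega, by
      rw [show k - #R = #Y by omega]; exact hYk.trans h⟩)
  by_cases hY1 : #Y = 1
  · obtain ⟨v, rfl⟩ := card_eq_one.1 hY1
    refine Or.inr ⟨v, rfl, fun d hd => ?_⟩
    have hvR : v ∉ R := fun h => disjoint_left.1 hRY h (mem_singleton_self _)
    rcases exists_popular_exchange hT hRYQ hRY hY hRYk (fun _ => d)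
      (fun X _ => mem_union_left _ hd) with h | ⟨y, hy, h⟩
    · exact absurd h hRc
    obtain rfl := mem_singleton.1 hy
    have hcardS : #(insert y (R.erase d)) = #R := by
      rw [card_insert_of_notMem (fun h => hvR (mem_of_mem_erase h)), card_erase_add_one hd]
    refine mem_filter.2 ⟨mem_univ _, by omega, ?_⟩
    rw [hcardS, show k - #R = #({y} : Finset (Fin n)) by omega]
    refine hYk.trans (h.trans ?_)
    have : #(((univ \ (R ∪ {y})).powersetCard #{y}).filter
        (fun X => insert y ((R ∪ X).erase d) ∈ T)) ≤
        #(T.filter (fun E => insert y (R.erase d) ⊆ E)) := by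
      refine card_le_card_of_injOn (fun X => insert y ((R ∪ X).erase d)) (fun X hXX => ?_)
        (fun X hXX X' hXX' h => ?_)
      · exact mem_coe.2 (mem_filter.2 ⟨(mem_filter.1 hXX).2,
          insert_subset_insert _ (erase_subset_erase _ subset_union_left)⟩)
      · obtain ⟨h1, h2, -⟩ := hX X (mem_filter.1 hXX).1
        obtain ⟨h1', h2', -⟩ := hX X' (mem_filter.1 hXX').1
        rw [disjoint_singleton_left] at h2 h2'
        rw [← recover_of_exchange h1 (mem_union_left _ hd) (y := y) (by simp [hvR, h2]),
          ← recover_of_exchange h1' (mem_union_left _ hd) (y := y) (by simp [hvR, h2'])]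
        exact congrArg (fun Z => insert d (Z.erase y) \ R) h
    exact_mod_cast this
  · have hg : ∀ X : Finset (Fin n), ∃ x, X.Nonempty → x ∈ X := fun X => by
      by_cases h : X.Nonempty
      · exact ⟨h.choose, fun _ => h.choose_spec⟩
      · exact ⟨hY.choose, fun h' => absurd h' h⟩
    choose g hg using hg
    have hg' : ∀ X ∈ (univ \ (R ∪ Y)).powersetCard #Y, g X ∈ R ∪ X := fun X hXX =>
      mem_union_right _ (hg X (card_pos.1 (by rw [(hX X hXX).2.2]; exact hYpos)))
    rcases exists_popular_exchange hT hRYQ hRY hY hRYk g hg' with h | ⟨y, hy, h⟩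
    · exact absurd h hRc
    have hyR : y ∉ R := fun h => disjoint_left.1 hRY h hy
    refine Or.inl ⟨insert y R, mem_filter.2 ⟨mem_univ _, ?_, ?_⟩, {y},
      singleton_subset_iff.2 (mem_insert_self _ _), by simp, ?_, singleton_subset_iff.2 hy, ?_⟩
    · rw [card_insert_of_notMem hyR]; omega
    · have h1 : #(((univ \ (R ∪ Y)).powersetCard #Y).filter
          (fun X => insert y ((R ∪ X).erase (g X)) ∈ T)) ≤
          #((univ : Finset (Fin n)) ×ˢ T.filter (fun E => insert y R ⊆ E)) := by
        have hgX : ∀ X ∈ (univ \ (R ∪ Y)).powersetCard #Y, g X ∈ X := fun X hXX =>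
          hg X (card_pos.1 (by rw [(hX X hXX).2.2]; exact hYpos))
        refine card_le_card_of_injOn (fun X => (g X, insert y ((R ∪ X).erase (g X))))
          (fun X hXX => ?_) (fun X hXX X' hXX' h => ?_)
        · refine mem_coe.2 (mem_product.2 ⟨mem_univ _, mem_filter.2 ⟨(mem_filter.1 hXX).2,
            insert_subset_insert _ (subset_erase.2 ⟨subset_union_left, ?_⟩)⟩⟩)
          exact fun hgR => disjoint_left.1 (hX X (mem_filter.1 hXX).1).1 hgR
            (hgX X (mem_filter.1 hXX).1)
        · obtain ⟨h1, h2, -⟩ := hX X (mem_filter.1 hXX).1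
          obtain ⟨h1', h2', -⟩ := hX X' (mem_filter.1 hXX').1
          rw [← recover_of_exchange h1 (hg' X (mem_filter.1 hXX).1) (y := y)
            (by simp [hyR, disjoint_left.1 h2 hy]),
            ← recover_of_exchange h1' (hg' X' (mem_filter.1 hXX').1) (y := y)
            (by simp [hyR, disjoint_left.1 h2' hy])]
          have e1 := congrArg Prod.fst h
          have e2 := congrArg Prod.snd h
          simp only at e1 e2
          rw [e2, e1]
      rw [card_product, card_univ, Fintype.card_fin] at h1
      have h2 : c * (n : ℝ) ^ #Y ≤ n * #(T.filter (fun E => insert y R ⊆ E)) :=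
        hYk.trans (h.trans (by exact_mod_cast h1))
      rw [card_insert_of_notMem hyR, show k - (#R + 1) = #Y - 1 by omega]
      rw [show #Y = #Y - 1 + 1 by omega, pow_succ, ← mul_assoc, mul_comm (n : ℝ)] at h2
      exact le_of_mul_le_mul_right h2 hn0'
    · rw [insert_sdiff_of_mem _ (mem_singleton_self _), sdiff_singleton_eq_erase,
        erase_eq_of_notMem hyR]
    · rw [card_insert_of_notMem hyR, card_singleton]; omega

end RichSets

/-! ### Counting the negative parts with prescribed rich sets -/

section ClosedFamilies

variable {n : ℕ}

open scoped FinsetFamily in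
theorem exists_shadow_le {r : ℕ} {𝒟 : Finset (Finset (Fin n))} {L : Finset (Finset (Fin n))}
    (h𝒟 : ∀ D ∈ 𝒟, #D = r + 1 ∧ ∀ d ∈ D, D.erase d ∈ L) (hne : 𝒟.Nonempty) :
    ∃ q : ℕ, r + 1 ≤ q ∧ #𝒟 ≤ (q + 1) * q.choose r ∧ q.choose r ≤ #L := by
  obtain ⟨D, hD⟩ := hne
  have hrn : r + 1 ≤ n := by
    rw [← (h𝒟 D hD).1]; simpa using card_le_univ D
  have hpos : (r + 1).choose (r + 1) ≤ #𝒟 := by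
    rw [Nat.choose_self]; exact card_pos.2 ⟨D, hD⟩
  obtain ⟨q, hq⟩ : ∃ q, q = Nat.findGreatest (fun q => q.choose (r + 1) ≤ #𝒟) n := ⟨_, rfl⟩
  have hq1 : r + 1 ≤ q := hq ▸ Nat.le_findGreatest hrn hpos
  have hq2 : q.choose (r + 1) ≤ #𝒟 := by
    rw [hq]; exact Nat.findGreatest_spec (P := fun q => q.choose (r + 1) ≤ #𝒟) hrn hpos
  have hqn : q ≤ n := hq ▸ Nat.findGreatest_le n
  have hsized : (𝒟 : Set (Finset (Fin n))).Sized (r + 1) := fun D hD => (h𝒟 D hD).1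
  have hkk := kruskal_katona_lovasz_form (i := 1) (by omega) hq1 hqn hsized hq2
  refine ⟨q, hq1, ?_, hkk.trans (card_le_card fun A hA => ?_)⟩
  · have h1 : #𝒟 ≤ (q + 1).choose (r + 1) := by
      rcases hqn.lt_or_eq with h | h
      · have := Nat.findGreatest_is_greatest (P := fun q => q.choose (r + 1) ≤ #𝒟)
          (hq ▸ Nat.lt_succ_self q) h
        exact (not_le.1 this).le
      · calc #𝒟 ≤ #((univ : Finset (Fin n)).powersetCard (r + 1)) :=
              card_le_card fun D hD => mem_powersetCard.2 ⟨subset_univ _, (h𝒟 D hD).1⟩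
          _ = n.choose (r + 1) := by simp
          _ ≤ _ := Nat.choose_le_choose _ (by omega)
    refine h1.trans ?_
    rw [Nat.add_one_mul_choose_eq]
    exact Nat.le_mul_of_pos_right _ (by omega)
  · rw [Function.iterate_one] at hA
    obtain ⟨D, hD, d, hd, rfl⟩ := mem_shadow_iff.1 hA
    exact (h𝒟 D hD).2 d hd

theorem exists_card_closed_small_le (r : ℕ) {h : ℝ} (hh : 0 < h) : ∃ η : ℝ, 0 < η ∧
    ∀ᶠ n : ℕ in atTop, ∀ L 𝒟 : Finset (Finset (Fin n)),
      (∀ D ∈ 𝒟, #D = r + 1 ∧ ∀ d ∈ D, D.erase d ∈ L) →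
      (#(𝒟.powerset.filter (fun X => (#X : ℝ) ≤ η * (n : ℝ) ^ (r + 1))) : ℝ) ≤
        2 ^ (h * (n * #L)) := by
  obtain ⟨c, hc⟩ : ∃ c : ℝ, c = (h / 2) ^ r / r.factorial := ⟨_, rfl⟩
  have hc0 : 0 < c := by rw [hc]; positivity
  obtain ⟨η, hη, hsmall⟩ := exists_card_small_subsets_le (h * c) (by positivity)
  refine ⟨η, hη, ?_⟩
  filter_upwards [tendsto_natCast_atTop_atTop.eventually_ge_atTop (2 * r / h)] with n hn L 𝒟 h𝒟
  rw [div_le_iff₀ hh] at hn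
  have hcard : #(𝒟.powerset.filter (fun X => (#X : ℝ) ≤ η * (n : ℝ) ^ (r + 1))) ≤ 2 ^ #𝒟 :=
    (card_filter_le _ _).trans (card_powerset _).le
  rcases 𝒟.eq_empty_or_nonempty with rfl | hne
  · have h1 : (#((∅ : Finset (Finset (Fin n))).powerset.filter
        (fun X => (#X : ℝ) ≤ η * (n : ℝ) ^ (r + 1))) : ℝ) ≤ 1 := by
      simpa using (by exact_mod_cast hcard : (#((∅ : Finset (Finset (Fin n))).powerset.filter
        (fun X => (#X : ℝ) ≤ η * (n : ℝ) ^ (r + 1))) : ℝ) ≤ ((2 ^ #(∅ : Finset (Finset (Fin n))) : ℕ) : ℝ))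
    exact h1.trans (Real.one_le_rpow (by norm_num) (by positivity))
  obtain ⟨q, hq1, hq2, hq3⟩ := exists_shadow_le h𝒟 hne
  have hq3' : (q.choose r : ℝ) ≤ #L := by exact_mod_cast hq3
  rcases le_or_gt ((q + 1 : ℕ) : ℝ) (h * n) with hqn | hqn
  · calc _ ≤ ((2 ^ #𝒟 : ℕ) : ℝ) := by exact_mod_cast hcard
      _ = 2 ^ (#𝒟 : ℝ) := by rw [Real.rpow_natCast]; push_cast; rfl
      _ ≤ _ := by
        refine Real.rpow_le_rpow_of_exponent_le (by norm_num) ?_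
        calc (#𝒟 : ℝ) ≤ ((q + 1 : ℕ) : ℝ) * q.choose r := by exact_mod_cast hq2
          _ ≤ h * n * #L := by gcongr
          _ = _ := by ring
  · have h1 := Nat.pow_sub_le_descFactorial q r
    rw [Nat.descFactorial_eq_factorial_mul_choose] at h1
    have h2 : h / 2 * n ≤ ((q + 1 - r : ℕ) : ℝ) := by
      rw [Nat.cast_sub (by omega)]; linarith
    have h3 : (h / 2 * n) ^ r ≤ r.factorial * q.choose r :=
      (pow_le_pow_left₀ (by positivity) h2 r).trans (by exact_mod_cast h1)
    have h4 : c * (n : ℝ) ^ r ≤ #L := by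
      rw [hc, div_mul_eq_mul_div, div_le_iff₀ (by positivity), ← mul_pow]
      nlinarith [(by positivity : (0 : ℝ) < r.factorial)]
    have h5 : (#𝒟 : ℝ) ≤ (n : ℝ) ^ (r + 1) := by
      have : #𝒟 ≤ n ^ (r + 1) := by
        calc #𝒟 ≤ #((univ : Finset (Fin n)).powersetCard (r + 1)) :=
              card_le_card fun D hD => mem_powersetCard.2 ⟨subset_univ _, (h𝒟 D hD).1⟩
          _ = n.choose (r + 1) := by simp
          _ ≤ _ := Nat.choose_le_pow _ _
      exact_mod_cast this
    refine (hsmall 𝒟 _ h5).trans (Real.rpow_le_rpow_of_exponent_le (by norm_num) ?_)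
    calc h * c * (n : ℝ) ^ (r + 1) = h * (n * (c * (n : ℝ) ^ r)) := by ring
      _ ≤ _ := by gcongr

theorem card_subsets_card_le {α : Type*} [DecidableEq α] (U : Finset α) (m : ℕ) :
    #(U.powerset.filter (fun X => #X ≤ m)) ≤ (#U + 1) ^ m := by
  have hsub : U.powerset.filter (fun X => #X ≤ m) ⊆
      (range (m + 1)).biUnion (fun i => U.powersetCard i) := fun X hX => by
    obtain ⟨h1, h2⟩ := mem_filter.1 hX
    exact mem_biUnion.2 ⟨#X, mem_range.2 (by omega), mem_powersetCard.2 ⟨mem_powerset.1 h1, rfl⟩⟩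
  calc _ ≤ ∑ i ∈ range (m + 1), #(U.powersetCard i) := (card_le_card hsub).trans card_biUnion_le
    _ ≤ ∑ i ∈ range (m + 1), #U ^ i * 1 ^ (m - i) * m.choose i := by
      refine sum_le_sum fun i hi => ?_
      rw [card_powersetCard, one_pow, mul_one]
      exact (Nat.choose_le_pow _ _).trans
        (Nat.le_mul_of_pos_right _ (Nat.choose_pos (by rw [mem_range] at hi; omega)))
    _ = _ := (add_pow _ _ _).symm

end ClosedFamilies

section CountGivenRich

variable {n : ℕ}

/-- The clauses of `Q` split over the blocks determined by the family `L` of rich sets. -/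
def CoveredBy (k : ℕ) (Q : Finset (Finset (Fin n) × Finset (Fin n)))
    (L : Finset (Finset (Fin n))) : Prop :=
  ∀ c ∈ Q, (∃ S ∈ L, ∃ A ⊆ S, #A ≤ 1 ∧ S \ A = c.1 ∧ A ⊆ c.2 ∧ #c.2 = k - #S + #A) ∨
    ∃ v, c.2 = {v} ∧ v ∉ c.1 ∧ #c.1 + 1 = k ∧ ∀ d ∈ c.1, insert v (c.1.erase d) ∈ L

/-- There are few clauses in `Q` with a given positive part, or with a given single negative
variable. -/
structure FewNegParts (k : ℕ) (η κ : ℝ) (Q : Finset (Finset (Fin n) × Finset (Fin n))) : Prop where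
  fiber : ∀ (R A : Finset (Fin n)) (j : ℕ), #A < j → ∀ 𝒴 ⊆ Q,
    (∀ c ∈ 𝒴, c.1 = R ∧ #c.2 = j ∧ A ⊆ c.2) → (#𝒴 : ℝ) ≤ 1 + η * (n : ℝ) ^ (j - #A)
  single : ∀ v, ∀ 𝒴 ⊆ Q, (∀ c ∈ 𝒴, c.2 = {v}) → (#𝒴 : ℝ) ≤ κ * (n : ℝ) ^ (k - 1)

theorem sum_links_le (k : ℕ) (L : Finset (Finset (Fin n))) :
    ∑ v : Fin n, ((n : ℝ) * #((L.filter (fun S => v ∈ S ∧ #S + 1 = k)).image (fun S => S.erase v))) ≤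
      k * ∑ S ∈ L, (n : ℝ) ^ (k - #S) := by
  have h1 : ∑ v : Fin n, #((L.filter (fun S => v ∈ S ∧ #S + 1 = k)).image (fun S => S.erase v)) ≤
      ∑ S ∈ L.filter (fun S => #S + 1 = k), #S := by
    calc _ ≤ ∑ v : Fin n, #((L.filter (fun S => #S + 1 = k)).bipartiteBelow (fun S v => v ∈ S) v) :=
          sum_le_sum fun v _ => card_image_le.trans (card_le_card fun S hS => by
            obtain ⟨a, b, c⟩ := mem_filter.1 hS
            exact mem_filter.2 ⟨mem_filter.2 ⟨a, c⟩, b⟩)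
      _ = ∑ S ∈ L.filter (fun S => #S + 1 = k),
          #((univ : Finset (Fin n)).bipartiteAbove (fun S v => v ∈ S) S) :=
        (sum_card_bipartiteAbove_eq_sum_card_bipartiteBelow _).symm
      _ = _ := sum_congr rfl fun S _ => congrArg card (by ext v; simp [bipartiteAbove])
  rw [← mul_sum]
  calc _ ≤ (n : ℝ) * ∑ S ∈ L.filter (fun S => #S + 1 = k), (#S : ℝ) := by
        gcongr
        exact_mod_cast h1
    _ ≤ ∑ S ∈ L.filter (fun S => #S + 1 = k), k * (n : ℝ) ^ (k - #S) := by
        rw [mul_sum]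
        refine sum_le_sum fun S hS => ?_
        have hS' := (mem_filter.1 hS).2
        have h2 : (#S : ℝ) ≤ k := by exact_mod_cast (by omega : #S ≤ k)
        rw [show k - #S = 1 by omega, pow_one, mul_comm]
        exact mul_le_mul_of_nonneg_right h2 (Nat.cast_nonneg n)
    _ ≤ ∑ S ∈ L, k * (n : ℝ) ^ (k - #S) :=
        sum_le_sum_of_subset_of_nonneg (filter_subset _ _) fun _ _ _ => by positivity
    _ = _ := (mul_sum _ _ _).symm

theorem card_powerset_filter_image_le {α β : Type*} [DecidableEq α] [DecidableEq β] (f : α → β) (g : β → α)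
    (hgf : ∀ a, g (f a) = a) (D : Finset α) (b : ℝ) :
    #((D.image f).powerset.filter (fun X => (#X : ℝ) ≤ b)) ≤
      #(D.powerset.filter (fun X => (#X : ℝ) ≤ b)) := by
  have key : ∀ X ⊆ D.image f, (X.image g).image f = X := fun X hX => by
    rw [image_image]
    refine (image_congr fun x hx => ?_).trans image_id
    obtain ⟨a, -, rfl⟩ := mem_image.1 (hX hx)
    simp [hgf]
  refine card_le_card_of_injOn (fun X => X.image g) (fun X hX => ?_) (fun X hX X' hX' h => ?_)
  · obtain ⟨h1, h2⟩ := mem_filter.1 hX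
    refine mem_coe.2 (mem_filter.2 ⟨mem_powerset.2 fun a ha => ?_, le_trans ?_ h2⟩)
    · obtain ⟨x, hx, rfl⟩ := mem_image.1 ha
      obtain ⟨a, ha, rfl⟩ := mem_image.1 (mem_powerset.1 h1 hx)
      rwa [hgf]
    · exact_mod_cast card_image_le
  · rw [← key X (mem_powerset.1 (mem_filter.1 hX).1), ← key X' (mem_powerset.1 (mem_filter.1 hX').1)]
    exact congrArg (fun Z => Z.image f) h

theorem exists_card_given_rich_le (k : ℕ) (hk : 2 ≤ k) {h : ℝ} (hh : 0 < h) :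
    ∃ η : ℝ, 0 < η ∧ ∃ κ : ℝ, 0 < κ ∧ ∀ᶠ n : ℕ in atTop, ∀ L : Finset (Finset (Fin n)),
      (∀ S ∈ L, #S < k) → ∀ 𝒬 : Finset (Finset (Finset (Fin n) × Finset (Fin n))),
        (∀ Q ∈ 𝒬, CoveredBy k Q L ∧ FewNegParts k η κ Q) →
        (#𝒬 : ℝ) ≤ 2 ^ (h * ∑ S ∈ L, (n : ℝ) ^ (k - #S)) := by
  classical
  obtain ⟨r, rfl⟩ : ∃ r, k = r + 2 := ⟨k - 2, by omega⟩
  obtain ⟨h₀, hh₀⟩ : ∃ h₀ : ℝ, h₀ = h / (2 * ((r + 2 : ℕ) : ℝ)) := ⟨_, rfl⟩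
  have hh₀' : 0 < h₀ := by rw [hh₀]; positivity
  obtain ⟨η, hη, hsmall⟩ := exists_card_small_subsets_le h₀ hh₀'
  obtain ⟨κ, hκ, hclosed⟩ := exists_card_closed_small_le r hh₀'
  refine ⟨η / 2, by positivity, κ, hκ, ?_⟩
  filter_upwards [hclosed, eventually_ge_atTop 1,
    tendsto_natCast_atTop_atTop.eventually_ge_atTop (2 / η)] with n hclosed hn1 hnη L hL 𝒬 h𝒬
  have hn1' : (1 : ℝ) ≤ n := by exact_mod_cast hn1
  rw [div_le_iff₀ hη] at hnη
  let I₁ : Finset ((_ : Finset (Fin n)) × Finset (Fin n)) :=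
    L.sigma (fun S => S.powerset.filter (fun A => #A ≤ 1))
  let U₁ : ((_ : Finset (Fin n)) × Finset (Fin n)) → Finset (Finset (Fin n) × Finset (Fin n)) :=
    fun p => ((univ.powersetCard (r + 2 - #p.1 + #p.2)).filter (fun Y => p.2 ⊆ Y)).image
      (fun Y => (p.1 \ p.2, Y))
  let K : Fin n → Finset (Finset (Fin n)) := fun v =>
    (L.filter (fun S => v ∈ S ∧ #S + 1 = r + 2)).image (fun S => S.erase v)
  let D : Fin n → Finset (Finset (Fin n)) := fun v =>
    (univ.powersetCard (r + 1)).filter (fun D => ∀ d ∈ D, D.erase d ∈ K v)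
  let U₂ : Fin n → Finset (Finset (Fin n) × Finset (Fin n)) := fun v =>
    (D v).image (fun D => (D, {v}))
  let b₁ : ((_ : Finset (Fin n)) × Finset (Fin n)) → ℝ := fun p =>
    η * (n : ℝ) ^ (r + 2 - #p.1)
  let b₂ : Fin n → ℝ := fun _ => κ * (n : ℝ) ^ (r + 1)
  have hprod := card_le_prod_card_traces 𝒬 (I₁.disjSum (univ : Finset (Fin n))) (Sum.elim U₁ U₂)
    (Sum.elim b₁ b₂) (fun Q hQ => by
      obtain ⟨hcov, hfew⟩ := h𝒬 Q hQ
      refine ⟨fun c hc => ?_, fun i hi => ?_⟩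
      · rcases hcov c hc with ⟨S, hS, A, hAS, hA1, hSA, hAc, hcard⟩ | ⟨v, hv, hvc, hck, hd⟩
        · refine mem_biUnion.2 ⟨Sum.inl ⟨S, A⟩, inl_mem_disjSum.2 (mem_sigma.2 ⟨hS, mem_filter.2
            ⟨mem_powerset.2 hAS, hA1⟩⟩), mem_image.2 ⟨c.2, mem_filter.2 ⟨mem_powersetCard.2
            ⟨subset_univ _, hcard⟩, hAc⟩, ?_⟩⟩
          exact Prod.ext hSA rfl
        · refine mem_biUnion.2 ⟨Sum.inr v, inr_mem_disjSum.2 (mem_univ _), mem_image.2 ⟨c.1,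
            mem_filter.2 ⟨mem_powersetCard.2 ⟨subset_univ _, by omega⟩, fun d hdc => ?_⟩, ?_⟩⟩
          · have hvd : v ∉ c.1.erase d := fun h => hvc (mem_of_mem_erase h)
            refine mem_image.2 ⟨insert v (c.1.erase d), mem_filter.2 ⟨hd d hdc,
              mem_insert_self _ _, ?_⟩, erase_insert hvd⟩
            rw [card_insert_of_notMem hvd, card_erase_add_one hdc, hck]
          · exact Prod.ext rfl hv.symm
      · rcases i with ⟨S, A⟩ | v
        · obtain ⟨hS, hA⟩ := mem_sigma.1 (inl_mem_disjSum.1 hi)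
          have hSk := hL S hS
          have h1 := hfew.fiber (S \ A) A (r + 2 - #S + #A) (by omega) (Q ∩ U₁ ⟨S, A⟩)
            inter_subset_left fun c hc => by
              obtain ⟨Y, hY, rfl⟩ := mem_image.1 (mem_inter.1 hc).2
              obtain ⟨hY1, hY2⟩ := mem_filter.1 hY
              exact ⟨rfl, (mem_powersetCard.1 hY1).2, hY2⟩
          rw [Nat.add_sub_cancel] at h1
          refine h1.trans ?_
          have h2 : (n : ℝ) ≤ (n : ℝ) ^ (r + 2 - #S) := le_self_pow₀ hn1' (by omega)
          change _ ≤ η * (n : ℝ) ^ (r + 2 - #S)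
          nlinarith
        · exact hfew.single v (Q ∩ U₂ v) inter_subset_left fun c hc => by
            obtain ⟨Y, hY, rfl⟩ := mem_image.1 (mem_inter.1 hc).2
            rfl)
  rw [prod_disjSum] at hprod
  have hP1 : ∀ p ∈ I₁, (#((U₁ p).powerset.filter (fun X => (#X : ℝ) ≤ b₁ p)) : ℝ) ≤
      2 ^ (h₀ * (n : ℝ) ^ (r + 2 - #p.1)) := by
    intro p hp
    refine hsmall (U₁ p) _ ?_
    have h1 : #(U₁ p) ≤ n ^ (r + 2 - #p.1 + #p.2 - #p.2) :=
      card_image_le.trans (card_filter_superset_le _ _)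
    rw [Nat.add_sub_cancel] at h1
    exact_mod_cast h1
  have hP2 : ∀ v, (#((U₂ v).powerset.filter (fun X => (#X : ℝ) ≤ b₂ v)) : ℝ) ≤
      2 ^ (h₀ * (n * #(K v))) := by
    intro v
    have h1 := card_powerset_filter_image_le
      (fun D => ((D, {v}) : Finset (Fin n) × Finset (Fin n))) Prod.fst (fun _ => rfl) (D v) (b₂ v)
    refine (Nat.cast_le.2 h1).trans (le_trans (le_of_eq ?_) (hclosed (K v) (D v) fun D hD => ?_))
    · simp only [b₂]
    · obtain ⟨h1, h2⟩ := mem_filter.1 hD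
      exact ⟨(mem_powersetCard.1 h1).2, h2⟩
  have hZ1 : ∑ p ∈ I₁, (n : ℝ) ^ (r + 2 - #p.1) ≤
      ((r + 2 : ℕ) : ℝ) * ∑ S ∈ L, (n : ℝ) ^ (r + 2 - #S) := by
    rw [sum_sigma, mul_sum]
    refine sum_le_sum fun S hS => ?_
    simp only []
    rw [sum_const, nsmul_eq_mul]
    have h1 := card_subsets_card_le S 1
    rw [pow_one] at h1
    have h2 := hL S hS
    gcongr
    omega
  have hZ2 := sum_links_le (r + 2) L
  calc (#𝒬 : ℝ) ≤ (∏ p ∈ I₁, (#((U₁ p).powerset.filter (fun X => (#X : ℝ) ≤ b₁ p)) : ℝ)) *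
        ∏ v, (#((U₂ v).powerset.filter (fun X => (#X : ℝ) ≤ b₂ v)) : ℝ) := by
        exact_mod_cast hprod
    _ ≤ (∏ p ∈ I₁, (2 : ℝ) ^ (h₀ * (n : ℝ) ^ (r + 2 - #p.1))) *
        ∏ v, (2 : ℝ) ^ (h₀ * (n * #(K v))) :=
      mul_le_mul (prod_le_prod (fun _ _ => by positivity) hP1)
        (prod_le_prod (fun _ _ => by positivity) fun v _ => hP2 v)
        (prod_nonneg fun _ _ => by positivity) (prod_nonneg fun _ _ => by positivity)
    _ = 2 ^ (h₀ * ∑ p ∈ I₁, (n : ℝ) ^ (r + 2 - #p.1) + h₀ * ∑ v, (n : ℝ) * #(K v)) := by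
      rw [← Real.rpow_sum_of_pos (by norm_num), ← Real.rpow_sum_of_pos (by norm_num),
        ← Real.rpow_add (by norm_num), mul_sum, mul_sum]
    _ ≤ _ := by
      refine Real.rpow_le_rpow_of_exponent_le (by norm_num) ?_
      calc _ ≤ h₀ * (((r + 2 : ℕ) : ℝ) * ∑ S ∈ L, (n : ℝ) ^ (r + 2 - #S)) +
          h₀ * (((r + 2 : ℕ) : ℝ) * ∑ S ∈ L, (n : ℝ) ^ (r + 2 - #S)) := by gcongr
        _ = _ := by rw [hh₀]; field_simp; ring

end CountGivenRich

/-! ### Counting pairs with few clauses on each negative variable -/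

section FewNegCount

variable {n : ℕ}

theorem eventually_succ_pow_le_rpow (k : ℕ) {δ : ℝ} (hδ : 0 < δ) :
    ∀ᶠ n : ℕ in atTop, ((n + 1 : ℕ) : ℝ) ^ k ≤ 2 ^ (δ * n) := by
  have hr : (1 : ℝ) < 2 ^ δ := Real.one_lt_rpow (by norm_num) hδ
  have h := (tendsto_pow_const_div_const_pow_of_one_lt k hr).comp (tendsto_add_atTop_nat 1)
  filter_upwards [h.eventually_le_const (u := 1 / 2 ^ δ) (by positivity)] with n hn
  simp only [Function.comp_apply] at hn
  rw [div_le_div_iff₀ (by positivity) (by positivity), one_mul, pow_succ] at hn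
  rw [Real.rpow_mul (by norm_num), Real.rpow_natCast]
  exact le_of_mul_le_mul_right hn (by positivity)

theorem exists_card_of_card_hits_le (k : ℕ) (hk : 2 ≤ k) {h : ℝ} (hh : 0 < h) :
    ∃ η : ℝ, 0 < η ∧ ∃ κ : ℝ, 0 < κ ∧ ∃ c : ℝ, 0 < c ∧ ∀ᶠ n : ℕ in atTop, ∀ t : ℕ,
      ∀ 𝒬 : Finset (Finset (Finset (Fin n) × Finset (Fin n))),
        (∀ Q ∈ 𝒬, (∀ c ∈ Q, Disjoint c.1 c.2 ∧ c.2.Nonempty ∧ #c.1 + #c.2 = k) ∧ Q.Nonempty ∧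
          FewNegParts k η κ Q ∧ ∃ T, (∀ E ∈ T, #E = k) ∧ #T = t ∧ HitsExchanges k Q T) →
        (#𝒬 : ℝ) ≤ 2 ^ (h * t) ∧ (𝒬.Nonempty → c * n ≤ t) := by
  classical
  obtain ⟨c, hc, hrich⟩ := exists_rich k (by omega)
  obtain ⟨η, hη, κ, hκ, hcount⟩ := exists_card_given_rich_le k hk
    (h := h / 2 * (c / 2 ^ k)) (by positivity)
  refine ⟨η, hη, κ, hκ, c, hc, ?_⟩
  filter_upwards [hrich, hcount, eventually_ge_atTop 1,
    eventually_succ_pow_le_rpow k (δ := h / 2 * (c / 2 ^ k)) (by positivity)]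
    with n hrich hcount hn hpoly t 𝒬 h𝒬
  have hn' : (1 : ℝ) ≤ n := by exact_mod_cast hn
  have hcov : ∀ Q ∈ 𝒬, ∃ T : Finset (Finset (Fin n)), (∀ E ∈ T, #E = k) ∧ #T = t ∧
      CoveredBy k Q (richSets k c T) := by
    intro Q hQ
    obtain ⟨hQc, -, -, T, hT, hTt, hhit⟩ := h𝒬 Q hQ
    refine ⟨T, hT, hTt, fun x hx => ?_⟩
    obtain ⟨hd, hne, hcard⟩ := hQc x hx
    rcases hrich Q T hhit x.1 x.2 hx hd hne hcard with h1 | ⟨v, hv, h1⟩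
    · exact Or.inl h1
    · refine Or.inr ⟨v, hv, ?_, ?_, h1⟩
      · rw [hv, disjoint_singleton_right] at hd
        exact hd
      · rw [hv, card_singleton] at hcard
        exact hcard
  have hrichk : ∀ T : Finset (Finset (Fin n)), ∀ S ∈ richSets k c T, #S < k :=
    fun T S hS => (mem_filter.1 hS).2.1
  constructor
  · choose! T hTk hTt hTc using hcov
    have hsum : ∀ Q ∈ 𝒬, ∑ S ∈ richSets k c (T Q), (n : ℝ) ^ (k - #S) ≤ 2 ^ k / c * t := by
      intro Q hQ
      have h1 := sum_richSets_le (c := c) (hTk Q hQ)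
      rw [hTt Q hQ] at h1
      rw [div_mul_eq_mul_div, le_div_iff₀ hc]
      linarith
    obtain ⟨U, hU⟩ : ∃ U : Finset (Finset (Fin n)),
        U = univ.powerset.filter (fun X : Finset (Fin n) => #X ≤ k - 1) := ⟨_, rfl⟩
    obtain ⟨m, hm⟩ : ∃ m : ℕ, m = ⌊(2 ^ k / c * t) / (n : ℝ)⌋₊ := ⟨_, rfl⟩
    have hU1 : #U + 1 ≤ (n + 1) ^ k := by
      have h1 := card_subsets_card_le (univ : Finset (Fin n)) (k - 1)
      rw [card_univ, Fintype.card_fin, ← hU] at h1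
      have h2 : 1 ≤ (n + 1) ^ (k - 1) := Nat.one_le_pow _ _ (by omega)
      have h3 : (n + 1) ^ k = (n + 1) ^ (k - 1) * (n + 1) := by
        rw [← pow_succ]
        congr 1
        omega
      nlinarith
    obtain ⟨I, hI⟩ : ∃ I : Finset (Finset (Finset (Fin n))),
        I = (U.powerset.filter (fun X => #X ≤ m)).filter (fun L => (∀ S ∈ L, #S < k) ∧
          ∑ S ∈ L, (n : ℝ) ^ (k - #S) ≤ 2 ^ k / c * t) := ⟨_, rfl⟩
    have hbound := card_le_of_subset_biUnion I
      (fun L => 𝒬.filter (fun Q => richSets k c (T Q) = L)) 𝒬 (2 ^ (h / 2 * t)) (fun Q hQ => by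
        refine mem_biUnion.2 ⟨richSets k c (T Q), ?_, mem_filter.2 ⟨hQ, rfl⟩⟩
        rw [hI]
        refine mem_filter.2 ⟨mem_filter.2 ⟨mem_powerset.2 fun S hS => ?_, ?_⟩, hrichk _, hsum Q hQ⟩
        · rw [hU]
          exact mem_filter.2 ⟨mem_powerset.2 (subset_univ _), Nat.le_sub_one_of_lt (hrichk _ S hS)⟩
        · rw [hm]
          refine Nat.le_floor ?_
          rw [le_div_iff₀ (by positivity)]
          refine le_trans ?_ (hsum Q hQ)
          rw [← nsmul_eq_mul, ← sum_const]
          refine sum_le_sum fun S hS => le_self_pow₀ hn' ?_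
          have := hrichk _ S hS
          omega) fun L hL => by
        rw [hI] at hL
        obtain ⟨-, hLk, hLs⟩ := mem_filter.1 hL
        refine (hcount L hLk _ fun Q hQ => ?_).trans
          (Real.rpow_le_rpow_of_exponent_le (by norm_num) ?_)
        · obtain ⟨hQ, hL⟩ := mem_filter.1 hQ
          rw [← hL]
          exact ⟨hTc Q hQ, (h𝒬 Q hQ).2.2.1⟩
        · calc _ ≤ h / 2 * (c / 2 ^ k) * (2 ^ k / c * t) := by gcongr
            _ = _ := by field_simp
    have hIcard : (#I : ℝ) ≤ 2 ^ (h / 2 * t) := by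
      have h1 : #I ≤ ((n + 1) ^ k) ^ m := by
        rw [hI]
        exact (card_filter_le _ _).trans ((card_subsets_card_le U m).trans
          (Nat.pow_le_pow_left hU1 m))
      have h2 : (m : ℝ) ≤ (2 ^ k / c * t) / (n : ℝ) := by
        rw [hm]
        exact Nat.floor_le (by positivity)
      calc (#I : ℝ) ≤ (((n + 1 : ℕ) : ℝ) ^ k) ^ m := by exact_mod_cast h1
        _ ≤ (2 ^ (h / 2 * (c / 2 ^ k) * n)) ^ m := by gcongr
        _ = 2 ^ (h / 2 * (c / 2 ^ k) * n * m) := by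
          rw [← Real.rpow_natCast, ← Real.rpow_mul (by norm_num)]
        _ ≤ _ := by
          refine Real.rpow_le_rpow_of_exponent_le (by norm_num) ?_
          calc _ ≤ h / 2 * (c / 2 ^ k) * n * ((2 ^ k / c * t) / (n : ℝ)) := by gcongr
            _ = _ := by field_simp
    calc (#𝒬 : ℝ) ≤ #I * 2 ^ (h / 2 * t) := hbound
      _ ≤ 2 ^ (h / 2 * t) * 2 ^ (h / 2 * t) := by gcongr
      _ = _ := by
        rw [← Real.rpow_add (by norm_num)]
        congr 1
        ring
  · rintro ⟨Q, hQ⟩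
    obtain ⟨T, hTk, hTt, hTc⟩ := hcov Q hQ
    obtain ⟨x, hx⟩ := (h𝒬 Q hQ).2.1
    have hS : (richSets k c T).Nonempty := by
      rcases hTc x hx with ⟨S, hS, -⟩ | ⟨v, -, -, hck, hd⟩
      · exact ⟨S, hS⟩
      · obtain ⟨d, hdc⟩ : x.1.Nonempty := card_pos.1 (by omega)
        exact ⟨_, hd d hdc⟩
    obtain ⟨S, hS⟩ := hS
    obtain ⟨-, hSk, hSc⟩ := mem_filter.1 hS
    have h1 : (n : ℝ) ≤ (n : ℝ) ^ (k - #S) := le_self_pow₀ hn' (by omega)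
    have h2 : (#(T.filter (fun E => S ⊆ E)) : ℝ) ≤ t := by
      rw [← hTt]
      exact_mod_cast card_filter_le _ _
    nlinarith

theorem card_le_of_card_fiber_le {α β : Type*} (𝒜 : Finset α) (g : α → β) (s : Finset β) (M : ℝ)
    (hs : ∀ x ∈ 𝒜, g x ∈ s)
    (hf : ∀ b ∈ s, ∀ 𝒟 ⊆ 𝒜, (∀ x ∈ 𝒟, g x = b) → (#𝒟 : ℝ) ≤ M) : (#𝒜 : ℝ) ≤ #s * M := by
  classical
  exact card_le_of_subset_biUnion s (fun b => 𝒜.filter (fun x => g x = b)) 𝒜 M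
    (fun x hx => mem_biUnion.2 ⟨g x, hs x hx, mem_filter.2 ⟨hx, rfl⟩⟩)
    fun b hb => hf b hb _ (filter_subset _ _) fun x hx => (mem_filter.1 hx).2

/-- The positive parts compatible with `Q` become rarer as the exchange edges of `Q` get harder to
hit. -/
theorem exists_hitting_family (k : ℕ) : ∃ c₀ : ℝ, 0 < c₀ ∧ ∀ n : ℕ,
    ∀ Q : Finset (Finset (Fin n) × Finset (Fin n)), Q ⊆ signedClauses k n →
      ∃ T : Finset (Finset (Fin n)), T ⊆ univ.powersetCard k ∧ HitsExchanges k Q T ∧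
        ∀ ℬ : Finset (Finset (Finset (Fin n))), (∀ P ∈ ℬ, IsMinPair k P Q) →
          (#ℬ : ℝ) ≤ 2 ^ ((n.choose k : ℝ) - c₀ * #T) := by
  classical
  obtain ⟨q, hq⟩ : ∃ q : ℝ, q = 1 - 1 / 2 ^ (k + 1) := ⟨_, rfl⟩
  have h2k : (2 : ℝ) ≤ 2 ^ (k + 1) := le_self_pow₀ (by norm_num) (by omega)
  have hq0 : 0 < q := by
    rw [hq, sub_pos, div_lt_one (by positivity)]
    linarith
  have hq1 : q < 1 := by
    rw [hq]
    linarith [show (0 : ℝ) < 1 / 2 ^ (k + 1) by positivity]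
  obtain ⟨c₀, hc₀⟩ : ∃ c₀ : ℝ, c₀ = -Real.logb 2 q / (k + 1) := ⟨_, rfl⟩
  have hc₀' : 0 < c₀ := by
    rw [hc₀]
    exact div_pos (neg_pos.2 (Real.logb_neg (by norm_num) hq0 hq1)) (by positivity)
  refine ⟨c₀, hc₀', fun n Q hQ => ?_⟩
  obtain ⟨𝓜, hdisj, hsub, hnot, hhit⟩ := exists_exchange_matching k Q hQ
  refine ⟨𝓜.biUnion id, biUnion_subset.2 fun X hX => (hsub X hX).1, hhit, fun ℬ hℬ => ?_⟩
  have hT : #(𝓜.biUnion id) ≤ #𝓜 * (k + 1) :=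
    card_biUnion_le_card_mul _ _ _ fun X hX => (hsub X hX).2
  have hT' : (#(𝓜.biUnion id) : ℝ) ≤ #𝓜 * (k + 1) := by exact_mod_cast hT
  have h1 := card_le_of_forall_not_subset 𝓜 (univ.powersetCard k) ℬ hdisj hsub fun P hP =>
    ⟨fun S hS => mem_powersetCard.2 ⟨subset_univ _, (hℬ P hP).card_pos S hS⟩,
      fun X hX => hnot P (hℬ P hP) X hX⟩
  rw [card_powersetCard, card_univ, Fintype.card_fin, ← hq] at h1
  refine h1.trans ?_
  rw [sub_eq_add_neg, Real.rpow_add (by norm_num), Real.rpow_natCast]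
  gcongr
  calc q ^ #𝓜 = 2 ^ (Real.logb 2 q * #𝓜) := by
        rw [Real.rpow_mul (by norm_num), Real.rpow_logb (by norm_num) (by norm_num) hq0,
          Real.rpow_natCast]
    _ ≤ _ := by
      refine Real.rpow_le_rpow_of_exponent_le (by norm_num) ?_
      have h1 : Real.logb 2 q = -(c₀ * (k + 1)) := by
        rw [hc₀]
        field_simp
      rw [h1]
      nlinarith

theorem exists_card_fewNegParts_le (k : ℕ) (hk : 2 ≤ k) :
    ∃ η : ℝ, 0 < η ∧ ∃ κ : ℝ, 0 < κ ∧ ∃ c : ℝ, 0 < c ∧ ∀ᶠ n : ℕ in atTop,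
      ∀ 𝒜 : Finset (Finset (Finset (Fin n)) × Finset (Finset (Fin n) × Finset (Fin n))),
        (∀ x ∈ 𝒜, IsMinPair k x.1 x.2 ∧ x.2.Nonempty ∧ FewNegParts k η κ x.2) →
        (#𝒜 : ℝ) ≤ 2 ^ ((n.choose k : ℝ) - c * n) := by
  classical
  obtain ⟨c₀, hc₀', hfam⟩ := exists_hitting_family k
  obtain ⟨η, hη, κ, hκ, c, hc, hcount⟩ := exists_card_of_card_hits_le k hk (half_pos hc₀')
  refine ⟨η, hη, κ, hκ, c₀ / 4 * c, by positivity, ?_⟩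
  filter_upwards [hcount, eventually_succ_pow_le_rpow k (δ := c₀ / 4 * c) (by positivity)]
    with n hcount hpoly 𝒜 h𝒜
  have hsigned : ∀ x ∈ 𝒜, x.2 ⊆ signedClauses k n := fun x hx a ha =>
    mem_signedClauses ((h𝒜 x hx).1.disjoint a ha) ((h𝒜 x hx).1.card_add a ha)
  choose! T hTsub hThit hTcount using hfam n
  have hfib : ∀ Q ∈ 𝒜.image Prod.snd, ∀ 𝒟 ⊆ 𝒜, (∀ x ∈ 𝒟, x.2 = Q) →
      (#𝒟 : ℝ) ≤ 2 ^ ((n.choose k : ℝ) - c₀ * #(T Q)) := by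
    intro Q hQ 𝒟 h𝒟 h𝒟Q
    obtain ⟨x₀, hx₀, rfl⟩ := mem_image.1 hQ
    have hinj : #(𝒟.image Prod.fst) = #𝒟 := card_image_of_injOn fun x hx y hy hxy =>
      Prod.ext hxy ((h𝒟Q x hx).trans (h𝒟Q y hy).symm)
    rw [← hinj]
    refine hTcount _ (hsigned x₀ hx₀) _ fun P hP => ?_
    obtain ⟨x, hx, rfl⟩ := mem_image.1 hP
    rw [← h𝒟Q x hx]
    exact (h𝒜 x (h𝒟 hx)).1
  have hfibt : ∀ t : ℕ, ∀ 𝒟 ⊆ 𝒜, (∀ x ∈ 𝒟, #(T x.2) = t) →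
      (#𝒟 : ℝ) ≤ 2 ^ ((n.choose k : ℝ) - c₀ / 2 * (c * n)) := by
    intro t 𝒟 h𝒟 h𝒟t
    obtain ⟨h1, h2⟩ := hcount t (𝒟.image Prod.snd) fun Q hQ => by
      obtain ⟨x, hx, rfl⟩ := mem_image.1 hQ
      obtain ⟨hmin, hne, hfew⟩ := h𝒜 x (h𝒟 hx)
      exact ⟨fun a ha => ⟨hmin.disjoint a ha, hmin.nonempty a ha, hmin.card_add a ha⟩, hne, hfew,
        T x.2, fun E hE => (mem_powersetCard.1 (hTsub _ (hsigned x (h𝒟 hx)) hE)).2, h𝒟t x hx,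
        hThit _ (hsigned x (h𝒟 hx))⟩
    rcases 𝒟.eq_empty_or_nonempty with rfl | h0
    · rw [card_empty, Nat.cast_zero]
      positivity
    · have h3 := h2 (h0.image _)
      have h4 := card_le_of_card_fiber_le 𝒟 Prod.snd (𝒟.image Prod.snd)
        (2 ^ ((n.choose k : ℝ) - c₀ * t)) (fun x hx => mem_image_of_mem _ hx) fun Q hQ 𝒟' h𝒟' hQ' => by
          obtain ⟨x, hx, rfl⟩ := mem_image.1 hQ
          rw [← h𝒟t x hx]
          exact hfib _ (mem_image_of_mem _ (h𝒟 hx)) 𝒟' (h𝒟'.trans h𝒟) hQ'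
      calc (#𝒟 : ℝ) ≤ #(𝒟.image Prod.snd) * 2 ^ ((n.choose k : ℝ) - c₀ * t) := h4
        _ ≤ 2 ^ (c₀ / 2 * t) * 2 ^ ((n.choose k : ℝ) - c₀ * t) := by gcongr
        _ = 2 ^ ((n.choose k : ℝ) - c₀ / 2 * t) := by
          rw [← Real.rpow_add (by norm_num)]
          congr 1
          ring
        _ ≤ _ := by
          refine Real.rpow_le_rpow_of_exponent_le (by norm_num) ?_
          gcongr
  have h5 := card_le_of_card_fiber_le 𝒜 (fun x => #(T x.2)) (range (n.choose k + 1))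
    (2 ^ ((n.choose k : ℝ) - c₀ / 2 * (c * n))) (fun x hx => by
      refine mem_range.2 (Nat.lt_succ_of_le ?_)
      have := card_le_card (hTsub x.2 (hsigned x hx))
      rwa [card_powersetCard, card_univ, Fintype.card_fin] at this)
    fun t _ 𝒟 h𝒟 ht => hfibt t 𝒟 h𝒟 ht
  rw [card_range] at h5
  have h6 : n.choose k + 1 ≤ (n + 1) ^ k := by
    have h7 := Nat.choose_le_pow n k
    have h8 : n ^ k < (n + 1) ^ k := Nat.pow_lt_pow_left (by omega) (by omega)
    omega
  calc (#𝒜 : ℝ) ≤ _ := h5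
    _ ≤ 2 ^ (c₀ / 4 * c * n) * 2 ^ ((n.choose k : ℝ) - c₀ / 2 * (c * n)) := by
      gcongr
      exact le_trans (by exact_mod_cast h6) hpoly
    _ = _ := by
      rw [← Real.rpow_add (by norm_num)]
      congr 1
      ring

end FewNegCount

/-! ### Pairs of families with few unions of size one larger -/

section UnionGeometry

variable {n : ℕ}

theorem card_le_card_unionSets_mul (k : ℕ) (L M : Finset (Finset (Fin n)))
    (X : Finset (Finset (Fin n) × Finset (Fin n)))
    (hX : ∀ p ∈ X, p.1 ∈ L ∧ p.2 ∈ M ∧ p.1 ≠ p.2 ∧ #(p.1 ∪ p.2) = k) :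
    #X ≤ #(unionSets k L M) * 4 ^ k := by
  classical
  have hsub : X ⊆ (unionSets k L M).biUnion (fun E => E.powerset ×ˢ E.powerset) := fun p hp => by
    obtain ⟨h1, h2, h3, h4⟩ := hX p hp
    exact mem_biUnion.2 ⟨p.1 ∪ p.2, mem_filter.2 ⟨mem_powersetCard.2 ⟨subset_univ _, h4⟩,
      p.1, h1, p.2, h2, h3, rfl⟩, mem_product.2 ⟨mem_powerset.2 subset_union_left,
      mem_powerset.2 subset_union_right⟩⟩
  refine (card_le_card hsub).trans (card_biUnion_le_card_mul _ _ _ fun E hE => ?_)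
  rw [card_product, card_powerset, (mem_powersetCard.1 (mem_filter.1 hE).1).2, ← mul_pow]
  norm_num

theorem sq_card_le_of_subset (m : ℕ) (L M X : Finset (Finset (Fin n)))
    (hX : X ⊆ univ.powersetCard (m + 1)) (hL : X ⊆ L) (hM : X ⊆ M) :
    #X ^ 2 ≤ n ^ m * (2 ^ (m + 1) * (#X + #(unionSets (m + 2) L M) * 4 ^ (m + 2))) := by
  classical
  let 𝒵 : Finset (Finset (Fin n)) := univ.powersetCard m
  let Y := (X ×ˢ X).filter (fun p => p.1 ≠ p.2 ∧ #(p.1 ∪ p.2) = m + 2)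
  have hY : #Y ≤ #(unionSets (m + 2) L M) * 4 ^ (m + 2) :=
    card_le_card_unionSets_mul _ _ _ _ fun p hp => by
      obtain ⟨hp, h1, h2⟩ := mem_filter.1 hp
      exact ⟨hL (mem_product.1 hp).1, hM (mem_product.1 hp).2, h1, h2⟩
  have h1 : #X ≤ ∑ Z ∈ 𝒵, #(X.filter (fun D => Z ⊆ D)) := by
    calc #X = ∑ D ∈ X, 1 := by simp
      _ ≤ ∑ D ∈ X, #(𝒵.bipartiteBelow (fun Z D => Z ⊆ D) D) := by
        refine sum_le_sum fun D hD => card_pos.2 ?_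
        obtain ⟨Z, hZ, hZc⟩ := exists_subset_card_eq
          (show m ≤ #D by rw [(mem_powersetCard.1 (hX hD)).2]; omega)
        exact ⟨Z, mem_filter.2 ⟨mem_powersetCard.2 ⟨subset_univ _, hZc⟩, hZ⟩⟩
      _ = _ := (sum_card_bipartiteAbove_eq_sum_card_bipartiteBelow _).symm
  have h2 : ∑ Z ∈ 𝒵, #(X.filter (fun D => Z ⊆ D)) ^ 2 ≤ 2 ^ (m + 1) * (#X + #Y) := by
    calc _ = ∑ Z ∈ 𝒵, #((X ×ˢ X).bipartiteAbove (fun Z p => Z ⊆ p.1 ∧ Z ⊆ p.2) Z) := by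
          refine sum_congr rfl fun Z _ => ?_
          rw [sq, ← card_product, bipartiteAbove, filter_product]
      _ = ∑ p ∈ X ×ˢ X, #(𝒵.bipartiteBelow (fun Z p => Z ⊆ p.1 ∧ Z ⊆ p.2) p) :=
        sum_card_bipartiteAbove_eq_sum_card_bipartiteBelow _
      _ = ∑ p ∈ X.image (fun D => (D, D)) ∪ Y,
          #(𝒵.bipartiteBelow (fun Z p => Z ⊆ p.1 ∧ Z ⊆ p.2) p) := by
        refine (sum_subset (union_subset (fun p hp => ?_) (filter_subset _ _)) ?_).symm
        · obtain ⟨D, hD, rfl⟩ := mem_image.1 hp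
          exact mem_product.2 ⟨hD, hD⟩
        · intro p hp hpY
          refine card_eq_zero.2 (filter_eq_empty_iff.2 fun Z hZ hZp => hpY ?_)
          obtain ⟨hp1, hp2⟩ := mem_product.1 hp
          by_cases hne : p.1 = p.2
          · exact mem_union_left _ (mem_image.2 ⟨p.1, hp1, Prod.ext rfl hne⟩)
          · refine mem_union_right _ (mem_filter.2 ⟨hp, hne, ?_⟩)
            have c1 := (mem_powersetCard.1 (hX hp1)).2
            have c2 := (mem_powersetCard.1 (hX hp2)).2
            have c3 := card_le_card (subset_inter hZp.1 hZp.2)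
            rw [(mem_powersetCard.1 hZ).2] at c3
            have c4 := card_union_add_card_inter p.1 p.2
            have c5 : #(p.1 ∩ p.2) ≠ m + 1 := fun h => hne <| by
              have e1 := eq_of_subset_of_card_le (inter_subset_left (s₁ := p.1) (s₂ := p.2)) (by omega)
              have e2 := eq_of_subset_of_card_le (inter_subset_right (s₁ := p.1) (s₂ := p.2))
                (by omega)
              exact e1.symm.trans e2
            have c6 := card_le_card (inter_subset_left (s₁ := p.1) (s₂ := p.2))
            omega
      _ ≤ ∑ p ∈ X.image (fun D => (D, D)) ∪ Y, 2 ^ (m + 1) := by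
        refine sum_le_sum fun p hp => ?_
        have hpX : p.1 ∈ X := by
          rcases mem_union.1 hp with h | h
          · obtain ⟨D, hD, rfl⟩ := mem_image.1 h
            exact hD
          · exact (mem_product.1 (mem_filter.1 h).1).1
        rw [← (mem_powersetCard.1 (hX hpX)).2, ← card_powerset]
        exact card_le_card fun Z hZ => mem_powerset.2 (mem_filter.1 hZ).2.1
      _ ≤ _ := by
        rw [sum_const, smul_eq_mul, mul_comm]
        exact Nat.mul_le_mul_left _ ((card_union_le _ _).trans
          (Nat.add_le_add_right card_image_le _))
  have h3 : #𝒵 ≤ n ^ m := by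
    rw [card_powersetCard, card_univ, Fintype.card_fin]
    exact Nat.choose_le_pow n m
  calc #X ^ 2 ≤ (∑ Z ∈ 𝒵, #(X.filter (fun D => Z ⊆ D))) ^ 2 := Nat.pow_le_pow_left h1 2
    _ ≤ #𝒵 * ∑ Z ∈ 𝒵, #(X.filter (fun D => Z ⊆ D)) ^ 2 := sq_sum_le_card_mul_sum_sq
    _ ≤ n ^ m * (2 ^ (m + 1) * (#X + #Y)) := Nat.mul_le_mul h3 h2
    _ ≤ _ := by gcongr

theorem exists_card_inter_le (m : ℕ) {τ : ℝ} (hτ : 0 < τ) : ∃ γ : ℝ, 0 < γ ∧ ∀ᶠ n : ℕ in atTop,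
    ∀ L M : Finset (Finset (Fin n)), L ⊆ univ.powersetCard (m + 1) →
      (#(unionSets (m + 2) L M) : ℝ) < γ * (n : ℝ) ^ (m + 2) →
      (#(L ∩ M) : ℝ) ≤ τ * (n : ℝ) ^ (m + 1) := by
  refine ⟨τ ^ 2 / 2 / (2 ^ (m + 1) * 4 ^ (m + 2)), by positivity, ?_⟩
  filter_upwards [eventually_pow_le_mul_pow (a := m + 1) (b := m + 2) (by omega)
    (δ := τ ^ 2 / 2 / 2 ^ (m + 1)) (by positivity), eventually_ge_atTop 1] with n hn hn1 L M hL hU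
  by_contra! hcon
  have hn0 : (0 : ℝ) < n := by exact_mod_cast hn1
  have h1 := sq_card_le_of_subset m L M (L ∩ M) (inter_subset_left.trans hL) inter_subset_left
    inter_subset_right
  have h2 : #(L ∩ M) ≤ n ^ (m + 1) := by
    have := card_le_card ((inter_subset_left (s₁ := L) (s₂ := M)).trans hL)
    rw [card_powersetCard, card_univ, Fintype.card_fin] at this
    exact this.trans (Nat.choose_le_pow _ _)
  have h3 : (#(L ∩ M) : ℝ) ^ 2 ≤ (n : ℝ) ^ m * (2 ^ (m + 1) * (#(L ∩ M) +
    #(unionSets (m + 2) L M) * 4 ^ (m + 2))) := by exact_mod_cast h1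
  have h4 : (#(L ∩ M) : ℝ) ≤ (n : ℝ) ^ (m + 1) := by exact_mod_cast h2
  have h5 : (τ * (n : ℝ) ^ (m + 1)) ^ 2 < (#(L ∩ M) : ℝ) ^ 2 := by gcongr
  have h6 : (2 : ℝ) ^ (m + 1) * (#(L ∩ M) + #(unionSets (m + 2) L M) * 4 ^ (m + 2)) ≤
      τ ^ 2 * (n : ℝ) ^ (m + 2) := by
    calc _ ≤ (2 : ℝ) ^ (m + 1) * (τ ^ 2 / 2 / 2 ^ (m + 1) * (n : ℝ) ^ (m + 2) +
          τ ^ 2 / 2 / (2 ^ (m + 1) * 4 ^ (m + 2)) * (n : ℝ) ^ (m + 2) * 4 ^ (m + 2)) := by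
          gcongr
          exact h4.trans hn
      _ = _ := by field_simp; ring
  have h7 : (n : ℝ) ^ m * (2 ^ (m + 1) * (#(L ∩ M) +
      #(unionSets (m + 2) L M) * 4 ^ (m + 2))) ≤ (n : ℝ) ^ m * (τ ^ 2 * (n : ℝ) ^ (m + 2)) := by
    gcongr
  have h8 : (n : ℝ) ^ m * (τ ^ 2 * (n : ℝ) ^ (m + 2)) = (τ * (n : ℝ) ^ (m + 1)) ^ 2 := by ring
  linarith

end UnionGeometry

section UnionGeometry

variable {n : ℕ}

theorem card_filter_forall_mem_mem_le {m : ℕ} (i : Fin (m + 1)) (U : Finset (Finset (Fin n)))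
    (hU : ∀ E ∈ U, #E = m + 2) (F : Finset ((Fin (m + 1) → Fin n) × (Fin (m + 1) → Fin n)))
    (hF : ∀ p ∈ F, ∃ E ∈ U, (∀ j, p.1 j ∈ E) ∧ p.2 i ∈ E) :
    #F ≤ #U * ((m + 2) ^ (m + 2) * n ^ m) := by
  classical
  have hsub : F ⊆ U.biUnion (fun E => Fintype.piFinset (fun _ => E) ×ˢ
      Fintype.piFinset (fun j => if j = i then E else univ)) := fun p hp => by
    obtain ⟨E, hE, h1, h2⟩ := hF p hp
    refine mem_biUnion.2 ⟨E, hE, mem_product.2 ⟨Fintype.mem_piFinset.2 h1,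
      Fintype.mem_piFinset.2 fun j => ?_⟩⟩
    by_cases hj : j = i
    · rw [if_pos hj, hj]
      exact h2
    · rw [if_neg hj]
      exact mem_univ _
  refine (card_le_card hsub).trans (card_biUnion_le_card_mul _ _ _ fun E hE => ?_)
  have h1 : ∏ j ∈ univ.erase i, #(if j = i then E else (univ : Finset (Fin n))) = n ^ m := by
    rw [prod_congr rfl fun j hj => by
      rw [if_neg (ne_of_mem_erase hj), card_univ, Fintype.card_fin], prod_const,
      card_erase_of_mem (mem_univ _), card_univ, Fintype.card_fin, Nat.add_sub_cancel]
  have h2 : ∏ j, #(if j = i then E else (univ : Finset (Fin n))) = (m + 2) * n ^ m := by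
    rw [← mul_prod_erase _ _ (mem_univ i), h1, if_pos rfl, hU E hE]
  rw [card_product, Fintype.card_piFinset, Fintype.card_piFinset, h2, prod_const, card_univ,
    Fintype.card_fin, hU E hE, pow_succ (m + 2) (m + 1), mul_assoc]

theorem card_mul_card_sdiff_le (m : ℕ) (L M : Finset (Finset (Fin n)))
    (hL : L ⊆ univ.powersetCard (m + 1)) (hM : M ⊆ univ.powersetCard (m + 1)) :
    #L * #(M \ L) ≤ (m + 1) * (2 * (((m + 1) ^ 2 * n ^ m + #(univ.powersetCard (m + 1) \ (L ∪ M)) *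
      (m + 1) ^ (m + 1)) * n ^ (m + 1)) +
        #(unionSets (m + 2) L M) * ((m + 2) ^ (m + 2) * n ^ m)) := by
  classical
  let f : (Fin (m + 1) → Fin n) → Option Bool := fun x =>
    if Function.Injective x ∧ univ.image x ∈ L then some true
    else if Function.Injective x ∧ univ.image x ∈ M then some false else none
  have hft : ∀ x, f x = some true ↔ Function.Injective x ∧ univ.image x ∈ L := by
    intro x
    simp only [f]
    split_ifs with h1 h2 <;> simp_all
  have hff : ∀ x, f x = some false ↔ Function.Injective x ∧ univ.image x ∈ M \ L := by
    intro x
    simp only [f]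
    split_ifs with h1 h2 <;> simp_all
  have hcardimg : ∀ x : Fin (m + 1) → Fin n, Function.Injective x → #(univ.image x) = m + 1 := by
    intro x hx
    rw [card_image_of_injective _ hx, card_univ, Fintype.card_fin]
  have henum : ∀ D : Finset (Fin n), D ∈ univ.powersetCard (m + 1) →
      ∃ x : Fin (m + 1) → Fin n, Function.Injective x ∧ univ.image x = D := by
    intro D hD
    refine ⟨D.orderEmbOfFin (mem_powersetCard.1 hD).2, (D.orderEmbOfFin _).injective, ?_⟩
    exact image_orderEmbOfFin_univ _ _
  rcases L.eq_empty_or_nonempty with rfl | ⟨D₀, hD₀⟩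
  · rw [card_empty, zero_mul]
    exact Nat.zero_le _
  have : Nonempty (Fin (m + 1) → Fin n) := ⟨(henum D₀ (hL hD₀)).choose⟩
  choose! e he heimg using henum
  have hlow : #L * #(M \ L) ≤ #((univ : Finset ((Fin (m + 1) → Fin n) × (Fin (m + 1) → Fin n))).filter
      (fun p => f p.1 ≠ f p.2)) := by
    rw [← card_product]
    refine card_le_card_of_injOn (fun p => (e p.1, e p.2)) (fun p hp => ?_) (fun p hp p' hp' h => ?_)
    · obtain ⟨h1, h2⟩ := mem_product.1 hp
      have h3 := hM (mem_sdiff.1 h2).1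
      refine mem_coe.2 (mem_filter.2 ⟨mem_univ _, ?_⟩)
      rw [(hft (e p.1)).2 ⟨he _ (hL h1), by rwa [heimg _ (hL h1)]⟩,
        (hff (e p.2)).2 ⟨he _ h3, by rwa [heimg _ h3]⟩]
      simp
    · obtain ⟨h1, h2⟩ := mem_product.1 hp
      obtain ⟨h1', h2'⟩ := mem_product.1 hp'
      obtain ⟨e1, e2⟩ := Prod.mk.inj h
      refine Prod.ext ?_ ?_
      · rw [← heimg _ (hL h1), ← heimg _ (hL h1')]
        exact congrArg (fun x => univ.image x) e1
      · rw [← heimg _ (hM (mem_sdiff.1 h2).1), ← heimg _ (hM (mem_sdiff.1 h2').1)]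
        exact congrArg (fun x => univ.image x) e2
  let B := (univ : Finset (Fin (m + 1) → Fin n)).filter (fun x => f x = none)
  have hB : #B ≤ (m + 1) ^ 2 * n ^ m + #(univ.powersetCard (m + 1) \ (L ∪ M)) *
      (m + 1) ^ (m + 1) := by
    have hsub : B ⊆ univ.filter (fun x : Fin (m + 1) → Fin n => ¬ Function.Injective x) ∪
        (univ.powersetCard (m + 1) \ (L ∪ M)).biUnion (fun D => Fintype.piFinset (fun _ => D)) := by
      intro x hx
      have hx' := (mem_filter.1 hx).2
      by_cases hinj : Function.Injective x
      · refine mem_union_right _ (mem_biUnion.2 ⟨univ.image x, mem_sdiff.2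
          ⟨mem_powersetCard.2 ⟨subset_univ _, hcardimg x hinj⟩, fun h => ?_⟩,
          Fintype.mem_piFinset.2 fun j => mem_image_of_mem _ (mem_univ _)⟩)
        by_cases hxL : univ.image x ∈ L
        · rw [(hft x).2 ⟨hinj, hxL⟩] at hx'
          cases hx'
        · rw [(hff x).2 ⟨hinj, mem_sdiff.2 ⟨(mem_union.1 h).resolve_left hxL, hxL⟩⟩] at hx'
          cases hx'
      · exact mem_union_left _ (mem_filter.2 ⟨mem_univ _, hinj⟩)
    refine (card_le_card hsub).trans ((card_union_le _ _).trans (Nat.add_le_add ?_ ?_))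
    · have := card_filter_not_injective_le (U := Fin (m + 1)) n
      rw [Fintype.card_fin, Nat.add_sub_cancel] at this
      exact this
    · refine card_biUnion_le_card_mul _ _ _ fun D hD => ?_
      rw [Fintype.card_piFinset, prod_const, (mem_powersetCard.1 (mem_sdiff.1 hD).1).2, card_univ,
        Fintype.card_fin]
  have hpath : #((univ : Finset ((Fin (m + 1) → Fin n) × (Fin (m + 1) → Fin n))).filter
      (fun p => f p.1 ≠ f p.2)) ≤ ∑ i : Fin (m + 1), #((univ : Finset ((Fin (m + 1) → Fin n) ×
        (Fin (m + 1) → Fin n))).filter (fun p => f p.1 ≠ f (Function.update p.1 i (p.2 i)))) := by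
    convert card_filter_ne_le_sum_update f
  refine hlow.trans (hpath.trans ?_)
  have hstep : ∀ i : Fin (m + 1), #((univ : Finset ((Fin (m + 1) → Fin n) ×
      (Fin (m + 1) → Fin n))).filter (fun p => f p.1 ≠ f (Function.update p.1 i (p.2 i)))) ≤
      2 * (#B * n ^ (m + 1)) + #(unionSets (m + 2) L M) * ((m + 2) ^ (m + 2) * n ^ m) := by
    intro i
    let σ : (Fin (m + 1) → Fin n) × (Fin (m + 1) → Fin n) →
        (Fin (m + 1) → Fin n) × (Fin (m + 1) → Fin n) :=
      fun p => (Function.update p.1 i (p.2 i), Function.update p.2 i (p.1 i))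
    have hσ : Function.Involutive σ := fun p => by simp [σ]
    let F₁ := B ×ˢ (univ : Finset (Fin (m + 1) → Fin n))
    let F₂ := univ.filter (fun p => σ p ∈ F₁)
    obtain ⟨F₃, hF₃mem⟩ : ∃ F₃ : Finset ((Fin (m + 1) → Fin n) × (Fin (m + 1) → Fin n)), ∀ p,
        p ∈ F₃ ↔ ∃ E ∈ unionSets (m + 2) L M, (∀ j, p.1 j ∈ E) ∧ p.2 i ∈ E :=
      ⟨(Set.toFinite {p | ∃ E ∈ unionSets (m + 2) L M, (∀ j, p.1 j ∈ E) ∧ p.2 i ∈ E}).toFinset,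
        fun p => by rw [Set.Finite.mem_toFinset, Set.mem_ofPred_eq]⟩
    have hF₁ : #F₁ = #B * n ^ (m + 1) := by
      rw [card_product, card_univ, Fintype.card_fun, Fintype.card_fin, Fintype.card_fin]
    have hF₂ : #F₂ ≤ #F₁ := card_le_card_of_injOn σ (fun p hp => (mem_filter.1 hp).2)
      hσ.injective.injOn
    have hF₃ := card_filter_forall_mem_mem_le i (unionSets (m + 2) L M)
      (fun E hE => (mem_powersetCard.1 (mem_filter.1 hE).1).2) F₃ fun p hp => (hF₃mem p).1 hp
    have hunion : ∀ x : Fin (m + 1) → Fin n, ∀ w : Fin n, Function.Injective x →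
        Function.Injective (Function.update x i w) →
        univ.image x ≠ univ.image (Function.update x i w) →
        #(univ.image x ∪ univ.image (Function.update x i w)) = m + 2 ∧
          univ.image x ∪ univ.image (Function.update x i w) = insert w (univ.image x) := by
      intro x w hx hxw hne
      have h1 : univ.image x ∪ univ.image (Function.update x i w) = insert w (univ.image x) := by
        ext y
        simp only [mem_union, mem_image, mem_univ, true_and, mem_insert]
        constructor
        · rintro (h | ⟨j, rfl⟩)
          · exact Or.inr h
          · by_cases hj : j = i
            · subst hj
              simp
            · rw [Function.update_of_ne hj]
              exact Or.inr ⟨j, rfl⟩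
        · rintro (rfl | h)
          · exact Or.inr ⟨i, Function.update_self _ _ _⟩
          · exact Or.inl h
      refine ⟨?_, h1⟩
      have hw : w ∉ univ.image x := fun hw => hne <| by
        rw [insert_eq_of_mem hw] at h1
        refine (eq_of_subset_of_card_le (union_eq_left.1 h1) ?_).symm
        rw [hcardimg _ hx, hcardimg _ hxw]
      rw [h1, card_insert_of_notMem hw, hcardimg _ hx]
    have hsub : (univ.filter (fun p : (Fin (m + 1) → Fin n) × (Fin (m + 1) → Fin n) =>
        f p.1 ≠ f (Function.update p.1 i (p.2 i)))) ⊆ F₁ ∪ F₂ ∪ F₃ := by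
      intro p hp
      have hp := (mem_filter.1 hp).2
      by_contra hcon
      simp only [mem_union, not_or] at hcon
      obtain ⟨⟨hc1, hc2⟩, hc3⟩ := hcon
      have hn1 : f p.1 ≠ none := fun h =>
        hc1 (mem_product.2 ⟨mem_filter.2 ⟨mem_univ _, h⟩, mem_univ _⟩)
      have hn2 : f (Function.update p.1 i (p.2 i)) ≠ none := fun h =>
        hc2 (mem_filter.2 ⟨mem_univ _, mem_product.2 ⟨mem_filter.2 ⟨mem_univ _, h⟩, mem_univ _⟩⟩)
      have hfin : ∀ D ∈ L, ∀ D' ∈ M, D ≠ D' → #(D ∪ D') = m + 2 →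
          D ∪ D' = insert (p.2 i) (univ.image p.1) → False := by
        intro D hD D' hD' hne hcard heq
        refine hc3 ((hF₃mem p).2 ⟨insert (p.2 i) (univ.image p.1), ?_, fun j =>
          mem_insert_of_mem (mem_image_of_mem _ (mem_univ _)), mem_insert_self _ _⟩)
        rw [← heq]
        exact mem_filter.2 ⟨mem_powersetCard.2 ⟨subset_univ _, hcard⟩, D, hD, D', hD', hne, rfl⟩
      rcases h1 : f p.1 with _ | b1
      · exact hn1 h1
      rcases h2 : f (Function.update p.1 i (p.2 i)) with _ | b2
      · exact hn2 h2
      cases b1 <;> cases b2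
      · exact hp (h1.trans h2.symm)
      · obtain ⟨i1, m1⟩ := (hff _).1 h1
        obtain ⟨i2, m2⟩ := (hft _).1 h2
        have hne : univ.image p.1 ≠ univ.image (Function.update p.1 i (p.2 i)) := fun h =>
          (mem_sdiff.1 m1).2 (h ▸ m2)
        obtain ⟨h3, h4⟩ := hunion _ _ i1 i2 hne
        rw [union_comm] at h3 h4
        exact hfin _ m2 _ (mem_sdiff.1 m1).1 hne.symm h3 h4
      · obtain ⟨i1, m1⟩ := (hft _).1 h1
        obtain ⟨i2, m2⟩ := (hff _).1 h2
        have hne : univ.image p.1 ≠ univ.image (Function.update p.1 i (p.2 i)) := fun h =>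
          (mem_sdiff.1 m2).2 (h ▸ m1)
        obtain ⟨h3, h4⟩ := hunion _ _ i1 i2 hne
        exact hfin _ m1 _ (mem_sdiff.1 m2).1 hne h3 h4
      · exact hp (h1.trans h2.symm)
    have := card_le_card hsub
    have h1 := card_union_le (F₁ ∪ F₂) F₃
    have h2 := card_union_le F₁ F₂
    omega
  refine (sum_le_sum fun i _ => hstep i).trans ?_
  rw [sum_const, card_univ, Fintype.card_fin, smul_eq_mul]
  gcongr

/-- Two large families with few unions of size one larger are almost disjoint and leave a
positive proportion of sets uncovered. -/
theorem exists_card_add_card_le (m : ℕ) {κ : ℝ} (hκ : 0 < κ) :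
    ∃ c : ℝ, 0 < c ∧ ∃ γ : ℝ, 0 < γ ∧ ∀ᶠ n : ℕ in atTop, ∀ L M : Finset (Finset (Fin n)),
      L ⊆ univ.powersetCard (m + 1) → M ⊆ univ.powersetCard (m + 1) →
      κ * (n : ℝ) ^ (m + 1) ≤ #L → κ * (n : ℝ) ^ (m + 1) ≤ #M →
      (#(unionSets (m + 2) L M) : ℝ) < γ * (n : ℝ) ^ (m + 2) →
      (#L + #M : ℝ) ≤ n.choose (m + 1) - c * (n : ℝ) ^ (m + 1) := by
  obtain ⟨A, hA⟩ : ∃ A : ℝ, A = 2 * (m + 1) * (m + 1) ^ (m + 1) := ⟨_, rfl⟩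
  obtain ⟨B, hB⟩ : ∃ B : ℝ, B = (m + 1) * (m + 2) ^ (m + 2) := ⟨_, rfl⟩
  have hA0 : 0 < A := by rw [hA]; positivity
  have hB0 : 0 < B := by rw [hB]; positivity
  obtain ⟨c, hc⟩ : ∃ c : ℝ, c = κ ^ 2 / 8 / A := ⟨_, rfl⟩
  have hc0 : 0 < c := by rw [hc]; positivity
  obtain ⟨γ₀, hγ₀, hinter⟩ := exists_card_inter_le m (τ := min c (κ / 2)) (by positivity)
  refine ⟨c, hc0, min γ₀ (κ ^ 2 / 8 / B), by positivity, ?_⟩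
  filter_upwards [hinter, eventually_ge_atTop 1,
    eventually_pow_le_mul_pow (a := m) (b := m + 1) (by omega)
      (δ := κ ^ 2 / 8 / (2 * (m + 1) * (m + 1) ^ 2)) (by positivity)]
    with n hinter hn hpow L M hL hM hLκ hMκ hU
  have hn0 : (0 : ℝ) < n := by exact_mod_cast hn
  have hI := hinter L M hL (hU.trans_le (by gcongr; exact min_le_left _ _))
  have hU2 : (#(unionSets (m + 2) L M) : ℝ) ≤ κ ^ 2 / 8 / B * (n : ℝ) ^ (m + 2) :=
    hU.le.trans (by gcongr; exact min_le_right _ _)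
  have hI1 : (#(L ∩ M) : ℝ) ≤ c * (n : ℝ) ^ (m + 1) :=
    hI.trans (by gcongr; exact min_le_left _ _)
  have hI2 : (#(L ∩ M) : ℝ) ≤ κ / 2 * (n : ℝ) ^ (m + 1) :=
    hI.trans (by gcongr; exact min_le_right _ _)
  have hmain := card_mul_card_sdiff_le m L M hL hM
  have hsd : (#(M \ L) : ℝ) + #(L ∩ M) = #M := by
    rw [inter_comm]
    exact_mod_cast card_sdiff_add_card_inter M L
  have hun : (#(L ∪ M) : ℝ) + #(L ∩ M) = #L + #M := by
    exact_mod_cast card_union_add_card_inter L M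
  have hcomp : (#(univ.powersetCard (m + 1) \ (L ∪ M)) : ℝ) + #(L ∪ M) = n.choose (m + 1) := by
    have := card_sdiff_add_card_eq_card (union_subset hL hM)
    rw [card_powersetCard, card_univ, Fintype.card_fin] at this
    exact_mod_cast this
  obtain ⟨K, hK⟩ : ∃ K : ℝ, K = #(univ.powersetCard (m + 1) \ (L ∪ M)) := ⟨_, rfl⟩
  have hmain' : (#L : ℝ) * #(M \ L) ≤ (m + 1) * (2 * (((m + 1) ^ 2 * (n : ℝ) ^ m + K *
      (m + 1) ^ (m + 1)) * (n : ℝ) ^ (m + 1)) +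
        #(unionSets (m + 2) L M) * ((m + 2) ^ (m + 2) * (n : ℝ) ^ m)) := by
    rw [hK]
    exact_mod_cast hmain
  rw [← hK] at hcomp
  suffices hK' : 2 * c * (n : ℝ) ^ (m + 1) ≤ K by linarith
  obtain ⟨N, hN⟩ : ∃ N : ℝ, N = (n : ℝ) ^ (m + 1) := ⟨_, rfl⟩
  have hN0 : 0 < N := by rw [hN]; positivity
  have h1 : κ ^ 2 / 2 * N * N ≤ (#L : ℝ) * #(M \ L) := by
    have h2 : κ / 2 * N ≤ #(M \ L) := by rw [hN]; linarith
    calc _ = (κ * N) * (κ / 2 * N) := by ring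
      _ ≤ _ := by
        gcongr
        rw [hN]
        exact hLκ
  have h2 : (m + 1) * (2 * (((m + 1) ^ 2 * (n : ℝ) ^ m + K * (m + 1) ^ (m + 1)) * (n : ℝ) ^ (m + 1)) +
      #(unionSets (m + 2) L M) * ((m + 2) ^ (m + 2) * (n : ℝ) ^ m)) ≤
      (κ ^ 2 / 4 * N + A * K) * N := by
    calc _ ≤ (m + 1) * (2 * (((m + 1) ^ 2 * (κ ^ 2 / 8 / (2 * (m + 1) * (m + 1) ^ 2) * (n : ℝ) ^ (m + 1)) +
          K * (m + 1) ^ (m + 1)) * (n : ℝ) ^ (m + 1)) +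
          κ ^ 2 / 8 / B * (n : ℝ) ^ (m + 2) * ((m + 2) ^ (m + 2) * (n : ℝ) ^ m)) := by
          gcongr
      _ = κ ^ 2 / 8 * N * N + A * K * N + κ ^ 2 / 8 * (((m + 1) * (m + 2) ^ (m + 2)) / B) * (N * N) := by
          rw [hA, hN]
          field_simp
          ring
      _ = _ := by
          rw [← hB, div_self hB0.ne']
          ring
  have h3 : κ ^ 2 / 2 * N ≤ κ ^ 2 / 4 * N + A * K :=
    le_of_mul_le_mul_right (h1.trans (hmain'.trans h2)) hN0
  rw [← hN, hc]
  have h4 : κ ^ 2 / 4 * N ≤ K * A := by linarith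
  calc 2 * (κ ^ 2 / 8 / A) * N = κ ^ 2 / 4 * N / A := by ring
    _ ≤ K := (div_le_iff₀ hA0).2 h4

end UnionGeometry

/-! ### Minimal pairs with many clauses on some negative variable -/

section LinkContainers

theorem exists_link_containers (k : ℕ) (hk : 2 ≤ k) {ε : ℝ} (hε : 0 < ε) :
    ∀ᶠ n : ℕ in atTop, ∀ P₀ : Finset (Finset (Fin n)),
      ∃ 𝒞 : Finset (Finset (Finset (Fin n)) × Finset (Finset (Fin n))),
        (#𝒞 : ℝ) ≤ 2 ^ (ε * (n : ℝ) ^ (k - 1)) ∧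
        ∀ L ⊆ univ.powersetCard (k - 1), ∀ M ⊆ univ.powersetCard (k - 1),
          Disjoint P₀ (unionSets k L M) → ∃ Γ ∈ 𝒞, L ⊆ Γ.1 ∧ M ⊆ Γ.2 ∧
            Γ.1 ⊆ univ.powersetCard (k - 1) ∧ Γ.2 ⊆ univ.powersetCard (k - 1) ∧
            (#(P₀ ∩ unionSets k Γ.1 Γ.2) : ℝ) ≤ ε * (n : ℝ) ^ k := by
  classical
  obtain ⟨δ, hδ, N₀, hcont⟩ := containerProperty 2 (ε / 2 ^ (k + 1)) (by positivity)
  filter_upwards [eventually_ge_atTop 1,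
    tendsto_natCast_atTop_atTop.eventually_ge_atTop (1 / (δ * 2 ^ k)),
    tendsto_natCast_atTop_atTop.eventually_ge_atTop N₀] with n hn hnδ hnN P₀
  have hn1 : (1 : ℝ) ≤ n := by exact_mod_cast hn
  have hpow : (n : ℝ) ^ k = n * (n : ℝ) ^ (k - 1) := by
    rw [← pow_succ', Nat.sub_add_cancel (by omega)]
  let 𝒟 : Finset (Finset (Fin n)) := univ.powersetCard (k - 1)
  let V₀ : Finset (Bool × Finset (Fin n)) := univ ×ˢ 𝒟
  let E := (𝒟 ×ˢ 𝒟).filter (fun p => p.1 ≠ p.2 ∧ #(p.1 ∪ p.2) = k ∧ p.1 ∪ p.2 ∈ P₀)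
  let e : Fin 2 → Finset (Fin n) × Finset (Fin n) → Bool × Finset (Fin n) :=
    fun j p => if j = 0 then (true, p.1) else (false, p.2)
  have hV₀ : (#V₀ : ℝ) ≤ 2 * (n : ℝ) ^ (k - 1) := by
    have : #V₀ ≤ 2 * n ^ (k - 1) := by
      rw [card_product, card_univ, Fintype.card_bool, card_powersetCard, card_univ,
        Fintype.card_fin]
      exact Nat.mul_le_mul_left _ (Nat.choose_le_pow _ _)
    exact_mod_cast this
  have hN : N₀ ≤ 2 * (n : ℝ) ^ (k - 1) := by
    have h1 : (n : ℝ) ≤ (n : ℝ) ^ (k - 1) := le_self_pow₀ hn1 (by omega)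
    linarith
  have hins : ∀ D D' : Finset (Fin n), D ∈ 𝒟 → #(D ∪ D') = k →
      ∃ w, D' ⊆ insert w D := by
    intro D D' hD hcard
    have h1 : #(D' \ D) = 1 := by
      have := card_sdiff_add_card D' D
      rw [union_comm] at this
      have h2 := (mem_powersetCard.1 hD).2
      omega
    obtain ⟨w, hw⟩ := card_eq_one.1 h1
    refine ⟨w, fun x hx => ?_⟩
    by_cases hxD : x ∈ D
    · exact mem_insert_of_mem hxD
    · rw [← mem_singleton.1 (hw ▸ mem_sdiff.2 ⟨hx, hxD⟩ : x ∈ ({w} : Finset (Fin n)))]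
      exact mem_insert_self _ _
  have hnbr : ∀ D ∈ 𝒟, #(univ.biUnion (fun w : Fin n => (insert w D).powerset)) ≤ 2 ^ k * n := by
    intro D hD
    refine (card_biUnion_le_card_mul _ _ (2 ^ k) fun w _ => ?_).trans
      (by rw [card_univ, Fintype.card_fin, mul_comm])
    rw [card_powerset]
    refine Nat.pow_le_pow_right (by norm_num) ((card_insert_le _ _).trans ?_)
    rw [(mem_powersetCard.1 hD).2]
    omega
  have hdeg : ∀ j x, (Set.ncard {i | i ∈ E ∧ e j i = x} : ℝ) ≤ 2 ^ k * n := by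
    intro j x
    rw [ncard_setOf_mem_and]
    suffices h : #(E.filter (fun i => e j i = x)) ≤ 2 ^ k * n by exact_mod_cast h
    rcases (E.filter (fun i => e j i = x)).eq_empty_or_nonempty with h0 | ⟨q, hq⟩
    · rw [h0, card_empty]
      exact Nat.zero_le _
    obtain ⟨hqE, hqx⟩ := mem_filter.1 hq
    obtain ⟨hq𝒟, -, -⟩ := mem_filter.1 hqE
    by_cases hj : j = 0
    · have hfst : ∀ p, e j p = x → p.1 = q.1 := fun p hp => by
        have := hp.trans hqx.symm
        simp only [e, hj, if_true] at this
        exact (Prod.mk.inj this).2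
      refine le_trans (card_le_card_of_injOn Prod.snd (fun p hp => ?_) fun p hp p' hp' h => ?_)
        (hnbr q.1 (mem_product.1 hq𝒟).1)
      · obtain ⟨hpE, hpx⟩ := mem_filter.1 hp
        obtain ⟨h𝒟, -, hc, -⟩ := mem_filter.1 hpE
        obtain ⟨w, hw⟩ := hins p.1 p.2 (mem_product.1 h𝒟).1 hc
        exact mem_biUnion.2 ⟨w, mem_univ _, mem_powerset.2 (hfst p hpx ▸ hw)⟩
      · exact Prod.ext ((hfst p (mem_filter.1 hp).2).trans (hfst p' (mem_filter.1 hp').2).symm) h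
    · have hsnd : ∀ p, e j p = x → p.2 = q.2 := fun p hp => by
        have := hp.trans hqx.symm
        simp only [e, hj, if_false] at this
        exact (Prod.mk.inj this).2
      refine le_trans (card_le_card_of_injOn Prod.fst (fun p hp => ?_) fun p hp p' hp' h => ?_)
        (hnbr q.2 (mem_product.1 hq𝒟).2)
      · obtain ⟨hpE, hpx⟩ := mem_filter.1 hp
        obtain ⟨h𝒟, -, hc, -⟩ := mem_filter.1 hpE
        obtain ⟨w, hw⟩ := hins p.2 p.1 (mem_product.1 h𝒟).2 (by rwa [union_comm])
        exact mem_biUnion.2 ⟨w, mem_univ _, mem_powerset.2 (hsnd p hpx ▸ hw)⟩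
      · exact Prod.ext h ((hsnd p (mem_filter.1 hp).2).trans (hsnd p' (mem_filter.1 hp').2).symm)
  have hcodeg : ∀ j l, j ≠ l → ∀ x y,
      (Set.ncard {i | i ∈ E ∧ e j i = x ∧ e l i = y} : ℝ) ≤ δ * (2 ^ k * n) := by
    intro j l hjl x y
    have h1 : Set.ncard {i | i ∈ E ∧ e j i = x ∧ e l i = y} ≤ 1 := by
      rw [ncard_setOf_mem_and]
      refine card_le_one.2 fun p hp p' hp' => ?_
      obtain ⟨-, h1, h2⟩ := mem_filter.1 hp
      obtain ⟨-, h1', h2'⟩ := mem_filter.1 hp'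
      have e1 := h1.trans h1'.symm
      have e2 := h2.trans h2'.symm
      have hcases : ∀ a b : Fin 2, a ≠ b → (a = 0 ∧ b ≠ 0) ∨ (a ≠ 0 ∧ b = 0) := by decide
      rcases hcases j l hjl with ⟨hj, hl⟩ | ⟨hj, hl⟩ <;>
      · simp only [e, hj, hl, if_true, if_false, Prod.mk.injEq, true_and] at e1 e2
        exact Prod.ext (by assumption) (by assumption)
    have h2 : (1 : ℝ) ≤ δ * (2 ^ k * n) := by
      rw [div_le_iff₀ (by positivity)] at hnδ
      linarith
    exact le_trans (by exact_mod_cast h1) h2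
  obtain ⟨𝒞, h𝒞, hcover⟩ := hcont V₀ E e (2 * (n : ℝ) ^ (k - 1)) (2 ^ k * n) hV₀ hN
    (by positivity) hdeg hcodeg
  let π : Finset (Bool × Finset (Fin n)) → Bool → Finset (Finset (Fin n)) :=
    fun Γ b => (Γ.filter (fun x => x.1 = b)).image Prod.snd
  have hπ : ∀ Γ b D, D ∈ π Γ b ↔ (b, D) ∈ Γ := by
    intro Γ b D
    simp [π]
  refine ⟨𝒞.image (fun Γ => (π Γ true, π Γ false)), ?_, fun L hL M hM hdis => ?_⟩
  · refine le_trans (by exact_mod_cast card_image_le) (h𝒞.trans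
      (Real.rpow_le_rpow_of_exponent_le (by norm_num) ?_))
    calc ε / 2 ^ (k + 1) * (2 * (n : ℝ) ^ (k - 1)) = ε * (n : ℝ) ^ (k - 1) * (1 / 2 ^ k) := by
          rw [pow_succ]; field_simp
      _ ≤ ε * (n : ℝ) ^ (k - 1) * 1 := by
          gcongr
          rw [div_le_one (by positivity)]
          exact one_le_pow₀ (by norm_num)
      _ = _ := mul_one _
  · obtain ⟨I, hI⟩ : ∃ I : Finset (Bool × Finset (Fin n)),
        I = L.image (fun D => (true, D)) ∪ M.image (fun D => (false, D)) := ⟨_, rfl⟩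
    have hIt : ∀ D, (true, D) ∈ I ↔ D ∈ L := by simp [hI]
    have hIf : ∀ D, (false, D) ∈ I ↔ D ∈ M := by simp [hI]
    have hIV : I ⊆ V₀ := by
      rintro ⟨b, D⟩ hD
      refine mem_product.2 ⟨mem_univ _, ?_⟩
      cases b
      · exact hM ((hIf D).1 hD)
      · exact hL ((hIt D).1 hD)
    obtain ⟨Γ, hΓ, hIΓ, hΓV, hedges⟩ := hcover I hIV fun p hp => by
      by_contra! hcon
      have h0 := (hIt _).1 (hcon 0)
      have h1 := (hIf _).1 (hcon 1)
      obtain ⟨-, hne, hc, hP⟩ := mem_filter.1 hp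
      exact disjoint_left.1 hdis hP (mem_filter.2 ⟨mem_powersetCard.2 ⟨subset_univ _, hc⟩,
        p.1, h0, p.2, h1, hne, rfl⟩)
    have hπV : ∀ b, π Γ b ⊆ univ.powersetCard (k - 1) := fun b D hD =>
      (mem_product.1 (hΓV ((hπ Γ b D).1 hD))).2
    refine ⟨(π Γ true, π Γ false), mem_image_of_mem _ hΓ,
      fun D hD => (hπ _ _ _).2 (hIΓ ((hIt D).2 hD)), fun D hD => (hπ _ _ _).2 (hIΓ ((hIf D).2 hD)),
      hπV _, hπV _, ?_⟩
    have hcard : #(P₀ ∩ unionSets k (π Γ true) (π Γ false)) ≤ #(edgesIn E e Γ) := by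
      refine (card_le_card fun S hS => ?_).trans
        (card_image_le (s := edgesIn E e Γ) (f := fun p => p.1 ∪ p.2))
      obtain ⟨hSP, hSu⟩ := mem_inter.1 hS
      obtain ⟨hSk, D, hD, D', hD', hne, rfl⟩ := mem_filter.1 hSu
      refine mem_image.2 ⟨(D, D'), mem_edgesIn.2 ⟨mem_filter.2 ⟨mem_product.2
        ⟨hπV _ hD, hπV _ hD'⟩, hne, (mem_powersetCard.1 hSk).2, hSP⟩, fun j => ?_⟩, rfl⟩
      by_cases hj : j = 0
      · simp only [e, hj, if_true]
        exact (hπ _ _ _).1 hD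
      · simp only [e, hj, if_false]
        exact (hπ _ _ _).1 hD'
    calc (#(P₀ ∩ unionSets k (π Γ true) (π Γ false)) : ℝ) ≤ #(edgesIn E e Γ) := by
          exact_mod_cast hcard
      _ ≤ ε / 2 ^ (k + 1) * (2 ^ k * n) * (2 * (n : ℝ) ^ (k - 1)) := hedges
      _ = ε * (n : ℝ) ^ k := by
          rw [hpow, pow_succ]; field_simp

end LinkContainers

section Links

variable {k n : ℕ}

/-- The link of `v` in `P`. -/
def linkPos {n : ℕ} (v : Fin n) (P : Finset (Finset (Fin n))) : Finset (Finset (Fin n)) :=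
  (P.filter (fun S => v ∈ S)).image (fun S => S.erase v)

/-- The positive parts of the members of `Q` whose only negative variable is `v`. -/
def linkNeg {n : ℕ} (v : Fin n) (Q : Finset (Finset (Fin n) × Finset (Fin n))) :
    Finset (Finset (Fin n)) :=
  (Q.filter (fun c => c.2 = {v})).image Prod.fst

theorem mem_linkPos {v : Fin n} {P : Finset (Finset (Fin n))} {D : Finset (Fin n)} :
    D ∈ linkPos v P ↔ v ∉ D ∧ insert v D ∈ P := by
  constructor
  · intro h
    obtain ⟨S, hS, rfl⟩ := mem_image.1 h
    obtain ⟨hSP, hv⟩ := mem_filter.1 hS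
    exact ⟨notMem_erase _ _, by rwa [insert_erase hv]⟩
  · rintro ⟨h1, h2⟩
    exact mem_image.2 ⟨insert v D, mem_filter.2 ⟨h2, mem_insert_self _ _⟩, erase_insert h1⟩

theorem mem_linkNeg {v : Fin n} {Q : Finset (Finset (Fin n) × Finset (Fin n))}
    {D : Finset (Fin n)} : D ∈ linkNeg v Q ↔ (D, {v}) ∈ Q := by
  constructor
  · intro h
    obtain ⟨c, hc, rfl⟩ := mem_image.1 h
    obtain ⟨hcQ, hv⟩ := mem_filter.1 hc
    rwa [← hv]
  · intro h
    exact mem_image.2 ⟨(D, {v}), mem_filter.2 ⟨h, rfl⟩, rfl⟩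

theorem IsMinPair.disjoint_unionSets {P : Finset (Finset (Fin n))}
    {Q : Finset (Finset (Fin n) × Finset (Fin n))} (h : IsMinPair k P Q) (v : Fin n) :
    Disjoint P (unionSets k (linkPos v P) (linkNeg v Q)) := by
  refine disjoint_left.2 fun E hE hEu => ?_
  obtain ⟨-, D, hD, D', hD', -, rfl⟩ := mem_filter.1 hEu
  obtain ⟨hvD, hDP⟩ := mem_linkPos.1 hD
  have hDQ := mem_linkNeg.1 hD'
  have hvD' : v ∉ D' := disjoint_singleton_right.1 (h.disjoint _ hDQ)
  obtain ⟨W, hW, huniq, hQ⟩ := h.witness_pos _ hE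
  have hvW : v ∈ W := by
    have := hQ _ hDQ (subset_union_right.trans hW)
    rwa [disjoint_singleton_left, not_not] at this
  have := huniq _ hDP (insert_subset hvW (subset_union_left.trans hW))
  have hv : v ∈ D ∪ D' := this ▸ mem_insert_self _ _
  exact (mem_union.1 hv).elim hvD hvD'

theorem IsMinPair.linkPos_subset {P : Finset (Finset (Fin n))}
    {Q : Finset (Finset (Fin n) × Finset (Fin n))} (h : IsMinPair k P Q) (v : Fin n) :
    linkPos v P ⊆ univ.powersetCard (k - 1) := fun D hD => by
  obtain ⟨h1, h2⟩ := mem_linkPos.1 hD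
  have := h.card_pos _ h2
  rw [card_insert_of_notMem h1] at this
  exact mem_powersetCard.2 ⟨subset_univ _, by omega⟩

theorem IsMinPair.linkNeg_subset {P : Finset (Finset (Fin n))}
    {Q : Finset (Finset (Fin n) × Finset (Fin n))} (h : IsMinPair k P Q) (v : Fin n) :
    linkNeg v Q ⊆ univ.powersetCard (k - 1) := fun D hD => by
  have := h.card_add _ (mem_linkNeg.1 hD)
  simp only [card_singleton] at this
  exact mem_powersetCard.2 ⟨subset_univ _, by omega⟩

/-- The sets whose image under `e` lies in `P`. -/
def comapFam {m n : ℕ} (e : Fin m ↪ Fin n) (P : Finset (Finset (Fin n))) :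
    Finset (Finset (Fin m)) :=
  univ.filter (fun S => S.map e ∈ P)

/-- The signed clauses whose image under `e` lies in `Q`. -/
def comapSigned {m n : ℕ} (e : Fin m ↪ Fin n) (Q : Finset (Finset (Fin n) × Finset (Fin n))) :
    Finset (Finset (Fin m) × Finset (Fin m)) :=
  univ.filter (fun c => (c.1.map e, c.2.map e) ∈ Q)

theorem IsMinPair.comap {m : ℕ} {P : Finset (Finset (Fin n))}
    {Q : Finset (Finset (Fin n) × Finset (Fin n))} (h : IsMinPair k P Q) (e : Fin m ↪ Fin n) :
    IsMinPair k (comapFam e P) (comapSigned e Q) := by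
  have hP : ∀ S, S ∈ comapFam e P ↔ S.map e ∈ P := fun S => by simp [comapFam]
  have hQ : ∀ c, c ∈ comapSigned e Q ↔ (c.1.map e, c.2.map e) ∈ Q := fun c => by
    simp [comapSigned]
  have hsub : ∀ (S : Finset (Fin m)) (W : Finset (Fin n)),
      S ⊆ univ.filter (fun x => e x ∈ W) ↔ S.map e ⊆ W := fun S W => by
    simp [subset_iff]
  have hdis : ∀ (S : Finset (Fin m)) (W : Finset (Fin n)),
      Disjoint S (univ.filter (fun x => e x ∈ W)) ↔ Disjoint (S.map e) W := fun S W => by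
    simp [disjoint_left]
  refine ⟨fun S hS => ?_, fun c hc => ?_, fun c hc => ?_, fun c hc => ?_, fun S hS => ?_,
    fun c hc => ?_⟩
  · rw [← card_map e]
    exact h.card_pos _ ((hP S).1 hS)
  · exact (disjoint_map e).1 (h.disjoint _ ((hQ c).1 hc))
  · exact (map_nonempty).1 (h.nonempty _ ((hQ c).1 hc))
  · have := h.card_add _ ((hQ c).1 hc)
    rwa [card_map, card_map] at this
  · obtain ⟨W, h1, h2, h3⟩ := h.witness_pos _ ((hP S).1 hS)
    refine ⟨univ.filter (fun x => e x ∈ W), (hsub _ _).2 h1, fun S' hS' hW => ?_,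
      fun c hc hW => ?_⟩
    · exact map_injective e (h2 _ ((hP S').1 hS') ((hsub _ _).1 hW))
    · rw [hdis]
      exact h3 _ ((hQ c).1 hc) ((hsub _ _).1 hW)
  · obtain ⟨W, h1, h2, h3, h4⟩ := h.witness_neg _ ((hQ c).1 hc)
    refine ⟨univ.filter (fun x => e x ∈ W), (hsub _ _).2 h1, (hdis _ _).2 h2,
      fun S hS hW => h3 _ ((hP S).1 hS) ((hsub _ _).1 hW), fun c' hc' hW hd => ?_⟩
    have := h4 _ ((hQ c').1 hc') ((hsub _ _).1 hW) ((hdis _ _).1 hd)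
    obtain ⟨e1, e2⟩ := Prod.mk.inj this
    exact Prod.ext (map_injective e e1) (map_injective e e2)

/-- The members of `Q` involving `v` other than those whose only negative variable is `v`. -/
def otherNeg {n : ℕ} (v : Fin n) (Q : Finset (Finset (Fin n) × Finset (Fin n))) :
    Finset (Finset (Fin n) × Finset (Fin n)) :=
  Q.filter (fun c => v ∈ c.1 ∨ v ∈ c.2 ∧ c.2 ≠ {v})

theorem exists_eq_map_succAbove (v : Fin (n + 1)) {S : Finset (Fin (n + 1))} (hS : v ∉ S) :
    ∃ S' : Finset (Fin n), S'.map v.succAboveEmb = S := by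
  refine ⟨univ.filter (fun x => v.succAbove x ∈ S), ?_⟩
  ext y
  simp only [Finset.mem_map, mem_filter, mem_univ, true_and, Fin.coe_succAboveEmb]
  constructor
  · rintro ⟨x, hx, rfl⟩
    exact hx
  · intro hy
    obtain ⟨x, rfl⟩ := Fin.exists_succAbove_eq (fun h : y = v => hS (h ▸ hy))
    exact ⟨x, hy, rfl⟩

/-- A pair is determined by its restriction, its links and its other negative members at `v`. -/
theorem eq_of_links_eq (v : Fin (n + 1)) {P P' : Finset (Finset (Fin (n + 1)))}
    {Q Q' : Finset (Finset (Fin (n + 1)) × Finset (Fin (n + 1)))}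
    (hP : comapFam v.succAboveEmb P = comapFam v.succAboveEmb P')
    (hQ : comapSigned v.succAboveEmb Q = comapSigned v.succAboveEmb Q')
    (hO : otherNeg v Q = otherNeg v Q') (hL : linkPos v P = linkPos v P')
    (hM : linkNeg v Q = linkNeg v Q') : P = P' ∧ Q = Q' := by
  constructor
  · ext S
    by_cases hv : v ∈ S
    · have := congrArg (fun T => S.erase v ∈ T) hL
      simp only [mem_linkPos, insert_erase hv, notMem_erase, not_false_eq_true, true_and] at this
      exact iff_of_eq this
    · obtain ⟨S', rfl⟩ := exists_eq_map_succAbove v hv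
      have := congrArg (fun T => S' ∈ T) hP
      simp only [comapFam, mem_filter, mem_univ, true_and] at this
      exact iff_of_eq this
  · ext c
    obtain ⟨R, Y⟩ := c
    by_cases hv : v ∈ R ∨ v ∈ Y ∧ Y ≠ {v}
    · have := congrArg (fun T => (R, Y) ∈ T) hO
      simp only [otherNeg, mem_filter, hv, and_true] at this
      exact iff_of_eq this
    · push Not at hv
      by_cases hvY : v ∈ Y
      · rw [hv.2 hvY]
        have := congrArg (fun T => R ∈ T) hM
        simp only [mem_linkNeg] at this
        exact iff_of_eq this
      · obtain ⟨R', rfl⟩ := exists_eq_map_succAbove v hv.1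
        obtain ⟨Y', rfl⟩ := exists_eq_map_succAbove v hvY
        have := congrArg (fun T => (R', Y') ∈ T) hQ
        simp only [comapSigned, mem_filter, mem_univ, true_and] at this
        exact iff_of_eq this

theorem IsMinPair.card_le_of_fst_mem {P : Finset (Finset (Fin n))}
    {Q : Finset (Finset (Fin n) × Finset (Fin n))} (h : IsMinPair k P Q) {η : ℝ} (hη : 0 ≤ η)
    (hP : DenseFam η P) (A : Finset (Fin n)) {j : ℕ} (hj : #A < j) (ℛ : Finset (Finset (Fin n)))
    (𝒴 : Finset (Finset (Fin n) × Finset (Fin n)))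
    (h𝒴 : ∀ c ∈ 𝒴, c ∈ Q ∧ c.1 ∈ ℛ ∧ #c.2 = j ∧ A ⊆ c.2) :
    (#𝒴 : ℝ) ≤ #ℛ * (1 + η * (n : ℝ) ^ (j - #A)) := by
  refine card_le_of_card_fiber_le 𝒴 Prod.fst ℛ _ (fun c hc => (h𝒴 c hc).2.1)
    fun R _ 𝒟 h𝒟 hR => ?_
  have h1 : #(𝒟.image Prod.snd) = #𝒟 := card_image_of_injOn fun c hc c' hc' heq =>
    Prod.ext ((hR c hc).trans (hR c' hc').symm) heq
  rw [← h1]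
  refine h.card_negParts_le hη hP R A hj _ fun Y hY => ?_
  obtain ⟨c, hc, rfl⟩ := mem_image.1 hY
  obtain ⟨h2, -, h3⟩ := h𝒴 c (h𝒟 hc)
  exact ⟨by rw [← hR c hc]; exact h2, h3⟩

theorem IsMinPair.card_otherNeg_le {P : Finset (Finset (Fin n))}
    {Q : Finset (Finset (Fin n) × Finset (Fin n))} (h : IsMinPair k P Q) (hk : 2 ≤ k) {η : ℝ}
    (hη : 0 ≤ η) (hP : DenseFam η P) (v : Fin n) :
    (#(otherNeg v Q) : ℝ) ≤ 2 * k * ((n : ℝ) ^ (k - 2) + η * (n : ℝ) ^ (k - 1)) := by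
  classical
  have hn : 1 ≤ n := v.pos
  have hn1 : (1 : ℝ) ≤ n := by exact_mod_cast hn
  obtain ⟨B, hB⟩ : ∃ B : ℝ, B = (n : ℝ) ^ (k - 2) + η * (n : ℝ) ^ (k - 1) := ⟨_, rfl⟩
  have hB0 : 0 ≤ B := by rw [hB]; positivity
  have hprod : ∀ a b : ℕ, a + b = k - 1 → 1 ≤ b → (n : ℝ) ^ a * (1 + η * (n : ℝ) ^ b) ≤ B := by
    intro a b hab hb
    calc (n : ℝ) ^ a * (1 + η * (n : ℝ) ^ b) = (n : ℝ) ^ a + η * (n : ℝ) ^ (a + b) := by ring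
      _ ≤ B := by
        rw [hB, hab]
        gcongr
        omega
  have hsub : otherNeg v Q ⊆ (Icc 1 (k - 1)).biUnion
        (fun j => Q.filter (fun c => v ∈ c.1 ∧ #c.2 = j)) ∪
      (Icc 2 k).biUnion (fun j => Q.filter (fun c => v ∈ c.2 ∧ #c.2 = j)) := by
    intro c hc
    obtain ⟨hcQ, hv⟩ := mem_filter.1 hc
    have h1 := h.card_add c hcQ
    have h2 := Finset.card_pos.2 (h.nonempty c hcQ)
    rcases hv with hv | ⟨hv, hne⟩
    · have := Finset.card_pos.2 ⟨v, hv⟩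
      exact mem_union_left _ (mem_biUnion.2 ⟨#c.2, mem_Icc.2 ⟨h2, by omega⟩,
        mem_filter.2 ⟨hcQ, hv, rfl⟩⟩)
    · have : #c.2 ≠ 1 := fun h1 => by
        obtain ⟨y, hy⟩ := card_eq_one.1 h1
        rw [hy, mem_singleton] at hv
        exact hne (hv ▸ hy)
      exact mem_union_right _ (mem_biUnion.2 ⟨#c.2, mem_Icc.2 ⟨by omega, by omega⟩,
        mem_filter.2 ⟨hcQ, hv, rfl⟩⟩)
  have hpart1 : (#((Icc 1 (k - 1)).biUnion
      (fun j => Q.filter (fun c => v ∈ c.1 ∧ #c.2 = j))) : ℝ) ≤ (k - 1 : ℕ) * B := by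
    have := card_le_of_subset_biUnion (Icc 1 (k - 1))
      (fun j => Q.filter (fun c => v ∈ c.1 ∧ #c.2 = j)) _ B subset_rfl fun j hj => ?_
    · simpa using this
    obtain ⟨hj1, hj2⟩ := mem_Icc.1 hj
    refine (h.card_le_of_fst_mem hη hP ∅ (j := j) (by simp; omega)
      ((univ.powersetCard (k - j)).filter (fun R => {v} ⊆ R)) _ fun c hc => ?_).trans ?_
    · obtain ⟨hcQ, hv, hcj⟩ := mem_filter.1 hc
      have := h.card_add c hcQ
      exact ⟨hcQ, mem_filter.2 ⟨mem_powersetCard.2 ⟨subset_univ _, by omega⟩,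
        singleton_subset_iff.2 hv⟩, hcj, empty_subset _⟩
    · have h1 := card_filter_superset_le ({v} : Finset (Fin n)) (k - j)
      rw [card_singleton] at h1
      refine le_trans ?_ (hprod (k - j - 1) j (by omega) hj1)
      rw [card_empty, Nat.sub_zero]
      gcongr
      exact_mod_cast h1
  have hpart2 : (#((Icc 2 k).biUnion
      (fun j => Q.filter (fun c => v ∈ c.2 ∧ #c.2 = j))) : ℝ) ≤ (k + 1 - 2 : ℕ) * B := by
    have := card_le_of_subset_biUnion (Icc 2 k)
      (fun j => Q.filter (fun c => v ∈ c.2 ∧ #c.2 = j)) _ B subset_rfl fun j hj => ?_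
    · simpa using this
    obtain ⟨hj1, hj2⟩ := mem_Icc.1 hj
    refine (h.card_le_of_fst_mem hη hP {v} (j := j) (by simp; omega)
      (univ.powersetCard (k - j)) _ fun c hc => ?_).trans ?_
    · obtain ⟨hcQ, hv, hcj⟩ := mem_filter.1 hc
      have := h.card_add c hcQ
      exact ⟨hcQ, mem_powersetCard.2 ⟨subset_univ _, by omega⟩, hcj, singleton_subset_iff.2 hv⟩
    · refine le_trans ?_ (hprod (k - j) (j - 1) (by omega) (by omega))
      rw [card_singleton, card_powersetCard, card_univ, Fintype.card_fin]
      gcongr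
      exact_mod_cast Nat.choose_le_pow _ _
  rw [← hB]
  calc (#(otherNeg v Q) : ℝ) ≤ (k - 1 : ℕ) * B + (k + 1 - 2 : ℕ) * B :=
        (by exact_mod_cast (card_le_card hsub).trans (card_union_le _ _) : _ ≤ _).trans
          (add_le_add hpart1 hpart2)
    _ ≤ k * B + k * B := by
        gcongr <;> omega
    _ = 2 * k * B := by ring

end Links

section ManyNegCount

theorem IsMinPair.not_joinFam_two {n : ℕ} {κ ε : ℝ} (hκ : 0 < κ) (hε : 0 < ε)
    (hn : (n : ℝ) ≤ κ ^ 2 / 2 * (n : ℝ) ^ 2) {P : Finset (Finset (Fin n))}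
    {Q : Finset (Finset (Fin n) × Finset (Fin n))} (h : IsMinPair 2 P Q) (v : Fin n)
    (hneg : κ * n ≤ #(linkNeg v Q)) (hpos : κ * n ≤ #(linkPos v P)) :
    ¬ JoinFam 2 (κ ^ 2 / 32) ε P := by
  classical
  intro hJ
  obtain ⟨L, hL⟩ : ∃ L, L = linkPos v P := ⟨_, rfl⟩
  obtain ⟨M, hM⟩ : ∃ M, M = linkNeg v Q := ⟨_, rfl⟩
  have hL1 : L ⊆ univ.powersetCard 1 := hL ▸ h.linkPos_subset v
  have hM1 : M ⊆ univ.powersetCard 1 := hM ▸ h.linkNeg_subset v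
  have hdis := h.disjoint_unionSets v
  rw [← hL, ← hM] at hdis
  rw [← hM] at hneg
  rw [← hL] at hpos
  have hn0 : (0 : ℝ) < n := by exact_mod_cast v.pos
  have h1 := card_le_card_unionSets_mul 2 L M ((L ×ˢ M).filter (fun p => ¬ p.1 = p.2))
    fun p hp => by
      obtain ⟨hp, hne⟩ := mem_filter.1 hp
      obtain ⟨hp1, hp2⟩ := mem_product.1 hp
      refine ⟨hp1, hp2, hne, ?_⟩
      obtain ⟨x, hx⟩ := card_eq_one.1 (mem_powersetCard.1 (hL1 hp1)).2
      obtain ⟨y, hy⟩ := card_eq_one.1 (mem_powersetCard.1 (hM1 hp2)).2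
      rw [hx, hy] at hne ⊢
      rw [singleton_union]
      exact card_pair fun hxy => hne (hxy ▸ rfl)
  have h2 : #((L ×ˢ M).filter (fun p => p.1 = p.2)) ≤ n := by
    have : #((univ : Finset (Fin n)).powersetCard 1) = n := by simp
    refine le_trans (card_le_card_of_injOn Prod.fst (fun p hp => ?_) fun p hp p' hp' heq => ?_)
      this.le
    · exact hL1 (mem_product.1 (mem_filter.1 hp).1).1
    · exact Prod.ext heq ((mem_filter.1 hp).2.symm.trans (heq.trans (mem_filter.1 hp').2))
  have h3 := card_filter_add_card_filter_not (s := L ×ˢ M) (fun p => p.1 = p.2)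
  rw [card_product] at h3
  have h4 : (#L * #M : ℝ) ≤ n + #(unionSets 2 L M) * 4 ^ 2 := by
    exact_mod_cast (by omega : #L * #M ≤ n + #(unionSets 2 L M) * 4 ^ 2)
  have h5 : κ * n * (κ * n) ≤ (#L * #M : ℝ) := by gcongr
  have h6 := hJ L hL1 M hM1 (by nlinarith)
  rw [disjoint_iff_inter_eq_empty.1 hdis, card_empty, Nat.cast_zero] at h6
  have : 0 < ε * (n : ℝ) ^ 2 := by positivity
  linarith

theorem exists_card_manyNeg_le_of_three_le (m : ℕ) (hm : 1 ≤ m) {κ : ℝ} (hκ : 0 < κ) :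
    ∃ γ : ℝ, 0 < γ ∧ ∃ η : ℝ, 0 < η ∧ ∀ ε : ℝ, 0 < ε → ∀ᶠ n : ℕ in atTop, ∀ B : ℝ,
      (∀ ℬ : Finset (Finset (Finset (Fin n)) × Finset (Finset (Fin n) × Finset (Fin n))),
        (∀ x ∈ ℬ, IsMinPair (m + 2) x.1 x.2) → (#ℬ : ℝ) ≤ B) →
      ∀ v : Fin (n + 1), ∀ 𝒜 : Finset (Finset (Finset (Fin (n + 1))) ×
          Finset (Finset (Fin (n + 1)) × Finset (Fin (n + 1)))),
        (∀ x ∈ 𝒜, IsMinPair (m + 2) x.1 x.2 ∧ DenseFam η x.1 ∧ JoinFam (m + 2) γ ε x.1 ∧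
          κ * ((n + 1 : ℕ) : ℝ) ^ (m + 1) ≤ #(linkNeg v x.2) ∧
          κ * ((n + 1 : ℕ) : ℝ) ^ (m + 1) ≤ #(linkPos v x.1)) →
        (#𝒜 : ℝ) ≤ B * 2 ^ ((n.choose (m + 1) : ℝ) - 2 * n) := by
  classical
  obtain ⟨c, hc, γ, hγ, hadd⟩ := exists_card_add_card_le m hκ
  obtain ⟨η₁, hη₁, hsmall⟩ := exists_card_small_subsets_le (c / 16 / 2 ^ (m + 2)) (by positivity)
  refine ⟨γ, hγ, η₁ / (4 * (m + 2)), by positivity, fun ε hε => ?_⟩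
  obtain ⟨ε₁, hε₁, hε₁c, hε₁ε⟩ : ∃ ε₁ : ℝ, 0 < ε₁ ∧ ε₁ ≤ c / 16 ∧ ε₁ ≤ ε / 4 :=
    ⟨min (c / 16) (ε / 4), by positivity, min_le_left _ _, min_le_right _ _⟩
  have hev := (tendsto_add_atTop_nat 1).eventually (hadd.and
    ((exists_link_containers (m + 2) (by omega) hε₁).and
    ((eventually_pow_le_mul_pow (a := m) (b := m + 1) (by omega)
      (δ := η₁ / 2 / (2 * (m + 2))) (by positivity)).and
    ((eventually_pow_le_mul_pow (a := m) (b := m + 1) (by omega) (δ := c / 16) (by positivity)).and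
    ((eventually_pow_le_mul_pow (a := 1) (b := m + 1) (by omega) (δ := c / 4) (by positivity)).and
    (eventually_pow_le_mul_pow (a := m + 1) (b := m + 2) (by omega) (δ := ε / 4)
      (by positivity)))))))
  filter_upwards [hev] with n ⟨hadd, hcont, hp1, hp2, hp3, hp4⟩ B hB v 𝒜 h𝒜
  obtain ⟨N, hN⟩ : ∃ N : ℝ, N = ((n + 1 : ℕ) : ℝ) := ⟨_, rfl⟩
  rw [← hN] at hp1 hp2 hp3 hp4
  simp only [← hN] at h𝒜
  have hN1 : 1 ≤ N := by rw [hN]; exact_mod_cast Nat.le_add_left 1 n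
  have hN0 : 0 < N := by linarith
  let e := v.succAboveEmb
  obtain ⟨U, hU⟩ : ∃ U : Finset (Finset (Fin (n + 1)) × Finset (Fin (n + 1))),
      U = ((univ.powersetCard (m + 2)).filter (fun S => {v} ⊆ S)).biUnion
        (fun S => S.powerset.image (fun R => (R, S \ R))) := ⟨_, rfl⟩
  have hUcard : (#U : ℝ) ≤ 2 ^ (m + 2) * N ^ (m + 1) := by
    have h1 := card_filter_superset_le ({v} : Finset (Fin (n + 1))) (m + 2)
    have h2 : #U ≤ (n + 1) ^ (m + 1) * 2 ^ (m + 2) := by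
      rw [hU]
      refine (card_biUnion_le_card_mul _ _ (2 ^ (m + 2)) fun S hS => card_image_le.trans ?_).trans
        (Nat.mul_le_mul_right _ (by simpa using h1))
      rw [card_powerset, (mem_powersetCard.1 (mem_filter.1 hS).1).2]
    rw [hN, mul_comm]
    exact_mod_cast h2
  obtain ⟨𝒪, h𝒪⟩ : ∃ 𝒪, 𝒪 = U.powerset.filter
      (fun X => (#X : ℝ) ≤ η₁ * (2 ^ (m + 2) * N ^ (m + 1))) := ⟨_, rfl⟩
  have h𝒪card : (#𝒪 : ℝ) ≤ 2 ^ (c / 16 * N ^ (m + 1)) := by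
    rw [h𝒪]
    refine (hsmall U _ hUcard).trans_eq ?_
    congr 1
    field_simp
  have hother : ∀ x ∈ 𝒜, otherNeg v x.2 ∈ 𝒪 := by
    intro x hx
    obtain ⟨hmin, hD, -⟩ := h𝒜 x hx
    rw [h𝒪]
    refine mem_filter.2 ⟨mem_powerset.2 fun d hd => ?_, ?_⟩
    · obtain ⟨hdQ, hv⟩ := mem_filter.1 hd
      have hdis := hmin.disjoint d hdQ
      rw [hU]
      refine mem_biUnion.2 ⟨d.1 ∪ d.2, mem_filter.2 ⟨mem_powersetCard.2 ⟨subset_univ _, ?_⟩,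
        singleton_subset_iff.2 (mem_union.2 (hv.imp_right And.left))⟩,
        mem_image.2 ⟨d.1, mem_powerset.2 subset_union_left, ?_⟩⟩
      · rw [card_union_of_disjoint hdis, hmin.card_add d hdQ]
      · rw [union_sdiff_cancel_left hdis]
    · have h1 := hmin.card_otherNeg_le (by omega) (by positivity) hD v
      rw [← hN] at h1
      refine h1.trans ?_
      have h2 : m + 2 - 1 = m + 1 := rfl
      have h3 : (1 : ℝ) ≤ 2 ^ (m + 2) := one_le_pow₀ (by norm_num)
      rw [h2, Nat.add_sub_cancel]
      push_cast
      calc 2 * ((m : ℝ) + 2) * (N ^ m + η₁ / (4 * (m + 2)) * N ^ (m + 1))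
          ≤ 2 * ((m : ℝ) + 2) * (η₁ / 2 / (2 * (m + 2)) * N ^ (m + 1) +
            η₁ / (4 * (m + 2)) * N ^ (m + 1)) := by gcongr
        _ = η₁ * (1 * N ^ (m + 1)) := by field_simp; ring
        _ ≤ _ := by gcongr
  obtain ⟨ℬ, hℬ⟩ : ∃ ℬ, ℬ = 𝒜.image (fun x => (comapFam e x.1, comapSigned e x.2)) := ⟨_, rfl⟩
  have hℬcard : (#ℬ : ℝ) ≤ B := hB ℬ fun y hy => by
    rw [hℬ] at hy
    obtain ⟨x, hx, rfl⟩ := mem_image.1 hy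
    exact (h𝒜 x hx).1.comap e
  have hchoose : ((n + 1).choose (m + 1) : ℝ) ≤ n.choose (m + 1) + c / 16 * N ^ (m + 1) := by
    rw [Nat.choose_succ_succ', add_comm]
    push_cast
    gcongr
    refine le_trans ?_ hp2
    rw [hN]
    exact_mod_cast (Nat.choose_le_choose m (Nat.le_succ n)).trans (Nat.choose_le_pow _ _)
  have hfiber := card_le_of_card_fiber_le 𝒜
    (fun x => ((comapFam e x.1, comapSigned e x.2), otherNeg v x.2)) (ℬ ×ˢ 𝒪)
    (2 ^ (ε₁ * N ^ (m + 1)) * 2 ^ ((n + 1).choose (m + 1) - c * N ^ (m + 1)))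
    (fun x hx => mem_product.2 ⟨hℬ ▸ mem_image_of_mem _ hx, hother x hx⟩)
    fun b _ 𝒟 h𝒟 hb => ?_
  · refine hfiber.trans ?_
    rw [card_product, Nat.cast_mul]
    have hB0 : 0 ≤ B := (Nat.cast_nonneg _).trans hℬcard
    calc (#ℬ * #𝒪 : ℝ) * (2 ^ (ε₁ * N ^ (m + 1)) * 2 ^ ((n + 1).choose (m + 1) - c * N ^ (m + 1)))
        ≤ B * 2 ^ (c / 16 * N ^ (m + 1)) *
          (2 ^ (c / 16 * N ^ (m + 1)) * 2 ^ ((n.choose (m + 1) + c / 16 * N ^ (m + 1)) -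
            c * N ^ (m + 1))) := by
          gcongr
          · norm_num
          · norm_num
      _ = B * 2 ^ ((n.choose (m + 1) : ℝ) - 13 / 16 * c * N ^ (m + 1)) := by
          rw [mul_assoc, ← Real.rpow_add (by norm_num), ← Real.rpow_add (by norm_num)]
          congr 2
          ring
      _ ≤ _ := by
          have h1 : (n : ℝ) ≤ N := by rw [hN]; exact_mod_cast Nat.le_succ n
          have h2 : 0 < c * N ^ (m + 1) := by positivity
          refine mul_le_mul_of_nonneg_left
            (Real.rpow_le_rpow_of_exponent_le (by norm_num) ?_) hB0
          rw [pow_one] at hp3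
          linarith
  · have hcom : ∀ x ∈ 𝒟, comapFam e x.1 = b.1.1 ∧ comapSigned e x.2 = b.1.2 ∧
        otherNeg v x.2 = b.2 := fun x hx => by
      rw [← hb x hx]
      exact ⟨rfl, rfl, rfl⟩
    obtain ⟨P₀, hP₀⟩ : ∃ P₀ : Finset (Finset (Fin (n + 1))), P₀ = b.1.1.image (Finset.map e) :=
      ⟨_, rfl⟩
    have hP₀sub : ∀ x ∈ 𝒟, P₀ ⊆ x.1 := fun x hx S hS => by
      rw [hP₀, ← (hcom x hx).1] at hS
      obtain ⟨S', hS', rfl⟩ := mem_image.1 hS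
      exact (mem_filter.1 hS').2
    have hP₀mem : ∀ x ∈ 𝒟, ∀ S ∈ x.1, v ∉ S → S ∈ P₀ := fun x hx S hS hv => by
      obtain ⟨S', rfl⟩ := exists_eq_map_succAbove v hv
      rw [hP₀, ← (hcom x hx).1]
      exact mem_image_of_mem _ (mem_filter.2 ⟨mem_univ _, hS⟩)
    obtain ⟨𝒞, h𝒞, hcov⟩ := hcont P₀
    rw [← hN] at h𝒞
    have hΓ : ∀ x ∈ 𝒟, ∃ Γ ∈ 𝒞, (linkPos v x.1 ⊆ Γ.1 ∧ linkNeg v x.2 ⊆ Γ.2) ∧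
        (#Γ.1 + #Γ.2 : ℝ) ≤ (n + 1).choose (m + 1) - c * N ^ (m + 1) := by
      intro x hx
      obtain ⟨hmin, -, hJ, hneg, hpos⟩ := h𝒜 x (h𝒟 hx)
      obtain ⟨Γ, hΓ, hΓ1, hΓ2, hΓ3, hΓ4, hΓ5⟩ := hcov _ (hmin.linkPos_subset v) _
        (hmin.linkNeg_subset v) ((hmin.disjoint_unionSets v).mono_left (hP₀sub x hx))
      refine ⟨Γ, hΓ, ⟨hΓ1, hΓ2⟩, ?_⟩
      rw [← hN] at hΓ5
      have := hadd Γ.1 Γ.2 hΓ3 hΓ4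
      rw [← hN] at this
      refine this (hpos.trans (by exact_mod_cast card_le_card hΓ1))
        (hneg.trans (by exact_mod_cast card_le_card hΓ2)) ?_
      by_contra! hcon
      have h1 := hJ Γ.1 hΓ3 Γ.2 hΓ4 (by rwa [← hN])
      rw [← hN] at h1
      have h2 : #(x.1 ∩ unionSets (m + 2) Γ.1 Γ.2) ≤
          #(P₀ ∩ unionSets (m + 2) Γ.1 Γ.2) + (n + 1) ^ (m + 1) := by
        have h3 : x.1 ∩ unionSets (m + 2) Γ.1 Γ.2 ⊆ P₀ ∩ unionSets (m + 2) Γ.1 Γ.2 ∪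
            (univ.powersetCard (m + 2)).filter (fun S => {v} ⊆ S) := fun S hS => by
          obtain ⟨hSx, hSu⟩ := mem_inter.1 hS
          by_cases hv : v ∈ S
          · exact mem_union_right _ (mem_filter.2 ⟨mem_powersetCard.2 ⟨subset_univ _,
              hmin.card_pos S hSx⟩, singleton_subset_iff.2 hv⟩)
          · exact mem_union_left _ (mem_inter.2 ⟨hP₀mem x hx S hSx hv, hSu⟩)
        refine (card_le_card h3).trans ((card_union_le _ _).trans (Nat.add_le_add_left ?_ _))
        simpa using card_filter_superset_le ({v} : Finset (Fin (n + 1))) (m + 2)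
      have h3 : (#(x.1 ∩ unionSets (m + 2) Γ.1 Γ.2) : ℝ) ≤
          #(P₀ ∩ unionSets (m + 2) Γ.1 Γ.2) + N ^ (m + 1) := by
        rw [hN]
        exact_mod_cast h2
      have h4 : ε₁ * N ^ (m + 2) ≤ ε / 4 * N ^ (m + 2) := by gcongr
      have h5 : 0 < ε * N ^ (m + 2) := by positivity
      linarith
    have hinj : #𝒟 = #(𝒟.image (fun x => (linkPos v x.1, linkNeg v x.2))) := by
      refine (card_image_of_injOn fun x hx y hy hxy => ?_).symm
      obtain ⟨e1, e2⟩ := Prod.mk.inj hxy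
      obtain ⟨a1, a2, a3⟩ := hcom x hx
      obtain ⟨b1, b2, b3⟩ := hcom y hy
      obtain ⟨h1, h2⟩ := eq_of_links_eq v (a1.trans b1.symm) (a2.trans b2.symm)
        (a3.trans b3.symm) e1 e2
      exact Prod.ext h1 h2
    rw [hinj]
    obtain ⟨𝒞', h𝒞'⟩ : ∃ 𝒞', 𝒞' = 𝒞.filter (fun Γ => (#Γ.1 + #Γ.2 : ℝ) ≤
      (n + 1).choose (m + 1) - c * N ^ (m + 1)) := ⟨_, rfl⟩
    refine (card_le_of_subset_biUnion 𝒞' (fun Γ => Γ.1.powerset ×ˢ Γ.2.powerset) _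
      (2 ^ ((n + 1).choose (m + 1) - c * N ^ (m + 1)))
      (fun y hy => ?_) fun Γ hΓ => ?_).trans ?_
    · obtain ⟨x, hx, rfl⟩ := mem_image.1 hy
      obtain ⟨Γ, hΓ, ⟨h1, h2⟩, h3⟩ := hΓ x hx
      exact mem_biUnion.2 ⟨Γ, h𝒞' ▸ mem_filter.2 ⟨hΓ, h3⟩, mem_product.2
        ⟨mem_powerset.2 h1, mem_powerset.2 h2⟩⟩
    · rw [h𝒞'] at hΓ
      rw [card_product, card_powerset, card_powerset, ← pow_add, Nat.cast_pow, Nat.cast_ofNat,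
        ← Real.rpow_natCast]
      refine Real.rpow_le_rpow_of_exponent_le (by norm_num) ?_
      rw [Nat.cast_add]
      exact (mem_filter.1 hΓ).2
    · gcongr
      refine le_trans ?_ h𝒞
      rw [h𝒞']
      exact_mod_cast card_filter_le _ _

/-- The minimal pairs with many clauses on some negative variable are controlled by the minimal
pairs on one variable fewer. -/
theorem exists_card_manyNeg_le (k : ℕ) (hk : 2 ≤ k) {κ : ℝ} (hκ : 0 < κ) :
    ∃ γ : ℝ, 0 < γ ∧ ∃ η : ℝ, 0 < η ∧ ∀ ε : ℝ, 0 < ε → ∀ᶠ n : ℕ in atTop, ∀ B : ℝ,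
      (∀ ℬ : Finset (Finset (Finset (Fin n)) × Finset (Finset (Fin n) × Finset (Fin n))),
        (∀ x ∈ ℬ, IsMinPair k x.1 x.2) → (#ℬ : ℝ) ≤ B) →
      ∀ 𝒜 : Finset (Finset (Finset (Fin (n + 1))) ×
          Finset (Finset (Fin (n + 1)) × Finset (Fin (n + 1)))),
        (∀ x ∈ 𝒜, IsMinPair k x.1 x.2 ∧ DenseFam η x.1 ∧ JoinFam k γ ε x.1 ∧ ∃ v,
          κ * ((n + 1 : ℕ) : ℝ) ^ (k - 1) ≤ #(linkNeg v x.2) ∧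
          κ * ((n + 1 : ℕ) : ℝ) ^ (k - 1) ≤ #(linkPos v x.1)) →
        (#𝒜 : ℝ) ≤ (n + 1 : ℕ) * (B * 2 ^ ((n.choose (k - 1) : ℝ) - 2 * n)) := by
  rcases hk.lt_or_eq with hk | rfl
  · obtain ⟨m, rfl⟩ : ∃ m, k = m + 2 := ⟨k - 2, by omega⟩
    obtain ⟨γ, hγ, η, hη, h⟩ := exists_card_manyNeg_le_of_three_le m (by omega) hκ
    refine ⟨γ, hγ, η, hη, fun ε hε => ?_⟩
    filter_upwards [h ε hε] with n h B hB 𝒜 h𝒜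
    choose! v hv using fun x hx => (h𝒜 x hx).2.2.2
    have := card_le_of_card_fiber_le 𝒜 v univ _ (fun _ _ => mem_univ _)
      fun w _ 𝒟 h𝒟 hw => h B hB w 𝒟 fun x hx => ?_
    · rwa [card_univ, Fintype.card_fin] at this
    · obtain ⟨h1, h2, h3, -⟩ := h𝒜 x (h𝒟 hx)
      exact ⟨h1, h2, h3, hw x hx ▸ hv x (h𝒟 hx)⟩
  · refine ⟨κ ^ 2 / 32, by positivity, 1, one_pos, fun ε hε => ?_⟩
    filter_upwards [(tendsto_add_atTop_nat 1).eventually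
      (eventually_pow_le_mul_pow (a := 1) (b := 2) (by omega) (δ := κ ^ 2 / 2) (by positivity))]
      with n hn B hB 𝒜 h𝒜
    have hB0 : 0 ≤ B := by simpa using hB ∅ (by simp)
    have h0 : 𝒜 = ∅ := eq_empty_of_forall_notMem fun x hx => by
      obtain ⟨h1, -, h3, v, h4, h5⟩ := h𝒜 x hx
      rw [pow_one] at hn
      exact h1.not_joinFam_two hκ hε hn v (by simpa using h4) (by simpa using h5) h3
    rw [h0, card_empty, Nat.cast_zero]
    positivity

end ManyNegCount

/-! ### From formulas to signed pairs -/

section Conversion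

variable {k n : ℕ}

/-- The clause with variables `c.1` of polarity `z` and variables `c.2` of the opposite
polarity. -/
def signedClause {n : ℕ} (z : Fin n → Bool) (c : Finset (Fin n) × Finset (Fin n)) :
    SatClause (Fin n) :=
  univ.filter (fun l => (l.2 = z l.1 ∧ l.1 ∈ c.1) ∨ (l.2 = !z l.1 ∧ l.1 ∈ c.2))

theorem mem_signedClause_self {z : Fin n → Bool} {c : Finset (Fin n) × Finset (Fin n)} {x : Fin n} :
    (x, z x) ∈ signedClause z c ↔ x ∈ c.1 := by
  cases h : z x <;> simp [signedClause, h]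

theorem mem_signedClause_not {z : Fin n → Bool} {c : Finset (Fin n) × Finset (Fin n)} {x : Fin n} :
    (x, !z x) ∈ signedClause z c ↔ x ∈ c.2 := by
  cases h : z x <;> simp [signedClause, h]

theorem signedClause_injective (z : Fin n → Bool) : Function.Injective (signedClause z) := by
  intro c c' h
  refine Prod.ext ?_ ?_ <;> ext x
  · rw [← mem_signedClause_self (z := z), h, mem_signedClause_self]
  · rw [← mem_signedClause_not (z := z), h, mem_signedClause_not]

theorem exists_eq_signedClause (z : Fin n → Bool) (C : SatClause (Fin n)) :
    ∃ c, signedClause z c = C := by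
  refine ⟨(univ.filter (fun x => (x, z x) ∈ C), univ.filter (fun x => (x, !z x) ∈ C)), ?_⟩
  ext ⟨x, b⟩
  have hb : b = z x ∨ b = !z x := by cases b <;> cases z x <;> simp
  rcases hb with rfl | rfl
  · rw [mem_signedClause_self]
    simp
  · rw [mem_signedClause_not]
    simp

theorem satisfiesClause_signedClause {z a : Fin n → Bool}
    {c : Finset (Fin n) × Finset (Fin n)} :
    SatisfiesClause a (signedClause z c) ↔
      c.1 ⊆ univ.filter (fun x => a x = z x) ∧
        Disjoint c.2 (univ.filter (fun x => a x = z x)) := by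
  constructor
  · intro h
    refine ⟨fun x hx => ?_, disjoint_left.2 fun x hx hx' => ?_⟩
    · exact mem_filter.2 ⟨mem_univ _, h (x, z x) (mem_signedClause_self.2 hx)⟩
    · have := h (x, !z x) (mem_signedClause_not.2 hx)
      rw [(mem_filter.1 hx').2] at this
      simp at this
  · rintro ⟨h1, h2⟩ ⟨x, b⟩ hl
    have hb : b = z x ∨ b = !z x := by cases b <;> cases z x <;> simp
    rcases hb with rfl | rfl
    · exact (mem_filter.1 (h1 (mem_signedClause_self.1 hl))).2
    · have := disjoint_left.1 h2 (mem_signedClause_not.1 hl)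
      simp only [mem_filter, mem_univ, true_and] at this
      exact Bool.eq_not_of_ne this

theorem signedClause_eq_union (z : Fin n → Bool) (c : Finset (Fin n) × Finset (Fin n)) :
    signedClause z c = c.1.image (fun x => (x, z x)) ∪ c.2.image (fun x => (x, !z x)) := by
  ext ⟨x, b⟩
  simp only [signedClause, mem_filter, mem_univ, true_and, mem_union, mem_image, Prod.mk.injEq]
  constructor
  · rintro (⟨rfl, h⟩ | ⟨rfl, h⟩)
    · exact Or.inl ⟨x, h, rfl, rfl⟩
    · exact Or.inr ⟨x, h, rfl, rfl⟩
  · rintro (⟨y, h, rfl, rfl⟩ | ⟨y, h, rfl, rfl⟩)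
    · exact Or.inl ⟨rfl, h⟩
    · exact Or.inr ⟨rfl, h⟩

theorem isKClause_signedClause {z : Fin n → Bool} {c : Finset (Fin n) × Finset (Fin n)} :
    IsKClause k (signedClause z c) ↔ Disjoint c.1 c.2 ∧ #c.1 + #c.2 = k := by
  have h1 : #(signedClause z c) = #c.1 + #c.2 := by
    rw [signedClause_eq_union, card_union_of_disjoint,
      card_image_of_injective _ fun x y h => (Prod.mk.inj h).1,
      card_image_of_injective _ fun x y h => (Prod.mk.inj h).1]
    refine disjoint_left.2 fun l hl hl' => ?_
    obtain ⟨x, -, rfl⟩ := mem_image.1 hl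
    obtain ⟨y, -, hy⟩ := mem_image.1 hl'
    obtain ⟨rfl, h⟩ := Prod.mk.inj hy
    simp at h
  have h2 : clauseVars (signedClause z c) = c.1 ∪ c.2 := by
    rw [clauseVars, signedClause_eq_union, image_union, image_image, image_image]
    congr 1 <;> exact image_id
  rw [IsKClause, h1, h2]
  constructor
  · rintro ⟨h3, h4⟩
    exact ⟨card_union_eq_card_add_card.1 (h4.trans h3.symm), h3⟩
  · rintro ⟨h3, h4⟩
    exact ⟨h4, (card_union_of_disjoint h3).trans h4⟩

/-- The variable sets of the clauses of `G` consistent with the polarity `z`. -/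
def posFam {n : ℕ} (z : Fin n → Bool) (G : SatFormula (Fin n)) : Finset (Finset (Fin n)) :=
  univ.filter (fun S => signedClause z (S, ∅) ∈ G)

/-- The clauses of `G` inconsistent with the polarity `z`, in signed form. -/
def negFam {n : ℕ} (z : Fin n → Bool) (G : SatFormula (Fin n)) :
    Finset (Finset (Fin n) × Finset (Fin n)) :=
  univ.filter (fun c => c.2.Nonempty ∧ signedClause z c ∈ G)

theorem mem_posFam {z : Fin n → Bool} {G : SatFormula (Fin n)} {S : Finset (Fin n)} :
    S ∈ posFam z G ↔ signedClause z (S, ∅) ∈ G := by simp [posFam]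

theorem mem_negFam {z : Fin n → Bool} {G : SatFormula (Fin n)}
    {c : Finset (Fin n) × Finset (Fin n)} :
    c ∈ negFam z G ↔ c.2.Nonempty ∧ signedClause z c ∈ G := by simp [negFam]

theorem eq_of_posFam_eq_of_negFam_eq (z : Fin n → Bool) {G G' : SatFormula (Fin n)}
    (hP : posFam z G = posFam z G') (hQ : negFam z G = negFam z G') : G = G' := by
  ext C
  obtain ⟨⟨R, Y⟩, rfl⟩ := exists_eq_signedClause z C
  rcases Y.eq_empty_or_nonempty with rfl | hY
  · rw [← mem_posFam, hP, mem_posFam]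
  · have h1 := mem_negFam (z := z) (G := G) (c := (R, Y))
    have h2 := mem_negFam (z := z) (G := G') (c := (R, Y))
    rw [hQ] at h1
    simp only [hY, true_and] at h1 h2
    exact h1.symm.trans h2

theorem card_negFam (z : Fin n → Bool) (G : SatFormula (Fin n)) :
    #(negFam z G) = #(G.filter (fun C => ∃ l ∈ C, l.2 ≠ z l.1)) := by
  refine card_bij (fun c _ => signedClause z c) (fun c hc => ?_)
    (fun c _ c' _ h => signedClause_injective z h) fun C hC => ?_
  · obtain ⟨⟨x, hx⟩, hG⟩ := mem_negFam.1 hc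
    exact mem_filter.2 ⟨hG, (x, !z x), mem_signedClause_not.2 hx, by simp⟩
  · obtain ⟨hG, ⟨x, b⟩, hl, hb⟩ := mem_filter.1 hC
    obtain ⟨c, rfl⟩ := exists_eq_signedClause z C
    have hb' : b = !z x := Bool.eq_not_of_ne hb
    subst hb'
    exact ⟨c, mem_negFam.2 ⟨⟨x, mem_signedClause_not.1 hl⟩, hG⟩, rfl⟩

theorem card_posFam_add_card_negFam (z : Fin n → Bool) (G : SatFormula (Fin n)) :
    #(posFam z G) + #(negFam z G) = #G := by
  have h : #(posFam z G) = #(G.filter (fun C => ¬ ∃ l ∈ C, l.2 ≠ z l.1)) := by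
    refine card_bij (fun S _ => signedClause z (S, ∅)) (fun S hS => ?_)
      (fun S _ S' _ h => (Prod.mk.inj (signedClause_injective z h)).1) fun C hC => ?_
    · refine mem_filter.2 ⟨mem_posFam.1 hS, ?_⟩
      rintro ⟨⟨x, b⟩, hl, hb⟩
      have hb' : b = !z x := Bool.eq_not_of_ne hb
      subst hb'
      exact notMem_empty _ (mem_signedClause_not.1 hl)
    · obtain ⟨hG, hC⟩ := mem_filter.1 hC
      obtain ⟨⟨R, Y⟩, rfl⟩ := exists_eq_signedClause z C
      have hY : Y = ∅ := eq_empty_of_forall_notMem fun x hx =>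
        hC ⟨(x, !z x), mem_signedClause_not.2 hx, by simp⟩
      subst hY
      exact ⟨R, mem_posFam.2 hG, rfl⟩
  rw [h, card_negFam, add_comm]
  exact card_filter_add_card_filter_not _

theorem MinimalFormula.isMinPair {G : SatFormula (Fin n)} (hG : MinimalFormula G)
    (hk : IsKFormula k G) (z : Fin n → Bool) : IsMinPair k (posFam z G) (negFam z G) := by
  refine ⟨fun S hS => ?_, fun c hc => ?_, fun c hc => (mem_negFam.1 hc).1, fun c hc => ?_,
    fun S hS => ?_, fun c hc => ?_⟩
  · simpa using (isKClause_signedClause.1 (hk _ (mem_posFam.1 hS))).2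
  · exact (isKClause_signedClause.1 (hk _ (mem_negFam.1 hc).2)).1
  · exact (isKClause_signedClause.1 (hk _ (mem_negFam.1 hc).2)).2
  · obtain ⟨w, hw, huniq⟩ := hG _ (mem_posFam.1 hS)
    refine ⟨_, (satisfiesClause_signedClause.1 hw).1, fun S' hS' hW => ?_, fun c hc hW hd => ?_⟩
    · have := huniq _ (mem_posFam.1 hS')
        (satisfiesClause_signedClause.2 ⟨hW, disjoint_empty_left _⟩)
      exact (Prod.mk.inj (signedClause_injective z this)).1
    · obtain ⟨hne, hcG⟩ := mem_negFam.1 hc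
      have := signedClause_injective z
        (huniq _ hcG (satisfiesClause_signedClause.2 ⟨hW, hd⟩))
      rw [this] at hne
      exact not_nonempty_empty hne
  · obtain ⟨hne, hcG⟩ := mem_negFam.1 hc
    obtain ⟨w, hw, huniq⟩ := hG _ hcG
    obtain ⟨h1, h2⟩ := satisfiesClause_signedClause.1 hw
    refine ⟨_, h1, h2, fun S hS hW => ?_, fun c' hc' hW hd => ?_⟩
    · have := signedClause_injective z (huniq _ (mem_posFam.1 hS)
        (satisfiesClause_signedClause.2 ⟨hW, disjoint_empty_left _⟩))
      rw [← this] at hne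
      exact not_nonempty_empty hne
    · exact signedClause_injective z (huniq _ (mem_negFam.1 hc').2
        (satisfiesClause_signedClause.2 ⟨hW, hd⟩))

/-- The formula with positive clauses `P` and signed clauses `Q`. -/
def formulaOfPair {n : ℕ} (P : Finset (Finset (Fin n)))
    (Q : Finset (Finset (Fin n) × Finset (Fin n))) : SatFormula (Fin n) :=
  (P.image (fun S => (S, ∅)) ∪ Q).image (signedClause (fun _ => true))

theorem signedClause_mem_formulaOfPair {P : Finset (Finset (Fin n))}
    {Q : Finset (Finset (Fin n) × Finset (Fin n))} {c : Finset (Fin n) × Finset (Fin n)} :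
    signedClause (fun _ => true) c ∈ formulaOfPair P Q ↔ (c.1 ∈ P ∧ c.2 = ∅) ∨ c ∈ Q := by
  rw [formulaOfPair, (signedClause_injective _).mem_finset_image, mem_union]
  refine or_congr_left ⟨fun h => ?_, fun ⟨h1, h2⟩ => mem_image.2 ⟨c.1, h1, Prod.ext rfl h2.symm⟩⟩
  obtain ⟨S, hS, rfl⟩ := mem_image.1 h
  exact ⟨hS, rfl⟩

theorem IsMinPair.isKFormula {P : Finset (Finset (Fin n))}
    {Q : Finset (Finset (Fin n) × Finset (Fin n))} (h : IsMinPair k P Q) :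
    IsKFormula k (formulaOfPair P Q) := by
  intro C hC
  obtain ⟨c, rfl⟩ := exists_eq_signedClause (fun _ => true) C
  rw [isKClause_signedClause]
  rcases signedClause_mem_formulaOfPair.1 hC with ⟨h1, h2⟩ | h1
  · rw [h2]
    exact ⟨disjoint_empty_right _, h.card_pos _ h1⟩
  · exact ⟨h.disjoint _ h1, h.card_add _ h1⟩

theorem IsMinPair.minimalFormula {P : Finset (Finset (Fin n))}
    {Q : Finset (Finset (Fin n) × Finset (Fin n))} (h : IsMinPair k P Q) :
    MinimalFormula (formulaOfPair P Q) := by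
  classical
  have hW : ∀ W : Finset (Fin n),
      univ.filter (fun x => decide (x ∈ W) = true) = W := fun W => by ext; simp
  intro C hC
  obtain ⟨c, rfl⟩ := exists_eq_signedClause (fun _ => true) C
  suffices hs : ∃ W : Finset (Fin n), (c.1 ⊆ W ∧ Disjoint c.2 W) ∧
      ∀ c', (c'.1 ∈ P ∧ c'.2 = ∅) ∨ c' ∈ Q → c'.1 ⊆ W → Disjoint c'.2 W → c' = c by
    obtain ⟨W, h1, h2⟩ := hs
    refine ⟨fun x => decide (x ∈ W), ?_, fun C' hC' hsat => ?_⟩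
    · rw [satisfiesClause_signedClause, hW]
      exact h1
    · obtain ⟨c', rfl⟩ := exists_eq_signedClause (fun _ => true) C'
      rw [satisfiesClause_signedClause, hW] at hsat
      rw [h2 c' (signedClause_mem_formulaOfPair.1 hC') hsat.1 hsat.2]
  rcases signedClause_mem_formulaOfPair.1 hC with ⟨hP, hc⟩ | hQ
  · obtain ⟨W, h1, h2, h3⟩ := h.witness_pos _ hP
    refine ⟨W, ⟨h1, hc ▸ disjoint_empty_left _⟩, fun c' hc' hsub hd => ?_⟩
    rcases hc' with ⟨hP', hc'⟩ | hQ'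
    · exact Prod.ext (h2 _ hP' hsub) (hc'.trans hc.symm)
    · exact absurd hd (h3 _ hQ' hsub)
  · obtain ⟨W, h1, h2, h3, h4⟩ := h.witness_neg _ hQ
    refine ⟨W, ⟨h1, h2⟩, fun c' hc' hsub hd => ?_⟩
    rcases hc' with ⟨hP', -⟩ | hQ'
    · exact absurd hsub (h3 _ hP')
    · exact h4 _ hQ' hsub hd

theorem IsMinPair.formulaOfPair_inj {P P' : Finset (Finset (Fin n))}
    {Q Q' : Finset (Finset (Fin n) × Finset (Fin n))} (h : IsMinPair k P Q)
    (h' : IsMinPair k P' Q') (heq : formulaOfPair P Q = formulaOfPair P' Q') :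
    P = P' ∧ Q = Q' := by
  have key : ∀ c : Finset (Fin n) × Finset (Fin n),
      (c.1 ∈ P ∧ c.2 = ∅) ∨ c ∈ Q ↔ (c.1 ∈ P' ∧ c.2 = ∅) ∨ c ∈ Q' := fun c => by
    rw [← signedClause_mem_formulaOfPair, heq, signedClause_mem_formulaOfPair]
  have hne : ∀ S : Finset (Fin n), (S, ∅) ∉ Q := fun S hS => not_nonempty_empty (h.nonempty _ hS)
  have hne' : ∀ S : Finset (Fin n), (S, ∅) ∉ Q' := fun S hS =>
    not_nonempty_empty (h'.nonempty _ hS)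
  constructor
  · ext S
    simpa [hne, hne'] using key (S, ∅)
  · ext c
    by_cases hc : c.2 = ∅
    · exact ⟨fun hcQ => absurd hc (h.nonempty c hcQ).ne_empty,
        fun hcQ => absurd hc (h'.nonempty c hcQ).ne_empty⟩
    · simpa [hc] using key c

/-- Optimality of a polarity with the largest number of consistent clauses. -/
theorem linkNeg_card_le_linkPos_card {G : SatFormula (Fin n)} (hG : IsKFormula k G)
    {z : Fin n → Bool} (hz : ∀ z', #(posFam z' G) ≤ #(posFam z G)) (v : Fin n) :
    #(linkNeg v (negFam z G)) ≤ #(linkPos v (posFam z G)) := by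
  obtain ⟨z', hz'⟩ : ∃ z' : Fin n → Bool, z' = Function.update z v (!z v) := ⟨_, rfl⟩
  have hv : z' v = !z v := by rw [hz', Function.update_self]
  have hnv : ∀ x, x ≠ v → z' x = z x := fun x hx => by rw [hz', Function.update_of_ne hx]
  have hcard : ∀ P : Finset (Finset (Fin n)),
      #(linkPos v P) + #(P.filter (fun S => ¬ v ∈ S)) = #P := fun P => by
    rw [← card_filter_add_card_filter_not (s := P) (fun S => v ∈ S), linkPos,
      card_image_of_injOn]
    intro S hS S' hS' h
    rw [← insert_erase (mem_filter.1 hS).2, ← insert_erase (mem_filter.1 hS').2]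
    exact congrArg (insert v) h
  have h1 : (posFam z' G).filter (fun S => ¬ v ∈ S) = (posFam z G).filter (fun S => ¬ v ∈ S) := by
    ext S
    simp only [mem_filter, mem_posFam]
    refine and_congr_left fun hS => ?_
    rw [signedClause_eq_union, signedClause_eq_union]
    simp only [image_empty, union_empty]
    rw [image_congr fun x hx => by rw [hnv x fun h => hS (h ▸ hx)]]
  have h2 : linkNeg v (negFam z G) ⊆ linkPos v (posFam z' G) := by
    intro D hD
    obtain ⟨-, hDG⟩ := mem_negFam.1 (mem_linkNeg.1 hD)
    have hvD : v ∉ D := disjoint_singleton_right.1 (isKClause_signedClause.1 (hG _ hDG)).1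
    refine mem_linkPos.2 ⟨hvD, mem_posFam.2 ?_⟩
    convert hDG using 1
    rw [signedClause_eq_union, signedClause_eq_union]
    simp only [image_empty, union_empty, image_singleton, image_insert, hv]
    rw [union_comm, ← insert_eq]
    congr 1
    exact image_congr fun x hx => by rw [hnv x fun h => hvD (h ▸ hx)]
  have h3 := hcard (posFam z G)
  have h4 := hcard (posFam z' G)
  have h5 := hz z'
  have h6 := card_le_card h2
  rw [h1] at h4
  omega

end Conversion

/-! ### Counting pairs with few negative clauses -/

section PairCount

theorem IsMinPair.fewNegParts {k n : ℕ} {P : Finset (Finset (Fin n))}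
    {Q : Finset (Finset (Fin n) × Finset (Fin n))} (h : IsMinPair k P Q) {η κ : ℝ} (hη : 0 ≤ η)
    (hP : DenseFam η P) (hQ : ∀ v, (#(linkNeg v Q) : ℝ) ≤ κ * (n : ℝ) ^ (k - 1)) :
    FewNegParts k η κ Q where
  fiber R A j hj 𝒴 h𝒴 hc := by
    classical
    have hinj : #(𝒴.image Prod.snd) = #𝒴 := card_image_of_injOn fun x hx y hy hxy =>
      Prod.ext ((hc x hx).1.trans (hc y hy).1.symm) hxy
    rw [← hinj]
    refine h.card_negParts_le hη hP R A hj _ fun Y hY => ?_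
    obtain ⟨c, hc𝒴, rfl⟩ := mem_image.1 hY
    obtain ⟨h1, h2, h3⟩ := hc c hc𝒴
    exact ⟨h1 ▸ h𝒴 hc𝒴, h2, h3⟩
  single v 𝒴 h𝒴 hc := by
    classical
    have hinj : #(𝒴.image Prod.fst) = #𝒴 := card_image_of_injOn fun x hx y hy hxy =>
      Prod.ext hxy ((hc x hx).trans (hc y hy).symm)
    refine le_trans ?_ (hQ v)
    rw [← hinj]
    refine Nat.cast_le.2 (card_le_card fun R hR => ?_)
    obtain ⟨c, hc𝒴, rfl⟩ := mem_image.1 hR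
    exact mem_linkNeg.2 (hc c hc𝒴 ▸ h𝒴 hc𝒴)

/-- Pairs with few negative clauses, switched so that no variable has more negative than positive
singleton links, are almost all purely positive, up to a recursive error term. -/
theorem exists_card_pairs_le (k : ℕ) (hk : 2 ≤ k) :
    ∃ ζ : ℝ, 0 < ζ ∧ ∃ c : ℝ, 0 < c ∧ ∀ᶠ n : ℕ in atTop, ∀ B : ℝ,
      (∀ ℬ : Finset (Finset (Finset (Fin n)) × Finset (Finset (Fin n) × Finset (Fin n))),
        (∀ x ∈ ℬ, IsMinPair k x.1 x.2) → (#ℬ : ℝ) ≤ B) →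
      ∀ 𝒜 : Finset (Finset (Finset (Fin (n + 1))) ×
          Finset (Finset (Fin (n + 1)) × Finset (Fin (n + 1)))),
        (∀ x ∈ 𝒜, IsMinPair k x.1 x.2 ∧ (#x.2 : ℝ) ≤ ζ * ((n + 1 : ℕ) : ℝ) ^ k ∧
          ∀ v, #(linkNeg v x.2) ≤ #(linkPos v x.1)) →
        (#𝒜 : ℝ) ≤ 2 ^ (((n + 1).choose k : ℕ) : ℝ) +
          2 * 2 ^ (((n + 1).choose k : ℝ) - c * (n + 1 : ℕ)) +
          (n + 1 : ℕ) * (B * 2 ^ ((n.choose (k - 1) : ℝ) - 2 * n)) := by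
  classical
  obtain ⟨η₂, hη₂, κ, hκ, c₂, hc₂, hfew⟩ := exists_card_fewNegParts_le k hk
  obtain ⟨γ, hγ, η₃, hη₃, hmany⟩ := exists_card_manyNeg_le k hk hκ
  obtain ⟨ε, hε, ζ, hζ, c₀, hc₀, htyp⟩ := exists_card_atypical_le k hk (lt_min hη₂ hη₃) hγ
  refine ⟨ζ, hζ, min c₀ c₂, lt_min hc₀ hc₂, ?_⟩
  filter_upwards [hmany ε hε, (tendsto_add_atTop_nat 1).eventually (hfew.and htyp)]
    with n hmany hft B hB 𝒜 h𝒜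
  obtain ⟨hfew, htyp⟩ := hft
  obtain ⟨𝒜₀, h𝒜₀⟩ : ∃ 𝒟, 𝒟 = 𝒜.filter (fun x => x.2 = ∅) := ⟨_, rfl⟩
  obtain ⟨𝒜₁, h𝒜₁⟩ : ∃ 𝒟, 𝒟 = 𝒜.filter
    (fun x => ¬ (DenseFam (min η₂ η₃) x.1 ∧ JoinFam k γ ε x.1)) := ⟨_, rfl⟩
  obtain ⟨𝒜₂, h𝒜₂⟩ : ∃ 𝒟, 𝒟 = 𝒜.filter (fun x => x.2.Nonempty ∧ FewNegParts k η₂ κ x.2) :=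
    ⟨_, rfl⟩
  obtain ⟨𝒜₃, h𝒜₃⟩ : ∃ 𝒟, 𝒟 = 𝒜.filter (fun x => DenseFam η₃ x.1 ∧ JoinFam k γ ε x.1 ∧ ∃ v,
    κ * ((n + 1 : ℕ) : ℝ) ^ (k - 1) ≤ #(linkNeg v x.2) ∧
      κ * ((n + 1 : ℕ) : ℝ) ^ (k - 1) ≤ #(linkPos v x.1)) := ⟨_, rfl⟩
  have hcover : 𝒜 ⊆ 𝒜₀ ∪ 𝒜₁ ∪ 𝒜₂ ∪ 𝒜₃ := by
    intro x hx
    obtain ⟨h1, h2, h3⟩ := h𝒜 x hx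
    simp only [mem_union, h𝒜₀, h𝒜₁, h𝒜₂, h𝒜₃, mem_filter, hx, true_and]
    by_contra! hcon
    obtain ⟨⟨⟨hQ, htyp⟩, hfew⟩, hmany⟩ := hcon
    refine hfew hQ (h1.fewNegParts hη₂.le
      (htyp.1.mono (min_le_left _ _)) fun v => ?_)
    by_contra hv
    have hv' := (not_le.1 hv).le
    exact absurd (hmany (htyp.1.mono (min_le_right _ _)) htyp.2 v hv')
      (not_lt.2 (hv'.trans (Nat.cast_le.2 (h3 v))))
  have h0 : (#𝒜₀ : ℝ) ≤ 2 ^ (((n + 1).choose k : ℕ) : ℝ) := by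
    have hle : #𝒜₀ ≤ #((univ : Finset (Fin (n + 1))).powersetCard k).powerset := by
      refine card_le_card_of_injOn Prod.fst (fun x hx => ?_) fun x hx y hy hxy => ?_
      · rw [mem_coe, h𝒜₀, mem_filter] at hx
        exact mem_powerset.2 fun S hS =>
          mem_powersetCard.2 ⟨subset_univ _, (h𝒜 x hx.1).1.card_pos S hS⟩
      · rw [mem_coe, h𝒜₀, mem_filter] at hx hy
        exact Prod.ext hxy (hx.2.trans hy.2.symm)
    rw [card_powerset, card_powersetCard, card_univ, Fintype.card_fin] at hle
    rw [Real.rpow_natCast]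
    exact_mod_cast hle
  have hexp : ∀ c : ℝ, 0 ≤ c → min c₀ c₂ ≤ c → (2 : ℝ) ^ (((n + 1).choose k : ℝ) - c * (n + 1 : ℕ)) ≤
      2 ^ (((n + 1).choose k : ℝ) - min c₀ c₂ * (n + 1 : ℕ)) := fun c _ hc =>
    Real.rpow_le_rpow_of_exponent_le (by norm_num) (sub_le_sub_left
      (mul_le_mul_of_nonneg_right hc (Nat.cast_nonneg _)) _)
  have h1 : (#𝒜₁ : ℝ) ≤ 2 ^ (((n + 1).choose k : ℝ) - min c₀ c₂ * (n + 1 : ℕ)) := by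
    refine (htyp 𝒜₁ fun x hx => ?_).trans (le_trans ?_ (hexp c₀ hc₀.le (min_le_left _ _)))
    · rw [h𝒜₁, mem_filter] at hx
      obtain ⟨h1, h2, -⟩ := h𝒜 x hx.1
      exact ⟨fun S hS => mem_powersetCard.2 ⟨subset_univ _, h1.card_pos S hS⟩,
        fun a ha => mem_signedClauses (h1.disjoint a ha) (h1.card_add a ha), h2, hx.2⟩
    · refine Real.rpow_le_rpow_of_exponent_le (by norm_num) (sub_le_sub_left
        (mul_le_mul_of_nonneg_left ?_ hc₀.le) _)
      exact_mod_cast Nat.le_self_pow (by omega) _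
  have h2 : (#𝒜₂ : ℝ) ≤ 2 ^ (((n + 1).choose k : ℝ) - min c₀ c₂ * (n + 1 : ℕ)) := by
    refine (hfew 𝒜₂ fun x hx => ?_).trans (hexp c₂ hc₂.le (min_le_right _ _))
    rw [h𝒜₂, mem_filter] at hx
    exact ⟨(h𝒜 x hx.1).1, hx.2⟩
  have h3 := hmany B hB 𝒜₃ fun x hx => by
    rw [h𝒜₃, mem_filter] at hx
    exact ⟨(h𝒜 x hx.1).1, hx.2⟩
  have hcard : #𝒜 ≤ #𝒜₀ + #𝒜₁ + #𝒜₂ + #𝒜₃ := (card_le_card hcover).trans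
    ((card_union_le _ _).trans (by gcongr; exact (card_union_le _ _).trans (by
      gcongr; exact card_union_le _ _)))
  have hcard' : (#𝒜 : ℝ) ≤ #𝒜₀ + #𝒜₁ + #𝒜₂ + #𝒜₃ := by exact_mod_cast hcard
  linarith

end PairCount

/-! ### The upper bound for minimal formulae -/

section UpperBound

open scoped Classical in
/-- The minimal `k`-SAT formulae on `n` variables. -/
noncomputable def minFormulas (k n : ℕ) : Finset (SatFormula (Fin n)) :=
  univ.filter (fun G => IsKFormula k G ∧ MinimalFormula G)

theorem mem_minFormulas {k n : ℕ} {G : SatFormula (Fin n)} :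
    G ∈ minFormulas k n ↔ IsKFormula k G ∧ MinimalFormula G := by
  simp [minFormulas]

theorem card_isMinPair_le {k n : ℕ}
    (ℬ : Finset (Finset (Finset (Fin n)) × Finset (Finset (Fin n) × Finset (Fin n))))
    (hℬ : ∀ x ∈ ℬ, IsMinPair k x.1 x.2) : #ℬ ≤ #(minFormulas k n) := by
  refine card_le_card_of_injOn (fun x => formulaOfPair x.1 x.2) (fun x hx => ?_)
    fun x hx y hy hxy => ?_
  · exact mem_minFormulas.2 ⟨(hℬ x hx).isKFormula, (hℬ x hx).minimalFormula⟩
  · obtain ⟨h1, h2⟩ := (hℬ x hx).formulaOfPair_inj (hℬ y hy) hxy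
    exact Prod.ext h1 h2

theorem eventually_le_one_add_of_le_add_mul {r a b : ℕ → ℝ} (ha : Tendsto a atTop (nhds 0))
    (hb : Tendsto b atTop (nhds 0)) (hr : ∀ n, 0 ≤ r n)
    (h : ∀ᶠ n in atTop, r (n + 1) ≤ 1 + a n + b n * r n) {ε : ℝ} (hε : 0 < ε) :
    ∀ᶠ n in atTop, r n ≤ 1 + ε := by
  obtain ⟨n₀, hn₀⟩ := eventually_atTop.1 (h.and ((ha.eventually_le_const one_pos).and
    (hb.eventually_le_const (u := 1 / 2) (by norm_num))))
  obtain ⟨M, hM, hM4⟩ : ∃ M, r n₀ ≤ M ∧ 4 ≤ M := ⟨max (r n₀) 4, le_max_left _ _, le_max_right _ _⟩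
  have hbd : ∀ n, n₀ ≤ n → r n ≤ M := by
    intro n hn
    induction n, hn using Nat.le_induction with
    | base => exact hM
    | succ n hn ih =>
      obtain ⟨h1, h2, h3⟩ := hn₀ n hn
      have := mul_le_mul_of_nonneg_right h3 (hr n)
      linarith
  have hM0 : 0 < M := by linarith
  rw [← map_add_atTop_eq_nat 1, eventually_map]
  filter_upwards [h, ha.eventually_le_const (u := ε / 2) (by positivity),
    hb.eventually_le_const (u := ε / (2 * M)) (by positivity), eventually_ge_atTop n₀]
    with n h1 h2 h3 h4
  have h5 : b n * r n ≤ ε / (2 * M) * M :=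
    mul_le_mul h3 (hbd n h4) (hr n) (by positivity)
  have h6 : ε / (2 * M) * M = ε / 2 := by field_simp
  linarith

theorem exists_card_minFormulas_succ_le (k : ℕ) (hk : 2 ≤ k) (θ : ℝ) (hθ : Real.logb 2 3 < θ)
    (hturan : ∀ ε : ℝ, 0 < ε → ∃ n₀ : ℕ, ∀ n ≥ n₀, ∀ H : PDG (Fin n),
      H.IsValid k → ¬ (TkPDG k).IsSubgraph H →
      (H.undir.card : ℝ) + θ * H.dir.card ≤ (1 + ε) * n.choose k) :
    ∃ c : ℝ, 0 < c ∧ ∀ᶠ n : ℕ in atTop,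
      (#(minFormulas k (n + 1)) : ℝ) ≤ 2 ^ (((n + 1).choose k : ℝ) - c * (n + 1 : ℕ)) +
        2 ^ (n + 1) * (2 ^ (((n + 1).choose k : ℕ) : ℝ) +
          2 * 2 ^ (((n + 1).choose k : ℝ) - c * (n + 1 : ℕ)) +
          (n + 1 : ℕ) * (#(minFormulas k n) * 2 ^ ((n.choose (k - 1) : ℝ) - 2 * n))) := by
  classical
  obtain ⟨ζ, hζ, c₁, hc₁, hpairs⟩ := exists_card_pairs_le k hk
  obtain ⟨c₂, hc₂, hfar⟩ := card_far_le k hk θ hθ hturan ζ hζ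
  refine ⟨min c₁ c₂, lt_min hc₁ hc₂, ?_⟩
  filter_upwards [hpairs, (tendsto_add_atTop_nat 1).eventually hfar] with n hpairs hfar
  have hmono : ∀ c : ℝ, min c₁ c₂ ≤ c → (2 : ℝ) ^ (((n + 1).choose k : ℝ) - c * (n + 1 : ℕ)) ≤
      2 ^ (((n + 1).choose k : ℝ) - min c₁ c₂ * (n + 1 : ℕ)) := fun c hc =>
    Real.rpow_le_rpow_of_exponent_le (by norm_num) (sub_le_sub_left
      (mul_le_mul_of_nonneg_right hc (Nat.cast_nonneg _)) _)
  obtain ⟨ℱ, hℱ⟩ : ∃ ℱ, ℱ = (minFormulas k (n + 1)).filter (fun G => ∀ z : Fin (n + 1) → Bool,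
    ζ * ((n + 1 : ℕ) : ℝ) ^ k < #(G.filter (fun C => ∃ l ∈ C, l.2 ≠ z l.1))) := ⟨_, rfl⟩
  obtain ⟨𝒩, h𝒩⟩ : ∃ 𝒩, 𝒩 = (minFormulas k (n + 1)).filter (fun G => ¬ ∀ z : Fin (n + 1) → Bool,
    ζ * ((n + 1 : ℕ) : ℝ) ^ k < #(G.filter (fun C => ∃ l ∈ C, l.2 ≠ z l.1))) := ⟨_, rfl⟩
  have hsplit : #ℱ + #𝒩 = #(minFormulas k (n + 1)) := by
    rw [hℱ, h𝒩]
    exact card_filter_add_card_filter_not _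
  have h1 : (#ℱ : ℝ) ≤ 2 ^ (((n + 1).choose k : ℝ) - min c₁ c₂ * (n + 1 : ℕ)) := by
    refine (hfar ℱ fun G hG => ?_).trans (le_trans ?_ (hmono c₂ (min_le_right _ _)))
    · rw [hℱ, mem_filter, mem_minFormulas] at hG
      exact ⟨hG.1.1, hG.1.2, hG.2⟩
    · refine Real.rpow_le_rpow_of_exponent_le (by norm_num) (sub_le_sub_left
        (mul_le_mul_of_nonneg_left ?_ hc₂.le) _)
      exact_mod_cast Nat.le_self_pow (by omega) _
  have hopt : ∀ G : SatFormula (Fin (n + 1)), ∃ z, ∀ z', #(posFam z' G) ≤ #(posFam z G) := fun G => by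
    obtain ⟨z, -, hz⟩ := exists_max_image (univ : Finset (Fin (n + 1) → Bool))
      (fun z => #(posFam z G)) univ_nonempty
    exact ⟨z, fun z' => hz z' (mem_univ _)⟩
  choose z hz using hopt
  have h2 := card_le_of_card_fiber_le 𝒩 z univ _ (fun _ _ => mem_univ _) fun y _ 𝒟 h𝒟 hy => by
    have hinj : #(𝒟.image fun G => (posFam y G, negFam y G)) = #𝒟 :=
      card_image_of_injOn fun G _ G' _ h =>
        eq_of_posFam_eq_of_negFam_eq y (Prod.mk.inj h).1 (Prod.mk.inj h).2
    rw [← hinj]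
    refine hpairs #(minFormulas k n)
      (fun ℬ hℬ => Nat.cast_le.2 (card_isMinPair_le ℬ hℬ)) _ fun x hx => ?_
    obtain ⟨G, hG, rfl⟩ := mem_image.1 hx
    have hG𝒩 := h𝒟 hG
    rw [h𝒩, mem_filter, mem_minFormulas] at hG𝒩
    obtain ⟨⟨hGk, hGm⟩, hfar⟩ := hG𝒩
    obtain rfl := hy G hG
    refine ⟨hGm.isMinPair hGk _, ?_, linkNeg_card_le_linkPos_card hGk (hz G)⟩
    push Not at hfar
    obtain ⟨z', hz'⟩ := hfar
    refine le_trans (Nat.cast_le.2 ?_) hz'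
    have e1 := card_posFam_add_card_negFam z' G
    have e2 := card_posFam_add_card_negFam (z G) G
    have e3 := hz G z'
    have e4 := card_negFam z' G
    simp only
    omega
  rw [card_univ, Fintype.card_fun, Fintype.card_bool, Fintype.card_fin] at h2
  push_cast at h2
  rw [← hsplit, Nat.cast_add]
  refine add_le_add h1 (h2.trans ?_)
  have h3 := hmono c₁ (min_le_left _ _)
  push_cast at h3 ⊢
  gcongr

theorem eventually_card_minFormulas_le (k : ℕ) (hk : 2 ≤ k) (θ : ℝ) (hθ : Real.logb 2 3 < θ)
    (hturan : ∀ ε : ℝ, 0 < ε → ∃ n₀ : ℕ, ∀ n ≥ n₀, ∀ H : PDG (Fin n),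
      H.IsValid k → ¬ (TkPDG k).IsSubgraph H →
      (H.undir.card : ℝ) + θ * H.dir.card ≤ (1 + ε) * n.choose k) {ε : ℝ} (hε : 0 < ε) :
    ∀ᶠ n : ℕ in atTop, (#(minFormulas k n) : ℝ) ≤ (1 + ε) * 2 ^ (n + n.choose k) := by
  obtain ⟨c, hc, h⟩ := exists_card_minFormulas_succ_le k hk θ hθ hturan
  have ha : Tendsto (fun n : ℕ => 3 * ((2 : ℝ) ^ (-c)) ^ (n + 1)) atTop (nhds 0) := by
    have h1 : (2 : ℝ) ^ (-c) < 1 := Real.rpow_lt_one_of_one_lt_of_neg (by norm_num) (by linarith)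
    simpa using ((tendsto_pow_atTop_nhds_zero_of_lt_one (by positivity) h1).comp
      (tendsto_add_atTop_nat 1)).const_mul 3
  have hb : Tendsto (fun n : ℕ => 2 * (((n + 1 : ℕ) : ℝ) ^ 1 / 2 ^ (n + 1))) atTop (nhds 0) := by
    simpa using ((tendsto_pow_const_div_const_pow_of_one_lt 1 (one_lt_two (α := ℝ))).comp
      (tendsto_add_atTop_nat 1)).const_mul 2
  have key := eventually_le_one_add_of_le_add_mul
    (r := fun n => (#(minFormulas k n) : ℝ) / 2 ^ (n + n.choose k)) ha hb
    (fun n => by positivity) ?_ hε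
  · filter_upwards [key] with n hn
    rwa [div_le_iff₀ (by positivity)] at hn
  filter_upwards [h] with n hn
  obtain ⟨k, rfl⟩ : ∃ j, k = j + 1 := ⟨k - 1, by omega⟩
  have hpow : ((2 : ℝ) ^ (-c)) ^ (n + 1) = 2 ^ (-(c * (n + 1 : ℕ))) := by
    rw [← Real.rpow_natCast, ← Real.rpow_mul (by norm_num)]
    congr 1
    ring
  obtain ⟨t, ht⟩ : ∃ t, t = ((2 : ℝ) ^ (-c)) ^ (n + 1) := ⟨_, rfl⟩
  have ht0 : 0 ≤ t := by rw [ht]; positivity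
  have hs : (2 : ℝ) ^ (((n + 1).choose (k + 1) : ℝ) - c * (n + 1 : ℕ)) =
      2 ^ ((n + 1).choose (k + 1)) * t := by
    rw [sub_eq_add_neg, Real.rpow_add (by norm_num), Real.rpow_natCast, ht, hpow]
  have hl : (2 : ℝ) ^ ((n.choose (k + 1 - 1) : ℝ) - 2 * n) =
      2 ^ (n.choose k) / (2 ^ n * 2 ^ n) := by
    rw [Real.rpow_sub (by norm_num), Nat.add_sub_cancel, Real.rpow_natCast, two_mul,
      Real.rpow_add (by norm_num), Real.rpow_natCast]
  rw [hs, hl, Real.rpow_natCast] at hn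
  rw [← ht, div_le_iff₀ (by positivity)]
  refine hn.trans ?_
  have h2n : (1 : ℝ) ≤ 2 ^ (n + 1) := one_le_pow₀ (by norm_num)
  have e : (1 + 3 * t + 2 * (((n + 1 : ℕ) : ℝ) ^ 1 / 2 ^ (n + 1)) *
        (#(minFormulas (k + 1) n) / 2 ^ (n + n.choose (k + 1)))) *
        2 ^ (n + 1 + (n + 1).choose (k + 1)) =
      2 ^ (n + 1) * (2 ^ ((n + 1).choose (k + 1)) * t) + 2 ^ (n + 1) * (2 ^ ((n + 1).choose (k + 1)) +
        2 * (2 ^ ((n + 1).choose (k + 1)) * t) +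
        (n + 1 : ℕ) * (#(minFormulas (k + 1) n) * (2 ^ (n.choose k) / (2 ^ n * 2 ^ n)))) := by
    rw [Nat.choose_succ_succ n k]
    simp only [pow_add, pow_one]
    field_simp
    ring
  rw [e]
  exact add_le_add (le_mul_of_one_le_left (mul_nonneg (by positivity) ht0) h2n) le_rfl

end UpperBound

/-! ### Functions versus formulae, and the lower bound -/

section LowerBound

theorem exists_minimalFormula_of_isKSatFunction {k n : ℕ} {f : (Fin n → Bool) → Bool}
    (hf : IsKSatFunction k n f) : ∃ G : SatFormula (Fin n), IsKFormula k G ∧ MinimalFormula G ∧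
      ∀ a, f a = true ↔ ∃ C ∈ G, SatisfiesClause a C := by
  classical
  obtain ⟨G₀, hG₀⟩ := hf
  obtain ⟨G, hG, hmin⟩ := exists_min_image (univ.filter fun G : SatFormula (Fin n) =>
    IsKFormula k G ∧ ∀ a, f a = true ↔ ∃ C ∈ G, SatisfiesClause a C) card
    ⟨G₀, mem_filter.2 ⟨mem_univ _, hG₀⟩⟩
  obtain ⟨hGk, hGf⟩ := (mem_filter.1 hG).2
  refine ⟨G, hGk, fun C hC => ?_, hGf⟩
  by_contra! hcon
  refine (card_erase_lt_of_mem hC).not_ge (hmin _ (mem_filter.2 ⟨mem_univ _,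
    fun C' hC' => hGk C' (mem_of_mem_erase hC'), fun a => (hGf a).trans ⟨?_, ?_⟩⟩))
  · rintro ⟨C', hC', ha⟩
    by_cases h : C' = C
    · subst h
      obtain ⟨C'', h1, h2, h3⟩ := hcon a ha
      exact ⟨C'', mem_erase.2 ⟨h3, h1⟩, h2⟩
    · exact ⟨C', mem_erase.2 ⟨h, hC'⟩, ha⟩
  · rintro ⟨C', hC', ha⟩
    exact ⟨C', mem_of_mem_erase hC', ha⟩

theorem ncard_isKSatFunction_le (k n : ℕ) :
    Set.ncard {f : (Fin n → Bool) → Bool | IsKSatFunction k n f} ≤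
      Set.ncard {G : SatFormula (Fin n) | IsKFormula k G ∧ MinimalFormula G} := by
  choose! G hG using fun (f : (Fin n → Bool) → Bool) (hf : IsKSatFunction k n f) =>
    exists_minimalFormula_of_isKSatFunction hf
  refine Set.ncard_le_ncard_of_injOn G (fun f hf => ⟨(hG f hf).1, (hG f hf).2.1⟩)
    (fun f hf g hg h => funext fun a => ?_) (Set.toFinite _)
  rw [Bool.eq_iff_iff, (hG f hf).2.2 a, (hG g hg).2.2 a, h]

/-- The unate function with polarity `z` and clauses supported on the sets in `P`. -/
def unateFunction {n : ℕ} (z : Fin n → Bool) (P : Finset (Finset (Fin n))) (a : Fin n → Bool) :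
    Bool :=
  decide (∃ S ∈ P, ∀ x ∈ S, a x = z x)

theorem unateFunction_eq_true {n : ℕ} {z : Fin n → Bool} {P : Finset (Finset (Fin n))}
    {a : Fin n → Bool} : unateFunction z P a = true ↔ ∃ S ∈ P, ∀ x ∈ S, a x = z x := by
  simp [unateFunction]

theorem isKSatFunction_unateFunction {k n : ℕ} (z : Fin n → Bool) {P : Finset (Finset (Fin n))}
    (hP : P ⊆ univ.powersetCard k) : IsKSatFunction k n (unateFunction z P) := by
  classical
  refine ⟨P.image (fun S => signedClause z (S, ∅)), fun C hC => ?_, fun a => ?_⟩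
  · obtain ⟨S, hS, rfl⟩ := mem_image.1 hC
    exact isKClause_signedClause.2
      ⟨disjoint_empty_right _, by simpa using (mem_powersetCard.1 (hP hS)).2⟩
  · rw [unateFunction_eq_true]
    simp [satisfiesClause_signedClause, subset_iff]

theorem exists_subset_of_unateFunction_eq {k n : ℕ} {z z' : Fin n → Bool}
    {P P' : Finset (Finset (Fin n))} (h : unateFunction z P = unateFunction z' P')
    (hP : P ⊆ univ.powersetCard k) {S : Finset (Fin n)} (hS : S ∈ P) :
    ∃ S' ∈ P', (∀ x ∈ S, x ∈ S' ∧ z x = z' x) := by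
  classical
  obtain ⟨a, ha⟩ : ∃ a : Fin n → Bool, a = fun x => if x ∈ S then z x else !z x := ⟨_, rfl⟩
  have haS : ∀ x, a x = z x → x ∈ S := fun x hx => by
    by_contra hxS
    simp [ha, hxS] at hx
  have h1 : unateFunction z' P' a = true := by
    rw [← h, unateFunction_eq_true]
    exact ⟨S, hS, fun x hx => by simp [ha, hx]⟩
  obtain ⟨S', hS', haS'⟩ := unateFunction_eq_true.1 h1
  refine ⟨S', hS', fun x hx => ?_⟩
  by_contra hcon
  have hax : a x = z x := by simp [ha, hx]
  have hxS' : x ∉ S' := fun hx' => hcon ⟨hx', hax.symm.trans (haS' x hx')⟩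
  have h2 : unateFunction z P (Function.update a x (!z x)) = true := by
    rw [h, unateFunction_eq_true]
    refine ⟨S', hS', fun y hy => ?_⟩
    have hyx : y ≠ x := fun e => hxS' (e ▸ hy)
    rw [Function.update_of_ne hyx]
    exact haS' y hy
  obtain ⟨S'', hS'', haS''⟩ := unateFunction_eq_true.1 h2
  have hx'' : x ∉ S'' := fun hx'' => by
    have := haS'' x hx''
    simp at this
  have hsub : S'' ⊆ S.erase x := fun y hy => by
    have hyx : y ≠ x := fun e => hx'' (e ▸ hy)
    refine mem_erase.2 ⟨hyx, haS y ?_⟩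
    rw [← haS'' y hy, Function.update_of_ne hyx]
  have := card_le_card hsub
  rw [card_erase_of_mem hx, (mem_powersetCard.1 (hP hS'')).2, (mem_powersetCard.1 (hP hS)).2]
    at this
  have hpos : 0 < #S := card_pos.2 ⟨x, hx⟩
  rw [(mem_powersetCard.1 (hP hS)).2] at hpos
  omega

theorem unateFunction_inj {k n : ℕ} {z z' : Fin n → Bool} {P P' : Finset (Finset (Fin n))}
    (hP : P ⊆ univ.powersetCard k) (hP' : P' ⊆ univ.powersetCard k)
    (hcov : ∀ v, ∃ S ∈ P, v ∈ S) (h : unateFunction z P = unateFunction z' P') :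
    z = z' ∧ P = P' := by
  have hsub : ∀ {z z' : Fin n → Bool} {P P' : Finset (Finset (Fin n))},
      P ⊆ univ.powersetCard k → P' ⊆ univ.powersetCard k →
      unateFunction z P = unateFunction z' P' → P ⊆ P' := by
    intro z z' P P' hP hP' h S hS
    obtain ⟨S', hS', hSS'⟩ := exists_subset_of_unateFunction_eq h hP hS
    rwa [eq_of_subset_of_card_le (fun x hx => (hSS' x hx).1) (by
      rw [(mem_powersetCard.1 (hP hS)).2, (mem_powersetCard.1 (hP' hS')).2])]
  refine ⟨funext fun v => ?_, (hsub hP hP' h).antisymm (hsub hP' hP h.symm)⟩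
  obtain ⟨S, hS, hv⟩ := hcov v
  obtain ⟨S', -, hSS'⟩ := exists_subset_of_unateFunction_eq h hP hS
  exact (hSS' v hv).2

theorem le_card_covering (k n : ℕ) : 2 ^ (n.choose k) ≤
    #((((univ : Finset (Fin n)).powersetCard k).powerset).filter (fun P => ∀ v, ∃ S ∈ P, v ∈ S)) +
      n * 2 ^ ((n - 1).choose k) := by
  classical
  have h : #((((univ : Finset (Fin n)).powersetCard k).powerset).filter
      (fun P => ¬ ∀ v, ∃ S ∈ P, v ∈ S)) ≤ n * 2 ^ ((n - 1).choose k) := by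
    calc _ ≤ #((univ : Finset (Fin n)).biUnion
          (fun v => ((univ.erase v).powersetCard k).powerset)) := by
          refine card_le_card fun P hP => ?_
          obtain ⟨hP, hv⟩ := mem_filter.1 hP
          push Not at hv
          obtain ⟨v, hv⟩ := hv
          refine mem_biUnion.2 ⟨v, mem_univ _, mem_powerset.2 fun S hS => mem_powersetCard.2 ⟨?_,
            (mem_powersetCard.1 (mem_powerset.1 hP hS)).2⟩⟩
          exact fun x hx => mem_erase.2 ⟨fun e => hv S hS (e ▸ hx), mem_univ _⟩
      _ ≤ #(univ : Finset (Fin n)) * 2 ^ ((n - 1).choose k) :=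
          card_biUnion_le_card_mul _ _ _ fun v _ => by
            rw [card_powerset, card_powersetCard, card_erase_of_mem (mem_univ _), card_univ,
              Fintype.card_fin]
      _ = _ := by rw [card_univ, Fintype.card_fin]
  have h2 := card_filter_add_card_filter_not (s := ((univ : Finset (Fin n)).powersetCard k).powerset)
    (fun P => ∀ v, ∃ S ∈ P, v ∈ S)
  rw [card_powerset, card_powersetCard, card_univ, Fintype.card_fin] at h2
  omega

theorem two_pow_mul_card_covering_le (k n : ℕ) :
    2 ^ n * #((((univ : Finset (Fin n)).powersetCard k).powerset).filter
      (fun P => ∀ v, ∃ S ∈ P, v ∈ S)) ≤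
      Set.ncard {f : (Fin n → Bool) → Bool | IsKSatFunction k n f} := by
  classical
  have h := Set.ncard_le_ncard_of_injOn
    (s := (((univ : Finset (Fin n → Bool)) ×ˢ
      (((univ : Finset (Fin n)).powersetCard k).powerset).filter (fun P => ∀ v, ∃ S ∈ P, v ∈ S) :
      Finset _) : Set ((Fin n → Bool) × Finset (Finset (Fin n)))))
    (t := {f : (Fin n → Bool) → Bool | IsKSatFunction k n f})
    (fun x => unateFunction x.1 x.2) (fun x hx => ?_) (fun x hx y hy hxy => ?_) (Set.toFinite _)
  · rwa [Set.ncard_coe_finset, card_product, card_univ, Fintype.card_fun, Fintype.card_bool,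
      Fintype.card_fin] at h
  · exact isKSatFunction_unateFunction _ (mem_powerset.1 (mem_filter.1 (mem_product.1 hx).2).1)
  · obtain ⟨hx1, hx2⟩ := mem_filter.1 (mem_product.1 hx).2
    obtain ⟨hy1, -⟩ := mem_filter.1 (mem_product.1 hy).2
    obtain ⟨h1, h2⟩ := unateFunction_inj (mem_powerset.1 hx1) (mem_powerset.1 hy1) hx2 hxy
    exact Prod.ext h1 h2

theorem le_choose_succ_add (n j : ℕ) : n ≤ n.choose (j + 1) + j := by
  induction n with
  | zero => omega
  | succ n ih =>
    rw [Nat.choose_succ_succ']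
    rcases le_or_gt j n with h | h
    · have := Nat.choose_pos h
      omega
    · omega

theorem eventually_le_ncard_isKSatFunction (k : ℕ) (hk : 2 ≤ k) {ε : ℝ} (hε : 0 < ε) :
    ∀ᶠ n : ℕ in atTop, (1 - ε) * 2 ^ (n + n.choose k) ≤
      (Set.ncard {f : (Fin n → Bool) → Bool | IsKSatFunction k n f} : ℝ) := by
  classical
  obtain ⟨j, rfl⟩ : ∃ j, k = j + 2 := ⟨k - 2, by omega⟩
  have hlim := (tendsto_pow_const_div_const_pow_of_one_lt 1 (one_lt_two (α := ℝ))).comp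
    (tendsto_add_atTop_nat 1)
  rw [← map_add_atTop_eq_nat 1, eventually_map]
  filter_upwards [hlim.eventually_le_const (u := ε / 2 ^ (j + 1)) (by positivity)] with n hn
  simp only [Function.comp_apply, pow_one] at hn
  have h1 := le_card_covering (j + 2) (n + 1)
  have h2 := two_pow_mul_card_covering_le (j + 2) (n + 1)
  rw [Nat.add_sub_cancel] at h1
  refine le_trans ?_ (Nat.cast_le.2 h2)
  obtain ⟨N, hN⟩ : ∃ N, N = #((((univ : Finset (Fin (n + 1))).powersetCard (j + 2)).powerset).filter
    (fun P => ∀ v, ∃ S ∈ P, v ∈ S)) := ⟨_, rfl⟩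
  rw [← hN] at h1 ⊢
  have h1' : (2 : ℝ) ^ ((n + 1).choose (j + 2)) ≤ N + (n + 1 : ℕ) * 2 ^ (n.choose (j + 2)) := by
    exact_mod_cast h1
  have h3 : ((n + 1 : ℕ) : ℝ) * 2 ^ (n.choose (j + 2)) ≤ ε * 2 ^ ((n + 1).choose (j + 2)) := by
    rw [div_le_div_iff₀ (by positivity) (by positivity)] at hn
    have h4 : (2 : ℝ) ^ (n + 1) ≤ 2 ^ (n.choose (j + 1)) * 2 ^ (j + 1) := by
      rw [← pow_add]
      exact pow_le_pow_right₀ (by norm_num) (by have := le_choose_succ_add n j; omega)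
    have h5 : ((n + 1 : ℕ) : ℝ) ≤ ε * 2 ^ (n.choose (j + 1)) := by
      refine le_of_mul_le_mul_right (hn.trans ?_) (by positivity : (0 : ℝ) < 2 ^ (j + 1))
      rw [mul_assoc]
      exact mul_le_mul_of_nonneg_left h4 hε.le
    rw [Nat.choose_succ_succ n (j + 1), pow_add, ← mul_assoc]
    exact mul_le_mul_of_nonneg_right h5 (by positivity)
  rw [Nat.cast_mul, Nat.cast_pow, Nat.cast_ofNat, pow_add, mul_left_comm]
  exact mul_le_mul_of_nonneg_left (by linarith) (by positivity)

end LowerBound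

end Proof

/-- If `θ > log₂ 3` satisfies the Turán-type bound for `T_k`-free `k`-PDGs,
then both the number of `k`-SAT functions and the number of minimal `k`-SAT formulae on `n`
variables lie between `(1−ε)·2^(n + C(n,k))` and `(1+ε)·2^(n + C(n,k))` for large `n`. -/
theorem reduction_to_turan (k : ℕ) (hk : 2 ≤ k) (θ : ℝ) (hθ : Real.logb 2 3 < θ)
    (hturan : ∀ ε : ℝ, 0 < ε → ∃ n₀ : ℕ, ∀ n ≥ n₀, ∀ H : PDG (Fin n),
      H.IsValid k → ¬ (TkPDG k).IsSubgraph H →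
      (H.undir.card : ℝ) + θ * H.dir.card ≤ (1 + ε) * n.choose k) :
    ∀ ε : ℝ, 0 < ε → ∃ n₁ : ℕ, ∀ n ≥ n₁,
      ((1 - ε) * 2 ^ (n + n.choose k) ≤
          (Set.ncard {f : (Fin n → Bool) → Bool | IsKSatFunction k n f} : ℝ) ∧
        (Set.ncard {f : (Fin n → Bool) → Bool | IsKSatFunction k n f} : ℝ) ≤
          (1 + ε) * 2 ^ (n + n.choose k)) ∧
      ((1 - ε) * 2 ^ (n + n.choose k) ≤
          (Set.ncard {G : SatFormula (Fin n) | IsKFormula k G ∧ MinimalFormula G} : ℝ) ∧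
        (Set.ncard {G : SatFormula (Fin n) | IsKFormula k G ∧ MinimalFormula G} : ℝ) ≤
          (1 + ε) * 2 ^ (n + n.choose k)) := by
  intro ε hε
  have hf := eventually_le_ncard_isKSatFunction k hk hε
  have hG := eventually_card_minFormulas_le k hk θ hθ hturan hε
  obtain ⟨n₁, hn₁⟩ := Filter.eventually_atTop.1 (hf.and hG)
  refine ⟨n₁, fun n hn => ?_⟩
  obtain ⟨h1, h2⟩ := hn₁ n hn
  have h3 : (Set.ncard {f : (Fin n → Bool) → Bool | IsKSatFunction k n f} : ℝ) ≤
      Set.ncard {G : SatFormula (Fin n) | IsKFormula k G ∧ MinimalFormula G} :=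
    Nat.cast_le.2 (ncard_isKSatFunction_le k n)
  have h4 : {G : SatFormula (Fin n) | IsKFormula k G ∧ MinimalFormula G} =
      (minFormulas k n : Set (SatFormula (Fin n))) :=
    Set.ext fun G => mem_minFormulas.symm
  rw [← Set.ncard_coe_finset, ← h4] at h2
  exact ⟨⟨h1, h3.trans h2⟩, ⟨h1.trans h3, h2⟩⟩
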